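/- Let H be a digraph with k arcs satisfying δ(H) ≥ 1. There exist a constant C₀ and constants α, β ∈ (0,1) such that for every integer C ≥ C₀, every digraph D on n ≥ Ck vertices with minimum semi-degree δ⁰(D) ≥ n/2 + k is arbitrary Hamiltonian H-linked with parameters α, β. -/

import Mathlib

open scoped Classical

/-- The out-degree of a vertex `v` in the digraph on `V` with arc relation `A`. -/
noncomputable def outDeg {V : Type*} (A : V → V → Prop) (v : V) : ℕ :=
  {u | A v u}.ncard

/-- The in-degree of a vertex `v` in the digraph on `V` with arc relation `A`. -/
noncomputable def inDeg {V : Type*} (A : V → V → Prop) (v : V) : ℕ :=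
  {u | A u v}.ncard

/-- `p` is a directed path from `u` to `v` in the digraph with arc relation `A`,
recorded as its list of vertices.  In the degenerate case `u = v` (used for loops of `H`)
it is a closed directed path (a cycle). -/
def IsDipathFrom {V : Type*} (A : V → V → Prop) (u v : V) (p : List V) : Prop :=
  p.Chain' A ∧ p.head? = some u ∧ p.getLast? = some v ∧
    (u = v → p.dropLast.Nodup) ∧ (u ≠ v → p.Nodup)

/-- The internal vertices of a path recorded as a list of vertices. -/
def listInterior {V : Type*} (p : List V) : List V := p.tail.dropLast

/-- `g` is a Hamiltonian `(N H)`-subdivision for the family of arcs `a` (already mapped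
into `V`): the `i`-th arc `a i = (u, v)` is assigned a directed path from `u` to `v`
of length `N i` (so with `N i + 1` vertices), the paths of distinct arcs are internally
vertex-disjoint, and together the paths cover all of `V`. -/
def IsHamSubdivision {V : Type*} (A : V → V → Prop) {k : ℕ}
    (a : Fin k → V × V) (N : Fin k → ℕ) (g : Fin k → List V) : Prop :=
  (∀ i, IsDipathFrom A (a i).1 (a i).2 (g i) ∧ (g i).length = N i + 1) ∧
  (∀ i j, i ≠ j → ∀ x ∈ listInterior (g i), x ∉ g j) ∧
  (∀ x : V, ∃ i, x ∈ g i)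

/-- A digraph on `V` with arc relation `A` is arbitrary Hamiltonian `H`-linked with
parameters `α, β`, where `H` is the digraph with vertex set `W` and arcs `a i`:
for every injective `f : W → V` and all `n₁, …, n_k ≥ 4` whose small values
(those `< β n`) sum to at most `α n` and with `∑ (nᵢ - 1) + |W| = n`, there is a
Hamiltonian `(N H)`-subdivision extending `f`. -/
def ArbHamHLinked {V W : Type*} [Fintype V] [Fintype W] (A : V → V → Prop)
    {k : ℕ} (a : Fin k → W × W) (α β : ℝ) : Prop :=
  ∀ f : W → V, Function.Injective f →
    ∀ N : Fin k → ℕ,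
      (∀ i, 4 ≤ N i) →
      (∑ i, if (N i : ℝ) < β * Fintype.card V then (N i : ℝ) else 0) ≤ α * Fintype.card V →
      (∑ i, (N i - 1)) + Fintype.card W = Fintype.card V →
      ∃ g : Fin k → List V, IsHamSubdivision A (fun i => (f (a i).1, f (a i).2)) N g

/-- junction condition between two lists -/
def JR {α : Type*} (R : α → α → Prop) (l₁ l₂ : List α) : Prop :=
  ∀ x ∈ l₁.getLast?, ∀ y ∈ l₂.head?, R x y

/-- cyclic chain -/
def CycChain {α : Type*} (R : α → α → Prop) (l : List α) : Prop := l.IsChain R ∧ JR R l l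

theorem isChain_app {α : Type*} (R : α → α → Prop) (l₁ l₂ : List α) :
    (l₁ ++ l₂).IsChain R ↔ l₁.IsChain R ∧ l₂.IsChain R ∧ JR R l₁ l₂ := List.isChain_append

theorem JR_app_left {α : Type*} (R : α → α → Prop) (l₁ l₂ l₃ : List α) (h : l₂ ≠ []) :
    JR R (l₁ ++ l₂) l₃ ↔ JR R l₂ l₃ := by
  unfold JR; rw [List.getLast?_append_of_ne_nil _ h]

theorem JR_app_right {α : Type*} (R : α → α → Prop) (l₁ l₂ l₃ : List α) (h : l₂ ≠ []) :
    JR R l₁ (l₂ ++ l₃) ↔ JR R l₁ l₂ := by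
  unfold JR; rw [List.head?_append_of_ne_nil _ h]

theorem cycChain_comm {α : Type*} (R : α → α → Prop) (l₁ l₂ : List α)
    (h : CycChain R (l₁ ++ l₂)) : CycChain R (l₂ ++ l₁) := by
  by_cases h1 : l₁ = []
  · simpa [h1] using h
  by_cases h2 : l₂ = []
  · simpa [h2] using h
  obtain ⟨h, h'⟩ := h
  rw [isChain_app] at h
  rw [JR_app_left _ _ _ _ h2, JR_app_right _ _ _ _ h1] at h'
  refine ⟨(isChain_app _ _ _).2 ⟨h.2.1, h.1, h'⟩, ?_⟩
  rw [JR_app_left _ _ _ _ h1, JR_app_right _ _ _ _ h2]; exact h.2.2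

/-- number of non-arcs along a list -/
noncomputable def bad {α : Type*} (R : α → α → Prop) : List α → ℕ
  | [] => 0
  | a :: l => (if JR R [a] l then 0 else 1) + bad R l

theorem bad_app {α : Type*} (R : α → α → Prop) (l₁ l₂ : List α) :
    bad R (l₁ ++ l₂) = bad R l₁ + bad R l₂ + (if JR R l₁ l₂ then 0 else 1) := by
  induction l₁ with
  | nil => simp [bad, JR]
  | cons a l ih =>
    by_cases hl : l = []
    · subst hl; simp [bad, JR]; omega
    · have e1 : JR R [a] (l ++ l₂) ↔ JR R [a] l := JR_app_right _ _ _ _ hl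
      have e2 : JR R (a :: l) l₂ ↔ JR R l l₂ := JR_app_left R [a] l l₂ hl
      rw [List.cons_append]
      simp only [bad, ih, e1, e2]; omega

noncomputable def cbad {α : Type*} (R : α → α → Prop) (l : List α) : ℕ :=
  bad R l + (if JR R l l then 0 else 1)

theorem cbad_comm {α : Type*} (R : α → α → Prop) (l₁ l₂ : List α) :
    cbad R (l₁ ++ l₂) = cbad R (l₂ ++ l₁) := by
  by_cases h1 : l₁ = []
  · simp [h1]
  by_cases h2 : l₂ = []
  · simp [h2]
  simp only [cbad, bad_app, JR_app_left _ _ _ _ h2, JR_app_right _ _ _ _ h1,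
    JR_app_left _ _ _ _ h1, JR_app_right _ _ _ _ h2]
  omega

theorem exists_bad_split {α : Type*} (R : α → α → Prop) (l : List α) (h : ¬ l.IsChain R) :
    ∃ l₁ l₂, l = l₁ ++ l₂ ∧ l₁ ≠ [] ∧ l₂ ≠ [] ∧ ¬ JR R l₁ l₂ := by
  induction l with
  | nil => simp at h
  | cons a l ih =>
    have e : (a :: l).IsChain R ↔ [a].IsChain R ∧ l.IsChain R ∧ JR R [a] l := isChain_app R [a] l
    by_cases hl : l.IsChain R
    · refine ⟨[a], l, rfl, by simp, ?_, ?_⟩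
      · rintro rfl; simp at h
      · intro hh; exact h (e.2 ⟨by simp, hl, hh⟩)
    · obtain ⟨l₁, l₂, h1, h2, h3, h4⟩ := ih hl
      refine ⟨a :: l₁, l₂, by simp [h1], by simp, h3, ?_⟩
      rw [show a :: l₁ = [a] ++ l₁ from rfl, JR_app_left _ _ _ _ h2]; exact h4

theorem exists_rot_bad {α : Type*} (R : α → α → Prop) (l : List α) (h : ¬ CycChain R l) :
    ∃ l₁ l₂, l = l₁ ++ l₂ ∧ ¬ JR R (l₂ ++ l₁) (l₂ ++ l₁) := by
  by_cases hl : l.IsChain R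
  · refine ⟨[], l, rfl, ?_⟩
    intro hh; rw [List.append_nil] at hh; exact h ⟨hl, hh⟩
  · obtain ⟨l₁, l₂, h1, h2, h3, h4⟩ := exists_bad_split R l hl
    refine ⟨l₁, l₂, h1, ?_⟩
    rwa [JR_app_left _ _ _ _ h2, JR_app_right _ _ _ _ h3]

theorem split3 {α : Type*} (l : List α) (i j : ℕ) (hij : i < j) (hj : j + 1 < l.length) :
    ∃ A B C : List α, l = A ++ B ++ C ∧ A ≠ [] ∧ B ≠ [] ∧ C ≠ [] ∧
      A.getLast? = some (l[i]) ∧ B.head? = some (l[i+1]) ∧ B.getLast? = some (l[j]) ∧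
      C.head? = some (l[j+1]) := by
  refine ⟨l.take (i+1), (l.take (j+1)).drop (i+1), l.drop (j+1), ?_, ?_, ?_, ?_, ?_, ?_, ?_, ?_⟩
  · have : l.take (i+1) = (l.take (j+1)).take (i+1) := by rw [List.take_take]; congr 1; omega
    rw [this, List.take_append_drop, List.take_append_drop]
  · simp; rintro rfl; simp at hj
  · intro h; have := congrArg List.length h; simp at this; omega
  · intro h; have := congrArg List.length h; simp at this; omega
  · rw [List.getLast?_eq_getElem?]; simp; rw [min_eq_left (by omega)]; simp
  · rw [List.head?_drop, List.getElem?_take_of_lt (by omega)]; simp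
  · rw [List.getLast?_eq_getElem?]; simp; rw [min_eq_left (by omega)]
    rw [show i + 1 + (j + 1 - (i + 1) - 1) = j by omega, List.getElem?_take_of_lt (by omega)]; simp
  · rw [List.head?_drop]; simp

theorem exchange_step {α : Type*} (R : α → α → Prop) (H S : α → Bool) (e : ℕ)
    (l : List α) (hnd : l.Nodup) (hty : CycChain (fun u v => S u = H v) l)
    (n1 : ∀ u ∈ l, (l.toFinset.filter (fun v => H v = S u ∧ ¬ R u v)).card ≤ e)
    (n2 : ∀ v ∈ l, (l.toFinset.filter (fun u => S u = H v ∧ ¬ R u v)).card ≤ e)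
    (hsz : ∀ σ, 3 * e + 3 ≤ (l.toFinset.filter (fun u => S u = σ)).card)
    (hb : ¬ JR R l l) :
    ∃ l' : List α, l'.Perm l ∧ CycChain (fun u v => S u = H v) l' ∧ cbad R l' < cbad R l := by
  -- basic data
  have hne : l ≠ [] := by rintro rfl; exact hb (by simp [JR])
  have hlen : 0 < l.length := List.length_pos_iff.2 hne
  set n := l.length with hn
  set y := l[n-1] with hy
  set h0 := l[0] with hh0
  have hlast : l.getLast? = some y := by rw [List.getLast?_eq_getElem?]; simp [hy, hn]
  have hhead : l.head? = some h0 := by rw [List.head?_eq_getElem?]; simp [hh0]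
  have hyl : y ∈ l := List.getElem_mem _
  have hh0l : h0 ∈ l := List.getElem_mem _
  have hwrap : S y = H h0 := hty.2 y (by simp [hlast]) h0 (by simp [hhead])
  have hnR : ¬ R y h0 := by
    intro h; apply hb; intro x hx z hz
    rw [hlast] at hx; rw [hhead] at hz
    simp at hx hz; subst hx; subst hz; exact h
  have hinj : ∀ i j (hi : i < n) (hj : j < n), l[i] = l[j] → i = j := by
    intro i j hi hj h; exact (List.Nodup.getElem_inj_iff hnd).1 h
  have hstep : ∀ i (hi : i + 1 < n), S l[i] = H l[i+1] := by
    intro i hi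
    have := List.isChain_iff_getElem.1 hty.1 i hi
    exact this
  -- index sets
  have gd : ∀ i, i + 1 < n → i < n := fun i h => by omega
  let g : ℕ → α := fun i => if h : i < n then l[i] else h0
  have gi : ∀ i (h : i < n), g i = l[i] := fun i h => by simp [g, h]
  have gmem : ∀ i, i < n → g i ∈ l := fun i h => by rw [gi i h]; exact List.getElem_mem _
  have ginj : ∀ i j, i < n → j < n → g i = g j → i = j := by
    intro i j hi hj h; rw [gi i hi, gi j hj] at h; exact hinj i j hi hj h
  have gstep : ∀ i, i + 1 < n → S (g i) = H (g (i+1)) := by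
    intro i hi; rw [gi i (by omega), gi (i+1) hi]; exact hstep i hi
  let Q : Finset ℕ := (Finset.range (n-1)).filter (fun i => S (g i) = S y)
  have hQ : 3 * e + 2 ≤ Q.card := by
    have h1 : l.toFinset.filter (fun u => S u = S y) ⊆ insert y (Q.image g) := by
      intro u hu
      simp only [Finset.mem_filter, List.mem_toFinset] at hu
      obtain ⟨i, hi, rfl⟩ := List.mem_iff_getElem.1 hu.1
      by_cases hi' : i = n - 1
      · subst hi'; simp [hy]
      · refine Finset.mem_insert_of_mem (Finset.mem_image.2 ⟨i, ?_, gi i hi⟩)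
        simp only [Q, Finset.mem_filter, Finset.mem_range]
        exact ⟨by omega, by rw [gi i hi]; exact hu.2⟩
    have h2 := (Finset.card_le_card h1).trans (Finset.card_insert_le _ _)
    have h3 : (Q.image g).card ≤ Q.card := Finset.card_image_le
    have := hsz (S y); omega
  have hQm : ∀ i ∈ Q, i + 1 < n ∧ S (g i) = S y := by
    intro i hi; simp only [Q, Finset.mem_filter, Finset.mem_range] at hi; exact ⟨by omega, hi.2⟩
  have b1 : (Q.filter (fun i => ¬ R y (g (i+1)))).card ≤ e := by
    refine le_trans ?_ (n1 y hyl)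
    refine Finset.card_le_card_of_injOn (fun i => g (i+1)) ?_ ?_
    · intro i hi
      simp only [Finset.coe_filter, Set.mem_ofPred_eq] at hi
      have := hQm i hi.1
      simp only [Finset.coe_filter, Set.mem_ofPred_eq, List.mem_toFinset]
      exact ⟨gmem _ this.1, by rw [← gstep i this.1]; exact this.2, hi.2⟩
    · intro i hi j hj hij
      simp only [Finset.coe_filter, Set.mem_ofPred_eq] at hi hj
      have := ginj _ _ (hQm i hi.1).1 (hQm j hj.1).1 hij
      omega
  have b2 : (Q.filter (fun j => ¬ R (g j) h0)).card ≤ e := by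
    refine le_trans ?_ (n2 h0 hh0l)
    refine Finset.card_le_card_of_injOn g ?_ ?_
    · intro i hi
      simp only [Finset.coe_filter, Set.mem_ofPred_eq] at hi
      have := hQm i hi.1
      simp only [Finset.coe_filter, Set.mem_ofPred_eq, List.mem_toFinset]
      exact ⟨gmem _ (by omega), by rw [this.2, hwrap], hi.2⟩
    · intro i hi j hj hij
      simp only [Finset.coe_filter, Set.mem_ofPred_eq] at hi hj
      have h1 := (hQm i hi.1).1
      have h2 := (hQm j hj.1).1
      exact ginj _ _ (by omega) (by omega) hij
  have b3 : ∀ i ∈ Q, (Q.filter (fun j => ¬ R (g i) (g (j+1)))).card ≤ e := by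
    intro i0 hi0
    have hi0' := hQm i0 hi0
    refine le_trans ?_ (n1 (g i0) (gmem _ (by omega)))
    refine Finset.card_le_card_of_injOn (fun i => g (i+1)) ?_ ?_
    · intro i hi
      simp only [Finset.coe_filter, Set.mem_ofPred_eq] at hi
      have := hQm i hi.1
      simp only [Finset.coe_filter, Set.mem_ofPred_eq, List.mem_toFinset]
      exact ⟨gmem _ this.1, by rw [← gstep i this.1, this.2, hi0'.2], hi.2⟩
    · intro i hi j hj hij
      simp only [Finset.coe_filter, Set.mem_ofPred_eq] at hi hj
      have := ginj _ _ (hQm i hi.1).1 (hQm j hj.1).1 hij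
      omega
  -- choose i
  have hG : (Q.filter (fun i => R y (g (i+1)))).Nonempty := by
    rw [← Finset.card_pos]
    have := Finset.card_filter_add_card_filter_not (s := Q) (fun i => R y (g (i+1)))
    omega
  obtain ⟨i, hi, himin⟩ := Finset.exists_min_image _ id hG
  have hiQ := (Finset.mem_filter.1 hi).1
  have hiR := (Finset.mem_filter.1 hi).2
  have hJ : ∃ j ∈ Q, i < j ∧ R (g j) h0 ∧ R (g i) (g (j+1)) := by
    by_contra hcon
    push Not at hcon
    have : Q ⊆ (insert i (Q.filter (fun i => ¬ R y (g (i+1)))) ∪ Q.filter (fun j => ¬ R (g j) h0)) ∪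
        Q.filter (fun j => ¬ R (g i) (g (j+1))) := by
      intro j hj
      simp only [Finset.mem_union, Finset.mem_insert, Finset.mem_filter]
      by_cases hij : i < j
      · by_cases h2 : R (g j) h0
        · exact Or.inr ⟨hj, hcon j hj hij h2⟩
        · exact Or.inl (Or.inr ⟨hj, h2⟩)
      · by_cases h3 : j = i
        · exact Or.inl (Or.inl (Or.inl h3))
        · refine Or.inl (Or.inl (Or.inr ⟨hj, ?_⟩))
          intro h4
          have := himin j (Finset.mem_filter.2 ⟨hj, h4⟩)
          simp at this; omega
    have c1 := Finset.card_le_card this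
    have c2 := Finset.card_union_le (insert i (Q.filter (fun i => ¬ R y (g (i+1)))) ∪ Q.filter (fun j => ¬ R (g j) h0))
      (Q.filter (fun j => ¬ R (g i) (g (j+1))))
    have c3 := Finset.card_union_le (insert i (Q.filter (fun i => ¬ R y (g (i+1))))) (Q.filter (fun j => ¬ R (g j) h0))
    have c4 := Finset.card_insert_le i (Q.filter (fun i => ¬ R y (g (i+1))))
    have := b3 i hiQ
    omega
  obtain ⟨j, hjQ, hij, hjR, hijR⟩ := hJ
  have hi' := hQm i hiQ
  have hj' := hQm j hjQ
  obtain ⟨A, B, C, hl, hA, hB, hC, eA, eB, eB', eC⟩ := split3 l i j hij hj'.1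
  rw [gi _ hi'.1] at hiR
  rw [gi _ (by omega)] at hjR
  rw [gi _ (by omega), gi _ hj'.1] at hijR
  have hAh : A.head? = some h0 := by
    rw [← hhead, hl, List.append_assoc, List.head?_append_of_ne_nil _ hA]
  have hCl : C.getLast? = some y := by
    rw [← hlast, hl, List.getLast?_append_of_ne_nil _ hC]
  have jr : ∀ (P : α → α → Prop) (l₁ l₂ : List α) (a b : α), l₁.getLast? = some a → l₂.head? = some b →
      (JR P l₁ l₂ ↔ P a b) := by
    intro P l₁ l₂ a b h1 h2; simp [JR, h1, h2]
  have hBA : B ++ A ≠ [] := by simp [hA]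
  have hAB : A ++ B ≠ [] := by simp [hA]
  refine ⟨B ++ A ++ C, ?_, ?_, ?_⟩
  · rw [hl]; exact List.Perm.append_right _ List.perm_append_comm
  · have h1 := hty
    rw [hl] at h1
    obtain ⟨h1, -⟩ := h1
    rw [isChain_app, isChain_app] at h1
    have si := hi'.2; rw [gi _ (by omega)] at si
    have sj := hj'.2; rw [gi _ (by omega)] at sj
    refine ⟨?_, ?_⟩
    · rw [isChain_app, isChain_app]
      refine ⟨⟨h1.1.2.1, h1.1.1, ?_⟩, h1.2.1, ?_⟩
      · rw [jr _ _ _ _ _ eB' hAh]; exact sj.trans hwrap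
      · rw [JR_app_left _ _ _ _ hA, jr _ _ _ _ _ eA eC, ← hstep j hj'.1]; rw [si, sj]
    · rw [JR_app_left _ _ _ _ hC, List.append_assoc, JR_app_right _ _ _ _ hB, jr _ _ _ _ _ hCl eB,
        ← hstep i hi'.1, si]
  · have e1 : cbad R l = bad R A + bad R B + (if JR R A B then 0 else 1) + bad R C +
        (if JR R (A ++ B) C then 0 else 1) + 1 := by
      rw [cbad, if_neg hb, hl, bad_app, bad_app]
    have e2 : cbad R (B ++ A ++ C) = bad R B + bad R A + bad R C := by
      rw [cbad, bad_app, bad_app, if_pos, if_pos, if_pos]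
      · omega
      · rw [JR_app_left _ _ _ _ hC, List.append_assoc, JR_app_right _ _ _ _ hB, jr _ _ _ _ _ hCl eB]
        exact hiR
      · rw [JR_app_left _ _ _ _ hA, jr _ _ _ _ _ eA eC]; exact hijR
      · rw [jr _ _ _ _ _ eB' hAh]; exact hjR
    omega

theorem exchange_all {α : Type*} (R : α → α → Prop) (H S : α → Bool) (e : ℕ)
    (l : List α) (hnd : l.Nodup) (hty : CycChain (fun u v => S u = H v) l)
    (n1 : ∀ u ∈ l, (l.toFinset.filter (fun v => H v = S u ∧ ¬ R u v)).card ≤ e)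
    (n2 : ∀ v ∈ l, (l.toFinset.filter (fun u => S u = H v ∧ ¬ R u v)).card ≤ e)
    (hsz : ∀ σ, 3 * e + 3 ≤ (l.toFinset.filter (fun u => S u = σ)).card) :
    ∃ l' : List α, l'.Perm l ∧ CycChain R l' := by
  induction hN : cbad R l using Nat.strong_induction_on generalizing l with
  | _ N ih =>
    by_cases hc : CycChain R l
    · exact ⟨l, List.Perm.refl _, hc⟩
    obtain ⟨l₁, l₂, hl, hb⟩ := exists_rot_bad R l hc
    have hp : (l₂ ++ l₁).Perm l := by rw [hl]; exact List.perm_append_comm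
    have hf : (l₂ ++ l₁).toFinset = l.toFinset := List.toFinset_eq_of_perm _ _ hp
    have hty' : CycChain (fun u v => S u = H v) (l₂ ++ l₁) := cycChain_comm _ _ _ (hl ▸ hty)
    obtain ⟨l', hp', ht', hlt⟩ := exchange_step R H S e (l₂ ++ l₁) (hp.nodup_iff.2 hnd) hty'
      (by intro u hu; rw [hf]; exact n1 u (hp.mem_iff.1 hu))
      (by intro u hu; rw [hf]; exact n2 u (hp.mem_iff.1 hu))
      (by intro σ; rw [hf]; exact hsz σ) hb
    have hp2 : l'.Perm l := hp'.trans hp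
    have hf2 : l'.toFinset = l.toFinset := List.toFinset_eq_of_perm _ _ hp2
    have hlt' : cbad R l' < N := by
      rw [← hN, hl, cbad_comm]; exact hlt
    obtain ⟨l'', h1, h2⟩ := ih _ hlt' l' (hp2.nodup_iff.2 hnd) ht'
      (by intro u hu; rw [hf2]; exact n1 u (hp2.mem_iff.1 hu))
      (by intro u hu; rw [hf2]; exact n2 u (hp2.mem_iff.1 hu))
      (by intro σ; rw [hf2]; exact hsz σ) rfl
    exact ⟨l'', h1.trans hp2, h2⟩

/-- alternating list -/
def alt {α : Type*} : List α → List α → List α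
  | d :: ds, a :: as => d :: a :: alt ds as
  | _, _ => []

theorem alt_perm {α : Type*} : ∀ (ds as : List α), ds.length = as.length → (alt ds as).Perm (ds ++ as)
  | [], [], _ => by simp [alt]
  | d :: ds, a :: as, h => by
    have := alt_perm ds as (by simpa using h)
    simp only [alt, List.cons_append]
    refine List.Perm.cons _ ?_
    exact (List.Perm.cons a this).trans List.perm_middle.symm
  | [], a :: as, h => by simp at h
  | d :: ds, [], h => by simp at h

theorem alt_chain {α : Type*} (H S : α → Bool) : ∀ (ds as : List α), ds.length = as.length →
    (∀ d ∈ ds, H d = true ∧ S d = false) → (∀ a ∈ as, H a = false ∧ S a = true) →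
    (alt ds as).IsChain (fun u v => S u = H v) ∧ (∀ x ∈ (alt ds as).head?, H x = true) ∧
      (∀ x ∈ (alt ds as).getLast?, S x = true)
  | [], [], _, _, _ => by simp [alt]
  | d :: ds, a :: as, h, hd, ha => by
    obtain ⟨h1, h2, h3⟩ := alt_chain H S ds as (by simpa using h)
      (fun x hx => hd x (by simp [hx])) (fun x hx => ha x (by simp [hx]))
    have d1 := hd d (by simp)
    have a1 := ha a (by simp)
    have e : alt (d :: ds) (a :: as) = [d, a] ++ alt ds as := rfl
    rw [e]
    refine ⟨?_, ?_, ?_⟩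
    · rw [isChain_app]; refine ⟨by simp [d1, a1], h1, ?_⟩
      intro x hx y hy; simp at hx; subst hx; rw [a1.2, h2 y hy]
    · simp [d1]
    · by_cases hn : alt ds as = []
      · simp [hn, a1]
      · rw [List.getLast?_append_of_ne_nil _ hn]; exact h3
  | [], a :: as, h, _, _ => by simp at h
  | d :: ds, [], h, _, _ => by simp at h

theorem const_chain {α : Type*} (H S : α → Bool) (σ : Bool) : ∀ (l : List α),
    (∀ d ∈ l, H d = σ ∧ S d = σ) → l.IsChain (fun u v => S u = H v)
  | [], _ => by simp
  | [a], _ => by simp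
  | a :: b :: l, h => by
    have := const_chain H S σ (b :: l) (fun x hx => h x (by simp [hx]))
    rw [List.isChain_cons_cons]
    exact ⟨by rw [(h a (by simp)).2, (h b (by simp)).1], this⟩

theorem finish {α : Type*} (R : α → α → Prop) (H S : α → Bool) (e : ℕ) (I : Finset α)
    (hbal : (I.filter (fun u => S u = true)).card = (I.filter (fun u => H u = true)).card)
    (hA : ∃ a ∈ I, H a = false ∧ S a = true)
    (n1 : ∀ u ∈ I, (I.filter (fun v => H v = S u ∧ ¬ R u v)).card ≤ e)
    (n2 : ∀ v ∈ I, (I.filter (fun u => S u = H v ∧ ¬ R u v)).card ≤ e)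
    (hsz : ∀ σ, 3 * e + 3 ≤ (I.filter (fun u => S u = σ)).card) :
    ∃ l' : List α, l'.Perm I.toList ∧ CycChain R l' := by
  let f : Bool → Bool → Finset α := fun b c => I.filter (fun u => H u = b ∧ S u = c)
  have hcard : (f true false).card = (f false true).card := by
    have e1 : (I.filter (fun u => S u = true)).card = (f true true).card + (f false true).card := by
      rw [← Finset.card_filter_add_card_filter_not (s := I.filter (fun u => S u = true)) (fun u => H u = true)]
      simp only [f, Finset.filter_filter, Bool.not_eq_true]
      simp only [and_comm]
    have e2 : (I.filter (fun u => H u = true)).card = (f true true).card + (f true false).card := by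
      rw [← Finset.card_filter_add_card_filter_not (s := I.filter (fun u => H u = true)) (fun u => S u = true)]
      simp only [f, Finset.filter_filter, Bool.not_eq_true]
    omega
  obtain ⟨a0, ha0, ha0'⟩ := hA
  have hAne : (f false true).toList ≠ [] := by
    have : a0 ∈ f false true := by simp [f, ha0, ha0']
    intro h; rw [Finset.toList_eq_nil] at h; simp [h] at this
  obtain ⟨a, as, has⟩ := List.exists_cons_of_ne_nil hAne
  have hlen : (f true false).toList.length = (f false true).toList.length := by simpa using hcard
  have hDne : (f true false).toList ≠ [] := by
    intro h; rw [h] at hlen; rw [has] at hlen; simp at hlen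
  obtain ⟨d, ds, hds⟩ := List.exists_cons_of_ne_nil hDne
  let Bs := (f true true).toList
  let Cs := (f false false).toList
  have mB : ∀ x ∈ Bs, H x = true ∧ S x = true := by intro x hx; simp [Bs, f] at hx; exact hx.2
  have mC : ∀ x ∈ Cs, H x = false ∧ S x = false := by intro x hx; simp [Cs, f] at hx; exact hx.2
  have mD : ∀ x ∈ d :: ds, H x = true ∧ S x = false := by
    intro x hx; rw [← hds] at hx; simp [f] at hx; exact hx.2
  have mA : ∀ x ∈ a :: as, H x = false ∧ S x = true := by
    intro x hx; rw [← has] at hx; simp [f] at hx; exact hx.2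
  have hl2 : ds.length = as.length := by rw [hds, has] at hlen; simpa using hlen
  let l := Bs ++ ([d] ++ (Cs ++ ([a] ++ alt ds as)))
  have hperm : l.Perm I.toList := by
    have p1 : l.Perm (Bs ++ ([d] ++ (Cs ++ ([a] ++ (ds ++ as))))) := by
      refine List.Perm.append_left _ (List.Perm.append_left _ (List.Perm.append_left _ (List.Perm.append_left _ (alt_perm _ _ hl2))))
    refine p1.trans ?_
    rw [List.perm_iff_count]
    intro x
    have : I.toList.count x = if x ∈ I then 1 else 0 := by
      rw [List.Nodup.count I.nodup_toList]; simp
    rw [this]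
    have cc : ∀ b c, (f b c).toList.count x = if x ∈ f b c then 1 else 0 := by
      intro b c; rw [List.Nodup.count (Finset.nodup_toList _)]; simp
    have cd := cc true false
    have ca := cc false true
    rw [hds, List.count_cons] at cd
    rw [has, List.count_cons] at ca
    simp only [List.count_append, Bs, Cs, cc, List.count_cons, List.count_nil]
    simp only [f, Finset.mem_filter] at cd ca ⊢
    by_cases hx : x ∈ I
    · cases hH : H x <;> cases hS : S x <;> simp only [hx, hH, hS, true_and, and_true, and_false, reduceCtorEq, if_true, if_false] at cd ca ⊢ <;> omega
    · simp only [hx, false_and, if_false] at cd ca ⊢; omega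
  have hnd : l.Nodup := hperm.nodup_iff.2 I.nodup_toList
  have hfs : l.toFinset = I := by rw [List.toFinset_eq_of_perm _ _ hperm]; simp
  obtain ⟨q1, q2, q3⟩ := alt_chain H S ds as hl2 (fun x hx => mD x (by simp [hx])) (fun x hx => mA x (by simp [hx]))
  have d1 := mD d (by simp)
  have a1 := mA a (by simp)
  -- tail end
  have r3 : ∀ x ∈ ([a] ++ alt ds as).getLast?, S x = true := by
    by_cases hn : alt ds as = []
    · simp [hn, a1]
    · rw [List.getLast?_append_of_ne_nil _ hn]; exact q3
  have hty : CycChain (fun u v => S u = H v) l := by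
    refine ⟨?_, ?_⟩
    · simp only [l]
      rw [isChain_app, isChain_app, isChain_app, isChain_app]
      refine ⟨const_chain H S true Bs mB, ⟨by simp, ⟨const_chain H S false Cs mC, ⟨by simp, q1, ?_⟩, ?_⟩, ?_⟩, ?_⟩
      · intro x hx y hy; simp at hx; subst hx; rw [a1.2, q2 y hy]
      · intro x hx y hy; simp at hy; subst hy
        rw [a1.1, (mC x (List.mem_of_getLast? hx)).2]
      · intro x hx y hy; simp at hx; subst hx
        rw [d1.2]
        rcases hC : Cs with _ | ⟨c, cs⟩
        · rw [hC] at hy; simp at hy; subst hy; exact a1.1.symm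
        · rw [hC] at hy; simp at hy; subst hy; exact ((mC c (by simp [hC])).1).symm
      · intro x hx y hy; simp at hy; subst hy
        rw [d1.1, (mB x (List.mem_of_getLast? hx)).2]
    · intro x hx y hy
      have hx' : S x = true := by
        apply r3
        simp only [l] at hx
        rw [List.getLast?_append_of_ne_nil _ (by simp), List.getLast?_append_of_ne_nil _ (by simp),
          List.getLast?_append_of_ne_nil _ (by simp)] at hx
        exact hx
      have hy' : H y = true := by
        simp only [l] at hy
        rcases hB : Bs with _ | ⟨c, cs⟩
        · rw [hB] at hy; simp at hy; subst hy; exact d1.1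
        · rw [hB] at hy; simp at hy; subst hy; exact (mB c (by simp [hB])).1
      rw [hx', hy']
  obtain ⟨l', hp', hc'⟩ := exchange_all R H S e l hnd hty
    (by intro u hu; rw [hfs]; exact n1 u (by rw [← hfs]; simpa using hu))
    (by intro u hu; rw [hfs]; exact n2 u (by rw [← hfs]; simpa using hu))
    (by intro σ; rw [hfs]; exact hsz σ)
  exact ⟨l', hp'.trans hperm, hc'⟩

theorem finish' {α : Type*} (R : α → α → Prop) (H S : α → Bool) (e : ℕ) (I : Finset α)
    (hbal : (I.filter (fun u => S u = true)).card = (I.filter (fun u => H u = true)).card)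
    (hA : ∃ a ∈ I, H a ≠ S a)
    (n1 : ∀ u ∈ I, (I.filter (fun v => H v = S u ∧ ¬ R u v)).card ≤ e)
    (n2 : ∀ v ∈ I, (I.filter (fun u => S u = H v ∧ ¬ R u v)).card ≤ e)
    (hsz : ∀ σ, 3 * e + 3 ≤ (I.filter (fun u => S u = σ)).card) :
    ∃ l' : List α, l'.Perm I.toList ∧ CycChain R l' := by
  refine finish R H S e I hbal ?_ n1 n2 hsz
  by_contra hcon
  push Not at hcon
  obtain ⟨a, ha, hne⟩ := hA
  have h1 : I.filter (fun u => S u = true) ⊆ I.filter (fun u => H u = true) := by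
    intro u hu
    simp only [Finset.mem_filter] at hu ⊢
    refine ⟨hu.1, ?_⟩
    by_contra h
    exact hcon u hu.1 (by simpa using h) hu.2
  have h2 := Finset.eq_of_subset_of_card_le h1 hbal.ge
  have h3 : S a = true ↔ H a = true := by
    have := Finset.ext_iff.1 h2 a
    simpa [ha] using this
  exact hne (Bool.eq_iff_iff.2 h3.symm)

theorem cycChain_flatten {α : Type*} (R : α → α → Prop) (Ls : List (List α))
    (hne : ∀ l ∈ Ls, l ≠ []) (hch : ∀ l ∈ Ls, l.IsChain R) (hc : CycChain (JR R) Ls) :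
    CycChain R Ls.flatten := by
  have hn : [] ∉ Ls := fun h => hne _ h rfl
  refine ⟨(List.isChain_flatten hn).2 ⟨hch, hc.1⟩, ?_⟩
  rcases List.eq_nil_or_concat Ls with rfl | ⟨X, b, hX⟩
  · simp [JR]
  rcases hY : Ls with _ | ⟨a, Y⟩
  · simp [JR]
  have e1 : Ls.flatten = X.flatten ++ b := by rw [hX]; simp
  have e2 : Ls.flatten = a ++ Y.flatten := by rw [hY]; simp
  rw [← hY]
  have h1 : b ≠ [] := hne b (by rw [hX]; simp)
  have h2 : a ≠ [] := hne a (by rw [hY]; simp)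
  have : JR R b a := hc.2 b (by rw [hX]; simp) a (by rw [hY]; simp)
  intro x hx y hy
  rw [e1, List.getLast?_append_of_ne_nil _ h1] at hx
  rw [e2, List.head?_append_of_ne_nil _ h2] at hy
  exact this x hx y hy

theorem sdr {α β : Type*} [Inhabited α] (D : Finset β) (cand : β → Finset α)
    (h : ∀ d ∈ D, D.card ≤ (cand d).card) :
    ∃ f : β → α, (∀ d ∈ D, f d ∈ cand d) ∧ Set.InjOn f D := by
  suffices H : ∀ E : Finset β, E ⊆ D → ∃ f : β → α, (∀ d ∈ E, f d ∈ cand d) ∧ Set.InjOn f E from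
    H D (Finset.Subset.refl _)
  intro E
  induction E using Finset.induction_on with
  | empty => intro _; exact ⟨fun _ => default, by simp, by simp⟩
  | insert d E hd ih =>
    intro hE
    obtain ⟨f, hf, hinj⟩ := ih (fun x hx => hE (Finset.mem_insert_of_mem hx))
    have hcc : (E.image f).card < (cand d).card := by
      have h1 : (E.image f).card ≤ E.card := Finset.card_image_le
      have h2 := Finset.card_le_card hE
      rw [Finset.card_insert_of_notMem hd] at h2
      have := h d (hE (Finset.mem_insert_self _ _)); omega
    obtain ⟨a, ha, ha'⟩ := Finset.exists_mem_notMem_of_card_lt_card hcc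
    have hfd : ∀ c ∈ E, Function.update f d a c = f c := by
      intro c hcE; exact Function.update_of_ne (by rintro rfl; exact hd hcE) _ _
    refine ⟨Function.update f d a, ?_, ?_⟩
    · intro c hc
      rcases Finset.mem_insert.1 hc with rfl | hc
      · simpa using ha
      · rw [hfd c hc]; exact hf c hc
    · intro c hc c' hc' heq
      simp only [Finset.coe_insert, Set.mem_insert_iff, Finset.mem_coe] at hc hc'
      rcases hc with rfl | hc <;> rcases hc' with rfl | hc'
      · rfl
      · rw [hfd c' hc', Function.update_self] at heq
        exact absurd (Finset.mem_image.2 ⟨c', hc', heq.symm⟩) ha'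
      · rw [hfd c hc, Function.update_self] at heq
        exact absurd (Finset.mem_image.2 ⟨c, hc, heq⟩) ha'
      · rw [hfd c hc, hfd c' hc'] at heq; exact hinj hc hc' heq

/-- a state walk with abundant kinds -/
def Conn (Ab : Bool → Bool → Prop) : Bool → Bool → ℕ → Prop
  | σ, e, 0 => σ = e
  | σ, e, n+1 => ∃ s, Ab σ s ∧ Conn Ab s e n

theorem connect {α : Type*} (R : α → α → Prop) (H S : α → Bool) (F : Finset α) (e M : ℕ)
    (Ab : Bool → Bool → Prop) (heM : e ≤ M)
    (n1 : ∀ u ∈ F, (F.filter (fun v => H v = S u ∧ ¬ R u v)).card ≤ e) (w : α)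
    (hw : (F.filter (fun u => S u = H w ∧ ¬ R u w)).card ≤ M) (n : ℕ) :
    ∀ (u : α) (Av : Finset α), (F.filter (fun v => H v = S u ∧ ¬ R u v)).card ≤ M →
      Conn Ab (S u) (H w) n → (n = 0 → R u w) →
      (∀ a b, Ab a b → Av.card + n + 2 * M < (F.filter (fun v => H v = a ∧ S v = b)).card) →
      ∃ l : List α, l.length = n ∧ l.Nodup ∧ (∀ x ∈ l, x ∈ F ∧ x ∉ Av) ∧
        (u :: l ++ [w]).IsChain (fun x y => R x y ∧ S x = H y) := by
  induction n with
  | zero =>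
    intro u Av _ hc h0 _
    exact ⟨[], rfl, List.nodup_nil, by simp, by simpa using ⟨h0 rfl, hc⟩⟩
  | succ n ih =>
    intro u Av hu hc _ hsz
    obtain ⟨s, hab, hc⟩ := hc
    have hs := hsz _ _ hab
    have : ∃ v ∈ F.filter (fun v => H v = S u ∧ S v = s), v ∉ (Av ∪ F.filter (fun v => H v = S u ∧ ¬ R u v)) ∪
        F.filter (fun u => S u = H w ∧ ¬ R u w) := by
      apply Finset.exists_mem_notMem_of_card_lt_card
      have c1 := Finset.card_union_le (Av ∪ F.filter (fun v => H v = S u ∧ ¬ R u v)) (F.filter (fun u => S u = H w ∧ ¬ R u w))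
      have c2 := Finset.card_union_le Av (F.filter (fun v => H v = S u ∧ ¬ R u v))
      omega
    obtain ⟨v, hv, hv'⟩ := this
    simp only [Finset.mem_filter, Finset.mem_union, not_or, not_and, not_not] at hv hv'
    obtain ⟨hvF, hvH, hvS⟩ := hv
    obtain ⟨⟨hvA, hvu⟩, hvw⟩ := hv'
    have huv : R u v := hvu hvF hvH
    obtain ⟨l, hl1, hl2, hl3, hl4⟩ := ih v (insert v Av) ((n1 v hvF).trans heM) (by rw [hvS]; exact hc)
      (by rintro rfl; exact hvw hvF (by rw [hvS]; exact hc))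
      (by intro a b hab; have := hsz a b hab; have := Finset.card_insert_le v Av; omega)
    refine ⟨v :: l, by simp [hl1], ?_, ?_, ?_⟩
    · refine List.nodup_cons.2 ⟨?_, hl2⟩
      intro hm; exact (hl3 v hm).2 (Finset.mem_insert_self _ _)
    · intro x hx
      rcases List.mem_cons.1 hx with rfl | hx
      · exact ⟨hvF, hvA⟩
      · exact ⟨(hl3 x hx).1, fun h => (hl3 x hx).2 (Finset.mem_insert_of_mem h)⟩
    · simp only [List.cons_append] at hl4 ⊢
      rw [List.isChain_cons_cons]
      exact ⟨⟨huv, hvH.symm⟩, hl4⟩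

theorem connect_all {α : Type*} (R : α → α → Prop) (H S : α → Bool) (F : Finset α) (e M : ℕ)
    (Ab : Bool → Bool → Prop) (heM : e ≤ M)
    (n1 : ∀ u ∈ F, (F.filter (fun v => H v = S u ∧ ¬ R u v)).card ≤ e)
    (a b : ℕ → α) (n : ℕ → ℕ) (Av : Finset α) (t : ℕ)
    (ha : ∀ i < t, (F.filter (fun v => H v = S (a i) ∧ ¬ R (a i) v)).card ≤ M)
    (hb : ∀ i < t, (F.filter (fun u => S u = H (b i) ∧ ¬ R u (b i))).card ≤ M)
    (hc : ∀ i < t, Conn Ab (S (a i)) (H (b i)) (n i)) (h0 : ∀ i < t, n i = 0 → R (a i) (b i))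
    (hsz : ∀ a b, Ab a b → Av.card + ∑ i ∈ Finset.range t, n i + 2 * M <
      (F.filter (fun v => H v = a ∧ S v = b)).card) :
    ∃ mid : ℕ → List α, (∀ i < t, (mid i).length = n i ∧ (mid i).Nodup ∧ (∀ x ∈ mid i, x ∈ F ∧ x ∉ Av) ∧
        (a i :: mid i ++ [b i]).IsChain (fun x y => R x y ∧ S x = H y)) ∧
        ∀ i < t, ∀ j < t, i ≠ j → ∀ x ∈ mid i, x ∉ mid j := by
  induction t with
  | zero => exact ⟨fun _ => [], by simp, by simp⟩
  | succ t ih =>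
    obtain ⟨mid, h1, h2⟩ := ih (fun i hi => ha i (by omega)) (fun i hi => hb i (by omega))
      (fun i hi => hc i (by omega)) (fun i hi => h0 i (by omega))
      (by intro a b hab; have := hsz a b hab; rw [Finset.sum_range_succ] at this; omega)
    let Av' := Av ∪ (Finset.range t).biUnion (fun i => (mid i).toFinset)
    have hAv' : Av'.card ≤ Av.card + ∑ i ∈ Finset.range t, n i := by
      refine (Finset.card_union_le _ _).trans ?_
      gcongr
      refine Finset.card_biUnion_le.trans ?_
      refine Finset.sum_le_sum ?_
      intro i hi
      rw [← (h1 i (Finset.mem_range.1 hi)).1]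
      exact List.toFinset_card_le _
    obtain ⟨l, hl1, hl2, hl3, hl4⟩ := connect R H S F e M Ab heM n1 (b t) (hb t (by omega)) (n t) (a t) Av'
      (ha t (by omega)) (hc t (by omega)) (h0 t (by omega))
      (by intro a b hab; have := hsz a b hab; rw [Finset.sum_range_succ] at this; omega)
    have hu : ∀ i < t, Function.update mid t l i = mid i := fun i hi => Function.update_of_ne (by omega) _ _
    have hsep : ∀ i < t, ∀ x ∈ l, x ∉ mid i := by
      intro i hi x hx hx'
      apply (hl3 x hx).2
      refine Finset.mem_union_right _ (Finset.mem_biUnion.2 ⟨i, Finset.mem_range.2 hi, by simpa using hx'⟩)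
    refine ⟨Function.update mid t l, ?_, ?_⟩
    · intro i hi
      rcases Nat.lt_succ_iff_lt_or_eq.1 hi with hi | rfl
      · rw [hu i hi]; exact h1 i hi
      · rw [Function.update_self]
        exact ⟨hl1, hl2, fun x hx => ⟨(hl3 x hx).1, fun h => (hl3 x hx).2 (Finset.mem_union_left _ h)⟩, hl4⟩
    · intro i hi j hj hij x hx
      rcases Nat.lt_succ_iff_lt_or_eq.1 hi with hi | rfl <;> rcases Nat.lt_succ_iff_lt_or_eq.1 hj with hj | rfl
      · rw [hu i hi] at hx; rw [hu j hj]; exact h2 i hi j hj hij x hx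
      · rw [hu i hi] at hx; rw [Function.update_self]; intro h; exact hsep i hi x h hx
      · rw [Function.update_self] at hx; rw [hu j hj]; exact hsep j hj x hx
      · exact absurd rfl hij

theorem chain_glue {α : Type*} (R : α → α → Prop) (z : ℕ → α) (seg : ℕ → List α) (t : ℕ)
    (h : ∀ i < t, (z i :: seg i ++ [z (i+1)]).IsChain R) :
    ((List.range t).flatMap (fun i => z i :: seg i) ++ [z t]).IsChain R := by
  induction t with
  | zero => simp
  | succ t ih =>
    have h1 := ih (fun i hi => h i (by omega))
    have h2 := h t (by omega)
    rw [List.range_succ, List.flatMap_append]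
    simp only [List.flatMap_cons, List.flatMap_nil, List.append_nil]
    rw [List.append_assoc, isChain_app]
    rw [isChain_app] at h1
    refine ⟨h1.1, h2, ?_⟩
    intro x hx y hy
    exact h1.2.2 x hx y (by simpa using hy)

/-- weight of a typed element -/
def wt {α : Type*} (H S : α → Bool) (b : α) : ℤ := ((S b).toNat : ℤ) - ((H b).toNat : ℤ)

/-- telescoping -/
theorem telescope {α : Type*} (H S : α → Bool) : ∀ (l : List α) (x y : α),
    l.head? = some x → l.getLast? = some y →
    l.IsChain (fun x y => S x = H y) →
    (l.map (wt H S)).sum = ((S y).toNat : ℤ) - ((H x).toNat : ℤ)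
  | [a], x, y, h1, h2, _ => by simp at h1 h2; subst h1; subst h2; simp [wt]
  | a :: b :: l, x, y, h1, h2, h => by
    rw [List.isChain_cons_cons] at h
    have := telescope H S (b :: l) b y rfl (by rw [← h2]; simp [List.getLast?_cons_cons]) h.2
    rw [List.map_cons, List.sum_cons, this]
    simp only [List.head?_cons, Option.some.injEq] at h1
    subst h1
    simp only [wt, h.1]
    ring

theorem perm_flatten_of_perm {α : Type*} {L L' : List (List α)} (h : L.Perm L') :
    L.flatten.Perm L'.flatten := h.flatten

/-- Closing up: a list of typed items covering everything can be permuted into a Hamilton cycle. -/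
theorem close_items {α : Type*} (R : α → α → Prop) (H S : α → Bool) (e : ℕ) (T : Finset α)
    (near1 : ∀ u ∈ T, (T.filter (fun v => H v = S u ∧ ¬ R u v)).card ≤ e)
    (near2 : ∀ v ∈ T, (T.filter (fun u => S u = H v ∧ ¬ R u v)).card ≤ e)
    (Ls : List (List α)) (hnd : Ls.flatten.Nodup) (hne : ∀ l ∈ Ls, l ≠ [])
    (hch : ∀ l ∈ Ls, l.IsChain (fun x y => R x y))
    (β : List α → ℤ)
    (hbal : (Ls.map β).sum = 0)
    (hβ : ∀ l ∈ Ls, ∀ x ∈ l.head?, ∀ y ∈ l.getLast?, β l = ((S y).toNat : ℤ) - ((H x).toNat : ℤ))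
    (hT : ∀ l ∈ Ls, (∀ x ∈ l.head?, x ∈ T) ∧ (∀ x ∈ l.getLast?, x ∈ T))
    (hA : ∃ l ∈ Ls, ∃ x ∈ l.head?, ∃ y ∈ l.getLast?, H x ≠ S y)
    (Y : Finset α) (hY : ∀ y ∈ Y, [y] ∈ Ls)
    (hsz : ∀ σ, 3 * e + 3 ≤ (Y.filter (fun u => S u = σ)).card) :
    ∃ Ls' : List (List α), Ls'.Perm Ls ∧ CycChain R Ls'.flatten := by
  obtain ⟨l0, hl0, x0, hx0, y0, hy0, hneq⟩ := hA
  let hd : List α → α := fun l => l.head?.getD x0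
  let la : List α → α := fun l => l.getLast?.getD x0
  have hhd : ∀ l ∈ Ls, l.head? = some (hd l) := by
    intro l hl
    obtain ⟨a, l', rfl⟩ := List.exists_cons_of_ne_nil (hne l hl); simp [hd]
  have hla : ∀ l ∈ Ls, l.getLast? = some (la l) := by
    intro l hl
    simp only [la]
    rw [List.getLast?_eq_some_getLast (hne l hl)]; simp
  have hdm : ∀ l ∈ Ls, hd l ∈ l := fun l hl => List.mem_of_head? (hhd l hl)
  have lam : ∀ l ∈ Ls, la l ∈ l := fun l hl => List.mem_of_getLast? (hla l hl)
  have hLnd := (List.nodup_flatten.1 hnd)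
  have hdis : ∀ l ∈ Ls, ∀ l' ∈ Ls, ∀ x, x ∈ l → x ∈ l' → l = l' := by
    intro l hl l' hl' x hx hx'
    by_contra hneq
    have : Std.Symm (List.Disjoint (α := α)) := ⟨fun _ _ h => List.Disjoint.symm h⟩
    have := hLnd.2.forall hl hl' hneq
    exact this hx hx'
  have hLsnd : Ls.Nodup := by
    refine List.Pairwise.imp_of_mem ?_ hLnd.2
    intro a b ha hb hab heq
    subst heq
    exact hab (hdm a ha) (hdm a ha)
  have hfin := finish' (fun l l' => R (la l) (hd l')) (fun l => H (hd l)) (fun l => S (la l)) e Ls.toFinset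
    ?_ ?_ ?_ ?_ ?_
  · obtain ⟨L', hp, hc⟩ := hfin
    have hp' : L'.Perm Ls := hp.trans (by rw [List.perm_ext_iff_of_nodup (Finset.nodup_toList _) hLsnd]; simp)
    refine ⟨L', hp', ?_⟩
    refine cycChain_flatten R L' (fun l hl => hne l (hp'.mem_iff.1 hl)) (fun l hl => hch l (hp'.mem_iff.1 hl)) ?_
    have key : ∀ l ∈ L', ∀ l' ∈ L', R (la l) (hd l') → JR R l l' := by
      intro l hl l' hl' h x hx y hy
      rw [hla l (hp'.mem_iff.1 hl)] at hx
      rw [hhd l' (hp'.mem_iff.1 hl')] at hy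
      simp at hx hy; subst hx; subst hy; exact h
    refine ⟨?_, ?_⟩
    · refine List.IsChain.imp_of_mem_imp ?_ hc.1
      intro a b ha hb h; exact key a ha b hb h
    · intro x hx y hy
      exact key x (List.mem_of_getLast? hx) y (List.mem_of_head? hy) (hc.2 x hx y hy)
  · have h1 : (Ls.map β).sum = ∑ l ∈ Ls.toFinset, (((S (la l)).toNat : ℤ) - ((H (hd l)).toNat : ℤ)) := by
      rw [List.sum_toFinset _ hLsnd]
      congr 1
      refine List.map_congr_left ?_
      intro l hl
      exact hβ l hl _ (by simp [hhd l hl]) _ (by simp [hla l hl])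
    rw [hbal, Finset.sum_sub_distrib] at h1
    have h2 : ∀ f : List α → Bool, ∑ l ∈ Ls.toFinset, ((f l).toNat : ℤ) = ((Ls.toFinset.filter (fun l => f l = true)).card : ℤ) := by
      intro f
      rw [Finset.card_filter]; push_cast
      refine Finset.sum_congr rfl ?_
      intro l _; cases f l <;> simp
    rw [h2, h2] at h1
    have := sub_eq_zero.1 h1.symm
    exact_mod_cast this
  · refine ⟨l0, by simpa using hl0, ?_⟩
    rw [hhd l0 hl0] at hx0; rw [hla l0 hl0] at hy0
    simp at hx0 hy0
    rw [hx0, hy0]; exact hneq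
  · intro u hu
    have hu' : u ∈ Ls := by simpa using hu
    refine le_trans (Finset.card_le_card_of_injOn hd ?_ ?_) (near1 (la u) ((hT u hu').2 _ (by simp [hla u hu'])))
    · intro v hv
      simp only [Finset.coe_filter, Set.mem_ofPred_eq, List.mem_toFinset] at hv ⊢
      exact ⟨(hT v hv.1).1 _ (by simp [hhd v hv.1]), hv.2⟩
    · intro v hv v' hv' h
      simp only [Finset.coe_filter, Set.mem_ofPred_eq, List.mem_toFinset] at hv hv'
      exact hdis v hv.1 v' hv'.1 _ (hdm v hv.1) (h ▸ hdm v' hv'.1)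
  · intro u hu
    have hu' : u ∈ Ls := by simpa using hu
    refine le_trans (Finset.card_le_card_of_injOn la ?_ ?_) (near2 (hd u) ((hT u hu').1 _ (by simp [hhd u hu'])))
    · intro v hv
      simp only [Finset.coe_filter, Set.mem_ofPred_eq, List.mem_toFinset] at hv ⊢
      exact ⟨(hT v hv.1).2 _ (by simp [hla v hv.1]), hv.2⟩
    · intro v hv v' hv' h
      simp only [Finset.coe_filter, Set.mem_ofPred_eq, List.mem_toFinset] at hv hv'
      exact hdis v hv.1 v' hv'.1 _ (lam v hv.1) (h ▸ lam v' hv'.1)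
  · intro σ
    refine (hsz σ).trans (Finset.card_le_card_of_injOn (fun y => [y]) ?_ ?_)
    · intro y hy
      simp only [Finset.coe_filter, Set.mem_ofPred_eq, List.mem_toFinset] at hy ⊢
      exact ⟨hY y hy.1, by simpa [la] using hy.2⟩
    · intro y _ y' _ h; simpa using h

theorem flatten_singles {α : Type*} (l : List α) : (l.map (fun y => [y])).flatten = l := by
  induction l with
  | nil => rfl
  | cons a l ih => simp only [List.map_cons, List.flatten_cons, ih, List.singleton_append]

theorem assemble {α : Type*} (R : α → α → Prop) (H S : α → Bool) (I T F : Finset α)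
    (hFT : F ⊆ T) (hTI : T ⊆ I) (e M ns t : ℕ) (heM : e ≤ M) (Ab : Bool → Bool → Prop)
    (near1 : ∀ u ∈ T, (T.filter (fun v => H v = S u ∧ ¬ R u v)).card ≤ e)
    (near2 : ∀ v ∈ T, (T.filter (fun u => S u = H v ∧ ¬ R u v)).card ≤ e)
    (hns : (I \ T).card ≤ ns)
    (sp1 : ∀ b ∈ I \ T, 2 * ns ≤ (F.filter (fun v => H v = S b ∧ R b v)).card)
    (sp2 : ∀ b ∈ I \ T, 2 * ns ≤ (F.filter (fun v => S v = H b ∧ R v b)).card)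
    (hbal : ∑ b ∈ I, wt H S b = 0)
    (z : ℕ → α) (hz : ∀ i ≤ t, z i ∈ I \ T) (hzi : ∀ i ≤ t, ∀ j ≤ t, z i = z j → i = j)
    (u : ℕ → Option α) (L : ℕ → ℕ)
    (hu : ∀ i < t, ∀ w, u i = some w → w ∈ T \ F ∧ R (z i) w ∧ S (z i) = H w ∧
      (L i = 0 → R w (z (i+1))) ∧ Conn Ab (S w) (H (z (i+1))) (L i) ∧
      (F.filter (fun v => S v = H (z (i+1)) ∧ ¬ R v (z (i+1)))).card ≤ M)
    (huinj : ∀ i < t, ∀ j < t, ∀ w, u i = some w → u j = some w → i = j)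
    (hm : ∀ i < t, u i = none → 3 ≤ L i ∧
      ∀ a b, Ab (S (z i)) a → Ab b (H (z (i+1))) → Conn Ab a b (L i - 2))
    (hAb : ∀ v ∈ F, Ab (H v) (S v))
    (hsz : ∀ a b, Ab a b → 2 * ns + ∑ i ∈ Finset.range t, L i + 2 * M <
      (F.filter (fun v => H v = a ∧ S v = b)).card)
    (hsz2 : ∀ σ, 3 * e + 3 + 2 * ns + ∑ i ∈ Finset.range t, L i ≤ (F.filter (fun v => S v = σ)).card)
    (hne : (∃ σ, Ab σ (!σ)) ∨ ∃ a ∈ T \ F, H a ≠ S a ∧ ∀ i < t, u i ≠ some a) :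
    ∃ (fill : ℕ → List α) (l : List α), (∀ i < t, (fill i).length = L i ∧ ∀ x ∈ fill i, x ∈ F) ∧
      (((List.range t).flatMap (fun i => z i :: ((u i).toList ++ fill i)) ++ [z t]) ++ l).Perm I.toList ∧
      CycChain R (((List.range t).flatMap (fun i => z i :: ((u i).toList ++ fill i)) ++ [z t]) ++ l) := by
  have : Inhabited α := ⟨z 0⟩
  -- wrappers
  obtain ⟨w, hw, hwi⟩ := sdr ((I \ T) ×ˢ (Finset.univ : Finset Bool))
    (fun p => if p.2 then F.filter (fun v => H v = S p.1 ∧ R p.1 v) else F.filter (fun v => S v = H p.1 ∧ R v p.1))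
    (by
      rintro ⟨b, c⟩ hb
      have hb' : b ∈ I \ T := (Finset.mem_product.1 hb).1
      rw [Finset.card_product]
      have h1 := sp1 b hb'
      have h2 := sp2 b hb'
      cases c <;> simp <;> omega)
  have hD : ∀ b ∈ I \ T, ∀ c, (b, c) ∈ ((I \ T) ×ˢ (Finset.univ : Finset Bool)) := by
    intro b hb c; exact Finset.mem_product.2 ⟨hb, Finset.mem_univ _⟩
  have hwt : ∀ b ∈ I \ T, w (b, true) ∈ F ∧ H (w (b, true)) = S b ∧ R b (w (b, true)) := by
    intro b hb; have := hw _ (hD b hb true); simpa using this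
  have hwf : ∀ b ∈ I \ T, w (b, false) ∈ F ∧ S (w (b, false)) = H b ∧ R (w (b, false)) b := by
    intro b hb; have := hw _ (hD b hb false); simpa using this
  have hwF : ∀ b ∈ I \ T, ∀ c, w (b, c) ∈ F := by
    intro b hb c; cases c; exacts [(hwf b hb).1, (hwt b hb).1]
  have hwinj : ∀ b ∈ I \ T, ∀ b' ∈ I \ T, ∀ c c', w (b, c) = w (b', c') → b = b' ∧ c = c' := by
    intro b hb b' hb' c c' h
    have := hwi (hD b hb c) (hD b' hb' c') h
    simpa using this
  let WR : Finset α := ((I \ T) ×ˢ (Finset.univ : Finset Bool)).image w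
  have hWRc : WR.card ≤ 2 * ns := by
    refine Finset.card_image_le.trans ?_
    rw [Finset.card_product]; simp; omega
  have hWR : ∀ b ∈ I \ T, ∀ c, w (b, c) ∈ WR := fun b hb c => Finset.mem_image_of_mem _ (hD b hb c)
  -- middle parts
  let a : ℕ → α := fun i => (u i).getD (w (z i, true))
  let b : ℕ → α := fun i => if u i = none then w (z (i+1), false) else z (i+1)
  let n : ℕ → ℕ := fun i => if u i = none then L i - 2 else L i
  have n1F : ∀ v ∈ T, (F.filter (fun y => H y = S v ∧ ¬ R v y)).card ≤ e := fun v hv =>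
    (Finset.card_le_card (Finset.filter_subset_filter _ hFT)).trans (near1 v hv)
  have n2F : ∀ v ∈ T, (F.filter (fun y => S y = H v ∧ ¬ R y v)).card ≤ e := fun v hv =>
    (Finset.card_le_card (Finset.filter_subset_filter _ hFT)).trans (near2 v hv)
  have hnL : ∑ i ∈ Finset.range t, n i ≤ ∑ i ∈ Finset.range t, L i := by
    refine Finset.sum_le_sum ?_; intro i _; simp only [n]; split_ifs <;> omega
  obtain ⟨mid, hmid, hmidd⟩ := connect_all R H S F e M Ab heM (fun v hv => n1F v (hFT hv)) a b n WR t
    (by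
      intro i hi
      refine le_trans (n1F _ ?_) heM
      rcases h : u i with _ | x
      · simp only [a, h, Option.getD_none]; exact hFT (hwF _ (hz i (by omega)) _)
      · simp only [a, h, Option.getD_some]; exact (Finset.mem_sdiff.1 (hu i hi x h).1).1)
    (by
      intro i hi
      rcases h : u i with _ | x
      · simp only [b, h, if_true]; exact (n2F _ (hFT (hwF _ (hz (i+1) (by omega)) _))).trans heM
      · simp only [b, h, reduceCtorEq, if_false]; exact (hu i hi x h).2.2.2.2.2)
    (by
      intro i hi
      rcases h : u i with _ | x
      · simp only [a, b, n, h, if_true, Option.getD_none]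
        have h1 := hwt _ (hz i (by omega))
        have h2 := hwf _ (hz (i+1) (by omega))
        refine (hm i hi h).2 _ _ ?_ ?_
        · rw [← h1.2.1]; exact hAb _ h1.1
        · rw [← h2.2.1]; exact hAb _ h2.1
      · simp only [a, b, n, h, reduceCtorEq, if_false, Option.getD_some]; exact (hu i hi x h).2.2.2.2.1)
    (by
      intro i hi h0
      rcases h : u i with _ | x
      · simp only [n, h, if_true] at h0; have := (hm i hi h).1; omega
      · simp only [a, b, h, reduceCtorEq, if_false, Option.getD_some]
        simp only [n, h, reduceCtorEq, if_false] at h0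
        exact (hu i hi x h).2.2.2.1 h0)
    (by intro c d hcd; have := hsz c d hcd; omega)
  let fill : ℕ → List α := fun i => if u i = none then w (z i, true) :: mid i ++ [w (z (i+1), false)] else mid i
  let seg : ℕ → List α := fun i => (u i).toList ++ fill i
  have hfillmem : ∀ i, ∀ x ∈ fill i, x ∈ mid i ∨ (u i = none ∧ (x = w (z i, true) ∨ x = w (z (i+1), false))) := by
    intro i x hx
    by_cases h : u i = none
    · simp only [fill, h, if_true] at hx; simp at hx; tauto
    · simp only [fill, h, if_false] at hx; exact Or.inl hx
  have hfillF : ∀ i < t, ∀ x ∈ fill i, x ∈ F := by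
    intro i hi x hx
    rcases hfillmem i x hx with h | ⟨-, h | h⟩
    · exact ((hmid i hi).2.2.1 x h).1
    · rw [h]; exact hwF _ (hz i (by omega)) _
    · rw [h]; exact hwF _ (hz (i+1) (by omega)) _
  have hfilllen : ∀ i < t, (fill i).length = L i := by
    intro i hi
    by_cases h : u i = none
    · have h1 := (hmid i hi).1; have h2 := (hm i hi h).1
      simp only [n, h, if_true] at h1
      simp only [fill, h, if_true]; simp; omega
    · have h1 := (hmid i hi).1
      simp only [n, h, if_false] at h1
      simp only [fill, h, if_false]; exact h1
  -- chains
  let R' : α → α → Prop := fun x y => R x y ∧ S x = H y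
  have hsegchain : ∀ i < t, (z i :: seg i ++ [z (i+1)]).IsChain R' := by
    intro i hi
    have h4 := (hmid i hi).2.2.2
    rcases h : u i with _ | x
    · simp only [a, b, h, if_true, Option.getD_none] at h4
      have h1 := hwt _ (hz i (by omega))
      have h2 := hwf _ (hz (i+1) (by omega))
      have e1 : z i :: seg i ++ [z (i+1)] = [z i] ++ ((w (z i, true) :: mid i ++ [w (z (i+1), false)]) ++ [z (i+1)]) := by
        simp [seg, fill, h]
      rw [e1, isChain_app, isChain_app]
      refine ⟨by simp, ⟨h4, by simp, ?_⟩, ?_⟩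
      · intro p hp q hq
        rw [show (w (z i, true) :: mid i ++ [w (z (i+1), false)]).getLast? = some (w (z (i+1), false)) from List.getLast?_concat] at hp
        simp at hp hq; subst hp; subst hq; exact ⟨h2.2.2, h2.2.1⟩
      · intro p hp q hq; simp at hp hq; subst hp; subst hq; exact ⟨h1.2.2, h1.2.1.symm⟩
    · simp only [a, b, h, reduceCtorEq, if_false, Option.getD_some] at h4
      have e1 : z i :: seg i ++ [z (i+1)] = [z i] ++ (x :: mid i ++ [z (i+1)]) := by
        simp [seg, fill, h]
      rw [e1, isChain_app]
      refine ⟨by simp, h4, ?_⟩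
      intro p hp q hq; simp at hp hq; rw [← hp, ← hq]
      exact ⟨(hu i hi _ h).2.1, (hu i hi _ h).2.2.1⟩
  have hZchain := chain_glue R' z seg t hsegchain
  set Z : List α := (List.range t).flatMap (fun i => z i :: seg i) ++ [z t] with hZdef
  have hZmem : ∀ x ∈ Z, (∃ i ≤ t, x = z i) ∨ (∃ i < t, u i = some x) ∨ (∃ i < t, x ∈ fill i) := by
    intro x hx
    simp only [hZdef, List.mem_append, List.mem_flatMap, List.mem_range, List.mem_cons, seg, Option.mem_toList,
      List.not_mem_nil, or_false] at hx
    rcases hx with ⟨i, hi, h | h | h⟩ | h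
    · exact Or.inl ⟨i, hi.le, h⟩
    · exact Or.inr (Or.inl ⟨i, hi, h⟩)
    · exact Or.inr (Or.inr ⟨i, hi, h⟩)
    · exact Or.inl ⟨t, le_refl _, h⟩
  have hzZ : ∀ i ≤ t, z i ∈ Z := by
    intro i hi
    rcases hi.lt_or_eq with hi | rfl
    · refine List.mem_append_left _ (List.mem_flatMap.2 ⟨i, List.mem_range.2 hi, by simp⟩)
    · simp [hZdef]
  have hzT : ∀ i ≤ t, z i ∉ T := fun i hi => (Finset.mem_sdiff.1 (hz i hi)).2
  have huT : ∀ i < t, ∀ x, u i = some x → x ∈ T ∧ x ∉ F := fun i hi x h => Finset.mem_sdiff.1 (hu i hi x h).1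
  have hmF : ∀ i < t, ∀ x ∈ mid i, x ∈ F ∧ x ∉ WR := fun i hi x h => (hmid i hi).2.2.1 x h
  have hzne : ∀ i ≤ t, ∀ j ≤ t, ∀ c c', w (z i, c) = w (z j, c') → i = j ∧ c = c' := by
    intro i hi j hj c c' h
    have := hwinj _ (hz i hi) _ (hz j hj) _ _ h
    exact ⟨hzi i hi j hj this.1, this.2⟩
  -- nodup of Z
  have hZnd : Z.Nodup := by
    rw [hZdef, List.nodup_append']
    refine ⟨?_, by simp, ?_⟩
    · rw [List.nodup_flatMap]
      refine ⟨?_, ?_⟩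
      · intro i hi
        have hi := List.mem_range.1 hi
        have hmn := (hmid i hi).2.1
        have z1 := hzT i hi.le
        rw [List.nodup_cons]
        refine ⟨?_, ?_⟩
        · intro h
          rcases List.mem_append.1 h with h | h
          · exact z1 (huT i hi _ (by simpa using h)).1
          · exact z1 (hFT (hfillF i hi _ h))
        · rcases h : u i with _ | x
          · simp only [seg, fill, h, if_true, Option.toList_none, List.nil_append, List.cons_append, List.nodup_cons]
            refine ⟨?_, ?_⟩
            · intro hx
              rcases List.mem_append.1 hx with hx | hx
              · exact (hmF i hi _ hx).2 (hWR _ (hz i hi.le) _)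
              · simp at hx; exact absurd (hzne i hi.le (i+1) hi _ _ hx).1 (by omega)
            · rw [List.nodup_append']
              refine ⟨hmn, by simp, ?_⟩
              intro y hy hy'
              simp at hy'; subst hy'
              exact (hmF i hi _ hy).2 (hWR _ (hz (i+1) hi) _)
          · simp only [seg, fill, h, reduceCtorEq, if_false, Option.toList_some, List.cons_append, List.nil_append, List.nodup_cons]
            exact ⟨fun hx => (huT i hi x h).2 (hmF i hi x hx).1, hmn⟩
      · refine List.Pairwise.imp_of_mem ?_ (List.nodup_range (n := t))
        intro i j hi hj hij x hx hx'
        have hi := List.mem_range.1 hi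
        have hj := List.mem_range.1 hj
        simp only [List.mem_cons, seg, List.mem_append, Option.mem_toList] at hx hx'
        rcases hx with hx | hx | hx
        · rcases hx' with hy | hy | hy
          · exact hij (hzi i hi.le j hj.le (hx ▸ hy))
          · exact hzT i hi.le (hx ▸ (huT j hj _ hy).1)
          · exact hzT i hi.le (hx ▸ hFT (hfillF j hj _ hy))
        · rcases hx' with hy | hy | hy
          · exact hzT j hj.le (hy ▸ (huT i hi _ hx).1)
          · exact hij (huinj i hi j hj x hx hy)
          · exact (huT i hi _ hx).2 (hfillF j hj _ hy)
        · rcases hx' with hy | hy | hy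
          · exact hzT j hj.le (hy ▸ hFT (hfillF i hi _ hx))
          · exact (huT j hj _ hy).2 (hfillF i hi _ hx)
          · rcases hfillmem i x hx with h | ⟨-, h | h⟩ <;> rcases hfillmem j x hy with g | ⟨-, g | g⟩
            · exact hmidd i hi j hj hij x h g
            · exact (hmF i hi _ h).2 (g ▸ hWR _ (hz j hj.le) _)
            · exact (hmF i hi _ h).2 (g ▸ hWR _ (hz (j+1) hj) _)
            · exact (hmF j hj _ g).2 (h ▸ hWR _ (hz i hi.le) _)
            · exact hij (hzne i hi.le j hj.le _ _ (h ▸ g)).1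
            · exact absurd (hzne i hi.le (j+1) hj _ _ (h ▸ g)).2 (by simp)
            · exact (hmF j hj _ g).2 (h ▸ hWR _ (hz (i+1) hi) _)
            · exact absurd (hzne (i+1) hi j hj.le _ _ (h ▸ g)).2 (by simp)
            · have := (hzne (i+1) hi (j+1) hj _ _ (h ▸ g)).1; omega
    · intro x hx hx'
      simp at hx'; subst hx'
      simp only [List.mem_flatMap, List.mem_range, List.mem_cons, seg, List.mem_append, Option.mem_toList] at hx
      obtain ⟨i, hi, h | h | h⟩ := hx
      · have := hzi t le_rfl i hi.le h; omega
      · exact hzT t le_rfl (huT i hi _ h).1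
      · exact hzT t le_rfl (hFT (hfillF i hi _ h))
  -- wrapped Z
  have hz0 := hz 0 (by omega)
  have hzt := hz t le_rfl
  have hp0 : w (z 0, false) ∉ Z := by
    intro h
    have hF := hwF _ hz0 false
    rcases hZmem _ h with ⟨i, hi, h⟩ | ⟨i, hi, h⟩ | ⟨i, hi, h⟩
    · exact hzT i hi (h ▸ hFT hF)
    · exact (huT i hi _ h).2 hF
    · rcases hfillmem i _ h with h | ⟨-, h | h⟩
      · exact (hmF i hi _ h).2 (hWR _ hz0 _)
      · exact absurd (hzne _ (by omega) _ hi.le _ _ h).2 (by simp)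
      · have := (hzne _ (by omega) _ hi _ _ h).1; omega
  have hrt : w (z t, true) ∉ Z := by
    intro h
    have hF := hwF _ hzt true
    rcases hZmem _ h with ⟨i, hi, h⟩ | ⟨i, hi, h⟩ | ⟨i, hi, h⟩
    · exact hzT i hi (h ▸ hFT hF)
    · exact (huT i hi _ h).2 hF
    · rcases hfillmem i _ h with h | ⟨-, h | h⟩
      · exact (hmF i hi _ h).2 (hWR _ hzt _)
      · have := (hzne _ (by omega) _ hi.le _ _ h).1; omega
      · exact absurd (hzne _ (by omega) _ hi _ _ h).2 (by simp)
  let Z' : List α := w (z 0, false) :: (Z ++ [w (z t, true)])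
  have hZ'nd : Z'.Nodup := by
    simp only [Z']
    rw [List.nodup_cons, List.nodup_append']
    refine ⟨?_, hZnd, by simp, ?_⟩
    · intro h
      rcases List.mem_append.1 h with h | h
      · exact hp0 h
      · simp at h; exact absurd (hzne _ (by omega) _ le_rfl _ _ h).2 (by simp)
    · intro x hx hx'; simp at hx'; subst hx'; exact hrt hx
  have hZhead : Z.head? = some (z 0) := by
    rw [hZdef]
    rcases Nat.eq_zero_or_pos t with h | h
    · subst h; simp
    · obtain ⟨t', rfl⟩ : ∃ t', t = t' + 1 := ⟨t - 1, by omega⟩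
      rw [List.range_succ_eq_map]; simp
  have hZne : Z ≠ [] := by rw [hZdef]; simp
  have hZlast : Z.getLast? = some (z t) := by rw [hZdef]; simp
  have hZ'chain : Z'.IsChain R' := by
    have e1 : Z' = [w (z 0, false)] ++ (Z ++ [w (z t, true)]) := rfl
    rw [e1, isChain_app, isChain_app]
    refine ⟨by simp, ⟨hZchain, by simp, ?_⟩, ?_⟩
    · intro p hp q hq; rw [hZlast] at hp; simp at hp hq; subst hp; subst hq
      exact ⟨(hwt _ hzt).2.2, (hwt _ hzt).2.1.symm⟩
    · intro p hp q hq; rw [List.head?_append_of_ne_nil _ hZne, hZhead] at hq; simp at hp hq; subst hp; subst hq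
      exact ⟨(hwf _ hz0).2.2, (hwf _ hz0).2.1⟩
  -- other specials
  let Sp : Finset α := (I \ T).filter (fun b => ∀ i ≤ t, b ≠ z i)
  have hSp : ∀ b ∈ Sp, b ∈ I \ T ∧ ∀ i ≤ t, b ≠ z i := fun b hb => Finset.mem_filter.1 hb
  let wrap : α → List α := fun b => [w (b, false), b, w (b, true)]
  let U0 : List (List α) := Z' :: Sp.toList.map wrap
  have hZ'mem : ∀ x ∈ Z', (x = w (z 0, false) ∨ x = w (z t, true)) ∨ x ∈ Z := by
    intro x hx; simp only [Z', List.mem_cons, List.mem_append, List.not_mem_nil, or_false] at hx; tauto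
  have hwrapdis : ∀ b ∈ Sp, ∀ x ∈ wrap b, x ∉ Z' := by
    intro b hb x hx hx'
    obtain ⟨hbI, hbz⟩ := hSp b hb
    have hbT := (Finset.mem_sdiff.1 hbI).2
    simp only [wrap, List.mem_cons, List.not_mem_nil, or_false] at hx
    have hx2 : x = b ∨ ∃ c, x = w (b, c) := by
      rcases hx with h | h | h
      exacts [Or.inr ⟨_, h⟩, Or.inl h, Or.inr ⟨_, h⟩]
    rcases hZ'mem x hx' with h | h
    · have hx3 : ∃ j ≤ t, ∃ c, x = w (z j, c) := by
        rcases h with h | h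
        exacts [⟨0, by omega, _, h⟩, ⟨t, le_rfl, _, h⟩]
      obtain ⟨j, hj, c, hxj⟩ := hx3
      rcases hx2 with h2 | ⟨c', h2⟩
      · exact hbT (h2 ▸ hxj ▸ hFT (hwF _ (hz j hj) c))
      · exact hbz j hj (hwinj _ hbI _ (hz j hj) _ _ (h2.symm.trans hxj)).1
    · rcases hx2 with h2 | ⟨c', h2⟩
      · rcases hZmem x h with ⟨i, hi, h⟩ | ⟨i, hi, h⟩ | ⟨i, hi, h⟩
        · exact hbz i hi (h2.symm.trans h)
        · exact hbT (h2 ▸ (huT i hi _ h).1)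
        · exact hbT (h2 ▸ hFT (hfillF i hi _ h))
      · have hF : x ∈ F := h2 ▸ hwF b hbI c'
        rcases hZmem x h with ⟨i, hi, h⟩ | ⟨i, hi, h⟩ | ⟨i, hi, h⟩
        · exact hzT i hi (h ▸ hFT hF)
        · exact (huT i hi _ h).2 hF
        · rcases hfillmem i _ h with h | ⟨-, h | h⟩
          · exact (hmF i hi _ h).2 (h2 ▸ hWR _ hbI _)
          · exact hbz i hi.le (hwinj _ hbI _ (hz i hi.le) _ _ (h2.symm.trans h)).1
          · exact hbz (i+1) hi (hwinj _ hbI _ (hz (i+1) hi) _ _ (h2.symm.trans h)).1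
  have hU0nd : U0.flatten.Nodup := by
    rw [List.nodup_flatten]
    refine ⟨?_, ?_⟩
    · intro l hl
      rcases List.mem_cons.1 hl with rfl | hl
      · exact hZ'nd
      · obtain ⟨b, hb, rfl⟩ := List.mem_map.1 hl
        obtain ⟨hbI, hbz⟩ := hSp b (by simpa using hb)
        have hbT := (Finset.mem_sdiff.1 hbI).2
        have h1 : w (b, false) ≠ b := fun h => hbT (h ▸ hFT (hwF b hbI false))
        have h2 : b ≠ w (b, true) := fun h => hbT (h.symm ▸ hFT (hwF b hbI true))
        have h3 : w (b, false) ≠ w (b, true) := fun h => absurd (hwinj b hbI b hbI _ _ h).2 (by simp)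
        simp [wrap, h1, h2, h3]
    · refine List.pairwise_cons.2 ⟨?_, ?_⟩
      · intro l hl x hx hx'
        obtain ⟨b, hb, rfl⟩ := List.mem_map.1 hl
        exact hwrapdis b (by simpa using hb) x hx' hx
      · rw [List.pairwise_map]
        refine List.Pairwise.imp_of_mem ?_ (Finset.nodup_toList Sp)
        intro b c hb hc hbc x hx hx'
        have hb' := (hSp b (by simpa using hb)).1
        have hc' := (hSp c (by simpa using hc)).1
        have hbT := (Finset.mem_sdiff.1 hb').2
        have hcT := (Finset.mem_sdiff.1 hc').2
        have cl : ∀ b, x ∈ wrap b → x = b ∨ ∃ c, x = w (b, c) := by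
          intro b hx
          simp only [wrap, List.mem_cons, List.not_mem_nil, or_false] at hx
          rcases hx with h | h | h
          exacts [Or.inr ⟨_, h⟩, Or.inl h, Or.inr ⟨_, h⟩]
        rcases cl b hx with h | ⟨d, h⟩ <;> rcases cl c hx' with g | ⟨f, g⟩
        · exact hbc (h.symm.trans g)
        · exact hbT (h ▸ g ▸ hFT (hwF c hc' f))
        · exact hcT (g ▸ h ▸ hFT (hwF b hb' d))
        · exact hbc (hwinj b hb' c hc' _ _ (h.symm.trans g)).1
  have hU0I : ∀ x ∈ U0.flatten, x ∈ I := by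
    intro x hx
    have hFI : ∀ y ∈ F, y ∈ I := fun y hy => hTI (hFT hy)
    obtain ⟨l, hl, hx⟩ := List.mem_flatten.1 hx
    rcases List.mem_cons.1 hl with rfl | hl
    · rcases hZ'mem x hx with (h | h) | h
      · exact h ▸ hFI _ (hwF _ hz0 _)
      · exact h ▸ hFI _ (hwF _ hzt _)
      · rcases hZmem x h with ⟨i, hi, h⟩ | ⟨i, hi, h⟩ | ⟨i, hi, h⟩
        · exact h ▸ (Finset.mem_sdiff.1 (hz i hi)).1
        · exact hTI (huT i hi _ h).1
        · exact hFI _ (hfillF i hi _ h)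
    · obtain ⟨b, hb, rfl⟩ := List.mem_map.1 hl
      obtain ⟨hbI, -⟩ := hSp b (by simpa using hb)
      simp only [wrap, List.mem_cons, List.not_mem_nil, or_false] at hx
      rcases hx with h | h | h
      · exact h ▸ hFI _ (hwF _ hbI _)
      · exact h ▸ (Finset.mem_sdiff.1 hbI).1
      · exact h ▸ hFI _ (hwF _ hbI _)
  -- the singles
  let Y : Finset α := I.filter (fun x => x ∉ U0.flatten)
  have hYT : ∀ y ∈ Y, y ∈ T := by
    intro y hy
    obtain ⟨hyI, hyU⟩ := Finset.mem_filter.1 hy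
    by_contra hyT
    have hyIT : y ∈ I \ T := Finset.mem_sdiff.2 ⟨hyI, hyT⟩
    apply hyU
    by_cases h : ∀ i ≤ t, y ≠ z i
    · refine List.mem_flatten.2 ⟨wrap y, List.mem_cons_of_mem _ (List.mem_map.2 ⟨y, ?_, rfl⟩), by simp [wrap]⟩
      simp only [Finset.mem_toList]; exact Finset.mem_filter.2 ⟨hyIT, h⟩
    · push Not at h
      obtain ⟨i, hi, rfl⟩ := h
      refine List.mem_flatten.2 ⟨Z', List.mem_cons_self, ?_⟩
      exact List.mem_cons_of_mem _ (List.mem_append_left _ (hzZ i hi))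
  let Ls : List (List α) := U0 ++ Y.toList.map (fun y => [y])
  have hfl : Ls.flatten = U0.flatten ++ Y.toList := by
    simp only [Ls, List.flatten_append]; congr 1
    exact flatten_singles _
  have hLsnd : Ls.flatten.Nodup := by
    rw [hfl, List.nodup_append']
    refine ⟨hU0nd, Finset.nodup_toList _, ?_⟩
    intro x hx hx'
    exact (Finset.mem_filter.1 (Finset.mem_toList.1 hx')).2 hx
  have hLsperm : Ls.flatten.Perm I.toList := by
    rw [List.perm_ext_iff_of_nodup hLsnd (Finset.nodup_toList _)]
    intro x
    rw [hfl, List.mem_append, Finset.mem_toList, Finset.mem_toList]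
    constructor
    · rintro (h | h)
      · exact hU0I x h
      · exact (Finset.mem_filter.1 h).1
    · intro h
      by_cases h' : x ∈ U0.flatten
      · exact Or.inl h'
      · exact Or.inr (Finset.mem_filter.2 ⟨h, h'⟩)
  have hLscase : ∀ l ∈ Ls, l = Z' ∨ (∃ b ∈ Sp, l = wrap b) ∨ (∃ y ∈ Y, l = [y]) := by
    intro l hl
    rcases List.mem_append.1 hl with hl | hl
    · rcases List.mem_cons.1 hl with rfl | hl
      · exact Or.inl rfl
      · obtain ⟨b, hb, rfl⟩ := List.mem_map.1 hl
        exact Or.inr (Or.inl ⟨b, by simpa using hb, rfl⟩)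
    · obtain ⟨b, hb, rfl⟩ := List.mem_map.1 hl
      exact Or.inr (Or.inr ⟨b, by simpa using hb, rfl⟩)
  have hLsch : ∀ l ∈ Ls, l.IsChain R' := by
    intro l hl
    rcases hLscase l hl with rfl | ⟨b, hb, rfl⟩ | ⟨y, hy, rfl⟩
    · exact hZ'chain
    · have h1 := hwf b (hSp b hb).1
      have h2 := hwt b (hSp b hb).1
      simp only [wrap, List.isChain_cons_cons, List.isChain_singleton, and_true, R']
      exact ⟨⟨h1.2.2, h1.2.1⟩, h2.2.2, h2.2.1.symm⟩
    · simp
  have husedc : (F.filter (fun x => x ∈ U0.flatten)).card ≤ 2 * ns + ∑ i ∈ Finset.range t, L i := by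
    have hsub : F.filter (fun x => x ∈ U0.flatten) ⊆ WR ∪ (Finset.range t).biUnion (fun i => (mid i).toFinset) := by
      intro x hx
      obtain ⟨hxF, hx⟩ := Finset.mem_filter.1 hx
      obtain ⟨l, hl, hx⟩ := List.mem_flatten.1 hx
      rw [Finset.mem_union]
      rcases List.mem_cons.1 hl with rfl | hl
      · rcases hZ'mem x hx with (h | h) | h
        · exact Or.inl (h ▸ (hWR _ hz0 _))
        · exact Or.inl (h ▸ (hWR _ hzt _))
        · rcases hZmem x h with ⟨i, hi, h⟩ | ⟨i, hi, h⟩ | ⟨i, hi, h⟩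
          · exact absurd (hFT hxF) (h ▸ hzT i hi)
          · exact absurd hxF (huT i hi _ h).2
          · rcases hfillmem i _ h with h | ⟨-, h | h⟩
            · exact Or.inr (Finset.mem_biUnion.2 ⟨i, Finset.mem_range.2 hi, by simpa using h⟩)
            · exact Or.inl (h ▸ hWR _ (hz i hi.le) _)
            · exact Or.inl (h ▸ hWR _ (hz (i+1) hi) _)
      · obtain ⟨b, hb, rfl⟩ := List.mem_map.1 hl
        obtain ⟨hbI, -⟩ := hSp b (by simpa using hb)
        simp only [wrap, List.mem_cons, List.not_mem_nil, or_false] at hx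
        rcases hx with h | h | h
        · exact Or.inl (h ▸ (hWR _ hbI _))
        · exact absurd (hFT hxF) (h ▸ (Finset.mem_sdiff.1 hbI).2)
        · exact Or.inl (h ▸ (hWR _ hbI _))
    refine (Finset.card_le_card hsub).trans ((Finset.card_union_le _ _).trans ?_)
    refine Nat.add_le_add hWRc ?_
    refine Finset.card_biUnion_le.trans (le_trans (Finset.sum_le_sum ?_) hnL)
    intro i hi
    rw [← (hmid i (Finset.mem_range.1 hi)).1]
    exact List.toFinset_card_le _
  have hfree : ∀ P : α → Prop, (F.filter P).card ≤ (Y.filter P).card + (2 * ns + ∑ i ∈ Finset.range t, L i) := by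
    intro P
    refine le_trans ?_ (Nat.add_le_add_left husedc _)
    refine le_trans (Finset.card_le_card ?_) (Finset.card_union_le _ _)
    intro x hx
    obtain ⟨hxF, hxP⟩ := Finset.mem_filter.1 hx
    rw [Finset.mem_union]
    by_cases h : x ∈ U0.flatten
    · exact Or.inr (Finset.mem_filter.2 ⟨hxF, h⟩)
    · exact Or.inl (Finset.mem_filter.2 ⟨Finset.mem_filter.2 ⟨hTI (hFT hxF), h⟩, hxP⟩)
  have hYs : ∀ y ∈ Y, [y] ∈ Ls := by
    intro y hy; exact List.mem_append_right _ (List.mem_map.2 ⟨y, by simpa using hy, rfl⟩)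
  obtain ⟨Ls', hperm, hcyc⟩ := close_items R H S e T near1 near2 Ls hLsnd
    (by
      intro l hl
      rcases hLscase l hl with rfl | ⟨b, hb, rfl⟩ | ⟨y, hy, rfl⟩ <;> simp [Z', wrap])
    (by
      intro l hl
      exact List.IsChain.imp (fun _ _ h => h.1) (hLsch l hl))
    (fun l => (l.map (wt H S)).sum)
    (by
      have h1 : (Ls.map (fun l => (l.map (wt H S)).sum)).sum = (Ls.flatten.map (wt H S)).sum := by
        rw [List.map_flatten, List.sum_flatten, List.map_map]; rfl
      rw [h1, (hLsperm.map (wt H S)).sum_eq, Finset.sum_map_toList]; exact hbal)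
    (by
      intro l hl x hx y hy
      exact telescope H S l x y hx hy (List.IsChain.imp (fun _ _ h => h.2) (hLsch l hl)))
    (by
      intro l hl
      rcases hLscase l hl with rfl | ⟨b, hb, rfl⟩ | ⟨y, hy, rfl⟩
      · refine ⟨?_, ?_⟩
        · intro x hx; simp [Z'] at hx; subst hx; exact hFT (hwF _ hz0 _)
        · intro x hx
          have e1 : Z' = (w (z 0, false) :: Z) ++ [w (z t, true)] := rfl
          rw [e1, List.getLast?_concat] at hx
          simp at hx; subst hx; exact hFT (hwF _ hzt _)
      · have hb' := (hSp b hb).1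
        refine ⟨?_, ?_⟩
        · intro x hx; simp [wrap] at hx; subst hx; exact hFT (hwF _ hb' _)
        · intro x hx; simp [wrap] at hx; subst hx; exact hFT (hwF _ hb' _)
      · simpa using hYT y hy)
    (by
      have : ∃ y ∈ Y, H y ≠ S y := by
        rcases hne with ⟨σ, hσ⟩ | ⟨y, hy, hy1, hy2⟩
        · have h1 : (F.filter (fun v => H v = σ ∧ S v = !σ)).card ≤ (Y.filter (fun v => H v = σ ∧ S v = !σ)).card +
              (2 * ns + ∑ i ∈ Finset.range t, L i) := by
            convert hfree (fun v => H v = σ ∧ S v = !σ)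
          have h2 := hsz _ _ hσ
          have h3 : 0 < (Y.filter (fun v => H v = σ ∧ S v = !σ)).card := by omega
          obtain ⟨y, hy⟩ := Finset.card_pos.1 h3
          obtain ⟨h4, h5, h6⟩ := Finset.mem_filter.1 hy
          refine ⟨y, h4, ?_⟩
          rw [h5, h6]; cases σ <;> simp
        · obtain ⟨hyT, hyF⟩ := Finset.mem_sdiff.1 hy
          refine ⟨y, Finset.mem_filter.2 ⟨hTI hyT, ?_⟩, hy1⟩
          intro hx
          obtain ⟨l, hl, hx⟩ := List.mem_flatten.1 hx
          rcases List.mem_cons.1 hl with rfl | hl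
          · rcases hZ'mem y hx with (h | h) | h
            · exact hyF (h ▸ hwF _ hz0 _)
            · exact hyF (h ▸ hwF _ hzt _)
            · rcases hZmem y h with ⟨i, hi, h⟩ | ⟨i, hi, h⟩ | ⟨i, hi, h⟩
              · exact hzT i hi (h ▸ hyT)
              · exact hy2 i hi h
              · exact hyF (hfillF i hi _ h)
          · obtain ⟨b, hb, rfl⟩ := List.mem_map.1 hl
            obtain ⟨hbI, -⟩ := hSp b (by simpa using hb)
            simp only [wrap, List.mem_cons, List.not_mem_nil, or_false] at hx
            rcases hx with h | h | h
            · exact hyF (h ▸ hwF _ hbI _)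
            · exact (Finset.mem_sdiff.1 hbI).2 (h ▸ hyT)
            · exact hyF (h ▸ hwF _ hbI _)
      obtain ⟨y, hy, hy'⟩ := this
      exact ⟨[y], hYs y hy, y, by simp, y, by simp, hy'⟩)
    Y hYs
    (by
      intro σ
      have h1 : (F.filter (fun v => S v = σ)).card ≤ (Y.filter (fun v => S v = σ)).card +
              (2 * ns + ∑ i ∈ Finset.range t, L i) := by
        convert hfree (fun v => S v = σ)
      have h2 := hsz2 σ
      omega)
  -- rotate
  have hZ'in : Z' ∈ Ls' := hperm.mem_iff.2 (by simp [Ls, U0])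
  obtain ⟨P, Q, hPQ⟩ := List.append_of_mem hZ'in
  have hc1 : CycChain R (Z ++ ([w (z t, true)] ++ Q.flatten ++ (P.flatten ++ [w (z 0, false)]))) := by
    have e1 : Ls'.flatten = (P.flatten ++ [w (z 0, false)]) ++ (Z ++ ([w (z t, true)] ++ Q.flatten)) := by
      rw [hPQ]; simp [Z']
    rw [e1] at hcyc
    have := cycChain_comm R _ _ hcyc
    simpa using this
  refine ⟨fill, _, fun i hi => ⟨hfilllen i hi, hfillF i hi⟩, ?_, hc1⟩
  have e1 : Ls'.flatten = (P.flatten ++ [w (z 0, false)]) ++ (Z ++ ([w (z t, true)] ++ Q.flatten)) := by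
    rw [hPQ]; simp [Z']
  have p2 : Ls'.flatten.Perm I.toList := hperm.flatten.trans hLsperm
  rw [e1] at p2
  refine List.Perm.trans ?_ p2
  have : (Z ++ ([w (z t, true)] ++ Q.flatten ++ (P.flatten ++ [w (z 0, false)]))) =
     (Z ++ ([w (z t, true)] ++ Q.flatten)) ++ (P.flatten ++ [w (z 0, false)]) := by simp
  show (Z ++ ([w (z t, true)] ++ Q.flatten ++ (P.flatten ++ [w (z 0, false)]))).Perm _
  rw [this]
  exact List.perm_append_comm

def Flx (a : Bool → Prop) : Prop := a true ∧ a false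

/-- cost of a tail type -/
noncomputable def cst (a : Bool → Prop) (x σ : Bool) : ℕ := if Flx a ∧ x = σ then 1 else 0

theorem seg_choice1 (a c : Bool → Prop) (ha : ∃ x, a x) (hc : ∃ x, c x) (b : Bool)
    (hn : ¬ (Flx a ∧ Flx c ∧ b = true)) :
    ∃ x y, a x ∧ c y ∧ (y = xor x b ∨ (¬ Flx a ∧ ¬ Flx c)) ∧
      ∀ σ, cst a x σ + cst c y (!σ) + (if y = xor x b then 0 else 1) ≤ 1 := by
  by_cases hfa : Flx a
  · by_cases hfc : Flx c
    · have hb : b = false := by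
        cases b
        · rfl
        · exact absurd ⟨hfa, hfc, rfl⟩ hn
      refine ⟨true, true, hfa.1, hfc.1, by simp [hb], ?_⟩
      intro σ; cases σ <;> simp [cst, hb]
      · split_ifs <;> omega
      · split_ifs <;> omega
    · obtain ⟨y, hy⟩ := hc
      refine ⟨xor y b, y, ?_, hy, ?_, ?_⟩
      · cases (xor y b); exacts [hfa.2, hfa.1]
      · left; cases y <;> cases b <;> rfl
      · intro σ
        have : y = xor (xor y b) b := by cases y <;> cases b <;> rfl
        rw [if_pos this]
        simp only [cst, hfc, false_and, if_false]; split_ifs <;> omega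
  · obtain ⟨x, hx⟩ := ha
    by_cases hfc : Flx c
    · refine ⟨x, xor x b, hx, ?_, Or.inl rfl, ?_⟩
      · cases (xor x b); exacts [hfc.2, hfc.1]
      · intro σ
        rw [if_pos rfl]
        simp only [cst, hfa, false_and, if_false]; split_ifs <;> omega
    · obtain ⟨y, hy⟩ := hc
      refine ⟨x, y, hx, hy, Or.inr ⟨hfa, hfc⟩, ?_⟩
      intro σ
      simp only [cst, hfa, hfc, false_and, if_false]; split_ifs <;> omega

theorem seg_choice3 (a c : Bool → Prop) (ha : ∃ x, a x) (hc : ∃ x, c x) :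
    ∃ x y, a x ∧ c y ∧ cst a x true + cst c y false = 0 ∧ cst a x false + cst c y true ≤ 2 := by
  have h1 : ∃ x, a x ∧ cst a x true = 0 := by
    by_cases hfa : Flx a
    · exact ⟨false, hfa.2, by simp [cst]⟩
    · obtain ⟨x, hx⟩ := ha; exact ⟨x, hx, by simp [cst, hfa]⟩
  have h2 : ∃ x, c x ∧ cst c x false = 0 := by
    by_cases hfa : Flx c
    · exact ⟨true, hfa.1, by simp [cst]⟩
    · obtain ⟨x, hx⟩ := hc; exact ⟨x, hx, by simp [cst, hfa]⟩
  obtain ⟨x, hx, hx'⟩ := h1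
  obtain ⟨y, hy, hy'⟩ := h2
  refine ⟨x, y, hx, hy, by omega, ?_⟩
  have q1 : cst a x false ≤ 1 := by unfold cst; split_ifs <;> omega
  have q2 : cst c y true ≤ 1 := by unfold cst; split_ifs <;> omega
  omega

theorem ztypes (t : ℕ) (b : ℕ → Bool) (AT AH : ℕ → Bool → Prop)
    (hT : ∀ j ≤ t, ∃ x, AT j x) (hH : ∀ j ≤ t, ∃ x, AH j x) :
    ∃ st hd : ℕ → Bool, (∀ j ≤ t, AT j (st j) ∧ AH j (hd j)) ∧
      (∀ i < t, hd (i+1) = xor (st i) (b i) ∨ (¬ Flx (AT i) ∧ ¬ Flx (AH (i+1)))) ∧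
      ((∀ i < t, b i = false) → hd 0 = st t ∨ (¬ Flx (AT t) ∧ ¬ Flx (AH 0))) ∧
      ∀ σ, ∑ j ∈ Finset.range (t+1), (cst (AT j) (st j) σ + cst (AH j) (hd j) (!σ)) +
        ((Finset.range t).filter (fun i => hd (i+1) ≠ xor (st i) (b i))).card ≤ t + 1 := by
  let D : Finset ℕ := (Finset.range t).filter (fun i => Flx (AT i) ∧ Flx (AH (i+1)) ∧ b i = true)
  obtain ⟨P, hPD, hPc⟩ := Finset.exists_subset_card_eq (s := D) (n := (D.card + 1) / 2) (by omega)
  -- segments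
  have hseg : ∀ i, ∃ xy : Bool × Bool, i < t → AT i xy.1 ∧ AH (i+1) xy.2 ∧
      (xy.2 = xor xy.1 (b i) ∨ (¬ Flx (AT i) ∧ ¬ Flx (AH (i+1)))) ∧
      ∀ σ, cst (AT i) xy.1 σ + cst (AH (i+1)) xy.2 (!σ) + (if xy.2 = xor xy.1 (b i) then 0 else 1) ≤
        if i ∈ D then (if (i ∈ P ↔ σ = true) then 2 else 0) else 1 := by
    intro i
    by_cases hi : i < t
    · by_cases hD : i ∈ D
      · obtain ⟨-, h1, h2, h3⟩ := Finset.mem_filter.1 hD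
        by_cases hP : i ∈ P
        · refine ⟨(true, false), fun _ => ⟨h1.1, h2.2, by simp [h3], ?_⟩⟩
          intro σ; cases σ <;> simp [cst, h3, hD, hP]
          split_ifs <;> omega
        · refine ⟨(false, true), fun _ => ⟨h1.2, h2.1, by simp [h3], ?_⟩⟩
          intro σ; cases σ <;> simp [cst, h3, hD, hP]
          split_ifs <;> omega
      · obtain ⟨x, y, h1, h2, h3, h4⟩ := seg_choice1 (AT i) (AH (i+1)) (hT i (by omega)) (hH (i+1) (by omega)) (b i)
          (fun h => hD (Finset.mem_filter.2 ⟨Finset.mem_range.2 hi, h⟩))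
        exact ⟨(x, y), fun _ => ⟨h1, h2, h3, fun σ => by rw [if_neg hD]; exact h4 σ⟩⟩
    · exact ⟨(true, true), fun h => absurd h hi⟩
  choose xy hxy using hseg
  -- long
  have hlong : ∃ x y, AT t x ∧ AH 0 y ∧ ((∀ i < t, b i = false) → y = x ∨ (¬ Flx (AT t) ∧ ¬ Flx (AH 0))) ∧
      ∀ σ, cst (AT t) x σ + cst (AH 0) y (!σ) ≤ if D.card % 2 = 0 then 1 else (if σ = true then 0 else 2) := by
    by_cases hD : D.card % 2 = 0
    · obtain ⟨x, y, h1, h2, h3, h4⟩ := seg_choice1 (AT t) (AH 0) (hT t le_rfl) (hH 0 (by omega)) false (by simp)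
      refine ⟨x, y, h1, h2, fun _ => by simpa using h3, ?_⟩
      intro σ; rw [if_pos hD]; have := h4 σ; omega
    · obtain ⟨x, y, h1, h2, h3, h4⟩ := seg_choice3 (AT t) (AH 0) (hT t le_rfl) (hH 0 (by omega))
      refine ⟨x, y, h1, h2, ?_, ?_⟩
      · intro hb
        exfalso; apply hD
        have : D = ∅ := by
          apply Finset.filter_false_of_mem
          intro i hi h; rw [hb i (Finset.mem_range.1 hi)] at h; simp at h
        simp [this]
      · intro σ; rw [if_neg hD]; cases σ
        · simpa using h4
        · simp; simpa using h3
  obtain ⟨xl, yl, hl1, hl2, hl3, hl4⟩ := hlong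
  let st : ℕ → Bool := fun j => if j = t then xl else (xy j).1
  let hd : ℕ → Bool := fun j => if j = 0 then yl else (xy (j-1)).2
  have hst : ∀ i < t, st i = (xy i).1 := fun i hi => by simp [st, hi.ne]
  have hhd : ∀ i, hd (i+1) = (xy i).2 := fun i => by simp [hd]
  have hstt : st t = xl := by simp [st]
  have hhd0 : hd 0 = yl := by simp [hd]
  refine ⟨st, hd, ?_, ?_, ?_, ?_⟩
  · intro j hj
    constructor
    · rcases hj.lt_or_eq with h | rfl
      · rw [hst j h]; exact (hxy j h).1
      · rw [hstt]; exact hl1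
    · rcases Nat.eq_zero_or_pos j with rfl | h
      · rw [hhd0]; exact hl2
      · obtain ⟨i, rfl⟩ : ∃ i, j = i + 1 := ⟨j - 1, by omega⟩
        rw [hhd]; exact (hxy i (by omega)).2.1
  · intro i hi; rw [hhd, hst i hi]; exact (hxy i hi).2.2.1
  · rw [hhd0, hstt]; exact hl3
  · intro σ
    rw [Finset.sum_add_distrib, Finset.sum_range_succ, Finset.sum_range_succ' (fun j => cst (AH j) (hd j) (!σ)), hstt, hhd0]
    have hmis : ((Finset.range t).filter (fun i => hd (i+1) ≠ xor (st i) (b i))).card =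
        ∑ i ∈ Finset.range t, (if (xy i).2 = xor (xy i).1 (b i) then 0 else 1) := by
      rw [Finset.card_filter]
      apply Finset.sum_congr rfl
      intro i hi
      rw [hhd, hst i (Finset.mem_range.1 hi)]
      by_cases h : (xy i).2 = xor (xy i).1 (b i) <;> simp [h]
    have hs1 : ∑ i ∈ Finset.range t, cst (AT i) (st i) σ = ∑ i ∈ Finset.range t, cst (AT i) (xy i).1 σ := by
      apply Finset.sum_congr rfl
      intro i hi; rw [hst i (Finset.mem_range.1 hi)]
    have hs2 : ∑ i ∈ Finset.range t, cst (AH (i+1)) (hd (i+1)) (!σ) = ∑ i ∈ Finset.range t, cst (AH (i+1)) (xy i).2 (!σ) := by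
      apply Finset.sum_congr rfl
      intro i hi; rw [hhd]
    have hmain : ∑ i ∈ Finset.range t, cst (AT i) (xy i).1 σ + ∑ i ∈ Finset.range t, cst (AH (i+1)) (xy i).2 (!σ) +
        ∑ i ∈ Finset.range t, (if (xy i).2 = xor (xy i).1 (b i) then 0 else 1) ≤
        ∑ i ∈ Finset.range t, (if i ∈ D then (if (i ∈ P ↔ σ = true) then 2 else 0) else 1) := by
      rw [← Finset.sum_add_distrib, ← Finset.sum_add_distrib]
      apply Finset.sum_le_sum
      intro i hi; exact (hxy i (Finset.mem_range.1 hi)).2.2.2 σ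
    have hDr : D ⊆ Finset.range t := Finset.filter_subset _ _
    have hcount : ∑ i ∈ Finset.range t, (if i ∈ D then (if (i ∈ P ↔ σ = true) then 2 else 0) else 1) =
        (∑ i ∈ D, (if (i ∈ P ↔ σ = true) then 2 else 0)) + (t - D.card) := by
      rw [← Finset.sum_sdiff hDr]
      have e1 : ∑ i ∈ Finset.range t \ D, (if i ∈ D then (if (i ∈ P ↔ σ = true) then 2 else 0) else 1) = t - D.card := by
        rw [Finset.sum_congr rfl (g := fun _ => 1)]
        · rw [Finset.sum_const, Finset.card_sdiff_of_subset hDr]; simp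
        · intro i hi; rw [if_neg (Finset.mem_sdiff.1 hi).2]
      have e2 : ∑ i ∈ D, (if i ∈ D then (if (i ∈ P ↔ σ = true) then 2 else 0) else 1) = ∑ i ∈ D, (if (i ∈ P ↔ σ = true) then 2 else 0) := by
        apply Finset.sum_congr rfl; intro i hi; rw [if_pos hi]
      rw [e1, e2, add_comm]
    have hDt : D.card ≤ t := by simpa using Finset.card_le_card hDr
    have hP2 : ∑ i ∈ D, (if (i ∈ P ↔ σ = true) then 2 else 0) = if σ = true then 2 * P.card else 2 * (D.card - P.card) := by
      rw [← Finset.sum_filter, Finset.sum_const, smul_eq_mul, mul_comm]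
      cases σ
      · have : D.filter (fun i => (i ∈ P ↔ false = true)) = D \ P := by
          ext i; simp
        rw [this, Finset.card_sdiff_of_subset hPD]; simp
      · have : D.filter (fun i => (i ∈ P ↔ true = true)) = P := by
          ext i; simp; exact fun h => hPD h
        rw [this]; simp
    have h5 := hl4 σ
    rw [hmis, hs1, hs2]
    rw [hcount, hP2] at hmain
    cases σ <;> simp only [Bool.false_eq_true, if_false, if_true] at h5 hmain ⊢ <;> split_ifs at h5 <;> omega

theorem greedy3 {V : Type*} [Inhabited V] (G : ℕ → V → V → V → Prop) (J : Finset ℕ) (mv : ℕ → Option V)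
    (X0 : Finset V) (B : ℕ)
    (hinj : ∀ i ∈ J, ∀ j ∈ J, ∀ v, mv i = some v → mv j = some v → i = j)
    (hX0 : ∀ i ∈ J, ∀ v, mv i = some v → v ∉ X0)
    (hB : X0.card + 4 * J.card ≤ B)
    (hav : ∀ i ∈ J, ∀ X : Finset V, X.card ≤ B → (∀ v, mv i = some v → v ∉ X) →
      ∃ p v q, G i p v q ∧ p ∉ X ∧ v ∉ X ∧ q ∉ X ∧ p ≠ v ∧ v ≠ q ∧ p ≠ q ∧ ∀ w, mv i = some w → v = w) :
    ∃ f : ℕ → Fin 3 → V, (∀ i ∈ J, G i (f i 0) (f i 1) (f i 2) ∧ ∀ w, mv i = some w → f i 1 = w) ∧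
      (∀ i ∈ J, ∀ c, f i c ∉ X0) ∧
      (∀ i ∈ J, ∀ j ∈ J, ∀ c d, f i c = f j d → i = j ∧ c = d) := by
  have key : ∀ J' : Finset ℕ, J' ⊆ J → ∃ f : ℕ → Fin 3 → V,
      (∀ i ∈ J', G i (f i 0) (f i 1) (f i 2) ∧ ∀ w, mv i = some w → f i 1 = w) ∧
      (∀ i ∈ J', ∀ c, f i c ∉ X0) ∧
      (∀ i ∈ J', ∀ c, ∀ j ∈ J \ J', mv j ≠ some (f i c)) ∧
      (∀ i ∈ J', ∀ j ∈ J', ∀ c d, f i c = f j d → i = j ∧ c = d) := by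
    intro J'
    induction J' using Finset.induction_on with
    | empty => intro _; exact ⟨fun _ _ => default, by simp, by simp, by simp, by simp⟩
    | insert a s has ih =>
      intro hs
      obtain ⟨f, h1, h2, h3, h4⟩ := ih (fun x hx => hs (Finset.mem_insert_of_mem hx))
      have haJ : a ∈ J := hs (Finset.mem_insert_self _ _)
      let Used : Finset V := s.biUnion (fun i => Finset.univ.image (f i))
      let Res : Finset V := (J \ insert a s).biUnion (fun j => (mv j).toFinset)
      have hUc : Used.card ≤ 3 * s.card := by
        refine Finset.card_biUnion_le.trans ?_
        refine (Finset.sum_le_card_nsmul _ _ 3 ?_).trans (by simp [mul_comm])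
        intro i _; exact Finset.card_image_le.trans (by simp)
      have hRc : Res.card ≤ (J \ insert a s).card := by
        refine Finset.card_biUnion_le.trans ?_
        refine (Finset.sum_le_card_nsmul _ _ 1 ?_).trans (by simp)
        intro i _; rcases mv i with _ | w <;> simp
      have hsc : s.card + 1 ≤ J.card := by
        have := Finset.card_le_card hs; rwa [Finset.card_insert_of_notMem has] at this
      have hJc : (J \ insert a s).card ≤ J.card := Finset.card_le_card Finset.sdiff_subset
      have hmu : ∀ v, mv a = some v → v ∉ X0 ∪ Used ∪ Res := by
        intro v hv hx
        rcases Finset.mem_union.1 hx with hx | hx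
        · rcases Finset.mem_union.1 hx with hx | hx
          · exact hX0 a haJ v hv hx
          · obtain ⟨i, hi, hx⟩ := Finset.mem_biUnion.1 hx
            obtain ⟨c, -, rfl⟩ := Finset.mem_image.1 hx
            exact h3 i hi c a (Finset.mem_sdiff.2 ⟨haJ, has⟩) hv
        · obtain ⟨j, hj, hx⟩ := Finset.mem_biUnion.1 hx
          obtain ⟨hj1, hj2⟩ := Finset.mem_sdiff.1 hj
          have hx' : mv j = some v := by simpa using hx
          have := hinj a haJ j hj1 v hv hx'
          exact hj2 (this ▸ Finset.mem_insert_self _ _)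
      obtain ⟨p, v, q, hG, hp, hv, hq, hpv, hvq, hpq, hmv⟩ := hav a haJ (X0 ∪ Used ∪ Res) (by
        have e1 := Finset.card_union_le (X0 ∪ Used) Res
        have e2 := Finset.card_union_le X0 Used
        omega) hmu
      simp only [Finset.mem_union, not_or] at hp hv hq
      have hg : ∀ c, (![p, v, q] c ∉ X0 ∧ ![p, v, q] c ∉ Used) ∧ ![p, v, q] c ∉ Res := by
        intro c; fin_cases c
        · exact hp
        · exact hv
        · exact hq
      have hinjg : ∀ c d : Fin 3, ![p, v, q] c = ![p, v, q] d → c = d := by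
        intro c d h
        fin_cases c <;> fin_cases d <;> first | rfl | (exfalso; simp at h; first | exact hpv h | exact hvq h | exact hpq h | exact hpv h.symm | exact hvq h.symm | exact hpq h.symm)
      have hne : ∀ i ∈ s, i ≠ a := fun i hi h => has (h ▸ hi)
      have hU : ∀ i ∈ s, ∀ c, f i c ∈ Used := fun i hi c =>
        Finset.mem_biUnion.2 ⟨i, hi, Finset.mem_image_of_mem _ (Finset.mem_univ _)⟩
      refine ⟨fun i => if i = a then ![p, v, q] else f i, ?_, ?_, ?_, ?_⟩
      · intro i hi
        rcases Finset.mem_insert.1 hi with rfl | hi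
        · simp only [if_true]; exact ⟨hG, hmv⟩
        · simp only [hne i hi, if_false]; exact h1 i hi
      · intro i hi c
        rcases Finset.mem_insert.1 hi with rfl | hi
        · simp only [if_true]; exact (hg c).1.1
        · simp only [hne i hi, if_false]; exact h2 i hi c
      · intro i hi c j hj hmj
        rcases Finset.mem_insert.1 hi with rfl | hi
        · simp only [if_true] at hmj
          exact (hg c).2 (Finset.mem_biUnion.2 ⟨j, hj, by simp [hmj]⟩)
        · simp only [hne i hi, if_false] at hmj
          refine h3 i hi c j ?_ hmj
          obtain ⟨h5, h6⟩ := Finset.mem_sdiff.1 hj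
          exact Finset.mem_sdiff.2 ⟨h5, fun h => h6 (Finset.mem_insert_of_mem h)⟩
      · intro i hi j hj c d h
        rcases Finset.mem_insert.1 hi with h5 | hi' <;> rcases Finset.mem_insert.1 hj with h6 | hj'
        · subst h5; subst h6; simp only [if_true] at h; exact ⟨rfl, hinjg c d h⟩
        · simp only [h5, hne j hj', if_false, if_true] at h
          exact absurd (h ▸ hU j hj' d) (hg c).1.2
        · simp only [h6, hne i hi', if_false, if_true] at h
          exact absurd (h ▸ hU i hi' c) (hg d).1.2
        · simp only [hne i hi', hne j hj', if_false] at h; exact h4 i hi' j hj' c d h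
  obtain ⟨f, h1, h2, -, h4⟩ := key J (Finset.Subset.refl _)
  exact ⟨f, h1, h2, h4⟩

theorem assign_mv {V : Type*} (J : Finset ℕ) (Y : Finset V) (h : Y.card ≤ J.card) :
    ∃ mv : ℕ → Option V, (∀ i v, mv i = some v → v ∈ Y ∧ i ∈ J) ∧ (∀ v ∈ Y, ∃ i ∈ J, mv i = some v) ∧
      (∀ i j v, mv i = some v → mv j = some v → i = j) ∧ (Y.card = J.card → ∀ i ∈ J, mv i ≠ none) := by
  obtain ⟨J', hJ', hc⟩ := Finset.exists_subset_card_eq h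
  let e : J' ≃ Y := Finset.equivOfCardEq hc
  have hf : ∀ (i : ℕ) (v : V), (if h : i ∈ J' then some (e ⟨i, h⟩ : V) else none) = some v ↔ ∃ h : i ∈ J', (e ⟨i, h⟩ : V) = v := by
    intro i v
    by_cases h : i ∈ J' <;> simp [h]
  refine ⟨fun i => if h : i ∈ J' then some (e ⟨i, h⟩ : V) else none, ?_, ?_, ?_, ?_⟩
  · intro i v hv
    obtain ⟨h, rfl⟩ := (hf i v).1 hv
    exact ⟨(e ⟨i, h⟩).2, hJ' h⟩
  · intro v hv
    refine ⟨(e.symm ⟨v, hv⟩ : ℕ), hJ' (e.symm ⟨v, hv⟩).2, (hf _ _).2 ⟨(e.symm ⟨v, hv⟩).2, ?_⟩⟩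
    simp
  · intro i j v hi hj
    obtain ⟨h, h1⟩ := (hf i v).1 hi
    obtain ⟨h', h2⟩ := (hf j v).1 hj
    have : e ⟨i, h⟩ = e ⟨j, h'⟩ := Subtype.ext (h1.trans h2.symm)
    have := e.injective this
    simpa using this
  · intro hc2 i hi
    have : J' = J := Finset.eq_of_subset_of_card_le hJ' (by omega)
    subst this
    simp [hi]

/-- one direction: rich or hub -/
theorem unit_dir {V : Type*} (R : V → V → Prop) (K1 K2 E : Finset V) (B B' c : ℕ)
    (hl : ∀ p ∈ K1 ∪ K2, ¬ R p p) (hdis : Disjoint K1 K2) (hE : ∀ p ∈ K1 ∪ K2, p ∉ E)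
    (hK1 : 2 ^ B * B' + B < K1.card) (hK2 : 2 ^ B * B' + B < K2.card)
    [Fintype V]
    (hc : ∀ p ∈ K1, ∀ q ∈ K2, (R p q ∧ B + 2 ≤ (K1.filter (fun p' => R p' p)).card) ∨
      c ≤ (Finset.univ.filter (fun v => v ∉ E ∧ R p v ∧ R v q)).card) :
    (∀ X : Finset V, X.card ≤ B → ∃ p ∈ K1, ∃ v, ∃ q ∈ K2, R p v ∧ R v q ∧ v ∉ E ∧ p ∉ X ∧ v ∉ X ∧ q ∉ X ∧
      p ≠ v ∧ v ≠ q ∧ p ≠ q) ∨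
    ∃ Hb K1' K2' : Finset V, c ≤ Hb.card ∧ Disjoint Hb E ∧ K1' ⊆ K1 ∧ K2' ⊆ K2 ∧ B' < K1'.card ∧ B' < K2'.card ∧
      ∀ v ∈ Hb, (∀ p ∈ K1', R p v) ∧ (∀ q ∈ K2', R v q) := by
  by_cases hr : (∀ X : Finset V, X.card ≤ B → ∃ p ∈ K1, ∃ v, ∃ q ∈ K2, R p v ∧ R v q ∧ v ∉ E ∧ p ∉ X ∧ v ∉ X ∧ q ∉ X ∧
      p ≠ v ∧ v ≠ q ∧ p ≠ q)
  · exact Or.inl hr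
  right
  push Not at hr
  obtain ⟨X, hX, hno⟩ := hr
  have hpq : ∀ p ∈ K1, ∀ q ∈ K2, p ≠ q := fun p hp q hq h => Finset.disjoint_left.1 hdis hp (h ▸ hq)
  have l1 : ∀ p ∈ K1, ¬ R p p := fun p hp => hl p (Finset.mem_union_left _ hp)
  have l2 : ∀ p ∈ K2, ¬ R p p := fun p hp => hl p (Finset.mem_union_right _ hp)
  have hin : ∀ p ∈ K1 \ X, ∀ q ∈ K2 \ X, ∀ v, v ∉ E → R p v → R v q → v ∈ X := by
    intro p hp q hq v hv h1 h2
    obtain ⟨hp, hpX⟩ := Finset.mem_sdiff.1 hp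
    obtain ⟨hq, hqX⟩ := Finset.mem_sdiff.1 hq
    by_contra hvX
    exact hpq p hp q hq (hno p hp v q hq h1 h2 hv hpX hvX hqX (fun h => l1 p hp (by rw [← h] at h1; exact h1)) (fun h => l2 q hq (by rw [h] at h2; exact h2)))
  have hcount : ∀ p ∈ K1 \ X, ∀ q ∈ K2 \ X, c ≤ (X.filter (fun v => v ∉ E ∧ R p v ∧ R v q)).card := by
    intro p hp q hq
    have hp' := (Finset.mem_sdiff.1 hp)
    have hq' := (Finset.mem_sdiff.1 hq)
    rcases hc p hp'.1 q hq'.1 with ⟨h1, h2⟩ | h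
    · exfalso
      obtain ⟨p', hp1, hp2⟩ := Finset.exists_mem_notMem_of_card_lt_card (s := X) (t := K1.filter (fun p' => R p' p)) (by omega)
      obtain ⟨h3, h4⟩ := Finset.mem_filter.1 hp1
      exact hp'.2 (hin p' (Finset.mem_sdiff.2 ⟨h3, hp2⟩) q hq p (hE p (Finset.mem_union_left _ hp'.1)) h4 h1)
    · refine h.trans (Finset.card_le_card ?_)
      intro v hv
      obtain ⟨-, h1, h2, h3⟩ := Finset.mem_filter.1 hv
      exact Finset.mem_filter.2 ⟨hin p hp q hq v h1 h2 h3, h1, h2, h3⟩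
  have hpow : 2 ^ X.card ≤ 2 ^ B := Nat.pow_le_pow_right (by norm_num) hX
  have pig : ∀ (K : Finset V) (f : V → Finset V), (∀ p, f p ⊆ X) → 2 ^ B * B' + B < K.card →
      ∃ P, B' < ((K \ X).filter (fun p => f p = P)).card := by
    intro K f hf hK
    obtain ⟨P, -, hP⟩ := Finset.exists_lt_card_fiber_of_mul_lt_card_of_maps_to (s := K \ X) (t := X.powerset) (f := f) (n := B')
      (fun a _ => Finset.mem_powerset.2 (hf a)) (by
        rw [Finset.card_powerset]
        have h1 : K.card ≤ (K \ X).card + X.card := by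
          have := Finset.le_card_sdiff X K; omega
        have h2 : 2 ^ X.card * B' ≤ 2 ^ B * B' := Nat.mul_le_mul_right _ hpow
        omega)
    exact ⟨P, hP⟩
  obtain ⟨P, hP⟩ := pig K1 (fun p => X.filter (fun v => R p v)) (fun p => Finset.filter_subset _ _) hK1
  obtain ⟨Q, hQ⟩ := pig K2 (fun q => X.filter (fun v => R v q)) (fun p => Finset.filter_subset _ _) hK2
  obtain ⟨p0, hp0⟩ := Finset.card_pos.1 (lt_of_le_of_lt (Nat.zero_le _) hP)
  obtain ⟨q0, hq0⟩ := Finset.card_pos.1 (lt_of_le_of_lt (Nat.zero_le _) hQ)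
  obtain ⟨hp0, hp0'⟩ := Finset.mem_filter.1 hp0
  obtain ⟨hq0, hq0'⟩ := Finset.mem_filter.1 hq0
  refine ⟨X.filter (fun v => v ∉ E ∧ R p0 v ∧ R v q0), _, _, hcount p0 hp0 q0 hq0, ?_, ?_, ?_, hP, hQ, ?_⟩
  · rw [Finset.disjoint_left]; intro v hv; exact (Finset.mem_filter.1 hv).2.1
  · intro p hp; exact (Finset.mem_sdiff.1 (Finset.mem_filter.1 hp).1).1
  · intro p hp; exact (Finset.mem_sdiff.1 (Finset.mem_filter.1 hp).1).1
  · intro v hv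
    obtain ⟨hvX, -, h2, h3⟩ := Finset.mem_filter.1 hv
    constructor
    · intro p hp
      have := (Finset.mem_filter.1 hp).2
      have : v ∈ X.filter (fun v => R p v) := by rw [this, ← hp0']; exact Finset.mem_filter.2 ⟨hvX, h2⟩
      exact (Finset.mem_filter.1 this).2
    · intro q hq
      have := (Finset.mem_filter.1 hq).2
      have : v ∈ X.filter (fun v => R v q) := by rw [this, ← hq0']; exact Finset.mem_filter.2 ⟨hvX, h3⟩
      exact (Finset.mem_filter.1 this).2

def DirOK {V : Type*} (R : V → V → Prop) (K1 K2 E : Finset V) (B n : ℕ) (Y : Finset V) : Prop :=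
  Y.card ≤ n ∧ Disjoint Y E ∧
  (∀ v ∈ Y, ∀ X : Finset V, X.card ≤ B → v ∉ X → ∃ p ∈ K1, ∃ q ∈ K2, R p v ∧ R v q ∧ p ∉ X ∧ q ∉ X) ∧
  (Y.card < n → ∀ X : Finset V, X.card ≤ B → ∃ p ∈ K1, ∃ v, ∃ q ∈ K2, R p v ∧ R v q ∧ v ∉ E ∧ p ∉ X ∧ v ∉ X ∧ q ∉ X)

theorem dirOK_of {V : Type*} [Fintype V] (R : V → V → Prop) (K1 K2 E : Finset V) (B c n : ℕ)
    (hl : ∀ p ∈ K1 ∪ K2, ¬ R p p) (hdis : Disjoint K1 K2) (hE : ∀ p ∈ K1 ∪ K2, p ∉ E)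
    (hK1 : 2 ^ B * B + B < K1.card) (hK2 : 2 ^ B * B + B < K2.card)
    (hc : ∀ p ∈ K1, ∀ q ∈ K2, (R p q ∧ B + 2 ≤ (K1.filter (fun p' => R p' p)).card) ∨
      c ≤ (Finset.univ.filter (fun v => v ∉ E ∧ R p v ∧ R v q)).card)
    (Y' : Finset V) (hn : n + Y'.card ≤ c) :
    ∃ Y, Disjoint Y Y' ∧ DirOK R K1 K2 E B n Y := by
  rcases unit_dir R K1 K2 E B B c hl hdis hE hK1 hK2 hc with h | ⟨Hb, K1', K2', h1, h2, h3, h4, h5, h6, h7⟩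
  · refine ⟨∅, by simp, by simp, by simp, by simp, ?_⟩
    intro _ X hX
    obtain ⟨p, hp, v, q, hq, h⟩ := h X hX
    exact ⟨p, hp, v, q, hq, h.1, h.2.1, h.2.2.1, h.2.2.2.1, h.2.2.2.2.1, h.2.2.2.2.2.1⟩
  · obtain ⟨Y, hY, hYc⟩ := Finset.exists_subset_card_eq (s := Hb \ Y') (n := n) (by
      have := Finset.le_card_sdiff Y' Hb; omega)
    refine ⟨Y, ?_, hYc.le, ?_, ?_, ?_⟩
    · rw [Finset.disjoint_left]; intro v hv; exact (Finset.mem_sdiff.1 (hY hv)).2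
    · exact Finset.disjoint_of_subset_left (hY.trans Finset.sdiff_subset) h2
    · intro v hv X hX _
      obtain ⟨p, hp, hpX⟩ := Finset.exists_mem_notMem_of_card_lt_card (lt_of_le_of_lt hX h5)
      obtain ⟨q, hq, hqX⟩ := Finset.exists_mem_notMem_of_card_lt_card (lt_of_le_of_lt hX h6)
      have := h7 v (Finset.mem_sdiff.1 (hY hv)).1
      exact ⟨p, h3 hp, q, h4 hq, this.1 p hp, this.2 q hq, hpX, hqX⟩
    · intro h; omega

theorem units {V : Type*} [Fintype V] [Inhabited V] (R : V → V → Prop) (K1 K2 Zs Dm Am : Finset V) (J1 J2 : Finset ℕ) (B c12 c21 : ℕ)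
    (hJ : Disjoint J1 J2)
    (hl : ∀ p ∈ K1 ∪ K2, ¬ R p p) (hdis : Disjoint K1 K2) (hE : ∀ p ∈ K1 ∪ K2, p ∉ Zs ∪ Dm ∪ Am)
    (hDA : Disjoint Dm Am) (hDZ : Disjoint Dm Zs) (hAZ : Disjoint Am Zs)
    (hK1 : 2 ^ B * B + B < K1.card) (hK2 : 2 ^ B * B + B < K2.card)
    (hB : Zs.card + 4 * (J1.card + J2.card) ≤ B)
    (hD : ∀ d ∈ Dm, (∀ p ∈ K1, R p d) ∧ ∀ q ∈ K2, R d q)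
    (hA : ∀ d ∈ Am, (∀ p ∈ K2, R p d) ∧ ∀ q ∈ K1, R d q)
    (hc12 : ∀ p ∈ K1, ∀ q ∈ K2, (R p q ∧ B + 2 ≤ (K1.filter (fun p' => R p' p)).card) ∨
      c12 ≤ (Finset.univ.filter (fun v => v ∉ Zs ∪ Dm ∪ Am ∧ R p v ∧ R v q)).card)
    (hc21 : ∀ p ∈ K2, ∀ q ∈ K1, (R p q ∧ B + 2 ≤ (K2.filter (fun p' => R p' p)).card) ∨
      c21 ≤ (Finset.univ.filter (fun v => v ∉ Zs ∪ Dm ∪ Am ∧ R p v ∧ R v q)).card)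
    (n1 : Dm.card ≤ J1.card) (n2 : Am.card ≤ J2.card) (n3 : J1.card ≤ c12 + Dm.card) (n4 : J2.card ≤ c21 + Am.card)
    (n5 : 2 * (J1.card + J2.card) ≤ c12 + c21 + 2 * Dm.card + 2 * Am.card) :
    ∃ f : ℕ → Fin 3 → V,
      (∀ i ∈ J1 ∪ J2, R (f i 0) (f i 1) ∧ R (f i 1) (f i 2) ∧ ∀ c, f i c ∉ Zs) ∧
      (∀ i ∈ J1, f i 0 ∈ K1 ∧ f i 2 ∈ K2) ∧ (∀ i ∈ J2, f i 0 ∈ K2 ∧ f i 2 ∈ K1) ∧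
      (∀ i ∈ J1 ∪ J2, ∀ j ∈ J1 ∪ J2, ∀ c d, f i c = f j d → i = j ∧ c = d) ∧
      (∀ d ∈ Dm, ∃ i ∈ J1, f i 1 = d) ∧ (∀ d ∈ Am, ∃ i ∈ J2, f i 1 = d) := by
  set E := Zs ∪ Dm ∪ Am with hEdef
  have hY : ∃ Y1 Y2, Disjoint Y1 Y2 ∧ DirOK R K1 K2 E B (J1.card - Dm.card) Y1 ∧ DirOK R K2 K1 E B (J2.card - Am.card) Y2 := by
    have l' : ∀ p ∈ K2 ∪ K1, ¬ R p p := fun p hp => hl p (by rwa [Finset.union_comm])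
    have hE' : ∀ p ∈ K2 ∪ K1, p ∉ E := fun p hp => hE p (by rwa [Finset.union_comm])
    have o1 := dirOK_of R K1 K2 E B c12 (J1.card - Dm.card) hl hdis hE hK1 hK2 hc12
    have o2 := dirOK_of R K2 K1 E B c21 (J2.card - Am.card) l' hdis.symm hE' hK2 hK1 hc21
    by_cases h : (J1.card - Dm.card) + (J2.card - Am.card) ≤ c12
    · obtain ⟨Y2, -, hY2⟩ := o2 ∅ (by simp; omega)
      obtain ⟨Y1, h1, hY1⟩ := o1 Y2 (by have := hY2.1; omega)
      exact ⟨Y1, Y2, h1, hY1, hY2⟩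
    · obtain ⟨Y1, -, hY1⟩ := o1 ∅ (by simp; omega)
      obtain ⟨Y2, h1, hY2⟩ := o2 Y1 (by have := hY1.1; omega)
      exact ⟨Y1, Y2, h1.symm, hY1, hY2⟩
  obtain ⟨Y1, Y2, hY12, ok1, ok2⟩ := hY
  have dE : ∀ v, v ∈ Dm → v ∈ E := fun v h => Finset.mem_union_left _ (Finset.mem_union_right _ h)
  have aE : ∀ v, v ∈ Am → v ∈ E := fun v h => Finset.mem_union_right _ h
  have zE : ∀ v, v ∈ Zs → v ∈ E := fun v h => Finset.mem_union_left _ (Finset.mem_union_left _ h)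
  have y1E : ∀ v, v ∈ Y1 → v ∉ E := fun v h => Finset.disjoint_left.1 ok1.2.1 h
  have y2E : ∀ v, v ∈ Y2 → v ∉ E := fun v h => Finset.disjoint_left.1 ok2.2.1 h
  have cu1 : (Dm ∪ Y1).card = Dm.card + Y1.card := Finset.card_union_of_disjoint (by
    rw [Finset.disjoint_left]; exact fun v h h' => y1E v h' (dE v h))
  have cu2 : (Am ∪ Y2).card = Am.card + Y2.card := Finset.card_union_of_disjoint (by
    rw [Finset.disjoint_left]; exact fun v h h' => y2E v h' (aE v h))
  obtain ⟨mv1, a1, a2, a3, a4⟩ := assign_mv J1 (Dm ∪ Y1) (by have := ok1.1; omega)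
  obtain ⟨mv2, b1, b2, b3, b4⟩ := assign_mv J2 (Am ∪ Y2) (by have := ok2.1; omega)
  let mv : ℕ → Option V := fun i => if i ∈ J1 then mv1 i else mv2 i
  have hm1 : ∀ i ∈ J1, mv i = mv1 i := fun i hi => if_pos hi
  have hm2 : ∀ i ∈ J2, mv i = mv2 i := fun i hi => if_neg (fun h => Finset.disjoint_left.1 hJ h hi)
  have hcross : ∀ v, v ∈ Dm ∪ Y1 → v ∈ Am ∪ Y2 → False := by
    intro v h1 h2
    rcases Finset.mem_union.1 h1 with h1 | h1 <;> rcases Finset.mem_union.1 h2 with h2 | h2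
    · exact Finset.disjoint_left.1 hDA h1 h2
    · exact y2E v h2 (dE v h1)
    · exact y1E v h1 (aE v h2)
    · exact Finset.disjoint_left.1 hY12 h1 h2
  have hpq : ∀ p ∈ K1, ∀ q ∈ K2, p ≠ q := fun p hp q hq h => Finset.disjoint_left.1 hdis hp (h ▸ hq)
  have l1 : ∀ p ∈ K1, ¬ R p p := fun p hp => hl p (Finset.mem_union_left _ hp)
  have l2 : ∀ p ∈ K2, ¬ R p p := fun p hp => hl p (Finset.mem_union_right _ hp)
  have ex : ∀ K : Finset V, 2 ^ B * B + B < K.card → ∀ X : Finset V, X.card ≤ B → ∃ p ∈ K, p ∉ X := by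
    intro K hK X hX
    exact Finset.exists_mem_notMem_of_card_lt_card (by omega)
  have nel : ∀ p v, ¬ R p p → R p v → p ≠ v := fun p v h h' e => h (by rw [← e] at h'; exact h')
  have ner : ∀ q v, ¬ R q q → R v q → v ≠ q := fun p v h h' e => h (by rw [e] at h'; exact h')
  obtain ⟨f, g1, g2, g3⟩ := greedy3 (fun i p v q => R p v ∧ R v q ∧ (i ∈ J1 → p ∈ K1 ∧ q ∈ K2) ∧ (i ∈ J2 → p ∈ K2 ∧ q ∈ K1))
    (J1 ∪ J2) mv Zs B
    (by
      intro i hi j hj v h1 h2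
      rcases Finset.mem_union.1 hi with hi | hi <;> rcases Finset.mem_union.1 hj with hj | hj
      · rw [hm1 i hi] at h1; rw [hm1 j hj] at h2; exact a3 i j v h1 h2
      · rw [hm1 i hi] at h1; rw [hm2 j hj] at h2; exact (hcross v (a1 i v h1).1 (b1 j v h2).1).elim
      · rw [hm2 i hi] at h1; rw [hm1 j hj] at h2; exact (hcross v (a1 j v h2).1 (b1 i v h1).1).elim
      · rw [hm2 i hi] at h1; rw [hm2 j hj] at h2; exact b3 i j v h1 h2)
    (by
      intro i hi v h1 hz
      rcases Finset.mem_union.1 hi with hi | hi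
      · rw [hm1 i hi] at h1
        rcases Finset.mem_union.1 (a1 i v h1).1 with h | h
        · exact Finset.disjoint_left.1 hDZ h hz
        · exact y1E v h (zE v hz)
      · rw [hm2 i hi] at h1
        rcases Finset.mem_union.1 (b1 i v h1).1 with h | h
        · exact Finset.disjoint_left.1 hAZ h hz
        · exact y2E v h (zE v hz))
    (by rw [Finset.card_union_of_disjoint hJ]; omega)
    (by
      intro i hi X hX hmX
      rcases Finset.mem_union.1 hi with hi | hi
      · have hn2 : i ∉ J2 := fun h => Finset.disjoint_left.1 hJ hi h
        rw [hm1 i hi] at hmX ⊢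
        rcases hmv : mv1 i with _ | v
        · have hlt : Y1.card < J1.card - Dm.card := by
            have := ok1.1
            by_contra hcon
            exact a4 (by omega) i hi hmv
          obtain ⟨p, hp, v, q, hq, h1, h2, h3, h4, h5, h6⟩ := ok1.2.2.2 hlt X hX
          exact ⟨p, v, q, ⟨h1, h2, fun _ => ⟨hp, hq⟩, fun h => absurd h hn2⟩, h4, h5, h6, nel _ _ (l1 p hp) h1, ner _ _ (l2 q hq) h2, hpq p hp q hq, by simp⟩
        · have hvX := hmX v hmv
          have : ∃ p ∈ K1, ∃ q ∈ K2, R p v ∧ R v q ∧ p ∉ X ∧ q ∉ X := by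
            rcases Finset.mem_union.1 (a1 i v hmv).1 with h | h
            · obtain ⟨p, hp, hpX⟩ := ex K1 hK1 X hX
              obtain ⟨q, hq, hqX⟩ := ex K2 hK2 X hX
              exact ⟨p, hp, q, hq, (hD v h).1 p hp, (hD v h).2 q hq, hpX, hqX⟩
            · exact ok1.2.2.1 v h X hX hvX
          obtain ⟨p, hp, q, hq, h1, h2, h4, h6⟩ := this
          exact ⟨p, v, q, ⟨h1, h2, fun _ => ⟨hp, hq⟩, fun h => absurd h hn2⟩, h4, hvX, h6, nel _ _ (l1 p hp) h1, ner _ _ (l2 q hq) h2, hpq p hp q hq, by simp⟩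
      · have hn2 : i ∉ J1 := fun h => Finset.disjoint_left.1 hJ h hi
        rw [hm2 i hi] at hmX ⊢
        rcases hmv : mv2 i with _ | v
        · have hlt : Y2.card < J2.card - Am.card := by
            have := ok2.1
            by_contra hcon
            exact b4 (by omega) i hi hmv
          obtain ⟨p, hp, v, q, hq, h1, h2, h3, h4, h5, h6⟩ := ok2.2.2.2 hlt X hX
          exact ⟨p, v, q, ⟨h1, h2, fun h => absurd h hn2, fun _ => ⟨hp, hq⟩⟩, h4, h5, h6, nel _ _ (l2 p hp) h1, ner _ _ (l1 q hq) h2, (hpq q hq p hp).symm, by simp⟩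
        · have hvX := hmX v hmv
          have : ∃ p ∈ K2, ∃ q ∈ K1, R p v ∧ R v q ∧ p ∉ X ∧ q ∉ X := by
            rcases Finset.mem_union.1 (b1 i v hmv).1 with h | h
            · obtain ⟨p, hp, hpX⟩ := ex K2 hK2 X hX
              obtain ⟨q, hq, hqX⟩ := ex K1 hK1 X hX
              exact ⟨p, hp, q, hq, (hA v h).1 p hp, (hA v h).2 q hq, hpX, hqX⟩
            · exact ok2.2.2.1 v h X hX hvX
          obtain ⟨p, hp, q, hq, h1, h2, h4, h6⟩ := this
          exact ⟨p, v, q, ⟨h1, h2, fun h => absurd h hn2, fun _ => ⟨hp, hq⟩⟩, h4, hvX, h6, nel _ _ (l2 p hp) h1, ner _ _ (l1 q hq) h2, (hpq q hq p hp).symm, by simp⟩)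
  refine ⟨f, ?_, ?_, ?_, g3, ?_, ?_⟩
  · intro i hi; exact ⟨(g1 i hi).1.1, (g1 i hi).1.2.1, g2 i hi⟩
  · intro i hi; exact (g1 i (Finset.mem_union_left _ hi)).1.2.2.1 hi
  · intro i hi; exact (g1 i (Finset.mem_union_right _ hi)).1.2.2.2 hi
  · intro d hd
    obtain ⟨i, hi, h⟩ := a2 d (Finset.mem_union_left _ hd)
    exact ⟨i, hi, (g1 i (Finset.mem_union_left _ hi)).2 d (by rw [hm1 i hi]; exact h)⟩
  · intro d hd
    obtain ⟨i, hi, h⟩ := b2 d (Finset.mem_union_left _ hd)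
    exact ⟨i, hi, (g1 i (Finset.mem_union_right _ hi)).2 d (by rw [hm2 i hi]; exact h)⟩

theorem bool_ne : ∀ a b : Bool, a ≠ b → a = !b := by decide

theorem mfam {V : Type*} [Fintype V] (R : V → V → Prop) (X Y U : Finset V) (d m k A : ℕ)
    (hm : Fintype.card V = m)
    (hdeg : ∀ p q, m + k ≤ (Finset.univ.filter (fun v => R p v)).card + (Finset.univ.filter (fun v => R v q)).card)
    (hl : ∀ v, v ∉ U → ¬ R v v)
    (hXd : ∀ x ∈ X, (Y.filter (fun y => R x y)).card ≤ d) (hYd : ∀ y ∈ Y, (X.filter (fun x => R x y)).card ≤ d)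
    (hA : 1 ≤ A) (hXY : m + A ≤ X.card + Y.card + k) (hX : m ≤ 4 * X.card) (hY : m ≤ 4 * Y.card)
    (hd : 16 * d * (2 + U.card) < m) :
    ∃ Mf : Finset (V × V), Mf.card = A ∧ (∀ a ∈ Mf, R a.1 a.2 ∧ a.1 ∈ X ∧ a.2 ∈ Y ∧ a.1 ∉ U ∧ a.2 ∉ U ∧ a.1 ≠ a.2) ∧
      (∀ a ∈ Mf, ∀ b ∈ Mf, a ≠ b → a.1 ≠ b.1 ∧ a.1 ≠ b.2 ∧ a.2 ≠ b.1 ∧ a.2 ≠ b.2) := by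
  let Ar : Finset (V × V) := (X ×ˢ Y).filter (fun a => R a.1 a.2)
  have hAr1 : Ar.card = ∑ x ∈ X, (Y.filter (fun y => R x y)).card := by
    simp only [Ar, Finset.card_filter, Finset.sum_product]
  have hAr2 : Ar.card = ∑ y ∈ Y, (X.filter (fun x => R x y)).card := by
    simp only [Ar, Finset.card_filter, Finset.sum_product_right]
  have hVne : (Finset.univ : Finset V).Nonempty := by
    rw [← Finset.card_pos, Finset.card_univ]; omega
  have hbig : A * m ≤ 8 * Ar.card := by
    obtain ⟨p, -, hp⟩ := Finset.exists_min_image Finset.univ (fun p => (Finset.univ.filter (fun v => R p v)).card) hVne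
    obtain ⟨q, -, hq⟩ := Finset.exists_min_image Finset.univ (fun q => (Finset.univ.filter (fun v => R v q)).card) hVne
    have hpq := hdeg p q
    set a := (Finset.univ.filter (fun v => R p v)).card
    set b := (Finset.univ.filter (fun v => R v q)).card
    have hx : ∀ x ∈ X, a ≤ (Y.filter (fun y => R x y)).card + (m - Y.card) := by
      intro x hx
      refine (hp x (Finset.mem_univ _)).trans ?_
      have e : Finset.univ.filter (fun v => R x v) ⊆ (Y.filter (fun y => R x y)) ∪ (Finset.univ \ Y) := by
        intro v hv
        by_cases h : v ∈ Y <;> simp [h] at hv ⊢; exact hv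
      refine (Finset.card_le_card e).trans ((Finset.card_union_le _ _).trans ?_)
      rw [Finset.card_sdiff_of_subset (Finset.subset_univ _), Finset.card_univ, hm]
    have hy : ∀ y ∈ Y, b ≤ (X.filter (fun x => R x y)).card + (m - X.card) := by
      intro y hy
      refine (hq y (Finset.mem_univ _)).trans ?_
      have e : Finset.univ.filter (fun v => R v y) ⊆ (X.filter (fun x => R x y)) ∪ (Finset.univ \ X) := by
        intro v hv
        by_cases h : v ∈ X <;> simp [h] at hv ⊢; exact hv
      refine (Finset.card_le_card e).trans ((Finset.card_union_le _ _).trans ?_)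
      rw [Finset.card_sdiff_of_subset (Finset.subset_univ _), Finset.card_univ, hm]
    have hXm : X.card ≤ m := by rw [← hm, ← Finset.card_univ]; exact Finset.card_le_card (Finset.subset_univ _)
    have hYm : Y.card ≤ m := by rw [← hm, ← Finset.card_univ]; exact Finset.card_le_card (Finset.subset_univ _)
    by_cases hc : A + 2 * (m - Y.card) ≤ 2 * a
    · have : ∀ x ∈ X, A ≤ 2 * (Y.filter (fun y => R x y)).card := by
        intro x hx'; have := hx x hx'; omega
      have := Finset.sum_le_sum this
      rw [← Finset.mul_sum, ← hAr1, Finset.sum_const, smul_eq_mul] at this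
      nlinarith
    · have : ∀ y ∈ Y, A ≤ 2 * (X.filter (fun x => R x y)).card := by
        intro y hy'; have := hy y hy'; omega
      have := Finset.sum_le_sum this
      rw [← Finset.mul_sum, ← hAr2, Finset.sum_const, smul_eq_mul] at this
      nlinarith
  have key : ∀ f ≤ A, ∃ Mf : Finset (V × V), Mf.card = f ∧ (∀ a ∈ Mf, R a.1 a.2 ∧ a.1 ∈ X ∧ a.2 ∈ Y ∧ a.1 ∉ U ∧ a.2 ∉ U ∧ a.1 ≠ a.2) ∧
      (∀ a ∈ Mf, ∀ b ∈ Mf, a ≠ b → a.1 ≠ b.1 ∧ a.1 ≠ b.2 ∧ a.2 ≠ b.1 ∧ a.2 ≠ b.2) := by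
    intro f
    induction f with
    | zero => intro _; exact ⟨∅, by simp, by simp, by simp⟩
    | succ f ih =>
      intro hf
      obtain ⟨Mf, h1, h2, h3⟩ := ih (by omega)
      let C : Finset V := U ∪ (Mf.image Prod.fst ∪ Mf.image Prod.snd)
      have hC : C.card ≤ U.card + 2 * f := by
        have e1 := Finset.card_union_le U (Mf.image Prod.fst ∪ Mf.image Prod.snd)
        have e2 := Finset.card_union_le (Mf.image Prod.fst) (Mf.image Prod.snd)
        have e3 : (Mf.image Prod.fst).card ≤ Mf.card := Finset.card_image_le
        have e4 : (Mf.image Prod.snd).card ≤ Mf.card := Finset.card_image_le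
        have : C.card ≤ _ := e1
        omega
      have hex : ∃ a ∈ Ar, a.1 ∉ C ∧ a.2 ∉ C := by
        by_contra hno
        push Not at hno
        have hsub : Ar ⊆ ((C ∩ X).biUnion (fun x => (Y.filter (fun y => R x y)).image (fun y => (x, y)))) ∪
            ((C ∩ Y).biUnion (fun y => (X.filter (fun x => R x y)).image (fun x => (x, y)))) := by
          rintro ⟨x, y⟩ ha
          obtain ⟨hxy, hr⟩ := Finset.mem_filter.1 ha
          obtain ⟨hx, hy⟩ := Finset.mem_product.1 hxy
          by_cases hxC : x ∈ C
          · refine Finset.mem_union_left _ (Finset.mem_biUnion.2 ⟨x, Finset.mem_inter.2 ⟨hxC, hx⟩, ?_⟩)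
            exact Finset.mem_image.2 ⟨y, Finset.mem_filter.2 ⟨hy, hr⟩, rfl⟩
          · refine Finset.mem_union_right _ (Finset.mem_biUnion.2 ⟨y, Finset.mem_inter.2 ⟨hno _ ha hxC, hy⟩, ?_⟩)
            exact Finset.mem_image.2 ⟨x, Finset.mem_filter.2 ⟨hx, hr⟩, rfl⟩
        have c1 : ((C ∩ X).biUnion (fun x => (Y.filter (fun y => R x y)).image (fun y => (x, y)))).card ≤ C.card * d := by
          refine Finset.card_biUnion_le.trans ((Finset.sum_le_card_nsmul _ _ d ?_).trans ?_)
          · intro x hx; exact Finset.card_image_le.trans (hXd x (Finset.mem_inter.1 hx).2)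
          · exact Nat.mul_le_mul_right _ (Finset.card_le_card Finset.inter_subset_left)
        have c2 : ((C ∩ Y).biUnion (fun y => (X.filter (fun x => R x y)).image (fun x => (x, y)))).card ≤ C.card * d := by
          refine Finset.card_biUnion_le.trans ((Finset.sum_le_card_nsmul _ _ d ?_).trans ?_)
          · intro x hx; exact Finset.card_image_le.trans (hYd x (Finset.mem_inter.1 hx).2)
          · exact Nat.mul_le_mul_right _ (Finset.card_le_card Finset.inter_subset_left)
        have c3 := (Finset.card_le_card hsub).trans (Finset.card_union_le _ _)
        have c4 : Ar.card ≤ 2 * (C.card * d) := by omega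
        have c5 : C.card ≤ A * (2 + U.card) := by nlinarith
        have c6 : C.card * d ≤ A * (2 + U.card) * d := Nat.mul_le_mul_right _ c5
        have c7 : A * (16 * d * (2 + U.card)) < A * m := Nat.mul_lt_mul_of_pos_left hd (by omega)
        have c8 : A * (16 * d * (2 + U.card)) = 16 * (A * (2 + U.card) * d) := by ring
        omega
      obtain ⟨⟨x, y⟩, ha, hx, hy⟩ := hex
      obtain ⟨hxy, hr⟩ := Finset.mem_filter.1 ha
      obtain ⟨hxX, hyY⟩ := Finset.mem_product.1 hxy
      simp only [C, Finset.mem_union, not_or, Finset.mem_image, not_exists, not_and] at hx hy hr hxX hyY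
      have hne : (x, y) ∉ Mf := fun h => hx.2.1 _ h rfl
      have hxy' : x ≠ y := by rintro rfl; exact hl x hx.1 hr
      refine ⟨insert (x, y) Mf, by rw [Finset.card_insert_of_notMem hne, h1], ?_, ?_⟩
      · intro a ha
        rcases Finset.mem_insert.1 ha with rfl | ha
        · exact ⟨hr, hxX, hyY, hx.1, hy.1, hxy'⟩
        · exact h2 a ha
      · intro a ha b hb hab
        rcases Finset.mem_insert.1 ha with rfl | ha <;> rcases Finset.mem_insert.1 hb with rfl | hb
        · exact absurd rfl hab
        · exact ⟨fun h => hx.2.1 b hb h.symm, fun h => hx.2.2 b hb h.symm, fun h => hy.2.1 b hb h.symm, fun h => hy.2.2 b hb h.symm⟩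
        · exact ⟨fun h => hx.2.1 a ha h, fun h => hy.2.1 a ha h, fun h => hx.2.2 a ha h, fun h => hy.2.2 a ha h⟩
        · exact h3 a ha b hb hab
  exact key A le_rfl

def ind (b c : Bool) : ℤ := if b = c then 1 else 0

theorem balance {V : Type*} [Fintype V] (R : V → V → Prop) (σ : Bool) (s h : V → Bool) (U Rs : Finset V)
    (hUR : Rs = Finset.univ \ U) (AT AH : V → Bool → Prop) (d m k qb : ℕ) (Q0 : ℤ)
    (hm : Fintype.card V = m)
    (hdeg : ∀ p q, m + k ≤ (Finset.univ.filter (fun v => R p v)).card + (Finset.univ.filter (fun v => R v q)).card)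
    (hl : ∀ v, v ∉ U → ¬ R v v)
    (hab : ∀ v ∈ Rs, AT v (s v) ∧ AH v (h v))
    (hXd : ∀ x, ¬ AT x (!σ) → (Finset.univ.filter (fun y => ¬ AH y σ ∧ R x y)).card ≤ d)
    (hYd : ∀ y, ¬ AH y σ → (Finset.univ.filter (fun x => ¬ AT x (!σ) ∧ R x y)).card ≤ d)
    (hd : 16 * d * (2 + U.card) < m)
    (hq0 : 0 ≤ Q0 + ∑ v ∈ Rs, (ind (s v) σ - ind (h v) σ))
    (hqb : Q0 + ∑ v ∈ Rs, (ind (s v) σ - ind (h v) σ) ≤ qb)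
    (hbig1 : m + 4 * qb ≤ 4 * (Rs.filter (fun v => s v = σ)).card)
    (hbig2 : m + 4 * qb ≤ 4 * (Rs.filter (fun v => h v = !σ)).card)
    (halt : (U.card + Q0 ≤ (U.filter (fun v => ¬ AT v (!σ))).card + (U.filter (fun v => ¬ AH v σ)).card + k) ∨
      (Q0 = 0 ∧ ∀ v ∈ Rs, ¬ (¬ AT v (!σ) ∧ ¬ AH v σ)) ∨
      qb ≤ (Rs.filter (fun v => s v = σ ∧ AT v (!σ))).card + (Rs.filter (fun v => h v = !σ ∧ AH v σ)).card) :
    ∃ (s' h' : V → Bool) (Mf : Finset (V × V)), Mf.card ≤ qb ∧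
      (∀ v ∈ Rs, AT v (s' v) ∧ AH v (h' v)) ∧
      (∀ v ∈ U, s' v = s v ∧ h' v = h v) ∧
      (Rs.filter (fun v => s' v ≠ s v ∨ h' v ≠ h v)).card ≤ qb ∧
      (∀ a ∈ Mf, R a.1 a.2 ∧ a.1 ∈ Rs ∧ a.2 ∈ Rs ∧ a.1 ≠ a.2 ∧ s' a.1 = σ ∧ h' a.2 = !σ) ∧
      (∀ a ∈ Mf, ∀ b ∈ Mf, a ≠ b → a.1 ≠ b.1 ∧ a.1 ≠ b.2 ∧ a.2 ≠ b.1 ∧ a.2 ≠ b.2) ∧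
      Q0 + ∑ v ∈ Rs, (ind (s' v) σ - ind (h' v) σ) - Mf.card = 0 := by
  set FT := Rs.filter (fun v => s v = σ ∧ AT v (!σ)) with hFT
  set FH := Rs.filter (fun v => h v = !σ ∧ AH v σ) with hFH
  obtain ⟨q, hq⟩ := Int.eq_ofNat_of_zero_le hq0
  have hRsU : ∀ v, v ∈ Rs ↔ v ∉ U := by intro v; simp [hUR]
  have hqqb : q ≤ qb := by rw [hq] at hqb; exact_mod_cast hqb
  obtain ⟨PT, hPT, hPTc⟩ := Finset.exists_subset_card_eq (s := FT) (n := min q FT.card) (by omega)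
  obtain ⟨PH, hPH, hPHc⟩ := Finset.exists_subset_card_eq (s := FH) (n := min (q - FT.card) FH.card) (by omega)
  let s' : V → Bool := fun v => if v ∈ PT then !σ else s v
  let h' : V → Bool := fun v => if v ∈ PH then σ else h v
  have hPTR : PT ⊆ Rs := hPT.trans (Finset.filter_subset _ _)
  have hPHR : PH ⊆ Rs := hPH.trans (Finset.filter_subset _ _)
  have hs' : ∑ v ∈ Rs, ind (s' v) σ = ∑ v ∈ Rs, ind (s v) σ - PT.card := by
    rw [eq_sub_iff_add_eq, Finset.card_eq_sum_ones, ← Finset.sum_filter_add_sum_filter_not Rs (fun v => v ∈ PT),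
      ← Finset.sum_filter_add_sum_filter_not Rs (fun v => v ∈ PT) (fun v => ind (s v) σ)]
    have e0 : Rs.filter (fun v => v ∈ PT) = PT := by
      ext v; simp; exact fun h => hPTR h
    rw [e0]
    have e1 : ∑ v ∈ PT, ind (s' v) σ = 0 := by
      apply Finset.sum_eq_zero; intro v hv; simp [s', hv, ind]
    have e2 : ∑ v ∈ PT, ind (s v) σ = ∑ v ∈ PT, 1 := by
      apply Finset.sum_congr rfl; intro v hv
      have := (Finset.mem_filter.1 (hPT hv)).2.1
      simp [ind, this]
    have e3 : ∑ v ∈ Rs with v ∉ PT, ind (s' v) σ = ∑ v ∈ Rs with v ∉ PT, ind (s v) σ := by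
      apply Finset.sum_congr rfl; intro v hv
      have := (Finset.mem_filter.1 hv).2
      simp [s', this]
    rw [e1, e2, e3]; push_cast; ring
  have hh' : ∑ v ∈ Rs, ind (h' v) σ = ∑ v ∈ Rs, ind (h v) σ + PH.card := by
    rw [Finset.card_eq_sum_ones, ← Finset.sum_filter_add_sum_filter_not Rs (fun v => v ∈ PH),
      ← Finset.sum_filter_add_sum_filter_not Rs (fun v => v ∈ PH) (fun v => ind (h v) σ)]
    have e0 : Rs.filter (fun v => v ∈ PH) = PH := by
      ext v; simp; exact fun h => hPHR h
    rw [e0]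
    have e1 : ∑ v ∈ PH, ind (h' v) σ = ∑ v ∈ PH, 1 := by
      apply Finset.sum_congr rfl; intro v hv; simp [h', hv, ind]
    have e2 : ∑ v ∈ PH, ind (h v) σ = 0 := by
      apply Finset.sum_eq_zero; intro v hv
      have := (Finset.mem_filter.1 (hPH hv)).2.1
      simp [ind, this]
    have e3 : ∑ v ∈ Rs with v ∉ PH, ind (h' v) σ = ∑ v ∈ Rs with v ∉ PH, ind (h v) σ := by
      apply Finset.sum_congr rfl; intro v hv
      have := (Finset.mem_filter.1 hv).2
      simp [h', this]
    rw [e1, e2, e3]; push_cast; ring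
  have hab' : ∀ v ∈ Rs, AT v (s' v) ∧ AH v (h' v) := by
    intro v hv
    constructor
    · by_cases hp : v ∈ PT
      · simp only [s', hp, if_true]; exact (Finset.mem_filter.1 (hPT hp)).2.2
      · simp only [s', hp, if_false]; exact (hab v hv).1
    · by_cases hp : v ∈ PH
      · simp only [h', hp, if_true]; exact (Finset.mem_filter.1 (hPH hp)).2.2
      · simp only [h', hp, if_false]; exact (hab v hv).2
  have hU' : ∀ v ∈ U, s' v = s v ∧ h' v = h v := by
    intro v hv
    have h1 : v ∉ PT := fun h => (hRsU v).1 (hPTR h) hv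
    have h2 : v ∉ PH := fun h => (hRsU v).1 (hPHR h) hv
    simp [s', h', h1, h2]
  have hchg : (Rs.filter (fun v => s' v ≠ s v ∨ h' v ≠ h v)).card ≤ qb := by
    have : Rs.filter (fun v => s' v ≠ s v ∨ h' v ≠ h v) ⊆ PT ∪ PH := by
      intro v hv
      have := (Finset.mem_filter.1 hv).2
      by_contra hn
      simp only [Finset.mem_union, not_or] at hn
      simp [s', h', hn.1, hn.2] at this
    have := (Finset.card_le_card this).trans (Finset.card_union_le _ _)
    omega
  have hsum : Q0 + ∑ v ∈ Rs, (ind (s' v) σ - ind (h' v) σ) = ((q - PT.card - PH.card : ℕ) : ℤ) := by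
    rw [Finset.sum_sub_distrib, hs', hh']
    rw [Finset.sum_sub_distrib] at hq
    have : PT.card + PH.card ≤ q := by omega
    have e : ((q - PT.card - PH.card : ℕ) : ℤ) = q - PT.card - PH.card := by omega
    rw [e]; linarith
  by_cases hz : q - PT.card - PH.card = 0
  · refine ⟨s', h', ∅, by simp, hab', hU', hchg, by simp, by simp, ?_⟩
    rw [hsum, hz]; simp
  -- stuck
  have hPTe : PT = FT := Finset.eq_of_subset_of_card_le hPT (by omega)
  have hPHe : PH = FH := Finset.eq_of_subset_of_card_le hPH (by omega)
  have hs1 : ∀ v ∈ Rs, (s' v = σ ↔ ¬ AT v (!σ)) := by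
    intro v hv
    constructor
    · intro h1 h2
      by_cases hp : v ∈ PT
      · simp [s', hp] at h1
      · simp only [s', hp, if_false] at h1
        exact hp (hPTe ▸ Finset.mem_filter.2 ⟨hv, h1, h2⟩)
    · intro h1
      by_contra h2
      have h3 : s' v = !σ := bool_ne _ _ h2
      exact h1 (h3 ▸ (hab' v hv).1)
  have hs2 : ∀ v ∈ Rs, (h' v = σ ↔ AH v σ) := by
    intro v hv
    constructor
    · intro h1; exact h1 ▸ (hab' v hv).2
    · intro h1
      by_contra h2
      have h3 : h' v = !σ := bool_ne _ _ h2
      by_cases hp : v ∈ PH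
      · simp [h', hp] at h3
      · simp only [h', hp, if_false] at h3
        exact hp (hPHe ▸ Finset.mem_filter.2 ⟨hv, h3, h1⟩)
  let X : Finset V := Finset.univ.filter (fun v => ¬ AT v (!σ))
  let Y : Finset V := Finset.univ.filter (fun v => ¬ AH v σ)
  have hsp : ∀ P : V → Prop, (Finset.univ.filter P).card = (U.filter P).card + (Rs.filter P).card := by
    intro P
    rw [hUR, ← Finset.card_union_of_disjoint]
    · congr 1; ext v; simp; tauto
    · rw [Finset.disjoint_left]; intro v hv hv'
      exact (Finset.mem_sdiff.1 (Finset.mem_filter.1 hv').1).2 (Finset.mem_filter.1 hv).1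
  have hcU : U.card + Rs.card = m := by
    rw [hUR, Finset.card_sdiff_of_subset (Finset.subset_univ _), Finset.card_univ, hm]
    have : U.card ≤ m := by rw [← hm, ← Finset.card_univ]; exact Finset.card_le_card (Finset.subset_univ _)
    omega
  have hXc : (Rs.filter (fun v => ¬ AT v (!σ))).card = ∑ v ∈ Rs, ind (s' v) σ := by
    rw [Finset.card_filter]; push_cast
    apply Finset.sum_congr rfl; intro v hv
    simp only [ind, hs1 v hv]
  have hYc : (Rs.card : ℤ) - (Rs.filter (fun v => ¬ AH v σ)).card = ∑ v ∈ Rs, ind (h' v) σ := by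
    have e1 := Finset.card_filter_add_card_filter_not (s := Rs) (fun v => AH v σ)
    have e2 : ((Rs.filter (fun v => AH v σ)).card : ℤ) = ∑ v ∈ Rs, ind (h' v) σ := by
      rw [Finset.card_filter]; push_cast
      apply Finset.sum_congr rfl; intro v hv
      simp only [ind, hs2 v hv]
    omega
  rw [Finset.sum_sub_distrib, ← hXc, ← hYc] at hsum
  rcases halt with halt | ⟨hQ, halt⟩ | halt
  · obtain ⟨Mf, m1, m2, m3⟩ := mfam R X Y U d m k (q - PT.card - PH.card) hm hdeg hl
      (by
        intro x hx
        refine le_trans (Finset.card_le_card ?_) (hXd x (Finset.mem_filter.1 hx).2)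
        intro y hy
        obtain ⟨h1, h2⟩ := Finset.mem_filter.1 hy
        exact Finset.mem_filter.2 ⟨Finset.mem_univ _, (Finset.mem_filter.1 h1).2, h2⟩)
      (by
        intro x hx
        refine le_trans (Finset.card_le_card ?_) (hYd x (Finset.mem_filter.1 hx).2)
        intro y hy
        obtain ⟨h1, h2⟩ := Finset.mem_filter.1 hy
        exact Finset.mem_filter.2 ⟨Finset.mem_univ _, (Finset.mem_filter.1 h1).2, h2⟩)
      (by omega)
      (by
        have e1 : X.card = (U.filter (fun v => ¬ AT v (!σ))).card + (Rs.filter (fun v => ¬ AT v (!σ))).card := by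
          simp only [X]; convert hsp (fun v => ¬ AT v (!σ))
        have e2 : Y.card = (U.filter (fun v => ¬ AH v σ)).card + (Rs.filter (fun v => ¬ AH v σ)).card := by
          simp only [Y]; convert hsp (fun v => ¬ AH v σ)
        rw [e1, e2]
        zify at hcU ⊢; linarith)
      (by
        have e1 : Rs.filter (fun v => s v = σ) ⊆ X ∪ PT := by
          intro v hv
          obtain ⟨h1, h2⟩ := Finset.mem_filter.1 hv
          by_cases h3 : AT v (!σ)
          · exact Finset.mem_union_right _ (hPTe ▸ Finset.mem_filter.2 ⟨h1, h2, h3⟩)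
          · exact Finset.mem_union_left _ (Finset.mem_filter.2 ⟨Finset.mem_univ _, h3⟩)
        have := (Finset.card_le_card e1).trans (Finset.card_union_le _ _)
        omega)
      (by
        have e1 : Rs.filter (fun v => h v = !σ) ⊆ Y ∪ PH := by
          intro v hv
          obtain ⟨h1, h2⟩ := Finset.mem_filter.1 hv
          by_cases h3 : AH v σ
          · exact Finset.mem_union_right _ (hPHe ▸ Finset.mem_filter.2 ⟨h1, h2, h3⟩)
          · exact Finset.mem_union_left _ (Finset.mem_filter.2 ⟨Finset.mem_univ _, h3⟩)
        have := (Finset.card_le_card e1).trans (Finset.card_union_le _ _)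
        omega) hd
    refine ⟨s', h', Mf, by omega, hab', hU', hchg, ?_, m3, ?_⟩
    · intro a ha
      obtain ⟨a1, a2, a3, a4, a5, a6⟩ := m2 a ha
      have r1 := (hRsU a.1).2 a4
      have r2 := (hRsU a.2).2 a5
      refine ⟨a1, r1, r2, a6, (hs1 _ r1).2 (Finset.mem_filter.1 a2).2, ?_⟩
      have : h' a.2 ≠ σ := fun h => (Finset.mem_filter.1 a3).2 ((hs2 _ r2).1 h)
      exact bool_ne _ _ this
    · rw [Finset.sum_sub_distrib, ← hXc, ← hYc, hsum, m1]; simp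
  · exfalso
    have e1 : Rs.filter (fun v => ¬ AT v (!σ)) ⊆ Rs \ Rs.filter (fun v => ¬ AH v σ) := by
      intro v hv
      obtain ⟨h1, h2⟩ := Finset.mem_filter.1 hv
      exact Finset.mem_sdiff.2 ⟨h1, fun h3 => halt v h1 ⟨h2, (Finset.mem_filter.1 h3).2⟩⟩
    have e2 := Finset.card_le_card e1
    rw [Finset.card_sdiff_of_subset (Finset.filter_subset _ _)] at e2
    have e3 : (Rs.filter (fun v => ¬ AH v σ)).card ≤ Rs.card := Finset.card_le_card (Finset.filter_subset _ _)
    omega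
  · exfalso; omega

theorem mem_sdiff' {α : Type*} {inst : DecidableEq α} {s t : Finset α} {a : α} : a ∈ s \ t ↔ a ∈ s ∧ a ∉ t :=
  Finset.mem_sdiff

/-- Output of the core theorem. -/
def HamOut {V : Type*} (R : V → V → Prop) (z : ℕ → V) (t : ℕ) (N : ℕ → ℕ) : Prop :=
  ∃ (seg : ℕ → List V) (l : List V), (∀ i < t, (seg i).length = N i - 1) ∧
    (((List.range t).flatMap (fun i => z i :: seg i) ++ [z t]) ++ l).Nodup ∧
    (∀ v, v ∈ ((List.range t).flatMap (fun i => z i :: seg i) ++ [z t]) ++ l) ∧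
    CycChain R (((List.range t).flatMap (fun i => z i :: seg i) ++ [z t]) ++ l)

abbrev BT (V : Type*) := V ⊕ ((V × V) ⊕ ℕ)

def blk {V : Type*} (f : ℕ → Fin 3 → V) : BT V → List V
  | Sum.inl v => [v]
  | Sum.inr (Sum.inl a) => [a.1, a.2]
  | Sum.inr (Sum.inr i) => [f i 0, f i 1, f i 2]

def bhd {V : Type*} (f : ℕ → Fin 3 → V) : BT V → V
  | Sum.inl v => v
  | Sum.inr (Sum.inl a) => a.1
  | Sum.inr (Sum.inr i) => f i 0

def btl {V : Type*} (f : ℕ → Fin 3 → V) : BT V → V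
  | Sum.inl v => v
  | Sum.inr (Sum.inl a) => a.2
  | Sum.inr (Sum.inr i) => f i 2

theorem blk_head {V : Type*} (f : ℕ → Fin 3 → V) (b : BT V) : (blk f b).head? = some (bhd f b) := by
  rcases b with v | a | i <;> rfl

theorem blk_last {V : Type*} (f : ℕ → Fin 3 → V) (b : BT V) : (blk f b).getLast? = some (btl f b) := by
  rcases b with v | a | i <;> rfl

theorem JR_blk {V : Type*} (R : V → V → Prop) (f : ℕ → Fin 3 → V) (b c : BT V) :
    JR R (blk f b) (blk f c) ↔ R (btl f b) (bhd f c) := by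
  simp [JR, blk_head, blk_last]

theorem cyc_blk {V : Type*} (R : V → V → Prop) (f : ℕ → Fin 3 → V) (l : List (BT V))
    (hl : ∀ b ∈ l, (blk f b).IsChain R)
    (h : CycChain (fun b c => R (btl f b) (bhd f c)) l) : CycChain R (l.map (blk f)).flatten := by
  apply cycChain_flatten
  · intro x hx
    obtain ⟨b, hb, rfl⟩ := List.mem_map.1 hx
    intro h; have := blk_head f b; rw [h] at this; simp at this
  · intro x hx
    obtain ⟨b, hb, rfl⟩ := List.mem_map.1 hx
    exact hl b hb
  · refine ⟨?_, ?_⟩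
    · rw [List.isChain_map]
      exact h.1.imp (fun a b hab => (JR_blk R f a b).2 hab)
    · intro x hx y hy
      rw [List.getLast?_map] at hx
      rw [List.head?_map] at hy
      obtain ⟨b, hb, rfl⟩ := Option.map_eq_some_iff.1 hx
      obtain ⟨c, hc, rfl⟩ := Option.map_eq_some_iff.1 hy
      exact (JR_blk R f b c).2 (h.2 b hb c hc)

theorem blk_single_len {V : Type*} (f : ℕ → Fin 3 → V) (l : List (BT V)) (hl : ∀ b ∈ l, ∃ v, b = Sum.inl v) :
    (l.flatMap (blk f)).length = l.length := by
  induction l with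
  | nil => rfl
  | cons a l ih =>
    obtain ⟨v, rfl⟩ := hl a (by simp)
    rw [List.flatMap_cons, List.length_append, ih (fun b hb => hl b (by simp [hb]))]
    simp [blk]; omega

set_option maxHeartbeats 1000000 in
theorem E_close {V : Type*} [Fintype V] (R : V → V → Prop) (s h : V → Bool) (σ : Bool) (Ty : Finset V)
    (e M ns t x qb : ℕ) (heM : e ≤ M) (Ab : Bool → Bool → Prop) (z : ℕ → V) (N : ℕ → ℕ)
    (J : Finset ℕ) (f : ℕ → Fin 3 → V) (Mf : Finset (V × V))
    (hz : ∀ i ≤ t, z i ∉ Ty) (hzi : ∀ i ≤ t, ∀ j ≤ t, z i = z j → i = j)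
    (hN : ∀ i < t, 4 ≤ N i)
    (near1 : ∀ u ∈ Ty, (Ty.filter (fun v => h v = s u ∧ ¬ R u v)).card ≤ e)
    (near2 : ∀ v ∈ Ty, (Ty.filter (fun u => s u = h v ∧ ¬ R u v)).card ≤ e)
    (hns : (Finset.univ \ Ty).card + qb ≤ ns)
    (hMf : Mf.card ≤ qb)
    (hMR : ∀ a ∈ Mf, R a.1 a.2 ∧ a.1 ≠ a.2 ∧ s a.1 = σ ∧ h a.2 = !σ)
    (hMd : ∀ a ∈ Mf, ∀ b ∈ Mf, a ≠ b → a.1 ≠ b.1 ∧ a.1 ≠ b.2 ∧ a.2 ≠ b.1 ∧ a.2 ≠ b.2)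
    (hMU : ∀ a ∈ Mf, ∀ i ∈ J, ∀ c, a.1 ≠ f i c ∧ a.2 ≠ f i c)
    (hMz : ∀ a ∈ Mf, ∀ i ≤ t, a.1 ≠ z i ∧ a.2 ≠ z i)
    (hUz : ∀ j ∈ J, ∀ c, ∀ i ≤ t, f j c ≠ z i)
    (hUR : ∀ i ∈ J, R (f i 0) (f i 1) ∧ R (f i 1) (f i 2) ∧ f i 0 ∈ Ty ∧ f i 2 ∈ Ty)
    (hUi : ∀ i ∈ J, ∀ c, ∀ j ∈ J, ∀ c', f i c = f j c' → i = j ∧ c = c')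
    (hx : 2 * ns + 3 * J.card + 2 * qb ≤ x)
    (sp1 : ∀ b, (∀ i ∈ J, ∀ c, b ≠ f i c) → x ≤ (Ty.filter (fun v => h v = s b ∧ R b v)).card)
    (sp2 : ∀ b, (∀ i ∈ J, ∀ c, b ≠ f i c) → x ≤ (Ty.filter (fun v => s v = h b ∧ R v b)).card)
    (hbal : ∑ v ∈ Finset.univ.filter (fun v => ∀ i ∈ J, ∀ c, v ≠ f i c), (ind (s v) σ - ind (h v) σ)
      + ∑ i ∈ J, (ind (s (f i 2)) σ - ind (h (f i 0)) σ) - Mf.card = 0)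
    (hJ : ∀ i < t, i ∈ J → R (z i) (f i 0) ∧ s (z i) = h (f i 0) ∧ (N i = 4 → R (f i 2) (z (i+1))) ∧
      Conn Ab (s (f i 2)) (h (z (i+1))) (N i - 4) ∧
      (Ty.filter (fun v => s v = h (z (i+1)) ∧ ¬ R v (z (i+1)))).card ≤ M)
    (hnJ : ∀ i < t, i ∉ J → ∀ a b, Ab (s (z i)) a → Ab b (h (z (i+1))) → Conn Ab a b (N i - 3))
    (hAb : ∀ v ∈ Ty, Ab (h v) (s v))
    (hsz : ∀ a b, Ab a b → 2 * ns + ∑ i ∈ Finset.range t, N i + 2 * M + 3 * J.card + 2 * qb <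
      (Ty.filter (fun v => h v = a ∧ s v = b)).card)
    (hsz2 : ∀ τ, 3 * e + 3 + 2 * ns + ∑ i ∈ Finset.range t, N i + 3 * J.card + 2 * qb ≤
      (Ty.filter (fun v => s v = τ)).card)
    (hne : (∃ τ, Ab τ (!τ)) ∨ ∃ i ∈ J, t ≤ i ∧ h (f i 0) ≠ s (f i 2)) :
    HamOut R z t N := by
  set UV : Finset V := J.biUnion (fun i => Finset.univ.image (f i)) with hUV
  have mUV : ∀ v, v ∈ UV ↔ ∃ i ∈ J, ∃ c, f i c = v := by
    intro v; simp [UV]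
  set MV : Finset V := Mf.biUnion (fun a => {a.1, a.2}) with hMV
  have mMV : ∀ v, v ∈ MV ↔ ∃ a ∈ Mf, v = a.1 ∨ v = a.2 := by
    intro v; simp [MV]
  have cUV : UV.card ≤ 3 * J.card := by
    rw [hUV, mul_comm]; apply Finset.card_biUnion_le_card_mul
    intro i hi; exact (Finset.card_image_le).trans (by simp)
  have cMV : MV.card ≤ 2 * qb := by
    refine le_trans (b := Mf.card * 2) ?_ (by omega)
    apply Finset.card_biUnion_le_card_mul
    intro i hi; exact Finset.card_le_two
  set Sg : Finset V := Finset.univ \ (UV ∪ MV) with hSg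
  have mSg : ∀ v, v ∈ Sg ↔ v ∉ UV ∧ v ∉ MV := by intro v; simp [Sg]
  have hzS : ∀ i ≤ t, z i ∈ Sg := by
    intro i hi
    rw [mSg, mUV, mMV]
    constructor
    · rintro ⟨j, hj, c, h1⟩; exact hUz j hj c i hi h1
    · rintro ⟨a, ha, h1 | h1⟩
      · exact (hMz a ha i hi).1 h1.symm
      · exact (hMz a ha i hi).2 h1.symm
  set Fs : Finset V := Sg ∩ Ty with hFs
  let R' : BT V → BT V → Prop := fun b c => R (btl f b) (bhd f c)
  let H' : BT V → Bool := fun b => h (bhd f b)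
  let S' : BT V → Bool := fun b => s (btl f b)
  let I : Finset (BT V) := Sg.disjSum (Mf.disjSum J)
  let T : Finset (BT V) := Fs.disjSum ((∅ : Finset (V × V)).disjSum J)
  let F : Finset (BT V) := Fs.map Function.Embedding.inl
  have Fcard : ∀ (P : BT V → Prop) [DecidablePred P], (F.filter P).card = (Fs.filter (fun v => P (Sum.inl v))).card := by
    intro P _
    simp only [F]
    rw [Finset.filter_map, Finset.card_map]; rfl
  have Fs_lb : ∀ (P : V → Prop) [DecidablePred P], (Ty.filter P).card ≤ (Fs.filter P).card + 3 * J.card + 2 * qb := by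
    intro P _
    have : Ty.filter P ⊆ Fs.filter P ∪ (UV ∪ MV) := by
      intro v hv
      obtain ⟨h1, h2⟩ := Finset.mem_filter.1 hv
      by_cases h3 : v ∈ UV ∪ MV
      · exact Finset.mem_union_right _ h3
      · exact Finset.mem_union_left _ (Finset.mem_filter.2 ⟨Finset.mem_inter.2 ⟨by simp [Sg]; simpa using h3, h1⟩, h2⟩)
    have h1 := (Finset.card_le_card this).trans (Finset.card_union_le _ _)
    have h2 := Finset.card_union_le UV MV
    omega
  have hbhd : ∀ b ∈ T, bhd f b ∈ Ty ∧ btl f b ∈ Ty := by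
    intro b hb
    rcases b with v | a | i
    · have : v ∈ Fs := by simpa [T] using hb
      have := (Finset.mem_inter.1 this).2
      exact ⟨this, this⟩
    · simp [T] at hb
    · have : i ∈ J := by simpa [T] using hb
      exact ⟨(hUR i this).2.2.1, (hUR i this).2.2.2⟩
  have hinjh : ∀ b ∈ T, ∀ c ∈ T, bhd f b = bhd f c → b = c := by
    intro b hb c hc hbc
    rcases b with v | a | i
    · have hv : v ∈ Fs := by simpa [T] using hb
      have hv' := ((mSg v).1 (Finset.mem_inter.1 hv).1).1
      rcases c with w | a' | j
      · simp only [bhd] at hbc; rw [hbc]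
      · simp [T] at hc
      · have hj : j ∈ J := by simpa [T] using hc
        exact absurd ((mUV v).2 ⟨j, hj, 0, hbc.symm⟩) hv'
    · simp [T] at hb
    · have hi : i ∈ J := by simpa [T] using hb
      rcases c with w | a' | j
      · have hv : w ∈ Fs := by simpa [T] using hc
        have hv' := ((mSg w).1 (Finset.mem_inter.1 hv).1).1
        exact absurd ((mUV w).2 ⟨i, hi, 0, hbc⟩) hv'
      · simp [T] at hc
      · have hj : j ∈ J := by simpa [T] using hc
        rw [(hUi i hi 0 j hj 0 hbc).1]
  have hinjt : ∀ b ∈ T, ∀ c ∈ T, btl f b = btl f c → b = c := by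
    intro b hb c hc hbc
    rcases b with v | a | i
    · have hv : v ∈ Fs := by simpa [T] using hb
      have hv' := ((mSg v).1 (Finset.mem_inter.1 hv).1).1
      rcases c with w | a' | j
      · simp only [btl] at hbc; rw [hbc]
      · simp [T] at hc
      · have hj : j ∈ J := by simpa [T] using hc
        exact absurd ((mUV v).2 ⟨j, hj, 2, hbc.symm⟩) hv'
    · simp [T] at hb
    · have hi : i ∈ J := by simpa [T] using hb
      rcases c with w | a' | j
      · have hv : w ∈ Fs := by simpa [T] using hc
        have hv' := ((mSg w).1 (Finset.mem_inter.1 hv).1).1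
        exact absurd ((mUV w).2 ⟨i, hi, 2, hbc⟩) hv'
      · simp [T] at hc
      · have hj : j ∈ J := by simpa [T] using hc
        rw [(hUi i hi 2 j hj 2 hbc).1]
  have hIT : ∀ b, (b ∈ I ∧ b ∉ T) → (∀ i ∈ J, ∀ c, bhd f b ≠ f i c) ∧ (∀ i ∈ J, ∀ c, btl f b ≠ f i c) := by
    rintro b ⟨h1, h2⟩
    rcases b with v | a | i
    · have hv : v ∈ Sg := by simpa [I] using h1
      have hv' := ((mSg v).1 hv).1
      constructor <;> intro i hi c hc <;> exact hv' ((mUV v).2 ⟨i, hi, c, hc.symm⟩)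
    · have ha : a ∈ Mf := by simpa [I] using h1
      exact ⟨fun i hi c => (hMU a ha i hi c).1, fun i hi c => (hMU a ha i hi c).2⟩
    · exfalso; apply h2
      have hi : i ∈ J := by simpa [I] using h1
      simpa [T] using hi
  let L : ℕ → ℕ := fun i => if i ∈ J then N i - 4 else N i - 1
  have hLN : ∑ i ∈ Finset.range t, L i ≤ ∑ i ∈ Finset.range t, N i := by
    apply Finset.sum_le_sum; intro i _; simp only [L]; split_ifs <;> omega
  obtain ⟨fill, l, hfill, hperm, hcyc⟩ := assemble R' H' S' I T F
    (by
      intro b hb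
      obtain ⟨v, hv, rfl⟩ := Finset.mem_map.1 hb
      simpa [T] using hv)
    (by
      intro b hb
      rcases b with v | a | i
      · have hv : v ∈ Fs := by simpa [T] using hb
        simpa [I] using (Finset.mem_inter.1 hv).1
      · simp [T] at hb
      · simpa [T, I] using hb)
    e M ns t heM Ab
    (by
      intro u hu
      refine le_trans ?_ (near1 _ (hbhd u hu).2)
      apply Finset.card_le_card_of_injOn (bhd f)
      · intro b hb
        obtain ⟨h1, h2, h3⟩ := Finset.mem_filter.1 (Finset.mem_coe.1 hb)
        exact Finset.mem_coe.2 (Finset.mem_filter.2 ⟨(hbhd b h1).1, h2, h3⟩)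
      · intro b hb c hc
        exact hinjh b (Finset.mem_filter.1 (Finset.mem_coe.1 hb)).1 c (Finset.mem_filter.1 (Finset.mem_coe.1 hc)).1)
    (by
      intro u hu
      refine le_trans ?_ (near2 _ (hbhd u hu).1)
      apply Finset.card_le_card_of_injOn (btl f)
      · intro b hb
        obtain ⟨h1, h2, h3⟩ := Finset.mem_filter.1 (Finset.mem_coe.1 hb)
        exact Finset.mem_coe.2 (Finset.mem_filter.2 ⟨(hbhd b h1).2, h2, h3⟩)
      · intro b hb c hc
        exact hinjt b (Finset.mem_filter.1 (Finset.mem_coe.1 hb)).1 c (Finset.mem_filter.1 (Finset.mem_coe.1 hc)).1)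
    (by
      have : I \ T ⊆ (Finset.univ \ Ty).disjSum (Mf.disjSum ∅) := by
        intro b hb
        obtain ⟨h1, h2⟩ := Finset.mem_sdiff.1 hb
        rcases b with v | a | i
        · have hv : v ∈ Sg := by simpa [I] using h1
          simp only [Finset.inl_mem_disjSum, Finset.mem_sdiff, Finset.mem_univ, true_and]
          intro h3; apply h2
          have : v ∈ Fs := Finset.mem_inter.2 ⟨hv, h3⟩
          simpa [T] using this
        · simpa [I] using h1
        · exfalso; apply h2; simpa [T, I] using h1
      have := Finset.card_le_card this
      rw [Finset.card_disjSum, Finset.card_disjSum] at this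
      simp only [Finset.card_empty] at this
      have h5 : (I \ T).card ≤ ns := by omega
      convert h5)
    (by
      intro b hb
      rw [Fcard]
      have h1 := sp1 _ (hIT b (mem_sdiff'.1 hb)).2
      have h2 := Fs_lb (fun v => h v = s (btl f b) ∧ R (btl f b) v)
      have h3 : (Fs.filter (fun v => H' (Sum.inl v) = S' b ∧ R' b (Sum.inl v))).card =
        (Fs.filter (fun v => h v = s (btl f b) ∧ R (btl f b) v)).card := by congr
      rw [h3]
      have h4 : (Ty.filter (fun v => h v = s (btl f b) ∧ R (btl f b) v)).card ≤ (Fs.filter (fun v => h v = s (btl f b) ∧ R (btl f b) v)).card + 3 * J.card + 2 * qb := by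
        convert h2
      omega)
    (by
      intro b hb
      rw [Fcard]
      have h1 := sp2 _ (hIT b (mem_sdiff'.1 hb)).1
      have h2 := Fs_lb (fun v => s v = h (bhd f b) ∧ R v (bhd f b))
      have h3 : (Fs.filter (fun v => S' (Sum.inl v) = H' b ∧ R' (Sum.inl v) b)).card =
        (Fs.filter (fun v => s v = h (bhd f b) ∧ R v (bhd f b))).card := by congr
      rw [h3]
      have h4 : (Ty.filter (fun v => s v = h (bhd f b) ∧ R v (bhd f b))).card ≤ (Fs.filter (fun v => s v = h (bhd f b) ∧ R v (bhd f b))).card + 3 * J.card + 2 * qb := by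
        convert h2
      omega)
    (by
      have hsplit : Finset.univ.filter (fun v => ∀ i ∈ J, ∀ c, v ≠ f i c) = Sg ∪ MV := by
        ext v
        simp only [Finset.mem_filter, Finset.mem_univ, true_and, Finset.mem_union]
        rw [mSg]
        constructor
        · intro h1
          have : v ∉ UV := by
            rw [mUV]; rintro ⟨i, hi, c, h2⟩; exact h1 i hi c h2.symm
          tauto
        · intro h1 i hi c h2
          rcases h1 with h1 | h1
          · exact h1.1 ((mUV v).2 ⟨i, hi, c, h2.symm⟩)
          · obtain ⟨a, ha, h3 | h3⟩ := (mMV v).1 h1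
            · exact (hMU a ha i hi c).1 (h3 ▸ h2)
            · exact (hMU a ha i hi c).2 (h3 ▸ h2)
      have hdis : Disjoint Sg MV := by
        rw [Finset.disjoint_left]; intro v hv; exact ((mSg v).1 hv).2
      rw [hsplit, Finset.sum_union hdis, hMV, Finset.sum_biUnion] at hbal
      · have hM2 : ∑ a ∈ Mf, ∑ v ∈ ({a.1, a.2} : Finset V), (ind (s v) σ - ind (h v) σ) =
            ∑ a ∈ Mf, ((ind (s a.2) σ - ind (h a.1) σ) + 1) := by
          apply Finset.sum_congr rfl; intro a ha
          obtain ⟨_, h2, h3, h4⟩ := hMR a ha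
          rw [Finset.sum_pair h2, h3, h4]
          simp only [ind]
          cases σ <;> simp <;> ring
        rw [hM2, Finset.sum_add_distrib, Finset.sum_const, nsmul_eq_mul, mul_one] at hbal
        have key : ∀ p q : V, (ind (s p) σ - ind (h q) σ) = (if σ = true then 1 else -1) * (((s p).toNat : ℤ) - ((h q).toNat : ℤ)) := by
          intro p q
          cases σ <;> cases s p <;> cases h q <;> simp [ind]
        simp only [key] at hbal
        rw [← Finset.mul_sum, ← Finset.mul_sum, ← Finset.mul_sum] at hbal
        simp only [I, wt, Finset.sum_disjSum, H', S', bhd, btl]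
        cases σ <;> simp at hbal ⊢ <;> linarith
      · intro a ha b hb hab
        rw [Function.onFun, Finset.disjoint_left]
        obtain ⟨h1, h2, h3, h4⟩ := hMd a ha b hb hab
        intro v hv hv'
        simp only [Finset.mem_insert, Finset.mem_singleton] at hv hv'
        rcases hv with rfl | rfl <;> rcases hv' with h5 | h5 <;> tauto)
    (fun i => Sum.inl (z i))
    (by
      intro i hi
      refine mem_sdiff'.2 ⟨by simpa [I] using hzS i hi, ?_⟩
      intro h1
      have : z i ∈ Fs := by simpa [T] using h1
      exact hz i hi (Finset.mem_inter.1 this).2)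
    (by
      intro i hi j hj hij
      exact hzi i hi j hj (Sum.inl.inj hij))
    (fun i => if i ∈ J then some (Sum.inr (Sum.inr i)) else none) L
    (by
      intro i hi w hw
      by_cases hiJ : i ∈ J
      · simp only [hiJ, if_true, Option.some.injEq] at hw
        subst hw
        obtain ⟨j1, j2, j3, j4, j5⟩ := hJ i hi hiJ
        refine ⟨?_, j1, j2, ?_, ?_, ?_⟩
        · refine mem_sdiff'.2 ⟨by simpa [T] using hiJ, by simp [F]⟩
        · simp only [L, hiJ, if_true]
          intro h0; apply j3; have := hN i hi; omega
        · simp only [L, hiJ, if_true]; exact j4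
        · rw [Fcard]
          refine le_trans (Finset.card_le_card ?_) j5
          intro v hv
          obtain ⟨h1, h2⟩ := Finset.mem_filter.1 hv
          exact Finset.mem_filter.2 ⟨(Finset.mem_inter.1 h1).2, h2⟩
      · simp [hiJ] at hw)
    (by
      intro i hi j hj w h1 h2
      by_cases hiJ : i ∈ J <;> by_cases hjJ : j ∈ J
      · simp only [hiJ, hjJ, if_true, Option.some.injEq] at h1 h2
        rw [← h2] at h1
        exact Sum.inr.inj (Sum.inr.inj h1)
      all_goals simp [hiJ, hjJ] at h1 h2)
    (by
      intro i hi hn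
      have hiJ : i ∉ J := by intro h1; simp [h1] at hn
      have := hN i hi
      simp only [L, hiJ, if_false]
      refine ⟨by omega, ?_⟩
      intro a b h1 h2
      have h5 := hnJ i hi hiJ a b h1 h2
      have h6 : N i - 1 - 2 = N i - 3 := by omega
      rw [h6]; exact h5)
    (by
      intro b hb
      obtain ⟨v, hv, rfl⟩ := Finset.mem_map.1 hb
      exact hAb v (Finset.mem_inter.1 hv).2)
    (by
      intro a b hab
      rw [Fcard]
      have h1 := hsz a b hab
      have h2 : (Ty.filter (fun v => h v = a ∧ s v = b)).card ≤ (Fs.filter (fun v => h v = a ∧ s v = b)).card + 3 * J.card + 2 * qb := by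
        convert Fs_lb (fun v => h v = a ∧ s v = b)
      have h3 : (Fs.filter (fun v => H' (Sum.inl v) = a ∧ S' (Sum.inl v) = b)).card =
        (Fs.filter (fun v => h v = a ∧ s v = b)).card := by congr
      rw [h3]; omega)
    (by
      intro τ
      rw [Fcard]
      have h1 := hsz2 τ
      have h2 : (Ty.filter (fun v => s v = τ)).card ≤ (Fs.filter (fun v => s v = τ)).card + 3 * J.card + 2 * qb := by
        convert Fs_lb (fun v => s v = τ)
      have h3 : (Fs.filter (fun v => S' (Sum.inl v) = τ)).card =
        (Fs.filter (fun v => s v = τ)).card := by congr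
      rw [h3]; omega)
    (by
      rcases hne with hne | ⟨i, hi, hti, hh⟩
      · exact Or.inl hne
      · refine Or.inr ⟨Sum.inr (Sum.inr i), ?_, hh, ?_⟩
        · refine mem_sdiff'.2 ⟨by simpa [T] using hi, by simp [F]⟩
        · intro j hj h1
          by_cases hjJ : j ∈ J
          · simp only [hjJ, if_true, Option.some.injEq] at h1
            have := Sum.inr.inj (Sum.inr.inj h1)
            omega
          · simp [hjJ] at h1)
  set u : ℕ → Option (BT V) := (fun i => if i ∈ J then some (Sum.inr (Sum.inr i)) else none) with hu
  have hlist : ((((List.range t).flatMap (fun i => Sum.inl (z i) :: ((u i).toList ++ fill i)) ++ [Sum.inl (z t)]) ++ l).map (blk f)).flatten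
      = ((List.range t).flatMap (fun i => z i :: ((u i).toList ++ fill i).flatMap (blk f)) ++ [z t]) ++ l.flatMap (blk f) := by
    rw [← List.flatMap_def, List.flatMap_append, List.flatMap_append, List.flatMap_assoc]
    rfl
  have hIch : ∀ b ∈ I, (blk f b).IsChain R := by
    intro b hb
    rcases b with v | a | i
    · simp [blk]
    · have ha : a ∈ Mf := by simpa [I] using hb
      simp [blk, (hMR a ha).1]
    · have hi : i ∈ J := by simpa [I] using hb
      simp [blk, (hUR i hi).1, (hUR i hi).2.1]
  have hpf : ((((List.range t).flatMap (fun i => Sum.inl (z i) :: ((u i).toList ++ fill i)) ++ [Sum.inl (z t)]) ++ l).map (blk f)).flatten.Perm (I.toList.map (blk f)).flatten :=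
    perm_flatten_of_perm (hperm.map _)
  have hnd : (I.toList.map (blk f)).flatten.Nodup := by
    rw [List.nodup_flatten]
    refine ⟨?_, ?_⟩
    · intro x hx
      obtain ⟨b, hb, rfl⟩ := List.mem_map.1 hx
      rw [Finset.mem_toList] at hb
      rcases b with v | a | i
      · simp [blk]
      · have ha : a ∈ Mf := by simpa [I] using hb
        simp [blk, (hMR a ha).2.1]
      · have hi : i ∈ J := by simpa [I] using hb
        have q1 : f i 0 ≠ f i 1 := fun h => absurd (hUi i hi 0 i hi 1 h).2 (by decide)
        have q2 : f i 0 ≠ f i 2 := fun h => absurd (hUi i hi 0 i hi 2 h).2 (by decide)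
        have q3 : f i 1 ≠ f i 2 := fun h => absurd (hUi i hi 1 i hi 2 h).2 (by decide)
        simp [blk, q1, q2, q3]
    · rw [List.pairwise_map]
      refine List.Pairwise.imp_of_mem ?_ I.nodup_toList
      intro b c hb hc hbc
      rw [Finset.mem_toList] at hb hc
      have U1 : ∀ i ∈ J, ∀ v ∈ [f i 0, f i 1, f i 2], ∃ c, v = f i c := by
        intro i hi v hv
        simp only [List.mem_cons, List.not_mem_nil, or_false] at hv
        rcases hv with h1 | h1 | h1
        exacts [⟨_, h1⟩, ⟨_, h1⟩, ⟨_, h1⟩]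
      have P1 : ∀ v ∈ Sg, ∀ a ∈ Mf, ¬ (v = a.1 ∨ v = a.2) := by
        intro v hv a ha h1; exact ((mSg v).1 hv).2 ((mMV v).2 ⟨a, ha, h1⟩)
      have P2 : ∀ v ∈ Sg, ∀ i ∈ J, ∀ c, v ≠ f i c := by
        intro v hv a ha c h1; exact ((mSg v).1 hv).1 ((mUV v).2 ⟨a, ha, c, h1.symm⟩)
      intro v hv hv'
      rcases b with w | a | i
      · have hw : w ∈ Sg := by simpa [I] using hb
        have hvw : v = w := by simpa [blk] using hv
        subst hvw
        rcases c with w' | a' | j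
        · have : v = w' := by simpa [blk] using hv'
          exact hbc (by rw [this])
        · have ha : a' ∈ Mf := by simpa [I] using hc
          exact P1 v hw a' ha (by simpa [blk] using hv')
        · have hj : j ∈ J := by simpa [I] using hc
          obtain ⟨c, h1⟩ := U1 j hj v hv'
          exact P2 v hw j hj c h1
      · have ha : a ∈ Mf := by simpa [I] using hb
        have hva : v = a.1 ∨ v = a.2 := by simpa [blk] using hv
        rcases c with w' | a' | j
        · have hw : w' ∈ Sg := by simpa [I] using hc
          have : v = w' := by simpa [blk] using hv'
          subst this
          exact P1 v hw a ha hva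
        · have ha' : a' ∈ Mf := by simpa [I] using hc
          have hva' : v = a'.1 ∨ v = a'.2 := by simpa [blk] using hv'
          have hne' : a ≠ a' := fun h => hbc (by rw [h])
          obtain ⟨h1, h2, h3, h4⟩ := hMd a ha a' ha' hne'
          rcases hva with h5 | h5 <;> rcases hva' with h6 | h6 <;> rw [h5] at h6 <;> tauto
        · have hj : j ∈ J := by simpa [I] using hc
          obtain ⟨c, h1⟩ := U1 j hj v hv'
          rcases hva with h5 | h5
          · exact (hMU a ha j hj c).1 (h5 ▸ h1)
          · exact (hMU a ha j hj c).2 (h5 ▸ h1)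
      · have hi : i ∈ J := by simpa [I] using hb
        obtain ⟨c0, h0⟩ := U1 i hi v hv
        rcases c with w' | a' | j
        · have hw : w' ∈ Sg := by simpa [I] using hc
          have : v = w' := by simpa [blk] using hv'
          subst this
          exact P2 v hw i hi c0 h0
        · have ha' : a' ∈ Mf := by simpa [I] using hc
          have hva' : v = a'.1 ∨ v = a'.2 := by simpa [blk] using hv'
          rcases hva' with h5 | h5
          · exact (hMU a' ha' i hi c0).1 (h5 ▸ h0)
          · exact (hMU a' ha' i hi c0).2 (h5 ▸ h0)
        · have hj : j ∈ J := by simpa [I] using hc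
          obtain ⟨c, h1⟩ := U1 j hj v hv'
          have := (hUi i hi c0 j hj c (h0 ▸ h1)).1
          exact hbc (by rw [this])
  have hcov : ∀ v, v ∈ (I.toList.map (blk f)).flatten := by
    intro v
    rw [List.mem_flatten]
    by_cases h1 : v ∈ UV
    · obtain ⟨i, hi, c, hc⟩ := (mUV v).1 h1
      refine ⟨blk f (Sum.inr (Sum.inr i)), List.mem_map.2 ⟨_, by rw [Finset.mem_toList]; simpa [I] using hi, rfl⟩, ?_⟩
      rw [← hc]
      fin_cases c <;> simp [blk]
    · by_cases h2 : v ∈ MV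
      · obtain ⟨a, ha, hv⟩ := (mMV v).1 h2
        refine ⟨blk f (Sum.inr (Sum.inl a)), List.mem_map.2 ⟨_, by rw [Finset.mem_toList]; simpa [I] using ha, rfl⟩, ?_⟩
        simpa [blk] using hv
      · refine ⟨blk f (Sum.inl v), List.mem_map.2 ⟨_, by rw [Finset.mem_toList]; simpa [I] using (mSg v).2 ⟨h1, h2⟩, rfl⟩, ?_⟩
        simp [blk]
  refine ⟨fun i => ((u i).toList ++ fill i).flatMap (blk f), l.flatMap (blk f), ?_, ?_, ?_, ?_⟩
  · intro i hi
    have h1 := (hfill i hi).1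
    have h2 := blk_single_len f (fill i) (by
      intro b hb
      obtain ⟨v, _, hv⟩ := Finset.mem_map.1 ((hfill i hi).2 b hb)
      exact ⟨v, hv.symm⟩)
    have h4 := hN i hi
    show (((u i).toList ++ fill i).flatMap (blk f)).length = _
    rw [List.flatMap_append, List.length_append, h2, h1]
    by_cases hiJ : i ∈ J
    · simp only [u, L, hiJ, if_true, Option.toList_some, List.flatMap_cons, List.flatMap_nil, blk]
      simp; omega
    · simp only [u, L, hiJ, if_false, Option.toList_none, List.flatMap_nil]
      simp
  · rw [← hlist]; exact hpf.nodup_iff.2 hnd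
  · intro v; rw [← hlist]; exact hpf.mem_iff.2 (hcov v)
  · rw [← hlist]
    apply cyc_blk
    · intro b hb
      exact hIch b (Finset.mem_toList.1 (hperm.mem_iff.1 hb))
    · exact hcyc

def ATd {V : Type*} (R : V → V → Prop) (h : V → Bool) (Ty : Finset V) (x1 : ℕ) (u : V) (σ : Bool) : Prop :=
  x1 ≤ (Ty.filter (fun v => h v = σ ∧ R u v)).card

def AHd {V : Type*} (R : V → V → Prop) (s : V → Bool) (Ty : Finset V) (x1 : ℕ) (v : V) (σ : Bool) : Prop :=
  x1 ≤ (Ty.filter (fun u => s u = σ ∧ R u v)).card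

structure ED {V : Type*} [Fintype V] (R : V → V → Prop) (z : ℕ → V) (t : ℕ) (s h : V → Bool) (Ty : Finset V)
    (m e0 nt x1 w : ℕ) : Prop where
  hm : Fintype.card V = m
  hdeg : ∀ p q, m + (t+1) ≤ (Finset.univ.filter (fun v => R p v)).card + (Finset.univ.filter (fun v => R v q)).card
  hl : ∀ v, (∀ i ≤ t, v ≠ z i) → ¬ R v v
  hzi : ∀ i ≤ t, ∀ j ≤ t, z i = z j → i = j
  hz : ∀ i ≤ t, z i ∉ Ty
  hAT : ∀ v, ATd R h Ty x1 v (s v)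
  hAH : ∀ v, AHd R s Ty x1 v (h v)
  near1 : ∀ u ∈ Ty, (Ty.filter (fun v => h v = s u ∧ ¬ R u v)).card ≤ e0
  near2 : ∀ v ∈ Ty, (Ty.filter (fun u => s u = h v ∧ ¬ R u v)).card ≤ e0
  hnt : (Finset.univ \ Ty).card ≤ nt
  hws : ∀ σ, m ≤ 2 * (Ty.filter (fun v => s v = σ)).card + w
  hwh : ∀ σ, m ≤ 2 * (Ty.filter (fun v => h v = σ)).card + w
  hdo : ∀ v, m ≤ 2 * (Finset.univ.filter (fun u => R v u)).card + 3 * (t+1)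
  hdi : ∀ v, m ≤ 2 * (Finset.univ.filter (fun u => R u v)).card + 3 * (t+1)

def Many {V : Type*} (R : V → V → Prop) (s h : V → Bool) (Ty : Finset V) (x1 b : ℕ) (σ : Bool) : Prop :=
  b ≤ (Ty.filter (fun v => s v = σ ∧ ATd R h Ty x1 v (!σ))).card + (Ty.filter (fun v => h v = !σ ∧ AHd R s Ty x1 v σ)).card

noncomputable def iP (p : Prop) : ℤ := if p then 1 else 0

theorem card_iP {α : Type*} (S : Finset α) (P : α → Prop) [DecidablePred P] : ((S.filter P).card : ℤ) = ∑ v ∈ S, iP (P v) := by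
  rw [Finset.card_filter]; push_cast
  apply Finset.sum_congr rfl; intro v _; unfold iP; congr

theorem card_ind {α : Type*} (S : Finset α) (s : α → Bool) (σ : Bool) : ((S.filter (fun v => s v = σ)).card : ℤ) = ∑ v ∈ S, ind (s v) σ := by
  rw [Finset.card_filter]; push_cast
  apply Finset.sum_congr rfl; intro v _; unfold ind; congr

theorem ind_flip (b : Bool) (σ : Bool) : ind b (!σ) = 1 - ind b σ := by
  cases b <;> cases σ <;> simp [ind]

set_option maxHeartbeats 1000000 in
theorem E_fin {V : Type*} [Fintype V] {R : V → V → Prop} {z : ℕ → V} {t : ℕ} {s h : V → Bool} {Ty : Finset V}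
    {m e0 nt x1 w : ℕ} (D : ED R z t s h Ty m e0 nt x1 w) (N : ℕ → ℕ) (M κ qb ns : ℕ) (Ab : Bool → Bool → Prop)
    (J : Finset ℕ) (f : ℕ → Fin 3 → V) (hκ : t + 1 + 3 * J.card ≤ κ) (heM : e0 ≤ M)
    (hqb : qb = w + 2 * κ) (hns : ns = nt + 2 * qb)
    (hd : 16 * (x1 + nt) * (2 + κ) < m) (hmw : 2 * w + 4 * κ + 4 * qb ≤ m)
    (hN : ∀ i < t, 4 ≤ N i)
    (hUz : ∀ j ∈ J, ∀ c, ∀ i ≤ t, f j c ≠ z i)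
    (hUR : ∀ i ∈ J, R (f i 0) (f i 1) ∧ R (f i 1) (f i 2) ∧ f i 0 ∈ Ty ∧ f i 2 ∈ Ty)
    (hUi : ∀ i ∈ J, ∀ c, ∀ j ∈ J, ∀ c', f i c = f j c' → i = j ∧ c = c')
    (halt : ∀ σ,
      (∑ i ∈ Finset.range (t+1), (ind (s (z i)) σ - ind (h (z i)) σ + 1 - iP (¬ ATd R h Ty x1 (z i) (!σ)) - iP (¬ AHd R s Ty x1 (z i) σ))
        + ∑ i ∈ J, (ind (s (f i 2)) σ - ind (h (f i 0)) σ + 3 - ∑ c, (iP (¬ ATd R h Ty x1 (f i c) (!σ)) + iP (¬ AHd R s Ty x1 (f i c) σ)))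
        ≤ t + 1) ∨
      ((∑ i ∈ Finset.range (t+1), (ind (s (z i)) σ - ind (h (z i)) σ) + ∑ i ∈ J, (ind (s (f i 2)) σ - ind (h (f i 0)) σ) = 0) ∧
        ∀ v, (∀ i ≤ t, v ≠ z i) → (∀ i ∈ J, ∀ c, v ≠ f i c) → ¬ (¬ ATd R h Ty x1 v (!σ) ∧ ¬ AHd R s Ty x1 v σ)) ∨
      Many R s h Ty x1 (qb + 2 * κ) σ)
    (hx : 2 * ns + 3 * J.card + 3 * qb ≤ x1)
    (hJ : ∀ i < t, i ∈ J → R (z i) (f i 0) ∧ s (z i) = h (f i 0) ∧ (N i = 4 → R (f i 2) (z (i+1))) ∧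
      Conn Ab (s (f i 2)) (h (z (i+1))) (N i - 4) ∧
      (Ty.filter (fun v => s v = h (z (i+1)) ∧ ¬ R v (z (i+1)))).card ≤ M)
    (hnJ : ∀ i < t, i ∉ J → ∀ a b, Ab (s (z i)) a → Ab b (h (z (i+1))) → Conn Ab a b (N i - 3))
    (hAb : ∀ v ∈ Ty, Ab (h v) (s v))
    (hsz : ∀ a b, Ab a b → 2 * ns + ∑ i ∈ Finset.range t, N i + 2 * M + 3 * J.card + 3 * qb <
      (Ty.filter (fun v => h v = a ∧ s v = b)).card)
    (hsz2 : 2 * (3 * e0 + 3 + 2 * ns + ∑ i ∈ Finset.range t, N i + 3 * J.card + 3 * qb) + w ≤ m)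
    (hne : (∃ τ, Ab τ (!τ)) ∨ ∃ i ∈ J, t ≤ i ∧ h (f i 0) ≠ s (f i 2)) :
    HamOut R z t N := by
  set Zs : Finset V := (Finset.range (t+1)).image z with hZs
  have mZs : ∀ v, v ∈ Zs ↔ ∃ i ≤ t, v = z i := by
    intro v; simp only [Zs, Finset.mem_image, Finset.mem_range]
    constructor
    · rintro ⟨i, hi, rfl⟩; exact ⟨i, by omega, rfl⟩
    · rintro ⟨i, hi, rfl⟩; exact ⟨i, by omega, rfl⟩
  set UV : Finset V := (J ×ˢ (Finset.univ : Finset (Fin 3))).image (fun p => f p.1 p.2) with hUV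
  have mUV : ∀ v, v ∈ UV ↔ ∃ i ∈ J, ∃ c, v = f i c := by
    intro v; simp only [UV, Finset.mem_image, Finset.mem_product, Finset.mem_univ, and_true]
    constructor
    · rintro ⟨⟨i, c⟩, hi, rfl⟩; exact ⟨i, hi, c, rfl⟩
    · rintro ⟨i, hi, c, rfl⟩; exact ⟨⟨i, c⟩, hi, rfl⟩
  have hZU : Disjoint Zs UV := by
    rw [Finset.disjoint_left]; intro v h1 h2
    obtain ⟨i, hi, rfl⟩ := (mZs v).1 h1
    obtain ⟨j, hj, c, h3⟩ := (mUV _).1 h2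
    exact hUz j hj c i hi h3.symm
  have sZ : ∀ g : V → ℤ, ∑ v ∈ Zs, g v = ∑ i ∈ Finset.range (t+1), g (z i) := by
    intro g; rw [hZs, Finset.sum_image]
    intro i hi j hj hij
    exact D.hzi i (by simp at hi; omega) j (by simp at hj; omega) hij
  have sU : ∀ g : V → ℤ, ∑ v ∈ UV, g v = ∑ i ∈ J, ∑ c, g (f i c) := by
    intro g; rw [hUV, Finset.sum_image, Finset.sum_product]
    rintro ⟨i, c⟩ hi ⟨j, c'⟩ hj hij
    have := hUi i (Finset.mem_product.1 hi).1 c j (Finset.mem_product.1 hj).1 c' hij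
    exact Prod.ext this.1 this.2
  set U : Finset V := Zs ∪ UV with hU
  have sUU : ∀ g : V → ℤ, ∑ v ∈ U, g v = ∑ i ∈ Finset.range (t+1), g (z i) + ∑ i ∈ J, ∑ c, g (f i c) := by
    intro g; rw [hU, Finset.sum_union hZU, sZ, sU]
  have cU : (U.card : ℤ) = (t + 1) + 3 * J.card := by
    have := sUU (fun _ => 1)
    simp at this; rw [this]; ring
  have cU' : U.card ≤ κ := by omega
  set Rs : Finset V := Finset.univ \ U with hRs
  have mRs : ∀ v, v ∈ Rs ↔ v ∉ U := by intro v; simp [Rs]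
  have mU : ∀ v, v ∉ U ↔ (∀ i ≤ t, v ≠ z i) ∧ (∀ i ∈ J, ∀ c, v ≠ f i c) := by
    intro v; rw [hU, Finset.mem_union, mZs, mUV]; push Not; rfl
  set Q : Bool → ℤ := fun σ => ∑ i ∈ Finset.range (t+1), (ind (s (z i)) σ - ind (h (z i)) σ) + ∑ i ∈ J, (ind (s (f i 2)) σ - ind (h (f i 0)) σ) with hQ
  have hind : ∀ a b, 0 ≤ ind a b ∧ ind a b ≤ 1 := by decide
  have hQle : ∀ σ, Q σ ≤ κ := by
    intro σ
    have h1 : ∑ i ∈ Finset.range (t+1), (ind (s (z i)) σ - ind (h (z i)) σ) ≤ ∑ i ∈ Finset.range (t+1), 1 := by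
      apply Finset.sum_le_sum; intro i _; have := hind (s (z i)) σ; have := hind (h (z i)) σ; omega
    have h2 : ∑ i ∈ J, (ind (s (f i 2)) σ - ind (h (f i 0)) σ) ≤ ∑ i ∈ J, 1 := by
      apply Finset.sum_le_sum; intro i _; have := hind (s (f i 2)) σ; have := hind (h (f i 0)) σ; omega
    simp only [Finset.sum_const, Finset.card_range, nsmul_eq_mul, mul_one] at h1 h2
    simp only [Q]
    push_cast at h1 h2
    omega
  have hRcard : ∀ (P : V → Prop) [DecidablePred P], (Ty.filter P).card ≤ (Rs.filter P).card + κ := by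
    intro P _
    have : Ty.filter P ⊆ Rs.filter P ∪ U := by
      intro v hv
      by_cases h1 : v ∈ U
      · exact Finset.mem_union_right _ h1
      · exact Finset.mem_union_left _ (Finset.mem_filter.2 ⟨(mRs v).2 h1, (Finset.mem_filter.1 hv).2⟩)
    have := (Finset.card_le_card this).trans (Finset.card_union_le _ _)
    omega
  have hRsm : Rs.card ≤ m := by rw [← D.hm]; exact Finset.card_le_univ _
  have hsR : ∀ σ, 2 * (Rs.filter (fun v => s v = σ)).card ≤ m + w ∧ m ≤ 2 * (Rs.filter (fun v => s v = σ)).card + w + 2 * κ := by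
    intro σ
    have h1 := D.hws σ
    have h2 := hRcard (fun v => s v = σ)
    refine ⟨?_, by omega⟩
    have h3 := D.hws (!σ)
    have h5 : (Rs.filter (fun v => s v = σ)).card + (Ty.filter (fun v => s v = !σ)).card ≤ m := by
      rw [← D.hm, ← Finset.card_union_of_disjoint]
      · exact Finset.card_le_univ _
      · rw [Finset.disjoint_left]; intro v a b
        have a := (Finset.mem_filter.1 a).2
        have b := (Finset.mem_filter.1 b).2
        rw [a] at b; simp at b
    omega
  have hhR : ∀ σ, 2 * (Rs.filter (fun v => h v = σ)).card ≤ m + w ∧ m ≤ 2 * (Rs.filter (fun v => h v = σ)).card + w + 2 * κ := by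
    intro σ
    have h1 := D.hwh σ
    have h2 := hRcard (fun v => h v = σ)
    refine ⟨?_, by omega⟩
    have h3 := D.hwh (!σ)
    have h5 : (Rs.filter (fun v => h v = σ)).card + (Ty.filter (fun v => h v = !σ)).card ≤ m := by
      rw [← D.hm, ← Finset.card_union_of_disjoint]
      · exact Finset.card_le_univ _
      · rw [Finset.disjoint_left]; intro v a b
        have a := (Finset.mem_filter.1 a).2
        have b := (Finset.mem_filter.1 b).2
        rw [a] at b; simp at b
    omega
  have hq : ∀ σ, Q σ + ∑ v ∈ Rs, (ind (s v) σ - ind (h v) σ) ≤ qb := by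
    intro σ
    rw [Finset.sum_sub_distrib, ← card_ind, ← card_ind]
    have := hQle σ; have := hsR σ; have := hhR σ
    omega
  obtain ⟨σ, hσ⟩ : ∃ σ, 0 ≤ Q σ + ∑ v ∈ Rs, (ind (s v) σ - ind (h v) σ) := by
    by_contra hcon
    push Not at hcon
    have h1 := hcon true
    have h2 := hcon (!true)
    simp only [Q, ind_flip] at h1 h2
    simp only [Finset.sum_sub_distrib] at h1 h2
    linarith
  obtain ⟨s', h', Mf, b1, b2, b3, b4, b5, b6, b7⟩ := balance R σ s h U Rs hRs (ATd R h Ty x1) (AHd R s Ty x1)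
    (x1 + nt) m (t+1) qb (Q σ) D.hm D.hdeg (fun v hv => D.hl v ((mU v).1 hv).1)
    (fun v _ => ⟨D.hAT v, D.hAH v⟩)
    (by
      intro u hu
      unfold ATd at hu
      push Not at hu
      have : Finset.univ.filter (fun y => ¬ AHd R s Ty x1 y σ ∧ R u y) ⊆ Ty.filter (fun v => h v = (!σ) ∧ R u v) ∪ (Finset.univ \ Ty) := by
        intro y hy
        obtain ⟨_, h2, h3⟩ := Finset.mem_filter.1 hy
        by_cases h4 : y ∈ Ty
        · refine Finset.mem_union_left _ (Finset.mem_filter.2 ⟨h4, bool_ne _ _ ?_, h3⟩)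
          intro h5; exact h2 (h5 ▸ D.hAH y)
        · exact Finset.mem_union_right _ (by simp [h4])
      have := (Finset.card_le_card this).trans (Finset.card_union_le _ _)
      have := D.hnt
      omega)
    (by
      intro u hu
      unfold AHd at hu
      push Not at hu
      have : Finset.univ.filter (fun y => ¬ ATd R h Ty x1 y (!σ) ∧ R y u) ⊆ Ty.filter (fun v => s v = σ ∧ R v u) ∪ (Finset.univ \ Ty) := by
        intro y hy
        obtain ⟨_, h2, h3⟩ := Finset.mem_filter.1 hy
        by_cases h4 : y ∈ Ty
        · refine Finset.mem_union_left _ (Finset.mem_filter.2 ⟨h4, ?_, h3⟩)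
          by_contra h5; exact h2 (bool_ne _ _ h5 ▸ D.hAT y)
        · exact Finset.mem_union_right _ (by simp [h4])
      have := (Finset.card_le_card this).trans (Finset.card_union_le _ _)
      have := D.hnt
      omega)
    (lt_of_le_of_lt (Nat.mul_le_mul_left _ (by omega)) hd) hσ (hq σ)
    (by have := hsR σ; omega) (by have := hhR (!σ); omega)
    (by
      rcases halt σ with h1 | h1 | h1
      · left
        have e1 := card_iP U (fun v => ¬ ATd R h Ty x1 v (!σ))
        have e2 := card_iP U (fun v => ¬ AHd R s Ty x1 v σ)
        rw [sUU] at e1 e2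
        rw [cU, e1, e2]
        simp only [Q]
        simp only [Finset.sum_sub_distrib, Finset.sum_add_distrib, Finset.sum_const, Finset.card_range, nsmul_eq_mul] at h1 ⊢
        push_cast at h1 ⊢
        linarith
      · right; left
        refine ⟨h1.1, ?_⟩
        intro v hv
        have := (mU v).1 ((mRs v).1 hv)
        exact h1.2 v this.1 this.2
      · right; right
        unfold Many at h1
        have e1 := hRcard (fun v => s v = σ ∧ ATd R h Ty x1 v (!σ))
        have e2 := hRcard (fun v => h v = (!σ) ∧ AHd R s Ty x1 v σ)
        omega)
  set Ty' : Finset V := Ty.filter (fun v => s' v = s v ∧ h' v = h v) with hTy'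
  have hTT : Ty' ⊆ Ty := Finset.filter_subset _ _
  have eS : ∀ v ∈ Ty', s' v = s v := fun v hv => (Finset.mem_filter.1 hv).2.1
  have eH : ∀ v ∈ Ty', h' v = h v := fun v hv => (Finset.mem_filter.1 hv).2.2
  have hdiff : Ty \ Ty' ⊆ Rs.filter (fun v => s' v ≠ s v ∨ h' v ≠ h v) := by
    intro v hv
    obtain ⟨h1, h2⟩ := Finset.mem_sdiff.1 hv
    have h3 : ¬ (s' v = s v ∧ h' v = h v) := fun h3 => h2 (Finset.mem_filter.2 ⟨h1, h3⟩)
    refine Finset.mem_filter.2 ⟨(mRs v).2 (fun h4 => h3 (b3 v h4)), by tauto⟩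
  have hdc : (Ty \ Ty').card ≤ qb := (Finset.card_le_card hdiff).trans b4
  have lbd : ∀ (P P' : V → Prop) [DecidablePred P] [DecidablePred P'], (∀ v ∈ Ty', P v → P' v) → (Ty.filter P).card ≤ (Ty'.filter P').card + qb := by
    intro P P' _ _ hPP
    have : Ty.filter P ⊆ Ty'.filter P' ∪ (Ty \ Ty') := by
      intro v hv
      obtain ⟨h1, h2⟩ := Finset.mem_filter.1 hv
      by_cases h3 : v ∈ Ty'
      · exact Finset.mem_union_left _ (Finset.mem_filter.2 ⟨h3, hPP v h3 h2⟩)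
      · exact Finset.mem_union_right _ (Finset.mem_sdiff.2 ⟨h1, h3⟩)
    have := (Finset.card_le_card this).trans (Finset.card_union_le _ _)
    omega
  have hzU : ∀ i ≤ t, z i ∈ U := fun i hi => Finset.mem_union_left _ ((mZs _).2 ⟨i, hi, rfl⟩)
  have hfU : ∀ i ∈ J, ∀ c, f i c ∈ U := fun i hi c => Finset.mem_union_right _ ((mUV _).2 ⟨i, hi, c, rfl⟩)
  have abl : ∀ v, ATd R h Ty x1 v (s' v) ∧ AHd R s Ty x1 v (h' v) := by
    intro v
    by_cases h1 : v ∈ U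
    · rw [(b3 v h1).1, (b3 v h1).2]; exact ⟨D.hAT v, D.hAH v⟩
    · exact b2 v ((mRs v).2 h1)
  refine E_close R s' h' σ Ty' e0 M ns t (x1 - qb) qb heM Ab z N J f Mf ?_ D.hzi hN ?_ ?_ ?_ b1 ?_ b6 ?_ ?_ hUz ?_ hUi ?_ ?_ ?_ ?_ ?_ ?_ ?_ ?_ ?_ ?_
  · intro i hi h1; exact D.hz i hi (hTT h1)
  · intro u hu
    refine le_trans (Finset.card_le_card ?_) (D.near1 u (hTT hu))
    intro v hv
    obtain ⟨h1, h2, h3⟩ := Finset.mem_filter.1 hv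
    exact Finset.mem_filter.2 ⟨hTT h1, by rw [← eH v h1, h2, eS u hu], h3⟩
  · intro u hu
    refine le_trans (Finset.card_le_card ?_) (D.near2 u (hTT hu))
    intro v hv
    obtain ⟨h1, h2, h3⟩ := Finset.mem_filter.1 hv
    exact Finset.mem_filter.2 ⟨hTT h1, by rw [← eS v h1, h2, eH u hu], h3⟩
  · have : Finset.univ \ Ty' ⊆ (Finset.univ \ Ty) ∪ (Ty \ Ty') := by
      intro v hv
      simp only [Finset.mem_union, Finset.mem_sdiff, Finset.mem_univ, true_and] at hv ⊢
      tauto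
    have := (Finset.card_le_card this).trans (Finset.card_union_le _ _)
    have := D.hnt
    omega
  · intro a ha
    obtain ⟨h1, h2, h3, h4, h5, h6⟩ := b5 a ha
    exact ⟨h1, h4, h5, h6⟩
  · intro a ha i hi c
    obtain ⟨h1, h2, h3, h4, h5, h6⟩ := b5 a ha
    exact ⟨((mU _).1 ((mRs _).1 h2)).2 i hi c, ((mU _).1 ((mRs _).1 h3)).2 i hi c⟩
  · intro a ha i hi
    obtain ⟨h1, h2, h3, h4, h5, h6⟩ := b5 a ha
    exact ⟨((mU _).1 ((mRs _).1 h2)).1 i hi, ((mU _).1 ((mRs _).1 h3)).1 i hi⟩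
  · intro i hi
    obtain ⟨h1, h2, h3, h4⟩ := hUR i hi
    exact ⟨h1, h2, Finset.mem_filter.2 ⟨h3, b3 _ (hfU i hi 0)⟩, Finset.mem_filter.2 ⟨h4, b3 _ (hfU i hi 2)⟩⟩
  · omega
  · intro b _
    have h1 := (abl b).1
    unfold ATd at h1
    have h2 := lbd (fun v => h v = s' b ∧ R b v) (fun v => h' v = s' b ∧ R b v) (fun v hv h => ⟨by rw [eH v hv]; exact h.1, h.2⟩)
    omega
  · intro b _
    have h1 := (abl b).2
    unfold AHd at h1
    have h2 := lbd (fun v => s v = h' b ∧ R v b) (fun v => s' v = h' b ∧ R v b) (fun v hv h => ⟨by rw [eS v hv]; exact h.1, h.2⟩)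
    omega
  · have hset : Finset.univ.filter (fun v => ∀ i ∈ J, ∀ c, v ≠ f i c) = Zs ∪ Rs := by
      ext v
      simp only [Finset.mem_filter, Finset.mem_univ, true_and, Finset.mem_union, mRs, mU, mZs]
      constructor
      · intro h1
        by_cases h2 : ∃ i ≤ t, v = z i
        · exact Or.inl h2
        · push Not at h2; exact Or.inr ⟨h2, h1⟩
      · rintro (⟨i, hi, rfl⟩ | h1)
        · intro j hj c h2; exact hUz j hj c i hi h2.symm
        · exact h1.2
    rw [hset, Finset.sum_union, sZ]
    · have e1 : ∑ i ∈ Finset.range (t+1), (ind (s' (z i)) σ - ind (h' (z i)) σ) = ∑ i ∈ Finset.range (t+1), (ind (s (z i)) σ - ind (h (z i)) σ) := by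
        apply Finset.sum_congr rfl; intro i hi
        have := b3 _ (hzU i (by simp at hi; omega))
        rw [this.1, this.2]
      have e2 : ∑ i ∈ J, (ind (s' (f i 2)) σ - ind (h' (f i 0)) σ) = ∑ i ∈ J, (ind (s (f i 2)) σ - ind (h (f i 0)) σ) := by
        apply Finset.sum_congr rfl; intro i hi
        rw [(b3 _ (hfU i hi 2)).1, (b3 _ (hfU i hi 0)).2]
      rw [e1, e2]
      simp only [Q] at b7
      linarith
    · rw [Finset.disjoint_left]; intro v h1 h2
      exact (mRs v).1 h2 (Finset.mem_union_left _ h1)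
  · intro i hi hiJ
    obtain ⟨h1, h2, h3, h4, h5⟩ := hJ i hi hiJ
    rw [(b3 _ (hzU i (by omega))).1, (b3 _ (hfU i hiJ 0)).2, (b3 _ (hfU i hiJ 2)).1, (b3 _ (hzU (i+1) (by omega))).2]
    refine ⟨h1, h2, h3, h4, le_trans (Finset.card_le_card ?_) h5⟩
    intro v hv
    obtain ⟨h6, h7, h8⟩ := Finset.mem_filter.1 hv
    exact Finset.mem_filter.2 ⟨hTT h6, by rw [← eS v h6]; exact h7, h8⟩
  · intro i hi hiJ
    rw [(b3 _ (hzU i (by omega))).1, (b3 _ (hzU (i+1) (by omega))).2]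
    exact hnJ i hi hiJ
  · intro v hv; rw [eS v hv, eH v hv]; exact hAb v (hTT hv)
  · intro a b hab
    have h1 := hsz a b hab
    have h2 := lbd (fun v => h v = a ∧ s v = b) (fun v => h' v = a ∧ s' v = b) (fun v hv h => ⟨by rw [eH v hv]; exact h.1, by rw [eS v hv]; exact h.2⟩)
    omega
  · intro τ
    have h1 := D.hws τ
    have h2 := lbd (fun v => s v = τ) (fun v => s' v = τ) (fun v hv h => by rw [eS v hv]; exact h)
    omega
  · rcases hne with h1 | ⟨i, hi, hti, h1⟩
    · exact Or.inl h1
    · refine Or.inr ⟨i, hi, hti, ?_⟩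
      rw [(b3 _ (hfU i hi 0)).2, (b3 _ (hfU i hi 2)).1]; exact h1

theorem filter_on {V : Type*} {Ty : Finset V} (P P' : V → Prop) [DecidablePred P] [DecidablePred P']
    (h : ∀ v ∈ Ty, P v ↔ P' v) :
    Ty.filter P = Ty.filter P' := Finset.filter_congr h

theorem ATd_congr {V : Type*} {R : V → V → Prop} {h h' : V → Bool} {Ty : Finset V} {x1 : ℕ}
    (hT : ∀ v ∈ Ty, h' v = h v) (u : V) (σ : Bool) : ATd R h' Ty x1 u σ ↔ ATd R h Ty x1 u σ := by
  unfold ATd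
  rw [filter_on (fun v => h' v = σ ∧ R u v) (fun v => h v = σ ∧ R u v)]
  intro v hv; rw [hT v hv]

theorem AHd_congr {V : Type*} {R : V → V → Prop} {s s' : V → Bool} {Ty : Finset V} {x1 : ℕ}
    (hT : ∀ v ∈ Ty, s' v = s v) (u : V) (σ : Bool) : AHd R s' Ty x1 u σ ↔ AHd R s Ty x1 u σ := by
  unfold AHd
  rw [filter_on (fun v => s' v = σ ∧ R v u) (fun v => s v = σ ∧ R v u)]
  intro v hv; rw [hT v hv]

theorem ED_restate {V : Type*} [Fintype V] {R : V → V → Prop} {z : ℕ → V} {t : ℕ} {s h : V → Bool} {Ty : Finset V}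
    {m e0 nt x1 w : ℕ} (D : ED R z t s h Ty m e0 nt x1 w) (st hd : ℕ → Bool)
    (hst : ∀ j ≤ t, ATd R h Ty x1 (z j) (st j) ∧ AHd R s Ty x1 (z j) (hd j)) :
    ∃ s' h' : V → Bool, ED R z t s' h' Ty m e0 nt x1 w ∧ (∀ j ≤ t, s' (z j) = st j ∧ h' (z j) = hd j) ∧
      (∀ v, (∀ i ≤ t, v ≠ z i) → s' v = s v ∧ h' v = h v) ∧
      (∀ u σ, ATd R h' Ty x1 u σ ↔ ATd R h Ty x1 u σ) ∧ (∀ u σ, AHd R s' Ty x1 u σ ↔ AHd R s Ty x1 u σ) := by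
  let s' : V → Bool := fun v => if hv : ∃ i ≤ t, v = z i then st hv.choose else s v
  let h' : V → Bool := fun v => if hv : ∃ i ≤ t, v = z i then hd hv.choose else h v
  have hz : ∀ j ≤ t, s' (z j) = st j ∧ h' (z j) = hd j := by
    intro j hj
    have hv : ∃ i ≤ t, z j = z i := ⟨j, hj, rfl⟩
    have : hv.choose = j := D.hzi _ hv.choose_spec.1 _ hj hv.choose_spec.2.symm
    simp only [s', h', hv, dif_pos, this]; exact ⟨trivial, trivial⟩
  have hnz : ∀ v, (∀ i ≤ t, v ≠ z i) → s' v = s v ∧ h' v = h v := by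
    intro v hv
    have : ¬ ∃ i ≤ t, v = z i := by push Not; exact hv
    simp only [s', h', this, dif_neg, not_false_eq_true, and_self]
  have hT : ∀ v ∈ Ty, s' v = s v ∧ h' v = h v := by
    intro v hv; apply hnz; intro i hi h1; exact D.hz i hi (h1 ▸ hv)
  have eAT := ATd_congr (R := R) (x1 := x1) fun v hv => (hT v hv).2
  have eAH := AHd_congr (R := R) (x1 := x1) fun v hv => (hT v hv).1
  refine ⟨s', h', ⟨D.hm, D.hdeg, D.hl, D.hzi, D.hz, ?_, ?_, ?_, ?_, D.hnt, ?_, ?_, D.hdo, D.hdi⟩, hz, hnz, eAT, eAH⟩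
  · intro v; rw [eAT]
    by_cases hv : ∃ i ≤ t, v = z i
    · obtain ⟨i, hi, rfl⟩ := hv; rw [(hz i hi).1]; exact (hst i hi).1
    · push Not at hv; rw [(hnz v hv).1]; exact D.hAT v
  · intro v; rw [eAH]
    by_cases hv : ∃ i ≤ t, v = z i
    · obtain ⟨i, hi, rfl⟩ := hv; rw [(hz i hi).2]; exact (hst i hi).2
    · push Not at hv; rw [(hnz v hv).2]; exact D.hAH v
  · intro u hu
    rw [filter_on (fun v => h' v = s' u ∧ ¬ R u v) (fun v => h v = s u ∧ ¬ R u v)]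
    · exact D.near1 u hu
    · intro v hv; rw [(hT v hv).2, (hT u hu).1]
  · intro u hu
    rw [filter_on (fun v => s' v = h' u ∧ ¬ R v u) (fun v => s v = h u ∧ ¬ R v u)]
    · exact D.near2 u hu
    · intro v hv; rw [(hT v hv).1, (hT u hu).2]
  · intro σ
    rw [filter_on (fun v => s' v = σ) (fun v => s v = σ)]
    · exact D.hws σ
    · intro v hv; rw [(hT v hv).1]
  · intro σ
    rw [filter_on (fun v => h' v = σ) (fun v => h v = σ)]
    · exact D.hwh σ
    · intro v hv; rw [(hT v hv).2]

theorem zterm (AT AH : Bool → Prop) (a b σ : Bool) (ha : AT a) (hb : AH b) :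
    ind a σ - ind b σ + 1 - iP (¬ AT (!σ)) - iP (¬ AH σ) = (cst AT a σ : ℤ) + (cst AH b (!σ) : ℤ) := by
  unfold ind iP cst Flx
  cases a <;> cases b <;> cases σ <;> simp_all <;> (try split_ifs) <;> simp_all

theorem zsum {V : Type*} [Fintype V] {R : V → V → Prop} {z : ℕ → V} {t : ℕ} {s h : V → Bool} {Ty : Finset V}
    {m e0 nt x1 w : ℕ} (D : ED R z t s h Ty m e0 nt x1 w) (σ : Bool) :
    ∑ i ∈ Finset.range (t+1), (ind (s (z i)) σ - ind (h (z i)) σ + 1 - iP (¬ ATd R h Ty x1 (z i) (!σ)) - iP (¬ AHd R s Ty x1 (z i) σ))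
     = ((∑ i ∈ Finset.range (t+1), (cst (ATd R h Ty x1 (z i)) (s (z i)) σ + cst (AHd R s Ty x1 (z i)) (h (z i)) (!σ)) : ℕ) : ℤ) := by
  push_cast
  apply Finset.sum_congr rfl; intro i _
  exact zterm _ _ _ _ _ (D.hAT _) (D.hAH _)

theorem conn_true : ∀ (n : ℕ) (a b : Bool), 1 ≤ n → Conn (fun _ _ => True) a b n := by
  intro n
  induction n with
  | zero => intro a b h; omega
  | succ n ih =>
    intro a b _
    refine ⟨b, trivial, ?_⟩
    rcases Nat.eq_zero_or_pos n with h | h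
    · subst h; rfl
    · exact ih b b h

theorem modeM {V : Type*} [Fintype V] {R : V → V → Prop} {z : ℕ → V} {t : ℕ} {s h : V → Bool} {Ty : Finset V}
    {m e0 nt x1 w : ℕ} (D : ED R z t s h Ty m e0 nt x1 w) (N : ℕ → ℕ) (qb ns κ : ℕ)
    (hκ : t + 1 ≤ κ)
    (hqb : qb = w + 2 * κ) (hns : ns = nt + 2 * qb)
    (hd : 16 * (x1 + nt) * (2 + κ) < m) (hmw : 2 * w + 4 * κ + 4 * qb ≤ m)
    (hN : ∀ i < t, 4 ≤ N i)
    (hx : 2 * ns + 3 * qb ≤ x1)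
    (hsz : ∀ a b, 2 * ns + ∑ i ∈ Finset.range t, N i + 2 * e0 + 3 * qb <
      (Ty.filter (fun v => h v = a ∧ s v = b)).card)
    (hsz2 : 2 * (3 * e0 + 3 + 2 * ns + ∑ i ∈ Finset.range t, N i + 3 * qb) + w ≤ m) : HamOut R z t N := by
  obtain ⟨st, hd', h1, h2, h3, h4⟩ := ztypes t (fun _ => false) (fun j => ATd R h Ty x1 (z j)) (fun j => AHd R s Ty x1 (z j))
    (fun j _ => ⟨_, D.hAT _⟩) (fun j _ => ⟨_, D.hAH _⟩)
  obtain ⟨s', h', D', e1, e2, e3, e4⟩ := ED_restate D st hd' h1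
  have hT : ∀ v ∈ Ty, s' v = s v ∧ h' v = h v := by
    intro v hv; apply e2; intro i hi h1; exact D.hz i hi (h1 ▸ hv)
  refine E_fin D' N e0 κ qb ns (fun _ _ => True) ∅ (fun _ _ => z 0) (by simpa using hκ) le_rfl hqb hns hd hmw hN
    (by simp) (by simp) (by simp) ?_ (by simpa using hx) (by simp) ?_ (by simp) ?_ (by simpa using hsz2) (Or.inl ⟨true, trivial⟩)
  · intro σ
    left
    rw [zsum D' σ]
    have h5 := h4 σ
    have h6 : ∑ i ∈ Finset.range (t+1), (cst (ATd R h' Ty x1 (z i)) (s' (z i)) σ + cst (AHd R s' Ty x1 (z i)) (h' (z i)) (!σ))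
      = ∑ j ∈ Finset.range (t+1), (cst (ATd R h Ty x1 (z j)) (st j) σ + cst (AHd R s Ty x1 (z j)) (hd' j) (!σ)) := by
      apply Finset.sum_congr rfl; intro i hi
      have hi : i ≤ t := by simp at hi; omega
      have a1 : ATd R h' Ty x1 (z i) = ATd R h Ty x1 (z i) := funext (fun σ => propext (e3 _ σ))
      have a2 : AHd R s' Ty x1 (z i) = AHd R s Ty x1 (z i) := funext (fun σ => propext (e4 _ σ))
      rw [a1, a2, (e1 i hi).1, (e1 i hi).2]
    rw [h6]; simp only [Finset.sum_empty, add_zero]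
    have h7 := (Nat.le_add_right _ _).trans h5
    exact_mod_cast h7
  · intro i hi _ a b _ _
    exact conn_true _ a b (by have := hN i hi; omega)
  · intro a b _
    have := hsz a b
    have e : Ty.filter (fun v => h' v = a ∧ s' v = b) = Ty.filter (fun v => h v = a ∧ s v = b) := by
      apply Finset.filter_congr; intro v hv; rw [(hT v hv).1, (hT v hv).2]
    rw [e]; simpa using this

section
variable {V : Type*} [Fintype V] {R : V → V → Prop} {z : ℕ → V} {t : ℕ} {s h : V → Bool} {Ty : Finset V}
    {m e0 nt x1 w : ℕ}

theorem upS (D : ED R z t s h Ty m e0 nt x1 w) (σ : Bool) : 2 * (Ty.filter (fun v => s v = σ)).card ≤ m + w := by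
  have h3 := D.hws (!σ)
  have h5 : (Ty.filter (fun v => s v = σ)).card + (Ty.filter (fun v => s v = !σ)).card ≤ m := by
    rw [← D.hm, ← Finset.card_union_of_disjoint]
    · exact Finset.card_le_univ _
    · rw [Finset.disjoint_left]; intro v a b
      have a := (Finset.mem_filter.1 a).2
      have b := (Finset.mem_filter.1 b).2
      rw [a] at b; simp at b
  omega

theorem upH (D : ED R z t s h Ty m e0 nt x1 w) (σ : Bool) : 2 * (Ty.filter (fun v => h v = σ)).card ≤ m + w := by
  have h3 := D.hwh (!σ)
  have h5 : (Ty.filter (fun v => h v = σ)).card + (Ty.filter (fun v => h v = !σ)).card ≤ m := by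
    rw [← D.hm, ← Finset.card_union_of_disjoint]
    · exact Finset.card_le_univ _
    · rw [Finset.disjoint_left]; intro v a b
      have a := (Finset.mem_filter.1 a).2
      have b := (Finset.mem_filter.1 b).2
      rw [a] at b; simp at b
  omega

theorem missT (D : ED R z t s h Ty m e0 nt x1 w) (hM : w + 2 * nt + 3 * (t+1) ≤ 2 * x1) (u : V) (σ : Bool)
    (hr : ¬ ATd R h Ty x1 u (!σ)) : (Ty.filter (fun v => h v = σ ∧ ¬ R u v)).card ≤ 2 * x1 := by
  unfold ATd at hr
  push Not at hr
  have h1 := D.hdo u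
  have h2 := upH D σ
  have h3 : Finset.univ.filter (fun v => R u v) ⊆ (Ty.filter (fun v => h v = σ ∧ R u v) ∪ Ty.filter (fun v => h v = (!σ) ∧ R u v)) ∪ (Finset.univ \ Ty) := by
    intro v hv
    have hv := (Finset.mem_filter.1 hv).2
    by_cases hT : v ∈ Ty
    · apply Finset.mem_union_left
      by_cases hs : h v = σ
      · exact Finset.mem_union_left _ (Finset.mem_filter.2 ⟨hT, hs, hv⟩)
      · exact Finset.mem_union_right _ (Finset.mem_filter.2 ⟨hT, bool_ne _ _ hs, hv⟩)
    · exact Finset.mem_union_right _ (by simp [hT])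
  have h4 := (Finset.card_le_card h3).trans ((Finset.card_union_le _ _).trans (Nat.add_le_add_right (Finset.card_union_le _ _) _))
  have h5 := Finset.card_filter_add_card_filter_not (s := Ty.filter (fun v => h v = σ)) (fun v => R u v)
  rw [Finset.filter_filter, Finset.filter_filter] at h5
  have := D.hnt
  omega

theorem missH (D : ED R z t s h Ty m e0 nt x1 w) (hM : w + 2 * nt + 3 * (t+1) ≤ 2 * x1) (u : V) (σ : Bool)
    (hr : ¬ AHd R s Ty x1 u (!σ)) : (Ty.filter (fun v => s v = σ ∧ ¬ R v u)).card ≤ 2 * x1 := by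
  unfold AHd at hr
  push Not at hr
  have h1 := D.hdi u
  have h2 := upS D σ
  have h3 : Finset.univ.filter (fun v => R v u) ⊆ (Ty.filter (fun v => s v = σ ∧ R v u) ∪ Ty.filter (fun v => s v = (!σ) ∧ R v u)) ∪ (Finset.univ \ Ty) := by
    intro v hv
    have hv := (Finset.mem_filter.1 hv).2
    by_cases hT : v ∈ Ty
    · apply Finset.mem_union_left
      by_cases hs : s v = σ
      · exact Finset.mem_union_left _ (Finset.mem_filter.2 ⟨hT, hs, hv⟩)
      · exact Finset.mem_union_right _ (Finset.mem_filter.2 ⟨hT, bool_ne _ _ hs, hv⟩)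
    · exact Finset.mem_union_right _ (by simp [hT])
  have h4 := (Finset.card_le_card h3).trans ((Finset.card_union_le _ _).trans (Nat.add_le_add_right (Finset.card_union_le _ _) _))
  have h5 := Finset.card_filter_add_card_filter_not (s := Ty.filter (fun v => s v = σ)) (fun v => R v u)
  rw [Finset.filter_filter, Finset.filter_filter] at h5
  have := D.hnt
  omega

def Gen (R : V → V → Prop) (s h : V → Bool) (Ty : Finset V) (x1 : ℕ) (a c : Bool) (p w : V) : Prop :=
  ((¬ AHd R s Ty x1 w (!c) → R p w) ∧ (¬ AHd R s Ty x1 w c → ¬ R p w)) ∧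
  ((¬ ATd R h Ty x1 w (!a) → R w p) ∧ (¬ ATd R h Ty x1 w a → ¬ R w p))

def RigAt (R : V → V → Prop) (s h : V → Bool) (Ty : Finset V) (x1 : ℕ) (σ : Bool) (p : V) : Prop :=
  (s p = σ → ¬ ATd R h Ty x1 p (!σ)) ∧ (h p = (!σ) → ¬ AHd R s Ty x1 p σ)

noncomputable def Kst (R : V → V → Prop) (s h : V → Bool) (Ty : Finset V) (x1 b : ℕ) (W : Finset V) (a c : Bool) : Finset V :=
  Ty.filter (fun p => h p = a ∧ s p = c ∧ (∀ σ, ¬ Many R s h Ty x1 b σ → RigAt R s h Ty x1 σ p) ∧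
    ∀ w ∈ W, Gen R s h Ty x1 a c p w)

theorem Kst_card (D : ED R z t s h Ty m e0 nt x1 w) (hM : w + 2 * nt + 3 * (t+1) ≤ 2 * x1) (b : ℕ) (W : Finset V)
    (a c : Bool) : (Ty.filter (fun p => h p = a ∧ s p = c)).card ≤ (Kst R s h Ty x1 b W a c).card + 2 * b + W.card * (6 * x1) := by
  let Bd : Bool → Finset V := fun σ => if Many R s h Ty x1 b σ then ∅ else
    Ty.filter (fun v => s v = σ ∧ ATd R h Ty x1 v (!σ)) ∪ Ty.filter (fun v => h v = (!σ) ∧ AHd R s Ty x1 v σ)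
  have hBd : ∀ σ, (Bd σ).card ≤ b := by
    intro σ
    simp only [Bd]
    split_ifs with h1
    · simp
    · unfold Many at h1
      push Not at h1
      exact (Finset.card_union_le _ _).trans h1.le
  let F : V → Finset V := fun v => Ty.filter (fun p => h p = a ∧ s p = c ∧ ¬ Gen R s h Ty x1 a c p v)
  have hF : ∀ v ∈ W, (F v).card ≤ 6 * x1 := by
    intro v _
    have b1 : (Ty.filter (fun p => s p = c ∧ ¬ (¬ AHd R s Ty x1 v (!c) → R p v))).card ≤ 2 * x1 := by
      by_cases hr : AHd R s Ty x1 v (!c)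
      · rw [Finset.filter_false_of_mem]
        · simp
        · intro p _ h1; exact h1.2 (fun h2 => absurd hr h2)
      · refine le_trans (Finset.card_le_card ?_) (missH D hM v c hr)
        intro p hp
        obtain ⟨h1, h2, h3⟩ := Finset.mem_filter.1 hp
        push Not at h3
        exact Finset.mem_filter.2 ⟨h1, h2, h3.2⟩
    have b2 : (Ty.filter (fun p => s p = c ∧ ¬ (¬ AHd R s Ty x1 v c → ¬ R p v))).card ≤ x1 := by
      by_cases hr : AHd R s Ty x1 v c
      · rw [Finset.filter_false_of_mem]
        · simp
        · intro p _ h1; exact h1.2 (fun h2 => absurd hr h2)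
      · have hr' := hr
        unfold AHd at hr'
        push Not at hr'
        refine le_trans (Finset.card_le_card ?_) hr'.le
        intro p hp
        obtain ⟨h1, h2, h3⟩ := Finset.mem_filter.1 hp
        push Not at h3
        exact Finset.mem_filter.2 ⟨h1, h2, h3.2⟩
    have b3 : (Ty.filter (fun p => h p = a ∧ ¬ (¬ ATd R h Ty x1 v (!a) → R v p))).card ≤ 2 * x1 := by
      by_cases hr : ATd R h Ty x1 v (!a)
      · rw [Finset.filter_false_of_mem]
        · simp
        · intro p _ h1; exact h1.2 (fun h2 => absurd hr h2)
      · refine le_trans (Finset.card_le_card ?_) (missT D hM v a hr)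
        intro p hp
        obtain ⟨h1, h2, h3⟩ := Finset.mem_filter.1 hp
        push Not at h3
        exact Finset.mem_filter.2 ⟨h1, h2, h3.2⟩
    have b4 : (Ty.filter (fun p => h p = a ∧ ¬ (¬ ATd R h Ty x1 v a → ¬ R v p))).card ≤ x1 := by
      by_cases hr : ATd R h Ty x1 v a
      · rw [Finset.filter_false_of_mem]
        · simp
        · intro p _ h1; exact h1.2 (fun h2 => absurd hr h2)
      · have hr' := hr
        unfold ATd at hr'
        push Not at hr'
        refine le_trans (Finset.card_le_card ?_) hr'.le
        intro p hp
        obtain ⟨h1, h2, h3⟩ := Finset.mem_filter.1 hp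
        push Not at h3
        exact Finset.mem_filter.2 ⟨h1, h2, h3.2⟩
    have hs : F v ⊆ (Ty.filter (fun p => s p = c ∧ ¬ (¬ AHd R s Ty x1 v (!c) → R p v)) ∪ Ty.filter (fun p => s p = c ∧ ¬ (¬ AHd R s Ty x1 v c → ¬ R p v)))
        ∪ (Ty.filter (fun p => h p = a ∧ ¬ (¬ ATd R h Ty x1 v (!a) → R v p)) ∪ Ty.filter (fun p => h p = a ∧ ¬ (¬ ATd R h Ty x1 v a → ¬ R v p))) := by
      intro p hp
      obtain ⟨h1, h2, h3, h4⟩ := Finset.mem_filter.1 hp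
      simp only [Finset.mem_union, Finset.mem_filter]
      unfold Gen at h4
      by_contra hcon
      apply h4
      refine ⟨⟨?_, ?_⟩, ⟨?_, ?_⟩⟩ <;> (by_contra h5; apply hcon)
      · exact Or.inl (Or.inl ⟨h1, h3, h5⟩)
      · exact Or.inl (Or.inr ⟨h1, h3, h5⟩)
      · exact Or.inr (Or.inl ⟨h1, h2, h5⟩)
      · exact Or.inr (Or.inr ⟨h1, h2, h5⟩)
    have := (Finset.card_le_card hs).trans ((Finset.card_union_le _ _).trans (Nat.add_le_add (Finset.card_union_le _ _) (Finset.card_union_le _ _)))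
    omega
  have hsub : Ty.filter (fun p => h p = a ∧ s p = c) ⊆ (Kst R s h Ty x1 b W a c ∪ (Bd true ∪ Bd false)) ∪ W.biUnion F := by
    intro p hp
    obtain ⟨h1, h2, h3⟩ := Finset.mem_filter.1 hp
    by_cases g1 : ∀ w ∈ W, Gen R s h Ty x1 a c p w
    · apply Finset.mem_union_left
      by_cases g2 : ∀ σ, ¬ Many R s h Ty x1 b σ → RigAt R s h Ty x1 σ p
      · exact Finset.mem_union_left _ (Finset.mem_filter.2 ⟨h1, h2, h3, g2, g1⟩)
      · push Not at g2
        obtain ⟨σ, g3, g4⟩ := g2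
        have : p ∈ Bd σ := by
          simp only [Bd, g3, if_false]
          unfold RigAt at g4
          rw [not_and_or] at g4
          push Not at g4
          rcases g4 with g4 | g4
          · exact Finset.mem_union_left _ (Finset.mem_filter.2 ⟨h1, g4⟩)
          · exact Finset.mem_union_right _ (Finset.mem_filter.2 ⟨h1, g4⟩)
        apply Finset.mem_union_right
        cases σ
        · exact Finset.mem_union_right _ this
        · exact Finset.mem_union_left _ this
    · push Not at g1
      obtain ⟨v, hv, g2⟩ := g1
      exact Finset.mem_union_right _ (Finset.mem_biUnion.2 ⟨v, hv, Finset.mem_filter.2 ⟨h1, h2, h3, g2⟩⟩)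
  have q1 := Finset.card_le_card hsub
  have q2 := Finset.card_union_le (Kst R s h Ty x1 b W a c ∪ (Bd true ∪ Bd false)) (W.biUnion F)
  have q3 := Finset.card_union_le (Kst R s h Ty x1 b W a c) (Bd true ∪ Bd false)
  have q4 := Finset.card_union_le (Bd true) (Bd false)
  have q5 := Finset.card_biUnion_le_card_mul W F _ hF
  have q6 := hBd true
  have q7 := hBd false
  omega

theorem unit_term (D : ED R z t s h Ty m e0 nt x1 w) (σ : Bool) (g : Fin 3 → V)
    (hp : RigAt R s h Ty x1 σ (g 0)) (hq : RigAt R s h Ty x1 σ (g 2)) :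
    ind (s (g 2)) σ - ind (h (g 0)) σ + 3 - ∑ c, (iP (¬ ATd R h Ty x1 (g c) (!σ)) + iP (¬ AHd R s Ty x1 (g c) σ))
      = ind (h (g 2)) σ - ind (s (g 0)) σ + 1 - iP (¬ ATd R h Ty x1 (g 1) (!σ)) - iP (¬ AHd R s Ty x1 (g 1) σ) := by
  have hT : ∀ p, RigAt R s h Ty x1 σ p → iP (¬ ATd R h Ty x1 p (!σ)) = ind (s p) σ ∧ iP (¬ AHd R s Ty x1 p σ) = 1 - ind (h p) σ := by
    intro p hp
    constructor
    · by_cases h1 : s p = σ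
      · simp only [iP, ind, hp.1 h1, h1]; simp
      · have := bool_ne _ _ h1 ▸ D.hAT p
        simp only [iP, ind, h1, this]; simp
    · by_cases h1 : h p = σ
      · have := h1 ▸ D.hAH p
        simp only [iP, ind, h1, this]; simp
      · simp only [iP, ind, hp.2 (bool_ne _ _ h1), h1]; simp
  rw [Fin.sum_univ_three, (hT _ hp).1, (hT _ hp).2, (hT _ hq).1, (hT _ hq).2]
  ring

theorem mid_count (D : ED R z t s h Ty m e0 nt x1 w) (p q : V) (E S : Finset V) (hES : Disjoint E S)
    (hS : ∀ v ∈ S, ¬ R p v ∧ ¬ R v q) :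
    (t + 1 : ℤ) + ∑ v ∈ E, (1 - iP (R p v) - iP (R v q)) + S.card ≤
      (Finset.univ.filter (fun v => v ∉ E ∧ R p v ∧ R v q)).card := by
  have h1 := D.hdeg p q
  have e1 := card_iP Finset.univ (fun v => R p v)
  have e2 := card_iP Finset.univ (fun v => R v q)
  have e3 := card_iP Finset.univ (fun v => v ∉ E ∧ R p v ∧ R v q)
  have e4 : ∑ v : V, (1:ℤ) = m := by simp [D.hm]
  have e5 : (S.card : ℤ) = ∑ v : V, iP (v ∈ S) := by
    rw [← card_iP]; simp
  have e6 : ∑ v ∈ E, (1 - iP (R p v) - iP (R v q)) = ∑ v : V, (if v ∈ E then (1 - iP (R p v) - iP (R v q)) else 0) := by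
    rw [Finset.sum_ite_mem]; simp
  rw [e3, e5, e6]
  have h2 : (m : ℤ) + (t+1) ≤ ∑ v : V, iP (R p v) + ∑ v : V, iP (R v q) := by
    rw [← e1, ← e2]; exact_mod_cast h1
  have h3 : ∑ v : V, ((iP (R p v) + iP (R v q) - 1) + (if v ∈ E then (1 - iP (R p v) - iP (R v q)) else 0) + iP (v ∈ S)) ≤
      ∑ v : V, iP (v ∉ E ∧ R p v ∧ R v q) := by
    apply Finset.sum_le_sum
    intro v _
    by_cases a1 : v ∈ E
    · have a2 : v ∉ S := Finset.disjoint_left.1 hES a1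
      have b1 : iP (v ∈ S) = 0 := by simp [iP, a2]
      have b2 : iP (v ∉ E ∧ R p v ∧ R v q) = 0 := by simp [iP, a1]
      rw [if_pos a1, b1, b2]; linarith
    · by_cases a2 : v ∈ S
      · obtain ⟨a3, a4⟩ := hS v a2
        simp [iP, a1, a2, a3, a4]
      · by_cases a3 : R p v <;> by_cases a4 : R v q <;> simp [iP, a1, a2, a3, a4]
  simp only [Finset.sum_add_distrib, Finset.sum_sub_distrib] at h3
  rw [e4] at h3
  linarith

end

theorem rig_of_not_flx (AT : Bool → Prop) (a : Bool) (ha : AT a) (h : ¬ Flx AT) : ¬ AT (!a) := by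
  intro h2; apply h; unfold Flx; cases a <;> simp_all

theorem zset {V : Type*} [Fintype V] {R : V → V → Prop} {z : ℕ → V} {t : ℕ} {s h : V → Bool} {Ty : Finset V}
    {m e0 nt x1 w : ℕ} (D : ED R z t s h Ty m e0 nt x1 w) (b : ℕ → Bool) :
    ∃ s' h' : V → Bool, ED R z t s' h' Ty m e0 nt x1 w ∧ (∀ v ∈ Ty, s' v = s v ∧ h' v = h v) ∧
      (∀ i < t, h' (z (i+1)) = xor (s' (z i)) (b i) ∨
        (¬ ATd R h' Ty x1 (z i) (!s' (z i)) ∧ ¬ AHd R s' Ty x1 (z (i+1)) (!h' (z (i+1))))) ∧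
      ((∀ i < t, b i = false) → h' (z 0) = s' (z t) ∨
        (¬ ATd R h' Ty x1 (z t) (!s' (z t)) ∧ ¬ AHd R s' Ty x1 (z 0) (!h' (z 0)))) ∧
      ∀ σ, ∑ i ∈ Finset.range (t+1), (ind (s' (z i)) σ - ind (h' (z i)) σ + 1 - iP (¬ ATd R h' Ty x1 (z i) (!σ)) - iP (¬ AHd R s' Ty x1 (z i) σ))
        + ((Finset.range t).filter (fun i => h' (z (i+1)) ≠ xor (s' (z i)) (b i))).card ≤ t + 1 := by
  obtain ⟨st, hd', h1, h2, h3, h4⟩ := ztypes t b (fun j => ATd R h Ty x1 (z j)) (fun j => AHd R s Ty x1 (z j))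
    (fun j _ => ⟨_, D.hAT _⟩) (fun j _ => ⟨_, D.hAH _⟩)
  obtain ⟨s', h', D', e1, e2, e3, e4⟩ := ED_restate D st hd' h1
  have a1 : ∀ v, ATd R h' Ty x1 v = ATd R h Ty x1 v := fun v => funext (fun σ => propext (e3 _ σ))
  have a2 : ∀ v, AHd R s' Ty x1 v = AHd R s Ty x1 v := fun v => funext (fun σ => propext (e4 _ σ))
  refine ⟨s', h', D', ?_, ?_, ?_, ?_⟩
  · intro v hv; apply e2; intro i hi h1; exact D.hz i hi (h1 ▸ hv)
  · intro i hi
    rw [(e1 (i+1) (by omega)).2, (e1 i (by omega)).1, a1, a2]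
    rcases h2 i hi with h5 | ⟨h5, h6⟩
    · left; exact h5
    · right; exact ⟨rig_of_not_flx _ _ (h1 i (by omega)).1 h5, rig_of_not_flx _ _ (h1 (i+1) (by omega)).2 h6⟩
  · intro hb
    rw [(e1 0 (by omega)).2, (e1 t (by omega)).1, a1, a2]
    rcases h3 hb with h5 | ⟨h5, h6⟩
    · left; exact h5
    · right; exact ⟨rig_of_not_flx _ _ (h1 t (by omega)).1 h5, rig_of_not_flx _ _ (h1 0 (by omega)).2 h6⟩
  · intro σ
    rw [zsum D' σ]
    have h5 := h4 σ
    have h6 : ∑ i ∈ Finset.range (t+1), (cst (ATd R h' Ty x1 (z i)) (s' (z i)) σ + cst (AHd R s' Ty x1 (z i)) (h' (z i)) (!σ))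
      = ∑ j ∈ Finset.range (t+1), (cst (ATd R h Ty x1 (z j)) (st j) σ + cst (AHd R s Ty x1 (z j)) (hd' j) (!σ)) := by
      apply Finset.sum_congr rfl; intro i hi
      have hi : i ≤ t := by simp at hi; omega
      rw [a1, a2, (e1 i hi).1, (e1 i hi).2]
    have h7 : (Finset.range t).filter (fun i => h' (z (i+1)) ≠ xor (s' (z i)) (b i)) = (Finset.range t).filter (fun i => hd' (i+1) ≠ xor (st i) (b i)) := by
      apply Finset.filter_congr; intro i hi
      have hi : i < t := by simpa using hi
      rw [(e1 (i+1) (by omega)).2, (e1 i (by omega)).1]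
    rw [h6, h7]
    exact_mod_cast h5

theorem conn_X : ∀ (n : ℕ) (a b : Bool), Conn (fun x y => y = !x) a b n ↔ b = xor a (decide (n % 2 = 1)) := by
  intro n
  induction n with
  | zero => intro a b; simp [Conn, eq_comm]
  | succ n ih =>
    intro a b
    simp only [Conn, exists_eq_left, ih]
    rcases Nat.mod_two_eq_zero_or_one n with h | h
    · have h2 : (n+1) % 2 = 1 := by omega
      rw [h, h2]; cases a <;> simp
    · have h2 : (n+1) % 2 = 0 := by omega
      rw [h, h2]; cases a <;> simp

section
variable {V : Type*} [Fintype V] {R : V → V → Prop} {z : ℕ → V} {t : ℕ} {s h : V → Bool} {Ty : Finset V}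
    {m e0 nt x1 w : ℕ}

/-- lower bound for the number of middles for a pair -/
theorem mid_z (D : ED R z t s h Ty m e0 nt x1 w) (p q : V) (E S : Finset V)
    (b : ℕ) (W : Finset V) (a c a' c' : Bool) (hW : ∀ i ≤ t, z i ∈ W)
    (hp : p ∈ Kst R s h Ty x1 b W a c) (hq : q ∈ Kst R s h Ty x1 b W a' c')
    (hES : Disjoint ((Finset.range (t+1)).image z ∪ E) S) (hE : Disjoint ((Finset.range (t+1)).image z) E)
    (hS : ∀ v ∈ S, ¬ R p v ∧ ¬ R v q) :
    (((Finset.range (t+1)).filter (fun i => ¬ AHd R s Ty x1 (z i) c)).card + ((Finset.range (t+1)).filter (fun i => ¬ ATd R h Ty x1 (z i) a')).card : ℤ)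
      + ∑ v ∈ E, (1 - iP (R p v) - iP (R v q)) + S.card ≤
      (Finset.univ.filter (fun v => v ∉ (Finset.range (t+1)).image z ∪ E ∧ R p v ∧ R v q)).card := by
  have h1 := mid_count D p q _ S hES hS
  rw [Finset.sum_union hE, Finset.sum_image] at h1
  · have h2 : ∑ i ∈ Finset.range (t+1), (iP (¬ AHd R s Ty x1 (z i) c) + iP (¬ ATd R h Ty x1 (z i) a') - 1) ≤
        ∑ i ∈ Finset.range (t+1), (1 - iP (R p (z i)) - iP (R (z i) q)) := by
      apply Finset.sum_le_sum; intro i hi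
      have hi : i ≤ t := by simp at hi; omega
      have g1 := ((Finset.mem_filter.1 hp).2.2.2.2 (z i) (hW i hi)).1.2
      have g2 := ((Finset.mem_filter.1 hq).2.2.2.2 (z i) (hW i hi)).2.2
      have b1 : iP (¬ AHd R s Ty x1 (z i) c) + iP (R p (z i)) ≤ 1 := by
        unfold iP; split_ifs with x1 x2 <;> simp_all
      have b2 : iP (¬ ATd R h Ty x1 (z i) a') + iP (R (z i) q) ≤ 1 := by
        unfold iP; split_ifs with x1 x2 <;> simp_all
      linarith
    rw [Finset.sum_sub_distrib, Finset.sum_add_distrib, ← card_iP, ← card_iP] at h2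
    simp only [Finset.sum_const, Finset.card_range, nsmul_eq_mul, mul_one] at h2
    push_cast at h2
    linarith
  · intro i hi j hj hij
    exact D.hzi i (by simp at hi; omega) j (by simp at hj; omega) hij

set_option maxHeartbeats 1000000 in
theorem modeX (D : ED R z t s h Ty m e0 nt x1 w) (N : ℕ → ℕ) (qb ns κ : ℕ)
    (hX : ∀ v ∈ Ty, s v = !h v)
    (hκ : 4 * (t + 3) ≤ κ)
    (hqb : qb = w + 2 * κ) (hns : ns = nt + 2 * qb)
    (hd : 16 * (x1 + nt) * (2 + κ) < m) (hmw : 2 * w + 4 * κ + 4 * qb ≤ m)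
    (hN : ∀ i < t, 4 ≤ N i) (he : e0 ≤ x1)
    (hx : 2 * ns + κ + 3 * qb ≤ x1)
    (hsz : ∀ a, 2 * ns + ∑ i ∈ Finset.range t, N i + 4 * x1 + κ + 3 * qb + 2 * (qb + 2 * κ) + κ * (6 * x1) + (2 ^ (5 * κ) * (5 * κ) + 5 * κ) <
      (Ty.filter (fun v => h v = a ∧ s v = !a)).card)
    (hsz2 : 2 * (3 * e0 + 3 + 2 * ns + ∑ i ∈ Finset.range t, N i + κ + 3 * qb) + w ≤ m) : HamOut R z t N := by
  obtain ⟨s', h', D', e1, e2, -, e4⟩ := zset D (fun i => decide (N i % 2 = 0))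
  have hX' : ∀ v ∈ Ty, s' v = !h' v := by intro v hv; rw [(e1 v hv).1, (e1 v hv).2, hX v hv]
  have hsz' : ∀ a, (Ty.filter (fun v => h' v = a ∧ s' v = !a)).card = (Ty.filter (fun v => h v = a ∧ s v = !a)).card := by
    intro a; congr 1; apply Finset.filter_congr; intro v hv; rw [(e1 v hv).1, (e1 v hv).2]
  simp only [← hsz'] at hsz
  clear hsz' e1 hX D
  generalize s' = s at *
  generalize h' = h at *
  clear s' h'
  have D := D'
  have : Inhabited V := ⟨z 0⟩
  have hM : w + 2 * nt + 3 * (t+1) ≤ 2 * x1 := by omega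
  set J : Finset ℕ := (Finset.range t).filter (fun i => h (z (i+1)) ≠ xor (s (z i)) (decide (N i % 2 = 0))) with hJdef
  set J1 : Finset ℕ := J.filter (fun i => s (z i) = true) with hJ1
  set J2 : Finset ℕ := J.filter (fun i => s (z i) = false) with hJ2
  have hJJ : Disjoint J1 J2 := by
    rw [Finset.disjoint_left]; intro i a b
    have a := (Finset.mem_filter.1 a).2
    have b := (Finset.mem_filter.1 b).2
    rw [a] at b; simp at b
  have hJU : J1 ∪ J2 = J := by
    ext i; simp only [hJ1, hJ2, Finset.mem_union, Finset.mem_filter]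
    cases s (z i) <;> simp
  have hJc : J1.card + J2.card = J.card := by rw [← hJU, Finset.card_union_of_disjoint hJJ]
  have hJt : J.card ≤ t := by
    have := Finset.card_filter_le (Finset.range t) (fun i => h (z (i+1)) ≠ xor (s (z i)) (decide (N i % 2 = 0)))
    simpa [hJdef] using this
  have mJ : ∀ i ∈ J, i < t ∧ h (z (i+1)) = !(xor (s (z i)) (decide (N i % 2 = 0))) ∧
      ¬ ATd R h Ty x1 (z i) (!s (z i)) ∧ ¬ AHd R s Ty x1 (z (i+1)) (!h (z (i+1))) := by
    intro i hi
    obtain ⟨h1, h2⟩ := Finset.mem_filter.1 hi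
    have h1 : i < t := by simpa using h1
    refine ⟨h1, bool_ne _ _ h2, ?_⟩
    rcases e2 i h1 with h3 | h3
    · exact absurd h3 h2
    · exact h3
  set Zs : Finset V := (Finset.range (t+1)).image z with hZs
  have zZ : ∀ i ≤ t, z i ∈ Zs := fun i hi => Finset.mem_image.2 ⟨i, by simp; omega, rfl⟩
  have Zc : Zs.card ≤ t + 1 := by simpa using Finset.card_image_le (s := Finset.range (t+1)) (f := z)
  set K1 := Kst R s h Ty x1 (qb + 2 * κ) Zs true false with hK1
  set K2 := Kst R s h Ty x1 (qb + 2 * κ) Zs false true with hK2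
  have k1c := Kst_card D hM (qb + 2 * κ) Zs true false
  have k2c := Kst_card D hM (qb + 2 * κ) Zs false true
  rw [← hK1] at k1c
  rw [← hK2] at k2c
  have w1 : Zs.card * (6 * x1) ≤ κ * (6 * x1) := Nat.mul_le_mul_right _ (by omega)
  have s1 := hsz true
  have s2 := hsz false
  simp only [Bool.not_true, Bool.not_false] at s1 s2
  have K1p : ∀ p ∈ K1, p ∈ Ty ∧ h p = true ∧ s p = false ∧ (∀ σ, ¬ Many R s h Ty x1 (qb + 2 * κ) σ → RigAt R s h Ty x1 σ p) ∧
    ∀ w ∈ Zs, Gen R s h Ty x1 true false p w := fun p hp => Finset.mem_filter.1 hp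
  have K2p : ∀ p ∈ K2, p ∈ Ty ∧ h p = false ∧ s p = true ∧ (∀ σ, ¬ Many R s h Ty x1 (qb + 2 * κ) σ → RigAt R s h Ty x1 σ p) ∧
    ∀ w ∈ Zs, Gen R s h Ty x1 false true p w := fun p hp => Finset.mem_filter.1 hp
  have KT : ∀ p ∈ K1 ∪ K2, p ∈ Ty := by
    intro p hp; rcases Finset.mem_union.1 hp with hp | hp
    · exact (K1p p hp).1
    · exact (K2p p hp).1
  have TZ : ∀ p ∈ Ty, p ∉ Zs := by
    intro p hp hp2
    obtain ⟨i, hi, rfl⟩ := Finset.mem_image.1 hp2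
    exact D.hz i (by simp at hi; omega) hp
  have cnt : ∀ (c a' : Bool) (p q : V), (c = false ∧ a' = false ∧ p ∈ K1 ∧ q ∈ K2) ∨ (c = true ∧ a' = true ∧ p ∈ K2 ∧ q ∈ K1) →
      ((Finset.range (t+1)).filter (fun i => ¬ AHd R s Ty x1 (z i) c)).card + ((Finset.range (t+1)).filter (fun i => ¬ ATd R h Ty x1 (z i) a')).card
       ≤ (Finset.univ.filter (fun v => v ∉ Zs ∪ ∅ ∪ ∅ ∧ R p v ∧ R v q)).card := by
    intro c a' p q hc
    have : (((Finset.range (t+1)).filter (fun i => ¬ AHd R s Ty x1 (z i) c)).card + ((Finset.range (t+1)).filter (fun i => ¬ ATd R h Ty x1 (z i) a')).card : ℤ)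
      + ∑ v ∈ (∅ : Finset V), (1 - iP (R p v) - iP (R v q)) + (∅ : Finset V).card ≤
      (Finset.univ.filter (fun v => v ∉ Zs ∪ ∅ ∧ R p v ∧ R v q)).card := by
      rcases hc with ⟨rfl, rfl, hp, hq⟩ | ⟨rfl, rfl, hp, hq⟩
      · exact mid_z D p q ∅ ∅ (qb + 2 * κ) Zs true false false true zZ hp hq (by simp) (by simp) (by simp)
      · exact mid_z D p q ∅ ∅ (qb + 2 * κ) Zs false true true false zZ hp hq (by simp) (by simp) (by simp)
    simp only [Finset.sum_empty, Finset.card_empty, Nat.cast_zero, add_zero] at this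
    simp only [Finset.union_empty] at this ⊢
    exact_mod_cast this
  have cT : ∀ (Q : Finset ℕ) (a : Bool), (∀ i ∈ Q, i ∈ J ∧ s (z i) = !a) → Q.card ≤ ((Finset.range (t+1)).filter (fun i => ¬ ATd R h Ty x1 (z i) a)).card := by
    intro Q a hQ
    apply Finset.card_le_card
    intro i hi
    have h1 := mJ i (hQ i hi).1
    refine Finset.mem_filter.2 ⟨by simp; omega, ?_⟩
    have h2 := h1.2.2.1
    rw [(hQ i hi).2] at h2; simpa using h2
  have cH : J.card ≤ ((Finset.range (t+1)).filter (fun i => ¬ AHd R s Ty x1 (z i) true)).card + ((Finset.range (t+1)).filter (fun i => ¬ AHd R s Ty x1 (z i) false)).card := by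
    refine le_trans ?_ (Finset.card_union_le _ _)
    apply Finset.card_le_card_of_injOn (fun i => i + 1)
    · intro i hi
      have h1 := mJ i hi
      have h2 := h1.2.2.2
      show i + 1 ∈ _
      have h3 : i + 1 ∈ Finset.range (t+1) := by simp; omega
      cases h4 : h (z (i+1)) <;> rw [h4] at h2
      · exact Finset.mem_union_left _ (Finset.mem_filter.2 ⟨h3, h2⟩)
      · exact Finset.mem_union_right _ (Finset.mem_filter.2 ⟨h3, h2⟩)
    · intro i _ j _ hij; simpa using hij
  have t1 := cT J1 false (fun i hi => Finset.mem_filter.1 hi)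
  have t2 := cT J2 true (fun i hi => Finset.mem_filter.1 hi)
  obtain ⟨f, f1, f2, f3, f4, -, -⟩ := units R K1 K2 Zs ∅ ∅ J1 J2 (5 * κ) _ _ hJJ
    (fun p hp hr => D.hl p (fun i hi hh => TZ p (KT p hp) (hh ▸ zZ i hi)) hr)
    (by
      rw [Finset.disjoint_left]; intro p a b
      have a := (K1p p a).2.1
      have b := (K2p p b).2.1
      rw [a] at b; simp at b)
    (by intro p hp; simpa using TZ p (KT p hp)) (by simp) (by simp) (by simp) (by omega) (by omega) (by omega) (by simp) (by simp)
    (fun p hp q hq => Or.inr (cnt false false p q (Or.inl ⟨rfl, rfl, hp, hq⟩)))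
    (fun p hp q hq => Or.inr (cnt true true p q (Or.inr ⟨rfl, rfl, hp, hq⟩)))
    (by simp) (by simp) (by simp only [Finset.card_empty]; omega) (by simp only [Finset.card_empty]; omega)
    (by simp only [Finset.card_empty]; omega)
  rw [hJU] at f1 f4
  have fK : ∀ i ∈ J, (i ∈ J1 ∧ f i 0 ∈ K1 ∧ f i 2 ∈ K2 ∧ s (z i) = true) ∨ (i ∈ J2 ∧ f i 0 ∈ K2 ∧ f i 2 ∈ K1 ∧ s (z i) = false) := by
    intro i hi
    rw [← hJU] at hi
    rcases Finset.mem_union.1 hi with hi | hi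
    · left; exact ⟨hi, (f2 i hi).1, (f2 i hi).2, (Finset.mem_filter.1 hi).2⟩
    · right; exact ⟨hi, (f3 i hi).1, (f3 i hi).2, (Finset.mem_filter.1 hi).2⟩
  have fT : ∀ i ∈ J, f i 0 ∈ Ty ∧ f i 2 ∈ Ty := by
    intro i hi
    rcases fK i hi with ⟨-, a, b, -⟩ | ⟨-, a, b, -⟩
    · exact ⟨(K1p _ a).1, (K2p _ b).1⟩
    · exact ⟨(K2p _ a).1, (K1p _ b).1⟩
  refine E_fin D N (2 * x1) κ qb ns (fun x y => y = !x) J f (by omega) (by omega) hqb hns hd hmw hN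
    ?_ ?_ ?_ ?_ (by omega) ?_ ?_ hX' ?_ (by omega) (Or.inl ⟨true, rfl⟩)
  · intro j hj c i hi hh
    exact (f1 j hj).2.2 c (hh ▸ zZ i hi)
  · intro i hi; exact ⟨(f1 i hi).1, (f1 i hi).2.1, fT i hi⟩
  · intro i hi c j hj c' hh; exact f4 i hi j hj c c' hh
  · intro σ
    by_cases hmany : Many R s h Ty x1 (qb + 2 * κ) σ
    · right; right; exact hmany
    · left
      have h1 := e4 σ
      have h2 : ∑ i ∈ J, (ind (s (f i 2)) σ - ind (h (f i 0)) σ + 3 - ∑ c, (iP (¬ ATd R h Ty x1 (f i c) (!σ)) + iP (¬ AHd R s Ty x1 (f i c) σ)))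
          ≤ ∑ i ∈ J, 1 := by
        apply Finset.sum_le_sum; intro i hi
        have nn : ∀ p : Prop, 0 ≤ iP p := by intro p; unfold iP; split_ifs <;> simp
        have n1 := nn (¬ ATd R h Ty x1 (f i 1) (!σ))
        have n2 := nn (¬ AHd R s Ty x1 (f i 1) σ)
        rcases fK i hi with ⟨-, a, b, -⟩ | ⟨-, a, b, -⟩
        · rw [unit_term D σ (f i) ((K1p _ a).2.2.2.1 σ hmany) ((K2p _ b).2.2.2.1 σ hmany), (K1p _ a).2.2.1, (K2p _ b).2.1]
          linarith
        · rw [unit_term D σ (f i) ((K2p _ a).2.2.2.1 σ hmany) ((K1p _ b).2.2.2.1 σ hmany), (K2p _ a).2.2.1, (K1p _ b).2.1]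
          linarith
      simp only [Finset.sum_const, nsmul_eq_mul, mul_one] at h2
      linarith
  · intro i hi hiJ
    obtain ⟨-, h2, h3, h4⟩ := mJ i hiJ
    have h5 := missH D hM (z (i+1)) (h (z (i+1))) h4
    have hN4 := hN i hi
    have z0 := zZ i (by omega)
    have z1 := zZ (i+1) (by omega)
    rcases fK i hiJ with ⟨-, a, b, c⟩ | ⟨-, a, b, c⟩
    · have g1 := (K1p _ a).2.2.2.2 _ z0
      have g2 := (K2p _ b).2.2.2.2 _ z1
      rw [c] at h2 h3
      refine ⟨g1.2.1 h3, by rw [c, (K1p _ a).2.1], ?_, ?_, h5⟩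
      · intro hN4
        rw [hN4] at h2
        apply g2.1.1
        have : h (z (i+1)) = true := by rw [h2]; simp
        rw [this] at h4; exact h4
      · rw [conn_X, (K2p _ b).2.2.1, h2]
        rcases Nat.mod_two_eq_zero_or_one (N i) with hh | hh
        · have h6 : (N i - 4) % 2 = 0 := by omega
          rw [hh, h6]; simp
        · have h6 : (N i - 4) % 2 = 1 := by omega
          rw [hh, h6]; simp
    · have g1 := (K2p _ a).2.2.2.2 _ z0
      have g2 := (K1p _ b).2.2.2.2 _ z1
      rw [c] at h2 h3
      refine ⟨g1.2.1 h3, by rw [c, (K2p _ a).2.1], ?_, ?_, h5⟩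
      · intro hN4
        rw [hN4] at h2
        apply g2.1.1
        have : h (z (i+1)) = false := by rw [h2]; simp
        rw [this] at h4; exact h4
      · rw [conn_X, (K1p _ b).2.2.1, h2]
        rcases Nat.mod_two_eq_zero_or_one (N i) with hh | hh
        · have h6 : (N i - 4) % 2 = 0 := by omega
          rw [hh, h6]; simp
        · have h6 : (N i - 4) % 2 = 1 := by omega
          rw [hh, h6]; simp
  · intro i hi hiJ a b ha hb
    have h1 : h (z (i+1)) = xor (s (z i)) (decide (N i % 2 = 0)) := by
      by_contra h1
      exact hiJ (Finset.mem_filter.2 ⟨by simpa using hi, h1⟩)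
    have hN4 := hN i hi
    rw [conn_X]
    rw [h1] at hb
    rcases Nat.mod_two_eq_zero_or_one (N i) with hh | hh
    · have h6 : (N i - 3) % 2 = 1 := by omega
      rw [hh] at hb; rw [h6, ha]; revert hb; cases s (z i) <;> cases b <;> simp
    · have h6 : (N i - 3) % 2 = 0 := by omega
      rw [hh] at hb; rw [h6, ha]; revert hb; cases s (z i) <;> cases b <;> simp
  · intro a b hab
    subst hab
    have := hsz a
    omega
end

theorem conn_Y : ∀ (n : ℕ) (a b : Bool), Conn (fun x y => y = x) a b n ↔ a = b := by
  intro n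
  induction n with
  | zero => intro a b; simp [Conn]
  | succ n ih => intro a b; simp only [Conn, exists_eq_left, ih]

section
variable {V : Type*} [Fintype V] {R : V → V → Prop} {z : ℕ → V} {t : ℕ} {s h : V → Bool} {Ty : Finset V}
    {m e0 nt x1 w : ℕ}

theorem surj_mid {V : Type*} (J : Finset ℕ) (f : ℕ → V) (Dm : Finset V) (hc : J.card ≤ Dm.card)
    (hs : ∀ d ∈ Dm, ∃ i ∈ J, f i = d) : ∀ i ∈ J, f i ∈ Dm := by
  have h1 : Dm ⊆ J.image f := by
    intro d hd; obtain ⟨i, hi, rfl⟩ := hs d hd; exact Finset.mem_image_of_mem _ hi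
  have h2 := Finset.eq_of_subset_of_card_le h1 (Finset.card_image_le.trans hc)
  intro i hi; rw [h2]; exact Finset.mem_image_of_mem _ hi

set_option maxHeartbeats 3000000 in
theorem modeY (D : ED R z t s h Ty m e0 nt x1 w) (N : ℕ → ℕ) (qb ns κ : ℕ)
    (hX : ∀ v ∈ Ty, s v = h v)
    (hκ : 4 * (t + 3) ≤ κ)
    (hqb : qb = w + 2 * κ) (hns : ns = nt + 2 * qb)
    (hd : 16 * (x1 + nt) * (2 + κ) < m) (hmw : 2 * w + 4 * κ + 4 * qb ≤ m)
    (hN : ∀ i < t, 4 ≤ N i) (he : e0 ≤ x1)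
    (hx : 2 * ns + κ + 3 * qb ≤ x1)
    (hsz : ∀ a, 2 * ns + ∑ i ∈ Finset.range t, N i + 4 * x1 + κ + 3 * qb + 2 * (qb + 2 * κ) + κ * (6 * x1) + (2 ^ (5 * κ) * (5 * κ) + 5 * κ) <
      (Ty.filter (fun v => h v = a ∧ s v = a)).card)
    (hsz2 : 2 * (3 * e0 + 3 + 2 * ns + ∑ i ∈ Finset.range t, N i + κ + 3 * qb) + w ≤ m) : HamOut R z t N := by
  obtain ⟨s', h', D', e1, e2, e3, e4⟩ := zset D (fun i => false)
  replace e3 := e3 (fun _ _ => rfl)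
  simp only [Bool.xor_false] at e2 e4
  have hX' : ∀ v ∈ Ty, s' v = h' v := by intro v hv; rw [(e1 v hv).1, (e1 v hv).2, hX v hv]
  have hsz' : ∀ a, (Ty.filter (fun v => h' v = a ∧ s' v = a)).card = (Ty.filter (fun v => h v = a ∧ s v = a)).card := by
    intro a; congr 1; apply Finset.filter_congr; intro v hv; rw [(e1 v hv).1, (e1 v hv).2]
  simp only [← hsz'] at hsz
  clear hsz' e1 hX D
  generalize s' = s at *
  generalize h' = h at *
  clear s' h'
  have D := D'
  have : Inhabited V := ⟨z 0⟩
  have hM : w + 2 * nt + 3 * (t+1) ≤ 2 * x1 := by omega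
  obtain ⟨nx, nx1, nx2⟩ : ∃ nx : ℕ → ℕ, (∀ i < t, nx i = i + 1) ∧ nx t = 0 :=
    ⟨fun i => if i = t then 0 else i + 1, fun i hi => by simp; omega, by simp⟩
  have nxt : ∀ i ≤ t, nx i ≤ t := by
    intro i hi; rcases Nat.lt_or_ge i t with h1 | h1
    · rw [nx1 i h1]; omega
    · rw [show i = t by omega, nx2]; omega
  have nxi : ∀ i ≤ t, ∀ j ≤ t, nx i = nx j → i = j := by
    intro i hi j hj hij
    rcases Nat.lt_or_ge i t with h1 | h1 <;> rcases Nat.lt_or_ge j t with h2 | h2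
    · rw [nx1 i h1, nx1 j h2] at hij; omega
    · rw [nx1 i h1, show j = t by omega, nx2] at hij; omega
    · rw [nx1 j h2, show i = t by omega, nx2] at hij; omega
    · omega
  set Mm : Finset ℕ := (Finset.range (t+1)).filter (fun i => h (z (nx i)) ≠ s (z i)) with hMm
  set M1 : Finset ℕ := Mm.filter (fun i => s (z i) = true) with hM1
  set M2 : Finset ℕ := Mm.filter (fun i => s (z i) = false) with hM2
  obtain ⟨X1, X2, ee, X1c, X2c, X1m, X2m, ee1, eeM⟩ : ∃ (X1 X2 : Finset ℕ) (ee : ℕ), X1.card = ee ∧ X2.card = ee ∧ (∀ i ∈ X1, i = t ∧ t ∉ Mm) ∧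
      (∀ i ∈ X2, i = t + 1) ∧ ee ≤ 1 ∧ (t ∈ Mm ∨ t ∈ X1) := by
    by_cases h1 : t ∈ Mm
    · exact ⟨∅, ∅, 0, by simp, by simp, by simp, by simp, by simp, Or.inl h1⟩
    · exact ⟨{t}, {t+1}, 1, by simp, by simp, by simp [h1], by simp, by simp, Or.inr (by simp)⟩
  have mM : ∀ i ∈ Mm, i ≤ t ∧ h (z (nx i)) = !(s (z i)) ∧
      ¬ ATd R h Ty x1 (z i) (!s (z i)) ∧ ¬ AHd R s Ty x1 (z (nx i)) (!h (z (nx i))) := by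
    intro i hi
    obtain ⟨h1, h2⟩ := Finset.mem_filter.1 hi
    have h1 : i ≤ t := by simp at h1; omega
    refine ⟨h1, bool_ne _ _ h2, ?_⟩
    rcases Nat.lt_or_ge i t with h4 | h4
    · rw [nx1 i h4] at h2 ⊢
      rcases e2 i h4 with h3 | h3
      · exact absurd h3 h2
      · exact h3
    · have h4 : i = t := by omega
      subst h4
      rw [nx2] at h2 ⊢
      rcases e3 with h3 | h3
      · exact absurd h3 h2
      · exact h3
  have M12 : Disjoint M1 M2 := by
    rw [Finset.disjoint_left]; intro i a b
    have a := (Finset.mem_filter.1 a).2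
    have b := (Finset.mem_filter.1 b).2
    rw [a] at b; simp at b
  have MU : M1 ∪ M2 = Mm := by
    ext i; simp only [hM1, hM2, Finset.mem_union, Finset.mem_filter]
    cases s (z i) <;> simp
  have Mc : M1.card + M2.card = Mm.card := by rw [← MU, Finset.card_union_of_disjoint M12]
  have Mt : Mm.card ≤ t + 1 := by
    have := Finset.card_filter_le (Finset.range (t+1)) (fun i => h (z (nx i)) ≠ s (z i))
    simpa [hMm] using this
  have M1m : ∀ i ∈ M1, i ∈ Mm ∧ s (z i) = true := fun i hi => Finset.mem_filter.1 hi
  have M2m : ∀ i ∈ M2, i ∈ Mm ∧ s (z i) = false := fun i hi => Finset.mem_filter.1 hi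
  have d1 : Disjoint M1 X1 := by
    rw [Finset.disjoint_left]; intro i a b
    obtain ⟨b1, b2⟩ := X1m i b
    exact b2 (b1 ▸ (M1m i a).1)
  have d2 : Disjoint M2 X2 := by
    rw [Finset.disjoint_left]; intro i a b
    have b1 := X2m i b
    have := (mM i (M2m i a).1).1; omega
  set J1 : Finset ℕ := M1 ∪ X1 with hJ1
  set J2 : Finset ℕ := M2 ∪ X2 with hJ2
  have J1c : J1.card = M1.card + ee := by rw [hJ1, Finset.card_union_of_disjoint d1, X1c]
  have J2c : J2.card = M2.card + ee := by rw [hJ2, Finset.card_union_of_disjoint d2, X2c]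
  have hJJ : Disjoint J1 J2 := by
    rw [Finset.disjoint_left]; intro i a b
    rcases Finset.mem_union.1 a with a | a <;> rcases Finset.mem_union.1 b with b | b
    · exact Finset.disjoint_left.1 M12 a b
    · have := (mM i (M1m i a).1).1; have := X2m i b; omega
    · obtain ⟨b1, b2⟩ := X1m i a
      exact b2 (b1 ▸ (M2m i b).1)
    · have := (X1m i a).1; have := X2m i b; omega
  set J : Finset ℕ := J1 ∪ J2 with hJ
  have Jc : J.card = J1.card + J2.card := Finset.card_union_of_disjoint hJJ
  have Jlt : ∀ i < t, i ∈ J → (i ∈ J1 ∧ i ∈ M1) ∨ (i ∈ J2 ∧ i ∈ M2) := by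
    intro i hi hiJ
    rcases Finset.mem_union.1 hiJ with a | a
    · rcases Finset.mem_union.1 a with b | b
      · exact Or.inl ⟨a, b⟩
      · have := (X1m i b).1; omega
    · rcases Finset.mem_union.1 a with b | b
      · exact Or.inr ⟨a, b⟩
      · have := X2m i b; omega
  set Zs : Finset V := (Finset.range (t+1)).image z with hZs
  have zZ : ∀ i ≤ t, z i ∈ Zs := fun i hi => Finset.mem_image.2 ⟨i, by simp; omega, rfl⟩
  have zZ' : ∀ v, v ∉ Zs ↔ ∀ i ≤ t, v ≠ z i := by
    intro v; constructor
    · intro h1 i hi h2; exact h1 (h2 ▸ zZ i hi)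
    · intro h1 h2
      obtain ⟨i, hi, h3⟩ := Finset.mem_image.1 h2
      exact h1 i (by simp at hi; omega) h3.symm
  have Zc : Zs.card ≤ t + 1 := by simpa using Finset.card_image_le (s := Finset.range (t+1)) (f := z)
  have TZ : ∀ p ∈ Ty, p ∉ Zs := by
    intro p hp hp2
    obtain ⟨i, hi, rfl⟩ := Finset.mem_image.1 hp2
    exact D.hz i (by simp at hi; omega) hp
  have rig : ∀ (τ : Bool) (n : ℕ), ∃ Q : Finset V, (∀ d ∈ Q, d ∉ Zs ∧ ¬ ATd R h Ty x1 d (!τ) ∧ ¬ AHd R s Ty x1 d τ) ∧ Q.card ≤ n ∧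
      (n ≤ Q.card ∨ ∀ v, v ∉ Zs → ¬ ATd R h Ty x1 v (!τ) → ¬ AHd R s Ty x1 v τ → v ∈ Q) := by
    intro τ n
    set F := Finset.univ.filter (fun d => d ∉ Zs ∧ ¬ ATd R h Ty x1 d (!τ) ∧ ¬ AHd R s Ty x1 d τ) with hF
    by_cases hn : n ≤ F.card
    · obtain ⟨Q, q1, q2⟩ := Finset.exists_subset_card_eq hn
      exact ⟨Q, fun d hd => (Finset.mem_filter.1 (q1 hd)).2, q2.le, Or.inl q2.ge⟩
    · exact ⟨F, fun d hd => (Finset.mem_filter.1 hd).2, by omega, Or.inr (fun v a b c => Finset.mem_filter.2 ⟨by simp, a, b, c⟩)⟩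
  obtain ⟨Dm, Dm1, Dm2, Dm3⟩ := rig false J1.card
  obtain ⟨Am, Am1, Am2, Am3⟩ := rig true J2.card
  have sh : ∀ (τ : Bool) d, ¬ ATd R h Ty x1 d (!τ) ∧ ¬ AHd R s Ty x1 d τ → s d = τ ∧ h d = !τ := by
    intro τ d ⟨a, b⟩
    constructor
    · by_contra hh
      have := bool_ne _ _ hh ▸ D.hAT d
      exact a this
    · apply bool_ne; intro hh
      exact b (hh ▸ D.hAH d)
  have DmT : ∀ d ∈ Dm, d ∉ Ty := by
    intro d hd hT
    have h1 := sh false d (Dm1 d hd).2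
    have h2 := hX' d hT
    rw [h1.1, h1.2] at h2; simp at h2
  have AmT : ∀ d ∈ Am, d ∉ Ty := by
    intro d hd hT
    have h1 := sh true d (Am1 d hd).2
    have h2 := hX' d hT
    rw [h1.1, h1.2] at h2; simp at h2
  have hDA : Disjoint Dm Am := by
    rw [Finset.disjoint_left]; intro d a b
    have h1 := (sh false d (Dm1 d a).2).1
    have h2 := (sh true d (Am1 d b).2).1
    rw [h1] at h2; simp at h2
  have hDZ : Disjoint Dm Zs := Finset.disjoint_left.2 (fun d a b => (Dm1 d a).1 b)
  have hAZ : Disjoint Am Zs := Finset.disjoint_left.2 (fun d a b => (Am1 d a).1 b)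
  set W : Finset V := Zs ∪ (Dm ∪ Am) with hW
  have ZW : ∀ i ≤ t, z i ∈ W := fun i hi => Finset.mem_union_left _ (zZ i hi)
  have DW : ∀ d ∈ Dm, d ∈ W := fun d hd => Finset.mem_union_right _ (Finset.mem_union_left _ hd)
  have AW : ∀ d ∈ Am, d ∈ W := fun d hd => Finset.mem_union_right _ (Finset.mem_union_right _ hd)
  have Wc : W.card ≤ κ := by
    have q1 := Finset.card_union_le Zs (Dm ∪ Am)
    have q2 := Finset.card_union_le Dm Am
    rw [← hW] at q1
    omega
  have TW : ∀ p ∈ Ty, p ∉ W := by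
    intro p hp hp2
    rcases Finset.mem_union.1 hp2 with h1 | h1
    · exact TZ p hp h1
    · rcases Finset.mem_union.1 h1 with h1 | h1
      · exact DmT p h1 hp
      · exact AmT p h1 hp
  set K1 := Kst R s h Ty x1 (qb + 2 * κ) W true true with hK1
  set K2 := Kst R s h Ty x1 (qb + 2 * κ) W false false with hK2
  have k1c := Kst_card D hM (qb + 2 * κ) W true true
  have k2c := Kst_card D hM (qb + 2 * κ) W false false
  rw [← hK1] at k1c
  rw [← hK2] at k2c
  have w1 : W.card * (6 * x1) ≤ κ * (6 * x1) := Nat.mul_le_mul_right _ Wc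
  have s1 := hsz true
  have s2 := hsz false
  have K1p : ∀ p ∈ K1, p ∈ Ty ∧ h p = true ∧ s p = true ∧ (∀ σ, ¬ Many R s h Ty x1 (qb + 2 * κ) σ → RigAt R s h Ty x1 σ p) ∧
    ∀ w ∈ W, Gen R s h Ty x1 true true p w := fun p hp => Finset.mem_filter.1 hp
  have K2p : ∀ p ∈ K2, p ∈ Ty ∧ h p = false ∧ s p = false ∧ (∀ σ, ¬ Many R s h Ty x1 (qb + 2 * κ) σ → RigAt R s h Ty x1 σ p) ∧
    ∀ w ∈ W, Gen R s h Ty x1 false false p w := fun p hp => Finset.mem_filter.1 hp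
  have KT : ∀ p ∈ K1 ∪ K2, p ∈ Ty := by
    intro p hp; rcases Finset.mem_union.1 hp with hp | hp
    · exact (K1p p hp).1
    · exact (K2p p hp).1
  have Tl : ∀ p ∈ Ty, ¬ R p p := fun p hp hr => D.hl p ((zZ' p).1 (TZ p hp)) hr
  have hdis : Disjoint K1 K2 := by
    rw [Finset.disjoint_left]; intro p a b
    have a := (K1p p a).2.1
    have b := (K2p p b).2.1
    rw [a] at b; simp at b
  -- the many in-neighbours alternative
  have near : ∀ (K : Finset V) (τ : Bool), (∀ p ∈ K, p ∈ Ty ∧ h p = τ ∧ s p = τ) → 5 * κ + 2 + e0 ≤ K.card → ∀ p ∈ K,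
      5 * κ + 2 ≤ (K.filter (fun p' => R p' p)).card := by
    intro K τ hK hc p hp
    have q1 := Finset.card_filter_add_card_filter_not (s := K) (fun p' => R p' p)
    have q2 : (K.filter (fun p' => ¬ R p' p)).card ≤ e0 := by
      refine le_trans (Finset.card_le_card ?_) (D.near2 p (hK p hp).1)
      intro v hv
      obtain ⟨a, b⟩ := Finset.mem_filter.1 hv
      exact Finset.mem_filter.2 ⟨(hK v a).1, by rw [(hK v a).2.2, (hK p hp).2.1], b⟩
    omega
  have near1 := near K1 true (fun p hp => ⟨(K1p p hp).1, (K1p p hp).2.1, (K1p p hp).2.2.1⟩) (by omega)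
  have near2 := near K2 false (fun p hp => ⟨(K2p p hp).1, (K2p p hp).2.1, (K2p p hp).2.2.1⟩) (by omega)
  have iP1 : ∀ p : Prop, p → iP p = 1 := by intro p hp; simp [iP, hp]
  have iP0 : ∀ p : Prop, ¬ p → iP p = 0 := by intro p hp; simp [iP, hp]
  have hc : ∀ (τ : Bool) (P Q : Finset V) (p q : V), p ∈ Kst R s h Ty x1 (qb + 2 * κ) W τ τ → q ∈ Kst R s h Ty x1 (qb + 2 * κ) W (!τ) (!τ) →
      P ∪ Q = Dm ∪ Am → Disjoint P Q →
      (∀ d ∈ P, d ∈ W ∧ ¬ ATd R h Ty x1 d τ ∧ ¬ AHd R s Ty x1 d (!τ)) →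
      (∀ d ∈ Q, d ∈ W ∧ ¬ ATd R h Ty x1 d (!τ) ∧ ¬ AHd R s Ty x1 d τ) → ¬ R p q →
      (((Finset.range (t+1)).filter (fun i => ¬ AHd R s Ty x1 (z i) τ)).card + ((Finset.range (t+1)).filter (fun i => ¬ ATd R h Ty x1 (z i) (!τ))).card
        + Q.card + 2) - P.card ≤ (Finset.univ.filter (fun v => v ∉ Zs ∪ Dm ∪ Am ∧ R p v ∧ R v q)).card := by
    intro τ P Q p q hp hq hPQ hd hP hQ hr
    have p1 := Finset.mem_filter.1 hp
    have q1 := Finset.mem_filter.1 hq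
    have hpq : p ≠ q := by
      intro hh
      have := p1.2.1; rw [hh, q1.2.1] at this; simp at this
    have hh := mid_z D p q (Dm ∪ Am) {p, q} (qb + 2 * κ) W τ τ (!τ) (!τ) ZW hp hq
      (by
        rw [Finset.disjoint_right]; intro v hv
        rcases Finset.mem_insert.1 hv with rfl | hv
        · exact TW _ p1.1
        · rw [Finset.mem_singleton.1 hv]; exact TW _ q1.1)
      (by
        rw [Finset.disjoint_union_right]; exact ⟨hDZ.symm, hAZ.symm⟩)
      (by
        intro v hv
        rcases Finset.mem_insert.1 hv with rfl | hv
        · exact ⟨Tl _ p1.1, hr⟩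
        · rw [Finset.mem_singleton.1 hv]; exact ⟨hr, Tl _ q1.1⟩)
    rw [Finset.card_pair hpq, ← hPQ, Finset.sum_union hd] at hh
    have u1 : ∑ v ∈ P, (1 - iP (R p v) - iP (R v q)) = ∑ v ∈ P, (-1) := by
      apply Finset.sum_congr rfl; intro d hd
      obtain ⟨a, b, c⟩ := hP d hd
      have g1 := (p1.2.2.2.2 d a).1.1 c
      have g2 := (q1.2.2.2.2 d a).2.1 (by simpa using b)
      rw [iP1 _ g1, iP1 _ g2]; norm_num
    have u2 : ∑ v ∈ Q, (1 - iP (R p v) - iP (R v q)) = ∑ v ∈ Q, 1 := by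
      apply Finset.sum_congr rfl; intro d hd
      obtain ⟨a, b, c⟩ := hQ d hd
      have g1 := (p1.2.2.2.2 d a).1.2 c
      have g2 := (q1.2.2.2.2 d a).2.2 b
      rw [iP0 _ g1, iP0 _ g2]; norm_num
    rw [u1, u2] at hh
    simp only [Finset.sum_const, nsmul_eq_mul, mul_one] at hh
    rw [hPQ, ← Finset.union_assoc] at hh
    push_cast at hh
    have hh2 : (((Finset.range (t+1)).filter (fun i => ¬ AHd R s Ty x1 (z i) τ)).card + ((Finset.range (t+1)).filter (fun i => ¬ ATd R h Ty x1 (z i) (!τ))).card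
        + Q.card + 2 : ℤ) ≤ ((Finset.univ.filter (fun v => v ∉ Zs ∪ Dm ∪ Am ∧ R p v ∧ R v q)).card + P.card : ℤ) := by
      linarith only [hh]
    have hh3 : ((Finset.range (t+1)).filter (fun i => ¬ AHd R s Ty x1 (z i) τ)).card + ((Finset.range (t+1)).filter (fun i => ¬ ATd R h Ty x1 (z i) (!τ))).card
        + Q.card + 2 ≤ (Finset.univ.filter (fun v => v ∉ Zs ∪ Dm ∪ Am ∧ R p v ∧ R v q)).card + P.card := by
      exact_mod_cast hh2
    omega
  have cT : ∀ (Q : Finset ℕ) (a : Bool), (∀ i ∈ Q, i ∈ Mm ∧ s (z i) = !a) → Q.card ≤ ((Finset.range (t+1)).filter (fun i => ¬ ATd R h Ty x1 (z i) a)).card := by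
    intro Q a hQ
    apply Finset.card_le_card
    intro i hi
    have h1 := mM i (hQ i hi).1
    refine Finset.mem_filter.2 ⟨by simp; omega, ?_⟩
    have h2 := h1.2.2.1
    rw [(hQ i hi).2] at h2; simpa using h2
  have cH : Mm.card ≤ ((Finset.range (t+1)).filter (fun i => ¬ AHd R s Ty x1 (z i) true)).card + ((Finset.range (t+1)).filter (fun i => ¬ AHd R s Ty x1 (z i) false)).card := by
    refine le_trans ?_ (Finset.card_union_le _ _)
    apply Finset.card_le_card_of_injOn nx
    · intro i hi
      have h1 := mM i hi
      have h2 := h1.2.2.2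
      have h3 : nx i ∈ Finset.range (t+1) := by have := nxt i h1.1; simp; omega
      cases h4 : h (z (nx i)) <;> rw [h4] at h2
      · exact Finset.mem_union_left _ (Finset.mem_filter.2 ⟨h3, h2⟩)
      · exact Finset.mem_union_right _ (Finset.mem_filter.2 ⟨h3, h2⟩)
    · intro i hi j hj hij; exact nxi i (mM i hi).1 j (mM j hj).1 hij
  have t1 := cT M1 false (fun i hi => M1m i hi)
  have t2 := cT M2 true (fun i hi => M2m i hi)
  obtain ⟨f, f1, f2, f3, f4, f5, f6⟩ := units R K1 K2 Zs Dm Am J1 J2 (5 * κ)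
    ((((Finset.range (t+1)).filter (fun i => ¬ AHd R s Ty x1 (z i) true)).card + ((Finset.range (t+1)).filter (fun i => ¬ ATd R h Ty x1 (z i) false)).card + Am.card + 2) - Dm.card)
    ((((Finset.range (t+1)).filter (fun i => ¬ AHd R s Ty x1 (z i) false)).card + ((Finset.range (t+1)).filter (fun i => ¬ ATd R h Ty x1 (z i) true)).card + Dm.card + 2) - Am.card) hJJ
    (fun p hp => Tl p (KT p hp)) hdis
    (by intro p hp; rw [Finset.union_assoc]; exact TW p (KT p hp)) hDA hDZ hAZ (by omega) (by omega) (by omega)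
    (fun d hd => ⟨fun p hp => ((K1p p hp).2.2.2.2 d (DW d hd)).1.1 (by simpa using (Dm1 d hd).2.2),
      fun p hp => ((K2p p hp).2.2.2.2 d (DW d hd)).2.1 (by simpa using (Dm1 d hd).2.1)⟩)
    (fun d hd => ⟨fun p hp => ((K2p p hp).2.2.2.2 d (AW d hd)).1.1 (by simpa using (Am1 d hd).2.2),
      fun p hp => ((K1p p hp).2.2.2.2 d (AW d hd)).2.1 (by simpa using (Am1 d hd).2.1)⟩)
    (by
      intro p hp q hq
      by_cases hr : R p q
      · exact Or.inl ⟨hr, near1 p hp⟩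
      · right
        exact hc true Dm Am p q hp hq rfl hDA (fun d hd => ⟨DW d hd, (Dm1 d hd).2⟩) (fun d hd => ⟨AW d hd, (Am1 d hd).2⟩) hr)
    (by
      intro p hp q hq
      by_cases hr : R p q
      · exact Or.inl ⟨hr, near2 p hp⟩
      · right
        exact hc false Am Dm p q hp hq (Finset.union_comm _ _) hDA.symm (fun d hd => ⟨AW d hd, (Am1 d hd).2⟩) (fun d hd => ⟨DW d hd, (Dm1 d hd).2⟩) hr)
    Dm2 Am2 (by omega) (by omega) (by omega)
  have fT : ∀ i ∈ J, f i 0 ∈ Ty ∧ f i 2 ∈ Ty := by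
    intro i hi
    rcases Finset.mem_union.1 hi with hi | hi
    · exact ⟨(K1p _ (f2 i hi).1).1, (K2p _ (f2 i hi).2).1⟩
    · exact ⟨(K2p _ (f3 i hi).1).1, (K1p _ (f3 i hi).2).1⟩
  -- the charge vanishes
  have Q0 : ∀ σ, ∑ i ∈ Finset.range (t+1), (ind (s (z i)) σ - ind (h (z i)) σ) + ∑ i ∈ J, (ind (s (f i 2)) σ - ind (h (f i 0)) σ) = 0 := by
    intro σ
    have a1 : ∑ i ∈ J1, (ind (s (f i 2)) σ - ind (h (f i 0)) σ) = ∑ i ∈ J1, (ind false σ - ind true σ) := by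
      apply Finset.sum_congr rfl; intro i hi; rw [(K1p _ (f2 i hi).1).2.1, (K2p _ (f2 i hi).2).2.2.1]
    have a2 : ∑ i ∈ J2, (ind (s (f i 2)) σ - ind (h (f i 0)) σ) = ∑ i ∈ J2, (ind true σ - ind false σ) := by
      apply Finset.sum_congr rfl; intro i hi; rw [(K2p _ (f3 i hi).1).2.1, (K1p _ (f3 i hi).2).2.2.1]
    have a3 : ∑ i ∈ Finset.range (t+1), ind (h (z i)) σ = ∑ i ∈ Finset.range (t+1), ind (h (z (nx i))) σ := by
      rw [Finset.sum_range_succ', Finset.sum_range_succ, nx2]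
      congr 1
      apply Finset.sum_congr rfl; intro i hi; rw [nx1 i (by simpa using hi)]
    have a4 : ∑ i ∈ Finset.range (t+1), (ind (s (z i)) σ - ind (h (z (nx i))) σ) = ∑ i ∈ Mm, (ind (s (z i)) σ - ind (h (z (nx i))) σ) := by
      symm
      apply Finset.sum_subset (Finset.filter_subset _ _)
      intro i hi hn
      have : h (z (nx i)) = s (z i) := by
        by_contra hh; exact hn (Finset.mem_filter.2 ⟨hi, hh⟩)
      rw [this]; ring
    have a5 : ∑ i ∈ M1, (ind (s (z i)) σ - ind (h (z (nx i))) σ) = ∑ i ∈ M1, (ind true σ - ind false σ) := by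
      apply Finset.sum_congr rfl; intro i hi
      rw [(mM i (M1m i hi).1).2.1, (M1m i hi).2]; rfl
    have a6 : ∑ i ∈ M2, (ind (s (z i)) σ - ind (h (z (nx i))) σ) = ∑ i ∈ M2, (ind false σ - ind true σ) := by
      apply Finset.sum_congr rfl; intro i hi
      rw [(mM i (M2m i hi).1).2.1, (M2m i hi).2]; rfl
    rw [hJ, Finset.sum_union hJJ, a1, a2]
    rw [Finset.sum_sub_distrib, a3, ← Finset.sum_sub_distrib, a4, ← MU, Finset.sum_union M12, a5, a6]
    simp only [Finset.sum_const, nsmul_eq_mul]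
    rw [J1c, J2c]; push_cast; ring
  have nn : ∀ p : Prop, 0 ≤ iP p := by intro p; unfold iP; split_ifs <;> simp
  have exf : ∀ σ, ¬ Many R s h Ty x1 (qb + 2 * κ) σ → (∀ i ∈ J, ind (h (f i 2)) σ - ind (s (f i 0)) σ + 1 - iP (¬ ATd R h Ty x1 (f i 1) (!σ)) - iP (¬ AHd R s Ty x1 (f i 1) σ) ≤ 0) →
      (∑ i ∈ Finset.range (t+1), (ind (s (z i)) σ - ind (h (z i)) σ + 1 - iP (¬ ATd R h Ty x1 (z i) (!σ)) - iP (¬ AHd R s Ty x1 (z i) σ))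
        + ∑ i ∈ J, (ind (s (f i 2)) σ - ind (h (f i 0)) σ + 3 - ∑ c, (iP (¬ ATd R h Ty x1 (f i c) (!σ)) + iP (¬ AHd R s Ty x1 (f i c) σ)))
        ≤ t + 1) := by
    intro σ hmany hle
    have h1 := e4 σ
    have h2 : ∑ i ∈ J, (ind (s (f i 2)) σ - ind (h (f i 0)) σ + 3 - ∑ c, (iP (¬ ATd R h Ty x1 (f i c) (!σ)) + iP (¬ AHd R s Ty x1 (f i c) σ))) ≤ 0 := by
      apply Finset.sum_nonpos; intro i hi
      have h3 := hle i hi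
      rcases Finset.mem_union.1 hi with hi | hi
      · rw [unit_term D σ (f i) ((K1p _ (f2 i hi).1).2.2.2.1 σ hmany) ((K2p _ (f2 i hi).2).2.2.2.1 σ hmany)]; exact h3
      · rw [unit_term D σ (f i) ((K2p _ (f3 i hi).1).2.2.2.1 σ hmany) ((K1p _ (f3 i hi).2).2.2.2.1 σ hmany)]; exact h3
    have h5 := add_le_add (le_trans (le_add_of_nonneg_right (Int.natCast_nonneg _)) h1) h2
    rw [add_zero] at h5
    exact h5
  refine E_fin D N (2 * x1) κ qb ns (fun x y => y = x) J f (by omega) (by omega) hqb hns hd hmw hN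
    ?_ ?_ ?_ ?_ (by omega) ?_ ?_ hX' ?_ (by omega) (Or.inr ?_)
  · intro j hj c i hi hh
    exact (f1 j hj).2.2 c (hh ▸ zZ i hi)
  · intro i hi; exact ⟨(f1 i hi).1, (f1 i hi).2.1, fT i hi⟩
  · intro i hi c j hj c' hh; exact f4 i hi j hj c c' hh
  · intro σ
    by_cases hmany : Many R s h Ty x1 (qb + 2 * κ) σ
    · right; right; exact hmany
    · cases σ
      · rcases Dm3 with hh | hh
        · left
          apply exf false hmany
          intro i hi
          have n1 := nn (¬ ATd R h Ty x1 (f i 1) true)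
          have n2 := nn (¬ AHd R s Ty x1 (f i 1) false)
          rcases Finset.mem_union.1 hi with hi | hi
          · have hm := surj_mid J1 (fun i => f i 1) Dm hh f5 i hi
            have hm2 := (Dm1 _ hm).2
            rw [iP1 _ hm2.1, iP1 _ hm2.2, (K1p _ (f2 i hi).1).2.2.1, (K2p _ (f2 i hi).2).2.1]
            simp [ind]
          · rw [(K2p _ (f3 i hi).1).2.2.1, (K1p _ (f3 i hi).2).2.1]
            simp only [ind, Bool.not_false]
            simp only [if_true, if_false, reduceCtorEq]
            linarith only [n1, n2]
        · right; left
          refine ⟨Q0 false, ?_⟩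
          intro v v1 v2 ⟨v3, v4⟩
          obtain ⟨i, hi, hv⟩ := f5 v (hh v ((zZ' v).2 v1) v3 v4)
          exact v2 i (Finset.mem_union_left _ hi) 1 hv.symm
      · rcases Am3 with hh | hh
        · left
          apply exf true hmany
          intro i hi
          have n1 := nn (¬ ATd R h Ty x1 (f i 1) false)
          have n2 := nn (¬ AHd R s Ty x1 (f i 1) true)
          rcases Finset.mem_union.1 hi with hi | hi
          · rw [(K1p _ (f2 i hi).1).2.2.1, (K2p _ (f2 i hi).2).2.1]
            simp only [ind, Bool.not_true]
            simp only [if_true, if_false, reduceCtorEq]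
            linarith only [n1, n2]
          · have hm := surj_mid J2 (fun i => f i 1) Am hh f6 i hi
            have hm2 := (Am1 _ hm).2
            rw [iP1 _ hm2.1, iP1 _ hm2.2, (K2p _ (f3 i hi).1).2.2.1, (K1p _ (f3 i hi).2).2.1]
            simp [ind]
        · right; left
          refine ⟨Q0 true, ?_⟩
          intro v v1 v2 ⟨v3, v4⟩
          obtain ⟨i, hi, hv⟩ := f6 v (hh v ((zZ' v).2 v1) v3 v4)
          exact v2 i (Finset.mem_union_right _ hi) 1 hv.symm
  · intro i hi hiJ
    have hN4 := hN i hi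
    have z0 := ZW i (by omega)
    have z1 := ZW (i+1) (by omega)
    rcases Jlt i hi hiJ with ⟨hj, hm⟩ | ⟨hj, hm⟩
    · obtain ⟨-, h2, h3, h4⟩ := mM i (M1m i hm).1
      rw [nx1 i hi] at h2 h4
      have h5 := missH D hM (z (i+1)) (h (z (i+1))) h4
      have g1 := (K1p _ (f2 i hj).1).2.2.2.2 _ z0
      have g2 := (K2p _ (f2 i hj).2).2.2.2.2 _ z1
      have c := (M1m i hm).2
      rw [c] at h2 h3
      refine ⟨g1.2.1 h3, by rw [c, (K1p _ (f2 i hj).1).2.1], ?_, ?_, h5⟩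
      · intro _
        apply g2.1.1
        rw [h2] at h4; simpa using h4
      · rw [conn_Y, (K2p _ (f2 i hj).2).2.2.1, h2]; rfl
    · obtain ⟨-, h2, h3, h4⟩ := mM i (M2m i hm).1
      rw [nx1 i hi] at h2 h4
      have h5 := missH D hM (z (i+1)) (h (z (i+1))) h4
      have g1 := (K2p _ (f3 i hj).1).2.2.2.2 _ z0
      have g2 := (K1p _ (f3 i hj).2).2.2.2.2 _ z1
      have c := (M2m i hm).2
      rw [c] at h2 h3
      refine ⟨g1.2.1 h3, by rw [c, (K2p _ (f3 i hj).1).2.1], ?_, ?_, h5⟩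
      · intro _
        apply g2.1.1
        rw [h2] at h4; simpa using h4
      · rw [conn_Y, (K1p _ (f3 i hj).2).2.2.1, h2]; rfl
  · intro i hi hiJ a b ha hb
    rw [conn_Y]
    have h1 : h (z (i+1)) = s (z i) := by
      by_contra h1
      apply hiJ
      have : i ∈ Mm := Finset.mem_filter.2 ⟨by simp; omega, by rw [nx1 i hi]; exact h1⟩
      rw [← MU] at this
      rcases Finset.mem_union.1 this with hh | hh
      · exact Finset.mem_union_left _ (Finset.mem_union_left _ hh)
      · exact Finset.mem_union_right _ (Finset.mem_union_left _ hh)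
    rw [ha, ← hb, h1]
  · intro a b hab
    subst hab
    have := hsz b
    omega
  · have htJ : t ∈ J := by
      rcases eeM with hh | hh
      · rw [← MU] at hh
        rcases Finset.mem_union.1 hh with hh | hh
        · exact Finset.mem_union_left _ (Finset.mem_union_left _ hh)
        · exact Finset.mem_union_right _ (Finset.mem_union_left _ hh)
      · exact Finset.mem_union_left _ (Finset.mem_union_right _ hh)
    refine ⟨t, htJ, le_rfl, ?_⟩
    rcases Finset.mem_union.1 htJ with hi | hi
    · rw [(K1p _ (f2 t hi).1).2.1, (K2p _ (f2 t hi).2).2.2.1]; simp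
    · rw [(K2p _ (f3 t hi).1).2.1, (K1p _ (f3 t hi).2).2.2.1]; simp
end

/-- degree hypotheses for the contracted digraph -/
structure DG {V : Type*} [Fintype V] (R : V → V → Prop) (z : ℕ → V) (t m : ℕ) : Prop where
  hm : Fintype.card V = m
  hdeg : ∀ p q, m + (t+1) ≤ (Finset.univ.filter (fun v => R p v)).card + (Finset.univ.filter (fun v => R v q)).card
  hl : ∀ v, (∀ i ≤ t, v ≠ z i) → ¬ R v v
  hzi : ∀ i ≤ t, ∀ j ≤ t, z i = z j → i = j
  hdo : ∀ v, m ≤ 2 * (Finset.univ.filter (fun u => R v u)).card + 3 * (t+1)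
  hdi : ∀ v, m ≤ 2 * (Finset.univ.filter (fun u => R u v)).card + 3 * (t+1)

section
variable {V : Type*} [Fintype V] {R : V → V → Prop} {z : ℕ → V} {t m : ℕ}

theorem preED (G : DG R z t m) (s h : V → Bool) (Ty : Finset V) (e0 nt x1 w : ℕ)
    (hz : ∀ i ≤ t, z i ∉ Ty)
    (near1 : ∀ u ∈ Ty, (Ty.filter (fun v => h v = s u ∧ ¬ R u v)).card ≤ e0)
    (near2 : ∀ v ∈ Ty, (Ty.filter (fun u => s u = h v ∧ ¬ R u v)).card ≤ e0)
    (hnt : (Finset.univ \ Ty).card ≤ nt)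
    (hws : ∀ σ, m ≤ 2 * (Ty.filter (fun v => s v = σ)).card + w)
    (hwh : ∀ σ, m ≤ 2 * (Ty.filter (fun v => h v = σ)).card + w)
    (n1 : 2 * (2 * x1 + nt) + 3 * (t + 1) ≤ m) (n2 : 2 * (x1 + e0) + w ≤ m) :
    ∃ s' h', (∀ v ∈ Ty, s' v = s v ∧ h' v = h v) ∧ ED R z t s' h' Ty m e0 nt x1 w := by
  let s' : V → Bool := fun v => if ATd R h Ty x1 v (s v) then s v else !s v
  let h' : V → Bool := fun v => if AHd R s Ty x1 v (h v) then h v else !h v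
  have tT : ∀ v ∈ Ty, ATd R h Ty x1 v (s v) := by
    intro u hu
    have a1 := near1 u hu
    have a2 := hwh (s u)
    have a3 := Finset.card_filter_add_card_filter_not (s := Ty.filter (fun v => h v = s u)) (fun v => R u v)
    rw [Finset.filter_filter, Finset.filter_filter] at a3
    unfold ATd; omega
  have tH : ∀ v ∈ Ty, AHd R s Ty x1 v (h v) := by
    intro u hu
    have a1 := near2 u hu
    have a2 := hws (h u)
    have a3 := Finset.card_filter_add_card_filter_not (s := Ty.filter (fun v => s v = h u)) (fun v => R v u)
    rw [Finset.filter_filter, Finset.filter_filter] at a3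
    unfold AHd; omega
  have hT : ∀ v ∈ Ty, s' v = s v ∧ h' v = h v := by
    intro v hv; simp only [s', h', tT v hv, tH v hv, if_true]; exact ⟨trivial, trivial⟩
  have eAT := ATd_congr (R := R) (x1 := x1) fun v hv => (hT v hv).2
  have eAH := AHd_congr (R := R) (x1 := x1) fun v hv => (hT v hv).1
  have split : ∀ (g : V → Bool) (σ : Bool) (P : V → Prop) [DecidablePred P], m ≤ 2 * (Finset.univ.filter P).card + 3 * (t+1) →
      x1 ≤ (Ty.filter (fun v => g v = σ ∧ P v)).card ∨ x1 ≤ (Ty.filter (fun v => g v = (!σ) ∧ P v)).card := by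
    intro g σ P _ hP
    have h3 : Finset.univ.filter P ⊆ (Ty.filter (fun v => g v = σ ∧ P v) ∪ Ty.filter (fun v => g v = (!σ) ∧ P v)) ∪ (Finset.univ \ Ty) := by
      intro v hv
      have hv := (Finset.mem_filter.1 hv).2
      by_cases hT : v ∈ Ty
      · apply Finset.mem_union_left
        by_cases hs : g v = σ
        · exact Finset.mem_union_left _ (Finset.mem_filter.2 ⟨hT, hs, hv⟩)
        · exact Finset.mem_union_right _ (Finset.mem_filter.2 ⟨hT, bool_ne _ _ hs, hv⟩)
      · exact Finset.mem_union_right _ (by simp [hT])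
    have h4 := (Finset.card_le_card h3).trans ((Finset.card_union_le _ _).trans (Nat.add_le_add_right (Finset.card_union_le _ _) _))
    omega
  refine ⟨s', h', hT, ⟨G.hm, G.hdeg, G.hl, G.hzi, hz, ?_, ?_, ?_, ?_, hnt, ?_, ?_, G.hdo, G.hdi⟩⟩
  · intro v; rw [eAT]
    by_cases h1 : ATd R h Ty x1 v (s v)
    · simp only [s', h1, if_true]
    · simp only [s', h1, if_false]
      rcases split h (s v) (fun u => R v u) (G.hdo v) with h2 | h2
      · exact absurd h2 h1
      · exact h2
  · intro v; rw [eAH]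
    by_cases h1 : AHd R s Ty x1 v (h v)
    · simp only [h', h1, if_true]
    · simp only [h', h1, if_false]
      rcases split s (h v) (fun u => R u v) (G.hdi v) with h2 | h2
      · exact absurd h2 h1
      · exact h2
  · intro u hu
    rw [filter_on (fun v => h' v = s' u ∧ ¬ R u v) (fun v => h v = s u ∧ ¬ R u v)]
    · exact near1 u hu
    · intro v hv; rw [(hT v hv).2, (hT u hu).1]
  · intro u hu
    rw [filter_on (fun v => s' v = h' u ∧ ¬ R v u) (fun v => s v = h u ∧ ¬ R v u)]
    · exact near2 u hu
    · intro v hv; rw [(hT v hv).1, (hT u hu).2]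
  · intro σ
    rw [filter_on (fun v => s' v = σ) (fun v => s v = σ)]
    · exact hws σ
    · intro v hv; rw [(hT v hv).1]
  · intro σ
    rw [filter_on (fun v => h' v = σ) (fun v => h v = σ)]
    · exact hwh σ
    · intro v hv; rw [(hT v hv).2]

/-- throwing out a small part of the typical vertices -/
theorem preED_sub (G : DG R z t m) (s h : V → Bool) (Ty : Finset V) (e0 nt w x : ℕ) (P : V → Prop) [DecidablePred P]
    (hz : ∀ i ≤ t, z i ∉ Ty)
    (near1 : ∀ u ∈ Ty, (Ty.filter (fun v => h v = s u ∧ ¬ R u v)).card ≤ e0)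
    (near2 : ∀ v ∈ Ty, (Ty.filter (fun u => s u = h v ∧ ¬ R u v)).card ≤ e0)
    (hnt : (Finset.univ \ Ty).card ≤ nt)
    (hws : ∀ σ, m ≤ 2 * (Ty.filter (fun v => s v = σ)).card + w)
    (hwh : ∀ σ, m ≤ 2 * (Ty.filter (fun v => h v = σ)).card + w)
    (hP : (Ty.filter (fun v => ¬ P v)).card ≤ x) :
    (∀ i ≤ t, z i ∉ Ty.filter P) ∧
    (∀ u ∈ Ty.filter P, ((Ty.filter P).filter (fun v => h v = s u ∧ ¬ R u v)).card ≤ e0) ∧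
    (∀ v ∈ Ty.filter P, ((Ty.filter P).filter (fun u => s u = h v ∧ ¬ R u v)).card ≤ e0) ∧
    ((Finset.univ \ Ty.filter P).card ≤ nt + x) ∧
    (∀ σ, m ≤ 2 * ((Ty.filter P).filter (fun v => s v = σ)).card + (w + 2 * x)) ∧
    (∀ σ, m ≤ 2 * ((Ty.filter P).filter (fun v => h v = σ)).card + (w + 2 * x)) := by
  have sub := Finset.filter_subset P Ty
  have cnt : ∀ (g : V → Bool) (σ : Bool), m ≤ 2 * (Ty.filter (fun v => g v = σ)).card + w → m ≤ 2 * ((Ty.filter P).filter (fun v => g v = σ)).card + (w + 2 * x) := by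
    intro g σ hg
    have : Ty.filter (fun v => g v = σ) ⊆ (Ty.filter P).filter (fun v => g v = σ) ∪ Ty.filter (fun v => ¬ P v) := by
      intro v hv
      obtain ⟨a, b⟩ := Finset.mem_filter.1 hv
      by_cases hPv : P v
      · exact Finset.mem_union_left _ (Finset.mem_filter.2 ⟨Finset.mem_filter.2 ⟨a, hPv⟩, b⟩)
      · exact Finset.mem_union_right _ (Finset.mem_filter.2 ⟨a, hPv⟩)
    have := (Finset.card_le_card this).trans (Finset.card_union_le _ _)
    omega
  refine ⟨fun i hi hh => hz i hi (sub hh), ?_, ?_, ?_, fun σ => cnt s σ (hws σ), fun σ => cnt h σ (hwh σ)⟩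
  · intro u hu
    exact (Finset.card_le_card (Finset.filter_subset_filter _ sub)).trans (near1 u (sub hu))
  · intro u hu
    exact (Finset.card_le_card (Finset.filter_subset_filter _ sub)).trans (near2 u (sub hu))
  · have : Finset.univ \ Ty.filter P ⊆ (Finset.univ \ Ty) ∪ Ty.filter (fun v => ¬ P v) := by
      intro v hv
      by_cases hT : v ∈ Ty
      · apply Finset.mem_union_right
        refine Finset.mem_filter.2 ⟨hT, fun hPv => ?_⟩
        exact (Finset.mem_sdiff.1 hv).2 (Finset.mem_filter.2 ⟨hT, hPv⟩)
      · exact Finset.mem_union_left _ (Finset.mem_sdiff.2 ⟨by simp, hT⟩)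
    have := (Finset.card_le_card this).trans (Finset.card_union_le _ _)
    omega

set_option maxHeartbeats 1000000 in
theorem E_modes (G : DG R z t m) (s h : V → Bool) (Ty : Finset V) (y κ : ℕ) (N : ℕ → ℕ)
    (hz : ∀ i ≤ t, z i ∉ Ty)
    (near1 : ∀ u ∈ Ty, (Ty.filter (fun v => h v = s u ∧ ¬ R u v)).card ≤ y)
    (near2 : ∀ v ∈ Ty, (Ty.filter (fun u => s u = h v ∧ ¬ R u v)).card ≤ y)
    (hnt : (Finset.univ \ Ty).card ≤ 6 * y)
    (hws : ∀ σ, m ≤ 2 * (Ty.filter (fun v => s v = σ)).card + 13 * y)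
    (hwh : ∀ σ, m ≤ 2 * (Ty.filter (fun v => h v = σ)).card + 13 * y)
    (hN : ∀ i < t, 4 ≤ N i) (hNs : ∑ i ∈ Finset.range t, N i ≤ y)
    (hκ : κ = 4 * (t + 3)) (hκy : 2 ^ (5 * κ) * (5 * κ) + 5 * κ ≤ y)
    (hy : 1000000 * (κ * y) + 2000000 * y ≤ m) : HamOut R z t N := by
  have y1 : κ ≤ y := by
    have : 0 ≤ 2 ^ (5 * κ) * (5 * κ) := Nat.zero_le _
    omega
  have ty : t + 3 ≤ y := by omega
  have hdn : ∀ c, 5261 * y ≥ c * y → 16 * (c * y) * (2 + κ) < m ∨ y = 0 := by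
    intro c hc
    have : 16 * (c * y) * (2 + κ) ≤ 16 * (5261 * y) * (2 + κ) := Nat.mul_le_mul_right _ (by omega)
    have e : 16 * (5261 * y) * (2 + κ) = 84176 * (κ * y) + 168352 * y := by ring
    omega
  have kk : κ * (6 * (5000 * y)) = 30000 * (κ * y) := by ring
  have big : ∀ (s h : V → Bool) (Ty : Finset V) (c : Bool → Bool), (c = id ∨ c = not) →
      (∀ i ≤ t, z i ∉ Ty) →
      (∀ u ∈ Ty, (Ty.filter (fun v => h v = s u ∧ ¬ R u v)).card ≤ y) →
      (∀ v ∈ Ty, (Ty.filter (fun u => s u = h v ∧ ¬ R u v)).card ≤ y) →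
      ((Finset.univ \ Ty).card ≤ 261 * y) →
      (∀ σ, m ≤ 2 * (Ty.filter (fun v => s v = σ)).card + 523 * y) →
      (∀ σ, m ≤ 2 * (Ty.filter (fun v => h v = σ)).card + 523 * y) →
      (∀ v ∈ Ty, s v = c (h v)) → HamOut R z t N := by
    intro s h Ty c hc hz n1 n2 hnt hws hwh hX
    obtain ⟨s', h', e, D⟩ := preED G s h Ty y (261 * y) (5000 * y) (523 * y) hz n1 n2 hnt hws hwh (by omega) (by omega)
    have hX' : ∀ v ∈ Ty, s' v = c (h' v) := by intro v hv; rw [(e v hv).1, (e v hv).2]; exact hX v hv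
    have hsz : ∀ a, m ≤ 2 * (Ty.filter (fun v => h' v = a ∧ s' v = c a)).card + 523 * y := by
      intro a
      have := D.hwh a
      have e2 : Ty.filter (fun v => h' v = a ∧ s' v = c a) = Ty.filter (fun v => h' v = a) := by
        apply Finset.filter_congr; intro v hv
        constructor
        · exact fun h => h.1
        · intro h1; exact ⟨h1, by rw [hX' v hv, h1]⟩
      rw [e2]; exact this
    have hd : 16 * (5000 * y + 261 * y) * (2 + κ) < m := by
      have := hdn 5261 le_rfl
      rw [show 5000 * y + 261 * y = 5261 * y by ring]
      omega
    rcases hc with rfl | rfl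
    · refine modeY D N (523 * y + 2 * κ) (261 * y + 2 * (523 * y + 2 * κ)) κ hX' (by omega) rfl rfl hd (by omega) hN (by omega) (by omega) ?_ (by omega)
      intro a
      have := hsz a
      simp only [id] at this
      rw [kk]; omega
    · refine modeX D N (523 * y + 2 * κ) (261 * y + 2 * (523 * y + 2 * κ)) κ hX' (by omega) rfl rfl hd (by omega) hN (by omega) (by omega) ?_ (by omega)
      intro a
      have := hsz a
      rw [kk]; omega
  have kd : ∀ a b, Ty.filter (fun v => h v = a ∧ s v = b) = (Ty.filter (fun v => h v = a)).filter (fun v => s v = b) := by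
    intro a b; rw [Finset.filter_filter]
  have half : ∀ (F : Finset V) (g : V → Bool), (F.filter (fun v => g v = true)).card + (F.filter (fun v => g v = false)).card = F.card := by
    intro F g
    have := Finset.card_filter_add_card_filter_not (s := F) (fun v => g v = true)
    simpa using this
  have TyM : Ty.card ≤ m := by rw [← G.hm]; exact Finset.card_le_univ _
  have k1 := half (Ty.filter (fun v => h v = true)) s
  have k2 := half (Ty.filter (fun v => h v = false)) s
  have k3 := half (Ty.filter (fun v => s v = true)) h
  have k4 := half (Ty.filter (fun v => s v = false)) h
  have k5 := half Ty s
  have k6 := half Ty h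
  simp only [Finset.filter_filter] at k1 k2 k3 k4
  simp only [and_comm (a := s _ = _)] at k3 k4
  have w1 := hws true
  have w2 := hws false
  have w3 := hwh true
  have w4 := hwh false
  have drop : ∀ (c : Bool → Bool), (c = id ∨ c = not) → (Ty.filter (fun v => h v = true ∧ s v = !c true)).card + (Ty.filter (fun v => h v = false ∧ s v = !c false)).card ≤ 255 * y →
      HamOut R z t N := by
    intro c hc hle
    have hP : (Ty.filter (fun v => ¬ (s v = c (h v)))).card ≤ 255 * y := by
      refine le_trans (le_trans (Finset.card_le_card ?_) (Finset.card_union_le _ _)) hle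
      intro v hv
      obtain ⟨a, b⟩ := Finset.mem_filter.1 hv
      have b := bool_ne _ _ b
      cases hh : h v
      · exact Finset.mem_union_right _ (Finset.mem_filter.2 ⟨a, hh, by rw [b, hh]⟩)
      · exact Finset.mem_union_left _ (Finset.mem_filter.2 ⟨a, hh, by rw [b, hh]⟩)
    obtain ⟨a1, a2, a3, a4, a5, a6⟩ := preED_sub G s h Ty y (6 * y) (13 * y) (255 * y) (fun v => s v = c (h v)) hz near1 near2 hnt hws hwh hP
    refine big s h _ c hc a1 a2 a3 (by omega) (fun σ => ?_) (fun σ => ?_) (fun v hv => (Finset.mem_filter.1 hv).2)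
    · have := a5 σ; omega
    · have := a6 σ; omega
  by_cases c1 : (Ty.filter (fun v => h v = true ∧ s v = true)).card < 121 * y ∨ (Ty.filter (fun v => h v = false ∧ s v = false)).card < 121 * y
  · apply drop not (Or.inr rfl)
    simp only [Bool.not_true, Bool.not_false]
    omega
  by_cases c2 : (Ty.filter (fun v => h v = true ∧ s v = false)).card < 121 * y ∨ (Ty.filter (fun v => h v = false ∧ s v = true)).card < 121 * y
  · apply drop id (Or.inl rfl)
    simp only [id, Bool.not_true, Bool.not_false]
    omega
  push Not at c1 c2
  obtain ⟨s', h', e, D⟩ := preED G s h Ty y (6 * y) (5000 * y) (13 * y) hz near1 near2 hnt hws hwh (by omega) (by omega)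
  have hd : 16 * (5000 * y + 6 * y) * (2 + κ) < m := by
    have := hdn 5006 (by omega)
    rw [show 5000 * y + 6 * y = 5006 * y by ring]
    omega
  refine modeM D N (13 * y + 2 * κ) (6 * y + 2 * (13 * y + 2 * κ)) κ (by omega) rfl rfl hd (by omega) hN (by omega) ?_ (by omega)
  intro a b
  have e2 : Ty.filter (fun v => h' v = a ∧ s' v = b) = Ty.filter (fun v => h v = a ∧ s v = b) := by
    apply Finset.filter_congr; intro v hv; rw [(e v hv).1, (e v hv).2]
  rw [e2]
  cases a <;> cases b <;> omega
end

section
variable {V : Type*} [Fintype V] {R : V → V → Prop} {z : ℕ → V} {t m : ℕ}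

theorem card_filter_mul_le {ι : Type*} (s : Finset ι) (f : ι → ℕ) (y : ℕ) :
    (s.filter (fun i => ¬ f i ≤ y)).card * (y+1) ≤ ∑ i ∈ s, f i := by
  calc _ = ∑ i ∈ s.filter (fun i => ¬ f i ≤ y), (y+1) := by
        simp only [Finset.sum_const, smul_eq_mul]
    _ ≤ ∑ i ∈ s.filter (fun i => ¬ f i ≤ y), f i := by
        apply Finset.sum_le_sum; intro i hi
        have := (Finset.mem_filter.1 hi).2
        omega
    _ ≤ _ := Finset.sum_le_sum_of_subset (Finset.filter_subset _ _)

theorem dc {α β : Type*} (s : Finset α) (u : Finset β) (P : α → β → Prop) [∀ a b, Decidable (P a b)] :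
    ∑ a ∈ s, (u.filter (fun b => P a b)).card = ∑ b ∈ u, (s.filter (fun a => P a b)).card :=
  Finset.sum_card_bipartiteAbove_eq_sum_card_bipartiteBelow P

theorem markov_num (B Q y m Mi : ℕ) (h0 : 0 < m) (hB : B * (y+1) ≤ Mi) (hy : m ≤ Q * y)
    (hM : 2 * (Q^2 * Mi) ≤ 5 * m^2) : 2 * B ≤ 5 * y := by
  have hQ : 0 < Q := by
    rcases Nat.eq_zero_or_pos Q with h | h
    · subst h; simp at hy; omega
    · exact h
  have h1 : 2 * (B * Q * m) * m ≤ (5 * Q * y) * m * m := by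
    have : B * m ≤ Q * Mi := by
      calc B * m ≤ B * (Q * y) := Nat.mul_le_mul_left _ hy
        _ = Q * (B * y) := by ring
        _ ≤ Q * Mi := Nat.mul_le_mul_left _ (by nlinarith)
    calc 2 * (B * Q * m) * m = 2 * Q * (B * m) * m := by ring
      _ ≤ 2 * Q * (Q * Mi) * m := by gcongr
      _ = 2 * (Q^2 * Mi) * m := by ring
      _ ≤ 5 * m^2 * m := by gcongr
      _ = 5 * m * m * m := by ring
      _ ≤ 5 * (Q * y) * m * m := by gcongr
      _ = _ := by ring
  have h2 : (2 * B) * (Q * m * m) ≤ (5 * y) * (Q * m * m) := by linarith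
  exact Nat.le_of_mul_le_mul_right h2 (by positivity)

set_option maxHeartbeats 2000000 in
theorem E_case (G : DG R z t m) (S0 T0 : Finset V) (p r Q y κ e : ℕ) (N : ℕ → ℕ)
    (h0 : 0 < m) (hS : S0.card = p) (hT : T0.card = p) (hmp : m = 2 * p + r)
    (he : ∑ u ∈ S0, (T0.filter (fun v => R u v)).card ≤ e)
    (hQ1 : Q^2 * (r + 3 * (t+1)) ≤ m) (hQ2 : Q^2 * e ≤ m^2) (hQy : m ≤ Q * y)
    (hry : r ≤ y) (hty : t + 1 ≤ y)
    (hN : ∀ i < t, 4 ≤ N i) (hNs : ∑ i ∈ Finset.range t, N i ≤ y) (hκ : κ = 4 * (t+3))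
    (hκy : 2^(5*κ)*(5*κ)+5*κ ≤ y) (hy : 1000000*(κ*y)+2000000*y ≤ m) : HamOut R z t N := by
  let s : V → Bool := fun v => decide (v ∈ S0)
  let h : V → Bool := fun v => decide (v ∉ T0)
  let om : V → ℕ := fun u => (Finset.univ.filter (fun v => h v = s u ∧ ¬ R u v)).card
  let im : V → ℕ := fun v => (Finset.univ.filter (fun u => h v = s u ∧ ¬ R u v)).card
  have e1 : ∑ u, om u = ∑ v, im v := dc Finset.univ Finset.univ (fun u v => h v = s u ∧ ¬ R u v)
  have hcompl : ∀ (X : Finset V), X.card + (Finset.univ.filter (fun v => v ∉ X)).card = m := by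
    intro X
    rw [← G.hm, ← Finset.card_univ, ← Finset.card_filter_add_card_filter_not (s := Finset.univ) (fun v => v ∈ X)]
    simp
  have gen : ∀ (X : Finset V) (P : V → Prop) [DecidablePred P], X.card = p → m ≤ 2 * (Finset.univ.filter P).card + 3 * (t+1) →
      2 * ((Finset.univ.filter (fun v => v ∉ X)).filter (fun v => ¬ P v)).card ≤ r + 3 * (t+1) + 2 * (X.filter P).card := by
    intro X P _ hX hP
    have a1 := hcompl X
    have a2 := Finset.card_filter_add_card_filter_not (s := Finset.univ.filter (fun v => v ∉ X)) P
    have a3 : Finset.univ.filter P ⊆ X.filter P ∪ (Finset.univ.filter (fun v => v ∉ X)).filter P := by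
      intro v hv; simp only [Finset.mem_union, Finset.mem_filter, Finset.mem_univ, true_and] at hv ⊢; tauto
    have a4 := (Finset.card_le_card a3).trans (Finset.card_union_le _ _)
    omega
  have e2 : 2 * ∑ u, om u ≤ m * (r + 3 * (t+1)) + 4 * e := by
    rw [← Finset.sum_filter_add_sum_filter_not Finset.univ (fun u => u ∈ S0)]
    have b1 : 2 * ∑ u ∈ Finset.univ.filter (fun u => u ∈ S0), om u ≤ p * (r + 3 * (t+1)) + 2 * e := by
      rw [Finset.filter_univ_mem]
      calc _ = ∑ u ∈ S0, 2 * om u := by rw [Finset.mul_sum]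
        _ ≤ ∑ u ∈ S0, (r + 3 * (t+1) + 2 * (T0.filter (fun v => R u v)).card) := by
          apply Finset.sum_le_sum; intro u hu
          have := gen T0 (fun v => R u v) hT (G.hdo u)
          rw [Finset.filter_filter] at this
          refine le_trans (le_of_eq ?_) this
          simp only [om, s, h, hu]
          congr 3; ext v; simp
        _ = p * (r + 3 * (t+1)) + 2 * ∑ u ∈ S0, (T0.filter (fun v => R u v)).card := by
          rw [Finset.sum_add_distrib, Finset.mul_sum, Finset.sum_const, hS, smul_eq_mul]
        _ ≤ _ := by omega
    have b2 : 2 * ∑ u ∈ Finset.univ.filter (fun u => ¬ u ∈ S0), om u ≤ p * (r + 3 * (t+1)) + 2 * e := by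
      have c1 : ∑ u ∈ Finset.univ.filter (fun u => ¬ u ∈ S0), om u = ∑ u ∈ Finset.univ.filter (fun u => ¬ u ∈ S0), (T0.filter (fun v => ¬ R u v)).card := by
        apply Finset.sum_congr rfl; intro u hu
        have hu := (Finset.mem_filter.1 hu).2
        simp only [om, s, h, hu]
        congr 1; ext v; simp
      rw [c1, dc (Finset.univ.filter (fun u => ¬ u ∈ S0)) T0 (fun u v => ¬ R u v)]
      rw [dc S0 T0 R] at he
      calc _ = ∑ v ∈ T0, 2 * ((Finset.univ.filter (fun u => ¬ u ∈ S0)).filter (fun u => ¬ R u v)).card := by rw [Finset.mul_sum]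
        _ ≤ ∑ v ∈ T0, (r + 3 * (t+1) + 2 * (S0.filter (fun u => R u v)).card) := by
          apply Finset.sum_le_sum; intro v hv
          exact gen S0 (fun u => R u v) hS (G.hdi v)
        _ = p * (r + 3 * (t+1)) + 2 * ∑ v ∈ T0, (S0.filter (fun u => R u v)).card := by
          rw [Finset.sum_add_distrib, Finset.mul_sum, Finset.sum_const, hT, smul_eq_mul]
        _ ≤ _ := by omega
    have b3 : 2 * (p * (r + 3 * (t+1))) ≤ m * (r + 3 * (t+1)) := by
      rw [← mul_assoc]; exact Nat.mul_le_mul_right _ (by omega)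
    omega
  have e3 : 2 * (Q^2 * ∑ u, om u) ≤ 5 * m^2 := by
    calc 2 * (Q^2 * ∑ u, om u) = Q^2 * (2 * ∑ u, om u) := by ring
      _ ≤ Q^2 * (m * (r + 3 * (t+1)) + 4 * e) := Nat.mul_le_mul_left _ e2
      _ = m * (Q^2 * (r + 3 * (t+1))) + 4 * (Q^2 * e) := by ring
      _ ≤ m * m + 4 * m^2 := by gcongr
      _ = _ := by ring
  have f1 := markov_num _ Q y m _ h0 (card_filter_mul_le Finset.univ om y) hQy e3
  have f2 := markov_num _ Q y m _ h0 (card_filter_mul_le Finset.univ im y) hQy (e1 ▸ e3)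
  let Ty : Finset V := Finset.univ.filter (fun v => om v ≤ y ∧ im v ≤ y ∧ ∀ i ≤ t, v ≠ z i)
  have hnt : (Finset.univ \ Ty).card ≤ 6 * y := by
    have c1 : Finset.univ \ Ty ⊆ (Finset.univ.filter (fun i => ¬ om i ≤ y) ∪ Finset.univ.filter (fun i => ¬ im i ≤ y)) ∪ (Finset.range (t+1)).image z := by
      intro v hv
      have hv := (mem_sdiff'.1 hv).2
      by_contra hc
      apply hv
      simp only [Finset.mem_union, Finset.mem_filter, Finset.mem_univ, true_and, Finset.mem_image, Finset.mem_range, not_or, not_not] at hc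
      refine Finset.mem_filter.2 ⟨Finset.mem_univ _, hc.1.1, hc.1.2, fun i hi hvz => hc.2 ⟨i, by omega, hvz.symm⟩⟩
    have c2 := Finset.card_le_card c1
    have c3 := Finset.card_union_le (Finset.univ.filter (fun i => ¬ om i ≤ y) ∪ Finset.univ.filter (fun i => ¬ im i ≤ y)) ((Finset.range (t+1)).image z)
    have c4 := Finset.card_union_le (Finset.univ.filter (fun i => ¬ om i ≤ y)) (Finset.univ.filter (fun i => ¬ im i ≤ y))
    have c5 : ((Finset.range (t+1)).image z).card ≤ t + 1 := Finset.card_image_le.trans (by simp)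
    omega
  have sub : ∀ (P : V → Prop) [DecidablePred P], p ≤ (Finset.univ.filter P).card → m ≤ 2 * (Ty.filter P).card + 13 * y := by
    intro P _ hP
    have c1 : Finset.univ.filter P ⊆ Ty.filter P ∪ (Finset.univ \ Ty) := by
      intro v hv
      have hv := (Finset.mem_filter.1 hv).2
      by_cases hvT : v ∈ Ty
      · exact Finset.mem_union_left _ (Finset.mem_filter.2 ⟨hvT, hv⟩)
      · exact Finset.mem_union_right _ (mem_sdiff'.2 ⟨Finset.mem_univ _, hvT⟩)
    have c2 := (Finset.card_le_card c1).trans (Finset.card_union_le _ _)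
    omega
  have sgen : ∀ (X : Finset V), X.card = p → ∀ σ, p ≤ (Finset.univ.filter (fun v => decide (v ∈ X) = σ)).card := by
    intro X hX σ
    have := hcompl X
    cases σ
    · simp only [decide_eq_false_iff_not]; omega
    · simp only [decide_eq_true_eq, Finset.filter_univ_mem]; omega
  refine E_modes G s h Ty y κ N ?_ ?_ ?_ hnt ?_ ?_ hN hNs hκ hκy hy
  · intro i hi hz
    exact (Finset.mem_filter.1 hz).2.2.2 i hi rfl
  · intro u hu
    refine le_trans (Finset.card_le_card ?_) (Finset.mem_filter.1 hu).2.1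
    exact Finset.filter_subset_filter _ (Finset.subset_univ _)
  · intro v hv
    refine le_trans (Finset.card_le_card ?_) (Finset.mem_filter.1 hv).2.2.1
    intro u hu
    have := (Finset.mem_filter.1 hu).2
    exact Finset.mem_filter.2 ⟨Finset.mem_univ _, this.1.symm, this.2⟩
  · intro σ; exact sub _ (sgen S0 hS σ)
  · intro σ
    apply sub
    refine (sgen T0 hT (!σ)).trans (Finset.card_le_card ?_)
    intro v hv
    have := (Finset.mem_filter.1 hv).2
    refine Finset.mem_filter.2 ⟨Finset.mem_univ _, ?_⟩
    simp only [h]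
    cases σ <;> simpa using this
end

section
open Equiv

section
variable {V : Type*} [Fintype V]

theorem swap_merge (σ : Perm V) (x y : V) (h : ¬ σ.SameCycle x y) :
    (∀ u v, σ.SameCycle u v → (σ * swap x y).SameCycle u v) ∧ (σ * swap x y).SameCycle x y := by
  set τ := σ * swap x y with hτ
  have ax : τ x = σ y := by simp [hτ]
  have ay : τ y = σ x := by simp [hτ]
  have ao : ∀ u, u ≠ x → u ≠ y → τ u = σ u := by
    intro u h1 h2; simp [hτ, swap_apply_of_ne_of_ne h1 h2]
  have st : ∀ u, τ.SameCycle u (τ u) := fun u => (Perm.sameCycle_apply_right).2 (Perm.SameCycle.refl _ _)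
  have hw : ∀ i, (∀ i', 1 ≤ i' → i' < i + 1 → (σ ^ i') x ≠ x) → τ.SameCycle (σ x) ((σ ^ (i+1)) x) := by
    intro i
    induction i with
    | zero => intro _; simpa using Perm.SameCycle.refl _ _
    | succ i ih =>
      intro hi
      refine (ih (fun i' h1 h2 => hi i' h1 (by omega))).trans ?_
      have h1 : (σ ^ (i+1)) x ≠ x := hi _ (by omega) (by omega)
      have h2 : (σ ^ (i+1)) x ≠ y := by
        intro hc; exact h ⟨(i+1 : ℕ), by rw [zpow_natCast]; exact hc⟩
      have := st ((σ ^ (i+1)) x)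
      rw [ao _ h1 h2] at this
      rwa [pow_succ' σ (i+1), Perm.mul_apply]
  have hxy : τ.SameCycle x y := by
    have hex : ∃ j, 1 ≤ j ∧ (σ ^ j) x = x := ⟨orderOf σ, orderOf_pos σ, by rw [pow_orderOf_eq_one]; rfl⟩
    obtain ⟨h1, h2⟩ := Nat.find_spec hex
    have h3 := fun i' => Nat.find_min hex (m := i')
    obtain ⟨i, hi⟩ : ∃ i, Nat.find hex = i + 1 := ⟨Nat.find hex - 1, by omega⟩
    rw [hi] at h2 h3
    have h4 := hw i (fun i' a b c => h3 i' b ⟨a, c⟩)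
    rw [h2, ← ay] at h4
    exact h4.symm.trans (st y).symm
  refine ⟨?_, hxy⟩
  have s1 : ∀ u, τ.SameCycle u (σ u) := by
    intro u
    by_cases h1 : u = x
    · subst h1; rw [← ay]; exact hxy.trans (st y)
    by_cases h2 : u = y
    · subst h2; rw [← ax]; exact hxy.symm.trans (st x)
    rw [← ao u h1 h2]; exact st u
  intro u v huv
  obtain ⟨i, hi⟩ := huv.exists_nat_pow_eq
  rw [← hi]
  clear hi
  induction i with
  | zero => exact Perm.SameCycle.refl _ _
  | succ i ih => rw [pow_succ', Perm.mul_apply]; exact ih.trans (s1 _)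

theorem ins (σ : Perm V) (y s t : V) (hs : σ s = s) (ht : σ t = t) (hst : s ≠ t) (hys : y ≠ s) (hyt : y ≠ t) :
    ∃ τ : Perm V, τ y = s ∧ τ s = t ∧ τ t = σ y ∧ (∀ v, v ≠ y → v ≠ s → v ≠ t → τ v = σ v) ∧
      (∀ u v, σ.SameCycle u v → τ.SameCycle u v) ∧ τ.SameCycle y s ∧ τ.SameCycle y t := by
  have fixpow : ∀ (ρ : Perm V) (x w : V), ρ x = x → w ≠ x → ¬ ρ.SameCycle w x := by
    intro ρ x w hx hw hc
    obtain ⟨i, hi⟩ := hc.symm.exists_nat_pow_eq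
    apply hw; rw [← hi]
    exact (Function.IsFixedPt.perm_pow (e := ρ) hx i)
  obtain ⟨a1, a2⟩ := swap_merge σ y s (fixpow σ s y hs hys)
  have ht' : (σ * swap y s) t = t := by
    rw [Perm.mul_apply, swap_apply_of_ne_of_ne hyt.symm hst.symm, ht]
  obtain ⟨b1, b2⟩ := swap_merge (σ * swap y s) s t (fixpow _ t s ht' hst)
  refine ⟨σ * swap y s * swap s t, ?_, ?_, ?_, ?_, fun u v h => b1 _ _ (a1 _ _ h), b1 _ _ a2, (b1 _ _ a2).trans b2⟩
  · rw [Perm.mul_apply, Perm.mul_apply, swap_apply_of_ne_of_ne hys hyt, swap_apply_left, hs]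
  · rw [Perm.mul_apply, Perm.mul_apply, swap_apply_left, swap_apply_of_ne_of_ne hyt.symm hst.symm, ht]
  · rw [Perm.mul_apply, Perm.mul_apply, swap_apply_right, swap_apply_right]
  · intro v h1 h2 h3
    rw [Perm.mul_apply, Perm.mul_apply, swap_apply_of_ne_of_ne h2 h3, swap_apply_of_ne_of_ne h1 h2]
end
end

section
open Equiv

section
variable {V ι : Type*} [Fintype V]

structure MInv (R : V → V → Prop) (u : ι → Fin 3 → V) (b : ι → V) (ZF : Finset V) (φ : V → V)
    (τ : Perm V) (U : Finset ι) (Rp Df : Finset V) : Prop where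
  h1 : ∀ v, v ∉ Df → (∀ i ∈ U, v ≠ u i 1 ∧ v ≠ u i 2) → R v (τ v)
  h2 : ∀ v ∈ ZF, τ v = φ v
  h3 : ∀ i ∈ U, τ (u i 0) = b i ∧ τ (u i 1) = u i 1 ∧ τ (u i 2) = u i 2
  h4 : ∀ v, (∀ i ∈ U, v ≠ u i 1 ∧ v ≠ u i 2) → ∃ r ∈ Rp, τ.SameCycle r v
  inj : ∀ i ∈ U, ∀ j ∈ U, ∀ c d, u i c = u j d → i = j ∧ c = d
  uR : ∀ i ∈ U, R (u i 0) (u i 1) ∧ R (u i 1) (u i 2) ∧ R (u i 2) (b i)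
  uZ : ∀ i ∈ U, ∀ c, u i c ∉ ZF
  rZ : ∀ r ∈ Rp, r ∉ ZF
  rU : ∀ r ∈ Rp, ∀ i ∈ U, ∀ c, r ≠ u i c

variable {R : V → V → Prop} {u : ι → Fin 3 → V} {b : ι → V} {ZF : Finset V} {φ : V → V}
  {τ : Perm V} {U : Finset ι} {Rp Df : Finset V}

theorem ins_inv (h : MInv R u b ZF φ τ U Rp Df) (i : ι) (hi : i ∈ U) (y : V)
    (hyZ : y ∉ ZF) (hyU : ∀ j ∈ U, j ≠ i → ∀ c, y ≠ u j c) (hy1 : y ≠ u i 1) (hy2 : y ≠ u i 2)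
    (r1 : R y (u i 1)) (r2 : R (u i 2) (τ y)) :
    ∃ τ' : Perm V, MInv R u b ZF φ τ' (U.erase i) Rp (Df.erase y) ∧
      (∀ v, v ≠ y → v ≠ u i 1 → v ≠ u i 2 → τ' v = τ v) := by
  have hst : u i 1 ≠ u i 2 := fun hc => by
    have := (h.inj i hi i hi 1 2 hc).2; revert this; decide
  obtain ⟨τ', p1, p2, p3, p4, p5, p6, p7⟩ := ins τ y (u i 1) (u i 2) (h.h3 i hi).2.1 (h.h3 i hi).2.2 hst hy1 hy2
  refine ⟨τ', ?_, p4⟩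
  constructor
  · intro v hv hvU
    by_cases a1 : v = y
    · rw [a1, p1]; exact r1
    by_cases a2 : v = u i 1
    · rw [a2, p2]; exact (h.uR i hi).2.1
    by_cases a3 : v = u i 2
    · rw [a3, p3]; exact r2
    rw [p4 v a1 a2 a3]
    apply h.h1
    · intro hc; exact hv (Finset.mem_erase.2 ⟨a1, hc⟩)
    · intro j hj
      by_cases hji : j = i
      · rw [hji]; exact ⟨a2, a3⟩
      · exact hvU j (Finset.mem_erase.2 ⟨hji, hj⟩)
  · intro v hv
    rw [p4 v, h.h2 v hv]
    · rintro rfl; exact hyZ hv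
    · rintro rfl; exact h.uZ i hi _ hv
    · rintro rfl; exact h.uZ i hi _ hv
  · intro j hj
    obtain ⟨hji, hj⟩ := Finset.mem_erase.1 hj
    have key : ∀ c, τ' (u j c) = τ (u j c) := by
      intro c
      apply p4
      · exact (hyU j hj hji c).symm
      · intro hc; exact hji (h.inj j hj i hi _ _ hc).1
      · intro hc; exact hji (h.inj j hj i hi _ _ hc).1
    rw [key, key, key]; exact h.h3 j hj
  · have cy : ∀ j ∈ U, y ≠ u j 1 ∧ y ≠ u j 2 := by
      intro j hj
      by_cases hji : j = i
      · rw [hji]; exact ⟨hy1, hy2⟩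
      · exact ⟨hyU j hj hji _, hyU j hj hji _⟩
    obtain ⟨r, hr, hry⟩ := h.h4 y cy
    intro v hvU
    by_cases a2 : v = u i 1
    · exact ⟨r, hr, a2 ▸ (p5 _ _ hry).trans p6⟩
    by_cases a3 : v = u i 2
    · exact ⟨r, hr, a3 ▸ (p5 _ _ hry).trans p7⟩
    obtain ⟨r', hr', hrv⟩ := h.h4 v (by
      intro j hj
      by_cases hji : j = i
      · rw [hji]; exact ⟨a2, a3⟩
      · exact hvU j (Finset.mem_erase.2 ⟨hji, hj⟩))
    exact ⟨r', hr', p5 _ _ hrv⟩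
  · exact fun j hj k hk => h.inj j (Finset.mem_of_mem_erase hj) k (Finset.mem_of_mem_erase hk)
  · exact fun j hj => h.uR j (Finset.mem_of_mem_erase hj)
  · exact fun j hj => h.uZ j (Finset.mem_of_mem_erase hj)
  · exact h.rZ
  · exact fun r hr j hj => h.rU r hr j (Finset.mem_of_mem_erase hj)

theorem absorb_rest : ∀ (n : ℕ) (τ : Perm V) (U : Finset ι), U.card = n → MInv R u b ZF φ τ U Rp ∅ →
    ∃ τ', MInv R u b ZF φ τ' ∅ Rp ∅ := by
  intro n
  induction n with
  | zero =>
    intro τ U hU h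
    rw [Finset.card_eq_zero.1 hU] at h
    exact ⟨τ, h⟩
  | succ n ih =>
    intro τ U hU h
    obtain ⟨i, hi⟩ := Finset.card_pos.1 (by omega : 0 < U.card)
    obtain ⟨τ', h', -⟩ := ins_inv h i hi (u i 0) (h.uZ i hi 0)
      (fun j hj hji c hc => hji (h.inj i hi j hj _ _ hc).1.symm)
      (fun hc => by have := (h.inj i hi i hi _ _ hc).2; revert this; decide)
      (fun hc => by have := (h.inj i hi i hi _ _ hc).2; revert this; decide)
      (h.uR i hi).1 (by rw [(h.h3 i hi).1]; exact (h.uR i hi).2.2)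
    exact ih τ' (U.erase i) (by rw [Finset.card_erase_of_mem hi]; omega) (by simpa using h')

theorem merge_all : ∀ (n : ℕ) (τ : Perm V) (U : Finset ι) (Rp : Finset V), Rp.card = n + 1 →
    MInv R u b ZF φ τ U Rp ∅ →
    (∀ p q, 2 * n ≤ (U.filter (fun i => R p (u i 1) ∧ R (u i 2) q)).card) →
    ∃ τ' : Perm V, (∀ v, R v (τ' v)) ∧ (∀ v ∈ ZF, τ' v = φ v) ∧ ∀ v w, τ'.SameCycle v w := by
  intro n
  induction n with
  | zero =>
    intro τ U Rp hRp h _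
    obtain ⟨τ', h'⟩ := absorb_rest U.card τ U rfl h
    obtain ⟨r, hr⟩ := Finset.card_eq_one.1 hRp
    have key : ∀ v, τ'.SameCycle r v := by
      intro v
      obtain ⟨r', hr', hv⟩ := h'.h4 v (by simp)
      rw [hr, Finset.mem_singleton] at hr'
      rwa [← hr']
    exact ⟨τ', fun v => h'.h1 v (by simp) (by simp), h'.h2, fun v w => (key v).symm.trans (key w)⟩
  | succ n ih =>
    intro τ U Rp hRp h hsv
    obtain ⟨y, hy, y', hy', hne⟩ := Finset.one_lt_card.1 (by omega : 1 < Rp.card)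
    have hcard : (Rp.erase y').card = n + 1 := by rw [Finset.card_erase_of_mem hy']; omega
    have hsub : ∀ τ'' : Perm V, ∀ U'' Df, τ''.SameCycle y y' → MInv R u b ZF φ τ'' U'' Rp Df → MInv R u b ZF φ τ'' U'' (Rp.erase y') Df := by
      intro τ'' U'' Df hs hI
      refine { hI with h4 := ?_, rZ := fun r hr => hI.rZ r (Finset.mem_of_mem_erase hr), rU := fun r hr => hI.rU r (Finset.mem_of_mem_erase hr) }
      intro v hv
      obtain ⟨r, hr, hrv⟩ := hI.h4 v hv
      by_cases hry : r = y'
      · exact ⟨y, Finset.mem_erase.2 ⟨hne, hy⟩, hs.trans (hry ▸ hrv)⟩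
      · exact ⟨r, Finset.mem_erase.2 ⟨hry, hr⟩, hrv⟩
    by_cases hsc : τ.SameCycle y y'
    · exact ih τ U (Rp.erase y') hcard (hsub τ U ∅ hsc h) (fun p q => le_trans (by omega) (hsv p q))
    obtain ⟨m1, m2⟩ := swap_merge τ y y' hsc
    have hswy : (τ * swap y y') y = τ y' := by simp
    have hswy' : (τ * swap y y') y' = τ y := by simp
    have hswo : ∀ v, v ≠ y → v ≠ y' → (τ * swap y y') v = τ v := by
      intro v a b; rw [Perm.mul_apply, swap_apply_of_ne_of_ne a b]
    have I1 : MInv R u b ZF φ (τ * swap y y') U Rp {y, y'} := by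
      refine { h with h1 := ?_, h2 := ?_, h3 := ?_, h4 := ?_ }
      · intro v hv hvU
        simp only [Finset.mem_insert, Finset.mem_singleton, not_or] at hv
        rw [hswo v hv.1 hv.2]; exact h.h1 v (by simp) hvU
      · intro v hv
        rw [hswo v (by rintro rfl; exact h.rZ _ hy hv) (by rintro rfl; exact h.rZ _ hy' hv)]
        exact h.h2 v hv
      · intro i hi
        have key : ∀ c, (τ * swap y y') (u i c) = τ (u i c) := fun c =>
          hswo _ (h.rU y hy i hi c).symm (h.rU y' hy' i hi c).symm
        rw [key, key, key]; exact h.h3 i hi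
      · intro v hv
        obtain ⟨r, hr, hrv⟩ := h.h4 v hv
        exact ⟨r, hr, m1 _ _ hrv⟩
    have I1 := hsub _ _ _ m2 I1
    obtain ⟨i, hi⟩ := Finset.card_pos.1 (by have := hsv y (τ y'); omega : 0 < (U.filter (fun i => R y (u i 1) ∧ R (u i 2) (τ y'))).card)
    obtain ⟨hi, i1, i2⟩ := Finset.mem_filter.1 hi
    obtain ⟨τ1, J1, hτ1⟩ := ins_inv I1 i hi y (h.rZ y hy) (fun j hj _ c => h.rU y hy j hj c)
      (h.rU y hy i hi _) (h.rU y hy i hi _) i1 (by rw [hswy]; exact i2)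
    have e1 : τ1 y' = τ y := by
      rw [hτ1 y' hne.symm (h.rU y' hy' i hi _) (h.rU y' hy' i hi _), hswy']
    have cnt : ∀ p q, 2 * n + 1 ≤ ((U.erase i).filter (fun i => R p (u i 1) ∧ R (u i 2) q)).card := by
      intro p q
      rw [Finset.filter_erase]
      have := Finset.pred_card_le_card_erase (s := U.filter (fun i => R p (u i 1) ∧ R (u i 2) q)) (a := i)
      have := hsv p q
      omega
    obtain ⟨j, hj⟩ := Finset.card_pos.1 (by have := cnt y' (τ y); omega : 0 < ((U.erase i).filter (fun i => R y' (u i 1) ∧ R (u i 2) (τ y))).card)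
    obtain ⟨hj, j1, j2⟩ := Finset.mem_filter.1 hj
    have hrU' : ∀ k ∈ U.erase i, ∀ c, y' ≠ u k c := fun k hk c => h.rU y' hy' k (Finset.mem_of_mem_erase hk) c
    obtain ⟨τ2, J2, -⟩ := ins_inv J1 j hj y' (h.rZ y' hy') (fun k hk _ c => hrU' k hk c)
      (hrU' j hj _) (hrU' j hj _) j1 (by rw [e1]; exact j2)
    have hDf : ((({y, y'} : Finset V).erase y).erase y') = ∅ := by
      ext v; simp only [Finset.mem_erase, Finset.mem_insert, Finset.mem_singleton, Finset.notMem_empty]; tauto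
    rw [hDf] at J2
    refine ih τ2 _ _ hcard J2 ?_
    intro p q
    rw [Finset.filter_erase]
    have := Finset.pred_card_le_card_erase (s := (U.erase i).filter (fun i => R p (u i 1) ∧ R (u i 2) q)) (a := j)
    have := cnt p q
    omega
end
end

section
open Equiv

/-- Any two sets of at least `p` vertices span at least `e0` arcs. -/
abbrev ManyArcs {V : Type*} (R : V → V → Prop) (p e0 : ℕ) : Prop :=
  ∀ S T : Finset V, p ≤ S.card → p ≤ T.card → e0 ≤ ((S ×ˢ T).filter (fun x => R x.1 x.2)).card

section
variable {V : Type*} [Fintype V]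

theorem far_long (τ τ' : Perm V) (B : Finset V) (ℓ : ℕ) (h1 : ∀ v, v ∉ B → τ' v = τ v)
    (h2 : ∀ p ∈ B, ∃ q ∈ B, τ' p = τ q) (far : ∀ p ∈ B, ∀ q ∈ B, ∀ j, 1 ≤ j → j < ℓ → (τ ^ j) p ≠ q)
    (v : V) (hv : ∀ j, 1 ≤ j → j < ℓ → (τ ^ j) v ≠ v) : ∀ j, 1 ≤ j → j < ℓ → (τ' ^ j) v ≠ v := by
  intro i hi hil hc
  by_cases hB : ∃ j, (τ' ^ j) v ∈ B
  · obtain ⟨j0, hj0⟩ := hB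
    set p := (τ' ^ j0) v with hp
    obtain ⟨q, hq, hpq⟩ := h2 p hj0
    have key : ∀ j, j + 1 < ℓ → (τ' ^ (j+1)) p = (τ ^ (j+1)) q := by
      intro j
      induction j with
      | zero => intro _; simpa using hpq
      | succ j ih =>
        intro hj
        rw [pow_succ' τ', Perm.mul_apply, ih (by omega), pow_succ' τ (j+1), Perm.mul_apply]
        apply h1
        intro hc
        exact far q hq _ hc (j+1) (by omega) (by omega) rfl
    obtain ⟨i, rfl⟩ : ∃ i', i = i' + 1 := ⟨i - 1, by omega⟩
    have h3 := key i hil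
    have h4 : (τ' ^ (i+1)) p = p := by
      rw [hp, ← Perm.mul_apply, ← pow_add, add_comm, pow_add, Perm.mul_apply, hc]
    exact far q hq p hj0 (i+1) hi hil (by rw [← h3, h4])
  · push Not at hB
    have key : ∀ j, (τ' ^ j) v = (τ ^ j) v := by
      intro j
      induction j with
      | zero => rfl
      | succ j ih =>
        rw [pow_succ' τ', Perm.mul_apply, h1 _ (hB j), ih, pow_succ' τ, Perm.mul_apply]
    exact hv i hi hil (by rw [← key, hc])

theorem near_card (τ : Perm V) (ℓ : ℕ) (x : V) :
    (Finset.univ.filter (fun y => ∃ j < ℓ, (τ ^ j) x = y ∨ (τ ^ j) y = x)).card ≤ 2 * ℓ := by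
  have : Finset.univ.filter (fun y => ∃ j < ℓ, (τ ^ j) x = y ∨ (τ ^ j) y = x) ⊆
      (Finset.range ℓ).image (fun j => (τ ^ j) x) ∪ (Finset.range ℓ).image (fun j => (τ ^ j)⁻¹ x) := by
    intro y hy
    obtain ⟨j, hj, h⟩ := (Finset.mem_filter.1 hy).2
    rcases h with h | h
    · exact Finset.mem_union_left _ (Finset.mem_image.2 ⟨j, Finset.mem_range.2 hj, h⟩)
    · exact Finset.mem_union_right _ (Finset.mem_image.2 ⟨j, Finset.mem_range.2 hj, by rw [← h]; simp⟩)
  refine (Finset.card_le_card this).trans ((Finset.card_union_le _ _).trans ?_)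
  have a1 := Finset.card_image_le (s := Finset.range ℓ) (f := fun j => (τ ^ j) x)
  have a2 := Finset.card_image_le (s := Finset.range ℓ) (f := fun j => (τ ^ j)⁻¹ x)
  simp only [Finset.card_range] at a1 a2
  omega

theorem minimize (R : V → V → Prop) (m p e0 ℓ : ℕ) (Fx E : Finset V) (τ0 : Perm V) (hm : Fintype.card V = m)
    (hEF : E ⊆ Fx) (hf : ∀ v ∈ Fx, v ∉ E → R v (τ0 v))
    (hlong : ∀ v, v ∉ E → ∀ j, 1 ≤ j → j < ℓ → (τ0 ^ j) v ≠ v)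
    (hdo : ∀ v, p ≤ (Finset.univ.filter (fun u => R v u)).card)
    (hdi : ∀ v, p ≤ (Finset.univ.filter (fun u => R u v)).card)
    (NE : ManyArcs R p e0)
    (hl0 : 0 < ℓ) (hℓ : 6 * (ℓ * m) + 2 * (Fx.card * m) < e0) :
    ∃ τ : Perm V, (∀ v ∈ Fx, τ v = τ0 v) ∧ (∀ v, v ∉ E → R v (τ v)) ∧
      (∀ v, v ∉ E → ∀ j, 1 ≤ j → j < ℓ → (τ ^ j) v ≠ v) := by
  have main : ∀ d : ℕ, ∀ τ : Perm V, (Finset.univ.filter (fun v => v ∉ E ∧ ¬ R v (τ v))).card = d →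
      (∀ v ∈ Fx, τ v = τ0 v) → (∀ v, v ∉ E → ∀ j, 1 ≤ j → j < ℓ → (τ ^ j) v ≠ v) →
      ∃ τ : Perm V, (∀ v ∈ Fx, τ v = τ0 v) ∧ (∀ v, v ∉ E → R v (τ v)) ∧
      (∀ v, v ∉ E → ∀ j, 1 ≤ j → j < ℓ → (τ ^ j) v ≠ v) := by
    intro d
    induction d using Nat.strong_induction_on with
    | _ d ih =>
    intro τ hd hfix hlg
    by_cases hall : ∀ v, v ∉ E → R v (τ v)
    · exact ⟨τ, hfix, hall, hlg⟩
    push Not at hall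
    obtain ⟨b, hbE, hbR⟩ := hall
    have hbF : b ∉ Fx := by
      intro hc; exact hbR (by rw [hfix b hc]; exact hf b hc hbE)
    let S : Finset V := Finset.univ.filter (fun g => R b (τ g))
    let T : Finset V := Finset.univ.filter (fun w => R (τ.symm w) (τ b))
    have hS : p ≤ S.card := by
      refine (hdo b).trans (le_of_eq ?_)
      apply Finset.card_bij (fun v _ => τ.symm v)
      · intro v hv; simpa [S] using hv
      · intro v _ w _ h; exact τ.symm.injective h
      · intro v hv; exact ⟨τ v, by simpa [S] using hv, by simp⟩
    have hT : p ≤ T.card := by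
      refine (hdi (τ b)).trans (le_of_eq ?_)
      apply Finset.card_bij (fun v _ => τ v)
      · intro v hv; simpa [T] using hv
      · intro v _ w _ h; exact τ.injective h
      · intro v hv; exact ⟨τ.symm v, by simpa [T] using hv, by simp⟩
    have hP := NE S T hS hT
    let near : V → V → Prop := fun x y => ∃ j < ℓ, (τ ^ j) x = y ∨ (τ ^ j) y = x
    let X : Finset V := Fx ∪ Finset.univ.filter (fun y => near b y)
    have hX : X.card ≤ Fx.card + 2 * ℓ := (Finset.card_union_le _ _).trans (Nat.add_le_add_left (near_card τ ℓ b) _)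
    let B1 : Finset (V × V) := X ×ˢ Finset.univ
    let B2 : Finset (V × V) := Finset.univ ×ˢ (X.image τ)
    let B3 : Finset (V × V) := Finset.univ.biUnion (fun g => ((Finset.univ.filter (fun y => near g y)).image (fun y => (g, τ y))))
    have c1 : B1.card ≤ (Fx.card + 2 * ℓ) * m := by
      simp only [B1, Finset.card_product, Finset.card_univ, hm]; exact Nat.mul_le_mul_right _ hX
    have c2 : B2.card ≤ (Fx.card + 2 * ℓ) * m := by
      simp only [B2, Finset.card_product, Finset.card_univ, hm]
      rw [mul_comm]; exact Nat.mul_le_mul_right _ (Finset.card_image_le.trans hX)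
    have c3 : B3.card ≤ m * (2 * ℓ) := by
      have := Finset.card_biUnion_le_card_mul Finset.univ (fun g => ((Finset.univ.filter (fun y => near g y)).image (fun y => (g, τ y)))) (2 * ℓ) (fun g _ => Finset.card_image_le.trans (near_card τ ℓ g))
      rwa [Finset.card_univ, hm] at this
    have cu : ((B1 ∪ B2) ∪ B3).card < ((S ×ˢ T).filter (fun x => R x.1 x.2)).card := by
      have a1 := Finset.card_union_le (B1 ∪ B2) B3
      have a2 := Finset.card_union_le B1 B2
      have a3 : (Fx.card + 2 * ℓ) * m + (Fx.card + 2 * ℓ) * m + m * (2 * ℓ) = 6 * (ℓ * m) + 2 * (Fx.card * m) := by ring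
      omega
    obtain ⟨⟨g, w⟩, hin, hout⟩ := Finset.exists_mem_notMem_of_card_lt_card cu
    obtain ⟨hST, hgw⟩ := Finset.mem_filter.1 hin
    obtain ⟨hgS, hwT⟩ := Finset.mem_product.1 hST
    have hgR : R b (τ g) := (Finset.mem_filter.1 hgS).2
    have hwT : R (τ.symm w) (τ b) := (Finset.mem_filter.1 hwT).2
    simp only [Finset.mem_union, not_or] at hout
    obtain ⟨⟨n1, n2⟩, n3⟩ := hout
    obtain ⟨y, rfl⟩ : ∃ y, w = τ y := ⟨τ.symm w, by simp⟩
    simp only [Equiv.symm_apply_apply] at hwT hgw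
    have n1 : g ∉ X := fun hc => n1 (Finset.mem_product.2 ⟨hc, Finset.mem_univ _⟩)
    have n2 : y ∉ X := fun hc => n2 (Finset.mem_product.2 ⟨Finset.mem_univ _, Finset.mem_image_of_mem _ hc⟩)
    have n3 : ¬ near g y := fun hc => n3 (Finset.mem_biUnion.2 ⟨g, Finset.mem_univ _, Finset.mem_image.2 ⟨y, Finset.mem_filter.2 ⟨Finset.mem_univ _, hc⟩, rfl⟩⟩)
    have hXn : ∀ x, x ∉ X → x ∉ Fx ∧ ¬ near b x := by
      intro x hx
      exact ⟨fun hc => hx (Finset.mem_union_left _ hc), fun hc => hx (Finset.mem_union_right _ (Finset.mem_filter.2 ⟨Finset.mem_univ _, hc⟩))⟩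
    obtain ⟨gF, gb⟩ := hXn g n1
    obtain ⟨yF, yb⟩ := hXn y n2
    have hgb : b ≠ g := fun hc => gb ⟨0, hl0, Or.inl hc⟩
    have hyb : b ≠ y := fun hc => yb ⟨0, hl0, Or.inl hc⟩
    have hgy : g ≠ y := fun hc => n3 ⟨0, hl0, Or.inl hc⟩
    set τ' := τ * swap b g * swap g y with hτ'
    have tb : τ' b = τ g := by rw [hτ', Perm.mul_apply, Perm.mul_apply, swap_apply_of_ne_of_ne hgb hyb, swap_apply_left]
    have tg : τ' g = τ y := by rw [hτ', Perm.mul_apply, Perm.mul_apply, swap_apply_left, swap_apply_of_ne_of_ne hyb.symm hgy.symm]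
    have ty : τ' y = τ b := by rw [hτ', Perm.mul_apply, Perm.mul_apply, swap_apply_right, swap_apply_right]
    have tO : ∀ v, v ≠ b → v ≠ g → v ≠ y → τ' v = τ v := by
      intro v a1 a2 a3
      rw [hτ', Perm.mul_apply, Perm.mul_apply, swap_apply_of_ne_of_ne a2 a3, swap_apply_of_ne_of_ne a1 a2]
    refine ih _ ?_ τ' rfl ?_ ?_
    · rw [← hd]
      apply Finset.card_lt_card
      refine ⟨?_, fun hc => ?_⟩
      · intro v hv
        obtain ⟨hv1, hv2⟩ := (Finset.mem_filter.1 hv).2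
        refine Finset.mem_filter.2 ⟨Finset.mem_univ _, hv1, ?_⟩
        have e1 : v ≠ b := by rintro rfl; apply hv2; rw [tb]; exact hgR
        have e2 : v ≠ g := by rintro rfl; apply hv2; rw [tg]; exact hgw
        have e3 : v ≠ y := by rintro rfl; apply hv2; rw [ty]; exact hwT
        rwa [tO v e1 e2 e3] at hv2
      · have := hc (Finset.mem_filter.2 ⟨Finset.mem_univ b, hbE, hbR⟩)
        apply (Finset.mem_filter.1 this).2.2
        rw [tb]; exact hgR
    · intro v hv
      rw [tO v, hfix v hv]
      · rintro rfl; exact hbF hv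
      · rintro rfl; exact gF hv
      · rintro rfl; exact yF hv
    · intro v hv
      refine far_long τ τ' {b, g, y} ℓ ?_ ?_ ?_ v (hlg v hv)
      · intro v hv
        simp only [Finset.mem_insert, Finset.mem_singleton, not_or] at hv
        exact tO v hv.1 hv.2.1 hv.2.2
      · intro q hq
        simp only [Finset.mem_insert, Finset.mem_singleton] at hq
        rcases hq with rfl | rfl | rfl
        · exact ⟨g, by simp, tb⟩
        · exact ⟨y, by simp, tg⟩
        · exact ⟨b, by simp, ty⟩
      · have nr : ∀ x y, ¬ near x y → ∀ j, 1 ≤ j → j < ℓ → (τ ^ j) x ≠ y ∧ (τ ^ j) y ≠ x := by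
          intro x y hxy j _ h2
          exact ⟨fun hc => hxy ⟨j, h2, Or.inl hc⟩, fun hc => hxy ⟨j, h2, Or.inr hc⟩⟩
        intro p hp q hq j h1 h2
        have d1 := nr b g gb j h1 h2
        have d2 := nr b y yb j h1 h2
        have d3 := nr g y n3 j h1 h2
        have d4 := hlg b hbE j h1 h2
        have d5 := hlg g (fun hc => gF (hEF hc)) j h1 h2
        have d6 := hlg y (fun hc => yF (hEF hc)) j h1 h2
        simp only [Finset.mem_insert, Finset.mem_singleton] at hp hq
        rcases hp with rfl | rfl | rfl <;> rcases hq with rfl | rfl | rfl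
        · exact d4
        · exact d1.1
        · exact d2.1
        · exact d1.2
        · exact d5
        · exact d3.1
        · exact d2.2
        · exact d3.2
        · exact d6
  exact main _ τ0 rfl (fun _ _ => rfl) hlong
end
end

section
variable {V Ω P : Type*} [Fintype Ω]

theorem cover_step (vs : Ω → Finset V) (sv : P → Ω → Prop) (M x : ℕ)
    (h : ∀ X : Finset V, X.card ≤ x → ∀ p, Fintype.card Ω ≤ M * (Finset.univ.filter (fun ω => sv p ω ∧ Disjoint (vs ω) X)).card)
    (X : Finset V) (hX : X.card ≤ x) (U : Finset P) (hU : U.Nonempty) (hΩ : 0 < Fintype.card Ω) :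
    ∃ ω, Disjoint (vs ω) X ∧ U.card ≤ M * (U.filter (fun p => sv p ω)).card := by
  by_contra hc
  push Not at hc
  let g : Finset Ω := Finset.univ.filter (fun ω => Disjoint (vs ω) X)
  have h1 : ∑ p ∈ U, (g.filter (fun ω => sv p ω)).card = ∑ ω ∈ g, (U.filter (fun p => sv p ω)).card := dc U g sv
  have h2 : U.card * Fintype.card Ω ≤ M * ∑ p ∈ U, (g.filter (fun ω => sv p ω)).card := by
    rw [Finset.mul_sum, ← smul_eq_mul, ← Finset.sum_const]
    apply Finset.sum_le_sum; intro p _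
    refine (h X hX p).trans (Nat.mul_le_mul_left _ (Finset.card_le_card ?_))
    intro ω hω
    obtain ⟨a1, a2⟩ := (Finset.mem_filter.1 hω).2
    exact Finset.mem_filter.2 ⟨Finset.mem_filter.2 ⟨Finset.mem_univ _, a2⟩, a1⟩
  have hUc := Finset.card_pos.2 hU
  have h3 : M * ∑ ω ∈ g, (U.filter (fun p => sv p ω)).card < U.card * Fintype.card Ω := by
    rcases g.eq_empty_or_nonempty with hg | hg
    · rw [hg]; simp only [Finset.sum_empty, mul_zero]; positivity
    · calc M * ∑ ω ∈ g, (U.filter (fun p => sv p ω)).card = ∑ ω ∈ g, M * (U.filter (fun p => sv p ω)).card := Finset.mul_sum _ _ _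
        _ < ∑ ω ∈ g, U.card := by
          apply Finset.sum_lt_sum_of_nonempty hg
          intro ω hω; exact hc ω (Finset.mem_filter.1 hω).2
        _ = g.card * U.card := by rw [Finset.sum_const, smul_eq_mul]
        _ ≤ Fintype.card Ω * U.card := Nat.mul_le_mul_right _ (Finset.card_le_univ _)
        _ = _ := mul_comm _ _
  rw [h1] at h2
  omega

theorem cover_round (vs : Ω → Finset V) (sv : P → Ω → Prop) (M x : ℕ) (hv4 : ∀ ω, (vs ω).card ≤ 4) (hne : ∀ ω, (vs ω).Nonempty)
    (h : ∀ X : Finset V, X.card ≤ x → ∀ p, Fintype.card Ω ≤ M * (Finset.univ.filter (fun ω => sv p ω ∧ Disjoint (vs ω) X)).card)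
    (hΩ : 0 < Fintype.card Ω) :
    ∀ (T : ℕ) (X : Finset V) (U : Finset P), X.card + 4 * T ≤ x → (M-1)^T * U.card < M^T →
    ∃ F : Finset Ω, F.card ≤ T ∧ (∀ ω ∈ F, Disjoint (vs ω) X ∧ ∃ p, sv p ω) ∧
      (∀ ω ∈ F, ∀ ω' ∈ F, ω ≠ ω' → Disjoint (vs ω) (vs ω')) ∧ ∀ p ∈ U, ∃ ω ∈ F, sv p ω := by
  intro T
  induction T with
  | zero =>
    intro X U _ hU
    have : U = ∅ := by rw [← Finset.card_eq_zero]; simpa using hU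
    subst this
    exact ⟨∅, by simp, by simp, by simp, by simp⟩
  | succ T ih =>
    intro X U hX hU
    rcases U.eq_empty_or_nonempty with hUe | hUe
    · subst hUe
      exact ⟨∅, by simp, by simp, by simp, by simp⟩
    obtain ⟨ω, hω, hωU⟩ := cover_step vs sv M x h X (by omega) U hUe hΩ
    have hUc := Finset.card_pos.2 hUe
    have hM : 0 < M := by
      rcases Nat.eq_zero_or_pos M with h0 | h0
      · rw [h0] at hωU; omega
      · exact h0
    have hp : 0 < (U.filter (fun p => sv p ω)).card := by
      rcases Nat.eq_zero_or_pos (U.filter (fun p => sv p ω)).card with h0 | h0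
      · rw [h0] at hωU; omega
      · exact h0
    obtain ⟨p0, hp0⟩ := Finset.card_pos.1 hp
    have hsplit := Finset.card_filter_add_card_filter_not (s := U) (fun p => sv p ω)
    have hU' : M * (U.filter (fun p => ¬ sv p ω)).card ≤ (M - 1) * U.card := by
      obtain ⟨M', rfl⟩ : ∃ M', M = M' + 1 := ⟨M - 1, by omega⟩
      rw [Nat.add_sub_cancel]
      have : (M'+1) * U.card = (M'+1) * (U.filter (fun p => sv p ω)).card + (M'+1) * (U.filter (fun p => ¬ sv p ω)).card := by
        rw [← hsplit]; ring
      have e : (M'+1) * U.card = M' * U.card + U.card := by ring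
      omega
    obtain ⟨F, f1, f2, f3, f4⟩ := ih (X ∪ vs ω) (U.filter (fun p => ¬ sv p ω))
      (by have := Finset.card_union_le X (vs ω); have := hv4 ω; omega)
      (by
        have : M * ((M-1)^T * (U.filter (fun p => ¬ sv p ω)).card) < M * M^T := by
          calc _ = (M-1)^T * (M * (U.filter (fun p => ¬ sv p ω)).card) := by ring
            _ ≤ (M-1)^T * ((M-1) * U.card) := Nat.mul_le_mul_left _ hU'
            _ = (M-1)^(T+1) * U.card := by ring
            _ < M^(T+1) := hU
            _ = _ := by ring
        exact Nat.lt_of_mul_lt_mul_left this)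
    refine ⟨insert ω F, (Finset.card_insert_le _ _).trans (by omega), ?_, ?_, ?_⟩
    · intro ω' hω'
      rcases Finset.mem_insert.1 hω' with rfl | h1
      · exact ⟨hω, p0, (Finset.mem_filter.1 hp0).2⟩
      · exact ⟨(f2 ω' h1).1.mono_right Finset.subset_union_left, (f2 ω' h1).2⟩
    · have key : ∀ ω' ∈ F, Disjoint (vs ω') (vs ω) := fun ω' h1 => (f2 ω' h1).1.mono_right Finset.subset_union_right
      intro ω1 h1 ω2 h2 h12
      rcases Finset.mem_insert.1 h1 with e1 | h1
      · rcases Finset.mem_insert.1 h2 with e2 | h2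
        · exact absurd (e1.trans e2.symm) h12
        · rw [e1]; exact (key _ h2).symm
      · rcases Finset.mem_insert.1 h2 with e2 | h2
        · rw [e2]; exact key _ h1
        · exact f3 _ h1 _ h2 h12
    · intro p hp
      by_cases hs : sv p ω
      · exact ⟨ω, Finset.mem_insert_self _ _, hs⟩
      · obtain ⟨ω', h1, h2⟩ := f4 p (Finset.mem_filter.2 ⟨hp, hs⟩)
        exact ⟨ω', Finset.mem_insert_of_mem h1, h2⟩

theorem cover_all [Fintype P] (vs : Ω → Finset V) (sv : P → Ω → Prop) (M x T : ℕ) (hv4 : ∀ ω, (vs ω).card ≤ 4) (hne : ∀ ω, (vs ω).Nonempty)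
    (h : ∀ X : Finset V, X.card ≤ x → ∀ p, Fintype.card Ω ≤ M * (Finset.univ.filter (fun ω => sv p ω ∧ Disjoint (vs ω) X)).card)
    (hΩ : 0 < Fintype.card Ω) (hT : (M-1)^T * Fintype.card P < M^T) (X : Finset V) :
    ∀ K : ℕ, X.card + 4 * (K * T) ≤ x →
    ∃ F : Finset Ω, F.card ≤ K * T ∧ (∀ ω ∈ F, Disjoint (vs ω) X ∧ ∃ p, sv p ω) ∧
      (∀ ω ∈ F, ∀ ω' ∈ F, ω ≠ ω' → Disjoint (vs ω) (vs ω')) ∧ ∀ p, K ≤ (F.filter (fun ω => sv p ω)).card := by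
  intro K
  induction K with
  | zero => intro _; exact ⟨∅, by simp, by simp, by simp, by simp⟩
  | succ K ih =>
    intro hx
    have e : (K+1) * T = K * T + T := by ring
    obtain ⟨F, f1, f2, f3, f4⟩ := ih (by omega)
    have hb : (F.biUnion vs).card ≤ 4 * F.card := by
      have := Finset.card_biUnion_le_card_mul F vs 4 (fun ω _ => hv4 ω); omega
    obtain ⟨F', g1, g2, g3, g4⟩ := cover_round vs sv M x hv4 hne h hΩ T (X ∪ F.biUnion vs) Finset.univ
      (by have := Finset.card_union_le X (F.biUnion vs); omega) (by rw [Finset.card_univ]; exact hT)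
    have key : ∀ ω ∈ F, ∀ ω' ∈ F', Disjoint (vs ω') (vs ω) := fun ω h1 ω' h2 =>
      (g2 ω' h2).1.mono_right ((Finset.subset_biUnion_of_mem vs h1).trans Finset.subset_union_right)
    have hdis : Disjoint F F' := by
      rw [Finset.disjoint_left]; intro ω h1 h2
      have := key ω h1 ω h2
      rw [disjoint_self] at this
      exact (hne ω).ne_empty this
    refine ⟨F ∪ F', (Finset.card_union_le _ _).trans (by omega), ?_, ?_, ?_⟩
    · intro ω hω
      rcases Finset.mem_union.1 hω with h1 | h1
      · exact f2 ω h1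
      · exact ⟨(g2 ω h1).1.mono_right Finset.subset_union_left, (g2 ω h1).2⟩
    · intro ω1 h1 ω2 h2 h12
      rcases Finset.mem_union.1 h1 with h1 | h1 <;> rcases Finset.mem_union.1 h2 with h2 | h2
      · exact f3 _ h1 _ h2 h12
      · exact (key _ h1 _ h2).symm
      · exact key _ h2 _ h1
      · exact g3 _ h1 _ h2 h12
    · intro p
      rw [Finset.filter_union, Finset.card_union_of_disjoint (Finset.disjoint_filter_filter hdis)]
      obtain ⟨ω, h1, h2⟩ := g4 p (Finset.mem_univ _)
      have : 0 < (F'.filter (fun ω => sv p ω)).card := Finset.card_pos.2 ⟨ω, Finset.mem_filter.2 ⟨h1, h2⟩⟩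
      have := f4 p
      omega
end

section
variable {V : Type*} [Fintype V]

/-- arcs between large sets avoiding a small set -/
theorem ne_avoid (R : V → V → Prop) (m p e0 : ℕ) (hm : Fintype.card V = m)
    (NE : ManyArcs R p e0)
    (S T X : Finset V) (hS : p ≤ S.card) (hT : p ≤ T.card) :
    e0 ≤ ((S ×ˢ T).filter (fun x => R x.1 x.2 ∧ x.1 ∉ X ∧ x.2 ∉ X)).card + 2 * (X.card * m) := by
  have h1 : (S ×ˢ T).filter (fun x => R x.1 x.2) ⊆ (S ×ˢ T).filter (fun x => R x.1 x.2 ∧ x.1 ∉ X ∧ x.2 ∉ X) ∪ (X ×ˢ Finset.univ ∪ Finset.univ ×ˢ X) := by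
    intro x hx
    simp only [Finset.mem_union, Finset.mem_filter, Finset.mem_product, Finset.mem_univ, true_and, and_true] at hx ⊢
    tauto
  have h2 := (NE S T hS hT).trans (Finset.card_le_card h1)
  have h3 := Finset.card_union_le ((S ×ˢ T).filter (fun x => R x.1 x.2 ∧ x.1 ∉ X ∧ x.2 ∉ X)) (X ×ˢ Finset.univ ∪ Finset.univ ×ˢ X)
  have h4 := Finset.card_union_le (X ×ˢ (Finset.univ : Finset V)) (Finset.univ ×ˢ X)
  rw [Finset.card_product, Finset.card_product, Finset.card_univ, hm] at h4
  have : m * X.card = X.card * m := mul_comm _ _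
  omega

/-- validity of an absorber quadruple for the pair `pq` -/
def svq (R : V → V → Prop) (pq : V × V) (ω : (V × V) × (V × V)) : Prop :=
  (R pq.1 ω.1.1 ∧ R ω.1.1 ω.1.2 ∧ R ω.1.2 pq.2) ∧
  (R ω.2.1 ω.1.1 ∧ R ω.1.2 ω.2.2 ∧ R ω.2.1 ω.2.2) ∧
  (ω.1.1 ≠ ω.1.2 ∧ ω.2.1 ≠ ω.2.2 ∧ ω.2.1 ≠ ω.1.1 ∧ ω.2.1 ≠ ω.1.2 ∧ ω.2.2 ≠ ω.1.1 ∧ ω.2.2 ≠ ω.1.2)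

noncomputable def vsq (ω : (V × V) × (V × V)) : Finset V := {ω.1.1, ω.1.2, ω.2.1, ω.2.2}

theorem svq_count (R : V → V → Prop) (m p e0 e1 : ℕ) (hm : Fintype.card V = m)
    (NE : ManyArcs R p e0)
    (hdo : ∀ v, p ≤ (Finset.univ.filter (fun u => R v u)).card)
    (hdi : ∀ v, p ≤ (Finset.univ.filter (fun u => R u v)).card)
    (X : Finset V) (hl : ∀ v, v ∉ X → ¬ R v v) (he : e1 + 2 * ((X.card + 2) * m) ≤ e0) (pq : V × V) :
    e1 * e1 ≤ (Finset.univ.filter (fun ω : (V × V) × (V × V) => svq R pq ω ∧ Disjoint (vsq ω) X)).card := by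
  let N1 : V → Finset V := fun v => Finset.univ.filter (fun u => R v u)
  let N2 : V → Finset V := fun v => Finset.univ.filter (fun u => R u v)
  let A : Finset (V × V) := (N1 pq.1 ×ˢ N2 pq.2).filter (fun x => R x.1 x.2 ∧ x.1 ∉ X ∧ x.2 ∉ X)
  let B : V × V → Finset (V × V) := fun y => (N2 y.1 ×ˢ N1 y.2).filter (fun x => R x.1 x.2 ∧ x.1 ∉ (X ∪ {y.1, y.2}) ∧ x.2 ∉ (X ∪ {y.1, y.2}))
  have hA : e1 ≤ A.card := by
    have := ne_avoid R m p e0 hm NE (N1 pq.1) (N2 pq.2) X (hdo _) (hdi _)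
    have e : 2 * ((X.card + 2) * m) = 2 * (X.card * m) + 4 * m := by ring
    simp only [A]; omega
  have hB : ∀ y, e1 ≤ (B y).card := by
    intro y
    have a1 := ne_avoid R m p e0 hm NE (N2 y.1) (N1 y.2) (X ∪ {y.1, y.2}) (hdi _) (hdo _)
    have a2 : (X ∪ {y.1, y.2}).card ≤ X.card + 2 := (Finset.card_union_le _ _).trans (Nat.add_le_add_left Finset.card_le_two _)
    have a3 := Nat.mul_le_mul_right m a2
    simp only [B]; omega
  have h1 : (A.sigma B).card = ∑ y ∈ A, (B y).card := Finset.card_sigma _ _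
  have h2 : e1 * e1 ≤ (A.sigma B).card := by
    rw [h1]
    calc e1 * e1 ≤ A.card * e1 := Nat.mul_le_mul_right _ hA
      _ = ∑ y ∈ A, e1 := by rw [Finset.sum_const, smul_eq_mul]
      _ ≤ _ := Finset.sum_le_sum (fun y _ => hB y)
  refine h2.trans ?_
  apply Finset.card_le_card_of_injOn (fun x => (x.1, x.2))
  · intro x hx
    obtain ⟨h1, h2⟩ := Finset.mem_sigma.1 hx
    obtain ⟨⟨s, t⟩, ⟨a, b⟩⟩ := x
    simp only [A, B, N1, N2, Finset.mem_filter, Finset.mem_product, Finset.mem_univ, true_and, Finset.mem_union, Finset.mem_insert, Finset.mem_singleton, not_or] at h1 h2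
    obtain ⟨⟨p1, p2⟩, p3, p4, p5⟩ := h1
    obtain ⟨⟨q1, q2⟩, q3, ⟨q4, q5, q6⟩, q7, q8, q9⟩ := h2
    simp only [Finset.coe_filter, Finset.mem_univ, true_and, Set.mem_ofPred_eq]
    refine ⟨⟨⟨p1, p3, p2⟩, ⟨q1, q2, q3⟩, ?_, ?_, q5, q6, q8, q9⟩, ?_⟩
    · intro hc; change s = t at hc; subst hc; exact hl s p4 p3
    · intro hc; change a = b at hc; subst hc; exact hl a q4 q3
    · simp only [vsq, Finset.disjoint_left, Finset.mem_insert, Finset.mem_singleton]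
      rintro v (rfl | rfl | rfl | rfl) <;> assumption
  · rintro ⟨x1, x2⟩ _ ⟨y1, y2⟩ _ h
    simp only [Prod.mk.injEq] at h
    obtain ⟨rfl, rfl⟩ := h
    rfl
end

section
variable {V : Type*} [Fintype V]

theorem path_conn (R : V → V → Prop) (m p e0 x : ℕ) (hm : Fintype.card V = m)
    (NE : ManyArcs R p e0)
    (hdo : ∀ v, p ≤ (Finset.univ.filter (fun u => R v u)).card)
    (hdi : ∀ v, p ≤ (Finset.univ.filter (fun u => R u v)).card)
    (he : 2 * (x * m) < e0) (hp : x < p) :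
    ∀ (n : ℕ) (X : Finset V) (u w : V), (∀ v, v ∉ X → ¬ R v v) → X.card + n ≤ x →
      ∃ l : List V, l.length = n + 2 ∧ l.Nodup ∧ (∀ v ∈ l, v ∉ X) ∧ (u :: l ++ [w]).IsChain R := by
  intro n
  induction n with
  | zero =>
    intro X u w hl hX
    have h1 := ne_avoid R m p e0 hm NE (Finset.univ.filter (fun v => R u v)) (Finset.univ.filter (fun v => R v w)) X (hdo u) (hdi w)
    have h2 := Nat.mul_le_mul_right m hX
    obtain ⟨⟨s, t⟩, hst⟩ := Finset.card_pos.1 (Nat.pos_of_ne_zero (fun hc => by rw [hc] at h1; simp only [add_zero] at h2; omega))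
    simp only [Finset.mem_filter, Finset.mem_product, Finset.mem_univ, true_and] at hst
    obtain ⟨⟨h3, h4⟩, h5, h6, h7⟩ := hst
    refine ⟨[s, t], rfl, ?_, ?_, ?_⟩
    · have : s ≠ t := by rintro rfl; exact hl s h6 h5
      simpa using this
    · simp [h6, h7]
    · simp [h3, h5, h4]
  | succ n ih =>
    intro X u w hl hX
    obtain ⟨v, hv1, hv2⟩ := Finset.exists_mem_notMem_of_card_lt_card (lt_of_lt_of_le (by omega : X.card < p) (hdo u))
    obtain ⟨l, l1, l2, l3, l4⟩ := ih (insert v X) v w (fun y hy => hl y (fun hc => hy (Finset.mem_insert_of_mem hc)))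
      (by have := Finset.card_insert_le v X; omega)
    refine ⟨v :: l, by simp [l1], ?_, ?_, ?_⟩
    · exact List.nodup_cons.2 ⟨fun hc => l3 v hc (Finset.mem_insert_self _ _), l2⟩
    · intro y hy
      rcases List.mem_cons.1 hy with rfl | hy
      · exact hv2
      · exact fun hc => l3 y hy (Finset.mem_insert_of_mem hc)
    · have := (Finset.mem_filter.1 hv1).2
      simp only [List.cons_append, List.isChain_cons_cons] at l4 ⊢
      exact ⟨this, l4⟩

theorem z_path (R : V → V → Prop) (z : ℕ → V) (t : ℕ) (m p e0 x : ℕ) (N : ℕ → ℕ) (hm : Fintype.card V = m)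
    (NE : ManyArcs R p e0)
    (hdo : ∀ v, p ≤ (Finset.univ.filter (fun u => R v u)).card)
    (hdi : ∀ v, p ≤ (Finset.univ.filter (fun u => R u v)).card)
    (he : 2 * (x * m) < e0) (hp : x < p) (hl : ∀ v, (∀ i ≤ t, v ≠ z i) → ¬ R v v)
    (hzi : ∀ i ≤ t, ∀ j ≤ t, z i = z j → i = j) (hN : ∀ i < t, 4 ≤ N i)
    (hx : ∑ i ∈ Finset.range t, N i + t + 2 ≤ x) :
    ∃ seg : ℕ → List V, (∀ i < t, (seg i).length = N i - 1) ∧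
      ((List.range t).flatMap (fun i => z i :: seg i) ++ [z t]).Nodup ∧
      ((List.range t).flatMap (fun i => z i :: seg i) ++ [z t]).IsChain R ∧
      ((List.range t).flatMap (fun i => z i :: seg i) ++ [z t]).length = 1 + ∑ i ∈ Finset.range t, N i := by
  have main : ∀ j ≤ t, ∃ seg : ℕ → List V, (∀ i < j, (seg i).length = N i - 1) ∧
      ((List.range j).flatMap (fun i => z i :: seg i) ++ [z j]).Nodup ∧
      ((List.range j).flatMap (fun i => z i :: seg i) ++ [z j]).IsChain R ∧
      ((List.range j).flatMap (fun i => z i :: seg i) ++ [z j]).length = 1 + ∑ i ∈ Finset.range j, N i ∧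
      ∀ i ≤ t, j < i → z i ∉ ((List.range j).flatMap (fun i => z i :: seg i) ++ [z j]) := by
    intro j
    induction j with
    | zero =>
      intro _
      refine ⟨fun _ => [], by simp, by simp, by simp, by simp, ?_⟩
      intro i hi h0 hc
      have := hzi i hi 0 (by omega) (by simpa using hc)
      omega
    | succ j ih =>
      intro hj
      obtain ⟨seg, s1, s2, s3, s4, s5⟩ := ih (by omega)
      set L := (List.range j).flatMap (fun i => z i :: seg i) ++ [z j] with hL
      have hsum : ∑ i ∈ Finset.range (j+1), N i ≤ ∑ i ∈ Finset.range t, N i :=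
        Finset.sum_le_sum_of_subset (Finset.range_subset_range.2 hj)
      rw [Finset.sum_range_succ] at hsum
      have hNj := hN j (by omega)
      obtain ⟨l, l1, l2, l3, l4⟩ := path_conn R m p e0 x hm NE hdo hdi he hp (N j - 3)
        (L.toFinset ∪ (Finset.range (t+1)).image z) (z j) (z (j+1))
        (fun v hv => hl v (fun i hi hc => hv (Finset.mem_union_right _ (Finset.mem_image.2 ⟨i, Finset.mem_range.2 (by omega), hc.symm⟩))))
        (by
          have a1 := Finset.card_union_le L.toFinset ((Finset.range (t+1)).image z)
          have a2 := L.toFinset_card_le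
          have a3 := Finset.card_image_le (s := Finset.range (t+1)) (f := z)
          rw [Finset.card_range] at a3
          omega)
      let seg' : ℕ → List V := fun i => if i < j then seg i else l
      have e1 : (List.range j).flatMap (fun i => z i :: seg' i) = (List.range j).flatMap (fun i => z i :: seg i) := by
        simp only [List.flatMap]
        congr 1
        apply List.map_congr_left
        intro i hi
        simp only [seg', List.mem_range.1 hi, if_true]
      have e2 : (List.range (j+1)).flatMap (fun i => z i :: seg' i) ++ [z (j+1)] = L ++ (l ++ [z (j+1)]) := by
        rw [List.range_succ, List.flatMap_append, e1, hL]
        simp [seg']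
      have hlL : ∀ v ∈ l, v ∉ L ∧ ∀ i ≤ t, v ≠ z i := by
        intro v hv
        have := l3 v hv
        simp only [Finset.mem_union, List.mem_toFinset, Finset.mem_image, Finset.mem_range, not_or] at this
        exact ⟨this.1, fun i hi hc => this.2 ⟨i, by omega, hc.symm⟩⟩
      refine ⟨seg', ?_, ?_, ?_, ?_, ?_⟩
      · intro i hi
        by_cases hij : i < j
        · simp only [seg', hij, if_true]; exact s1 i hij
        · have : i = j := by omega
          subst this
          simp only [seg', lt_irrefl, if_false]; omega
      · rw [e2, List.nodup_append']
        refine ⟨s2, ?_, ?_⟩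
        · rw [List.nodup_append']
          refine ⟨l2, by simp, ?_⟩
          intro v hv hv'
          rw [List.mem_singleton] at hv'
          exact (hlL v hv).2 (j+1) hj hv'
        · intro v hv hv'
          rcases List.mem_append.1 hv' with h | h
          · exact (hlL v h).1 hv
          · rw [List.mem_singleton] at h; subst h
            exact s5 (j+1) hj (by omega) hv
      · rw [e2, isChain_app]
        refine ⟨s3, ?_, ?_⟩
        · have : (z j :: (l ++ [z (j+1)])).IsChain R := by simpa using l4
          exact this.tail
        · intro a ha b hb
          rw [hL] at ha
          simp only [List.getLast?_append, List.getLast?_singleton, Option.some_or, Option.mem_def, Option.some.injEq] at ha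
          subst ha
          have : (z j :: (l ++ [z (j+1)])).IsChain R := by simpa using l4
          rw [List.isChain_cons] at this
          exact this.1 b hb
      · rw [e2, List.length_append, s4, Finset.sum_range_succ, List.length_append, l1, List.length_singleton]
        omega
      · intro i hi hji hc
        rw [e2] at hc
        rcases List.mem_append.1 hc with h | h
        · exact s5 i hi (by omega) h
        · rcases List.mem_append.1 h with h | h
          · exact (hlL _ h).2 i hi rfl
          · rw [List.mem_singleton] at h
            have := hzi i hi (j+1) hj h
            omega
  obtain ⟨seg, a, b, c, d, -⟩ := main t le_rfl
  exact ⟨seg, a, b, c, d⟩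
end

section
open Equiv

section
variable {V : Type*} [Fintype V]

theorem fp_consec (l1 l2 : List V) (x y : V) (h : (l1 ++ x :: y :: l2).Nodup) :
    (l1 ++ x :: y :: l2).formPerm x = y := by
  have := List.formPerm_apply_lt_getElem (l1 ++ x :: y :: l2) h l1.length (by simp)
  simpa using this

theorem fp_long (L : List V) (h : L.Nodup) (v : V) (hv : v ∈ L) (j : ℕ) (h1 : 1 ≤ j) (h2 : j < L.length) :
    (L.formPerm ^ j) v ≠ v := by
  obtain ⟨i, hi, rfl⟩ := List.getElem_of_mem hv
  rw [List.formPerm_pow_apply_getElem L h j i hi]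
  intro hc
  have h3 := (h.getElem_inj_iff).1 hc
  rcases lt_or_ge (i + j) L.length with h4 | h4
  · rw [Nat.mod_eq_of_lt h4] at h3; omega
  · rw [Nat.mod_eq_sub_mod h4, Nat.mod_eq_of_lt (by omega)] at h3; omega

theorem perm_list (R : V → V → Prop) (σ : Perm V) (hR : ∀ v, R v (σ v)) (hc : ∀ v w, σ.SameCycle v w)
    (L1 : List V) (hne : L1 ≠ []) (hn : L1.Nodup)
    (hL : ∀ v w l1 l2, L1 = l1 ++ v :: w :: l2 → σ v = w) (h2 : 2 ≤ Fintype.card V) :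
    ∃ l : List V, (L1 ++ l).Nodup ∧ (∀ v, v ∈ L1 ++ l) ∧ CycChain R (L1 ++ l) := by
  obtain ⟨x, L2, rfl⟩ := List.exists_cons_of_ne_nil hne
  have hsup : ∀ v, v ∈ σ.support := by
    intro v
    rw [Perm.mem_support]
    intro hv
    obtain ⟨w, hw⟩ := Finset.exists_mem_ne (by rw [Finset.card_univ]; omega : 1 < (Finset.univ : Finset V).card) v
    exact hw.2 ((hc v w).eq_of_left hv).symm
  have hmem : ∀ v, v ∈ Perm.toList σ x := fun v => Perm.mem_toList_iff.2 ⟨hc x v, hsup x⟩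
  have hnd := Perm.nodup_toList σ x
  have hpos : 0 < (Perm.toList σ x).length := List.length_pos_of_mem (hmem x)
  have hpre : ∀ i (hi : i < (x :: L2).length), (x :: L2)[i] = (σ ^ i) x := by
    intro i
    induction i with
    | zero => intro _; simp
    | succ i ih =>
      intro hi
      rw [pow_succ', Perm.mul_apply, ← ih (by omega)]
      refine (hL _ _ ((x :: L2).take i) ((x :: L2).drop (i+2)) ?_).symm
      conv_lhs => rw [← List.take_append_drop i (x :: L2)]
      rw [List.drop_eq_getElem_cons (by omega), List.drop_eq_getElem_cons (by omega)]
  have hlen : (x :: L2).length ≤ (Perm.toList σ x).length := by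
    have e1 : (x :: L2).toFinset ⊆ (Perm.toList σ x).toFinset := fun v _ => List.mem_toFinset.2 (hmem v)
    have := Finset.card_le_card e1
    rwa [List.toFinset_card_of_nodup hn, List.toFinset_card_of_nodup hnd] at this
  have hpr : (x :: L2) <+: Perm.toList σ x := by
    rw [List.prefix_iff_getElem]
    refine ⟨hlen, fun i hi => ?_⟩
    rw [hpre i hi, Perm.getElem_toList]
  obtain ⟨l, hl⟩ := hpr
  refine ⟨l, ?_⟩
  rw [hl]
  refine ⟨hnd, hmem, ?_, ?_⟩
  · rw [List.isChain_iff_getElem]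
    intro i hi
    rw [Perm.getElem_toList, Perm.getElem_toList, pow_succ', Perm.mul_apply]
    exact hR _
  · intro a ha b hb
    have hb' : b = x := by
      rw [← hl] at hb; simpa using hb.symm
    have ha' : a = (σ ^ ((Perm.toList σ x).length - 1)) x := by
      rw [List.getLast?_eq_getElem?, Option.mem_def, List.getElem?_eq_getElem (by omega), Perm.getElem_toList] at ha
      simpa using ha.symm
    have : σ a = b := by
      obtain ⟨i, hi, h5⟩ := List.getElem_of_mem (hmem (σ a))
      have h6 := h5
      rw [Perm.getElem_toList, ha'] at h5
      rcases Nat.eq_zero_or_pos i with h0 | h0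
      · rw [h0] at h5; rw [hb', ha', ← h5]; simp
      · exfalso
        obtain ⟨i, rfl⟩ := Nat.exists_eq_add_of_lt h0
        simp only [zero_add] at h5 hi
        rw [pow_succ', Perm.mul_apply] at h5
        have h7 := σ.injective h5
        rw [← Perm.getElem_toList σ x i (by omega), ← Perm.getElem_toList σ x _ (by omega)] at h7
        have := hnd.getElem_inj_iff.1 h7
        omega
    rw [← this]; exact hR a
end
end

section
open Equiv

section
variable {V : Type*} [Fintype V]

theorem reps (τ : Perm V) (Fx E : Finset V) (ℓ : ℕ) (hEF : E ⊆ Fx) (hF : Fx.card < ℓ)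
    (hlong : ∀ v, v ∉ E → ∀ j, 1 ≤ j → j < ℓ → (τ ^ j) v ≠ v) :
    ∃ Rp : Finset V, (∀ r ∈ Rp, r ∉ Fx) ∧ (∀ v, v ∉ E → ∃ r ∈ Rp, τ.SameCycle r v) ∧
      Rp.card * ℓ ≤ Fintype.card V := by
  have hinj : ∀ v, v ∉ E → ∀ i < ℓ, ∀ j < ℓ, (τ ^ i) v = (τ ^ j) v → i = j := by
    have key : ∀ v, v ∉ E → ∀ i < ℓ, ∀ j < ℓ, i < j → (τ ^ i) v ≠ (τ ^ j) v := by
      intro v hv i hi j hj hij hc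
      refine hlong v hv (j - i) (by omega) (by omega) ((τ ^ i).injective ?_)
      rw [← Perm.mul_apply, ← pow_add, show i + (j - i) = j by omega]; exact hc.symm
    intro v hv i hi j hj hc
    rcases lt_trichotomy i j with h | h | h
    · exact absurd hc (key v hv i hi j hj h)
    · exact h
    · exact absurd hc.symm (key v hv j hj i hi h)
  obtain ⟨Rp, hRp, hmax⟩ := Finset.exists_max_image
    (Finset.univ.filter (fun S : Finset V => (∀ r ∈ S, r ∉ Fx) ∧ ∀ r ∈ S, ∀ r' ∈ S, τ.SameCycle r r' → r = r'))
    Finset.card ⟨∅, by simp⟩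
  obtain ⟨p1, p2⟩ := (Finset.mem_filter.1 hRp).2
  refine ⟨Rp, p1, ?_, ?_⟩
  · intro v hv
    by_contra hc
    push Not at hc
    have h1 : Fx.card < ((Finset.range ℓ).image (fun j => (τ ^ j) v)).card := by
      rw [Finset.card_image_of_injOn]
      · simpa using hF
      · intro i hi j hj h; exact hinj v hv i (by simpa using hi) j (by simpa using hj) h
    obtain ⟨w, hw1, hw2⟩ := Finset.exists_mem_notMem_of_card_lt_card h1
    obtain ⟨j, hj, rfl⟩ := Finset.mem_image.1 hw1
    have hsc : ∀ r ∈ Rp, ¬ τ.SameCycle r ((τ ^ j) v) := by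
      intro r hr h
      exact hc r hr (Perm.sameCycle_pow_right.1 h)
    have hn : (τ ^ j) v ∉ Rp := fun h => hsc _ h (Perm.SameCycle.refl _ _)
    have := hmax (insert ((τ ^ j) v) Rp) (by
      refine Finset.mem_filter.2 ⟨Finset.mem_univ _, ?_, ?_⟩
      · intro r hr
        rcases Finset.mem_insert.1 hr with h | h
        · rw [h]; exact hw2
        · exact p1 r h
      · intro r hr r' hr' h
        rcases Finset.mem_insert.1 hr with h1 | h1 <;> rcases Finset.mem_insert.1 hr' with h2 | h2
        · rw [h1, h2]
        · rw [h1] at h; exact absurd h.symm (hsc r' h2)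
        · rw [h2] at h; exact absurd h (hsc r h1)
        · exact p2 r h1 r' h2 h)
    rw [Finset.card_insert_of_notMem hn] at this
    omega
  · have : (Rp ×ˢ Finset.range ℓ).card ≤ (Finset.univ : Finset V).card := by
      apply Finset.card_le_card_of_injOn (fun x => (τ ^ x.2) x.1) (fun _ _ => Finset.mem_univ _)
      rintro ⟨r, i⟩ hr ⟨r', j⟩ hr' h
      simp only [Finset.coe_product, Set.mem_prod, Finset.mem_coe, Finset.mem_range] at hr hr' h
      have e1 : τ.SameCycle r r' := by
        have : τ.SameCycle ((τ ^ i) r) ((τ ^ j) r') := by rw [h]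
        exact Perm.sameCycle_pow_right.1 (Perm.sameCycle_pow_left.1 this)
      have e2 := p2 r hr.1 r' hr'.1 e1
      subst e2
      rw [hinj r (fun hc => p1 r hr.1 (hEF hc)) i hr.2 j hr'.2 h]
    rwa [Finset.card_product, Finset.card_range, Finset.card_univ] at this

theorem NE_case (R : V → V → Prop) (z : ℕ → V) (t m p e0 e1 K T M ℓ : ℕ) (N : ℕ → ℕ) (hm : Fintype.card V = m)
    (NE : ManyArcs R p e0)
    (hdo : ∀ v, p ≤ (Finset.univ.filter (fun u => R v u)).card)
    (hdi : ∀ v, p ≤ (Finset.univ.filter (fun u => R u v)).card)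
    (hl : ∀ v, (∀ i ≤ t, v ≠ z i) → ¬ R v v)
    (hzi : ∀ i ≤ t, ∀ j ≤ t, z i = z j → i = j) (hN : ∀ i < t, 4 ≤ N i)
    (h0 : 2 ≤ m)
    (hx1 : 2 * ((∑ i ∈ Finset.range t, N i + t + 2) * m) < e0) (hx2 : ∑ i ∈ Finset.range t, N i + t + 2 < p)
    (he : e1 + 2 * ((4 * (K * T) + (1 + ∑ i ∈ Finset.range t, N i) + 2) * m) ≤ e0)
    (hM : m ^ 4 ≤ M * (e1 * e1)) (hT : (M - 1) ^ T * m ^ 2 < M ^ T)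
    (hℓ : 6 * (ℓ * m) + 2 * (((1 + ∑ i ∈ Finset.range t, N i) + 3 * (K * T)) * m) < e0)
    (hFl : (1 + ∑ i ∈ Finset.range t, N i) + 3 * (K * T) < ℓ) (hL0 : ℓ + 2 * (K * T) ≤ m) (hK : 2 * m ≤ K * ℓ) :
    HamOut R z t N := by
  obtain ⟨seg, sg1, sg2, sg3, sg4⟩ := z_path R z t m p e0 _ N hm NE hdo hdi hx1 hx2 hl hzi hN le_rfl
  suffices H : ∃ l : List V, (((List.range t).flatMap (fun i => z i :: seg i) ++ [z t]) ++ l).Nodup ∧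
      (∀ v, v ∈ ((List.range t).flatMap (fun i => z i :: seg i) ++ [z t]) ++ l) ∧
      CycChain R (((List.range t).flatMap (fun i => z i :: seg i) ++ [z t]) ++ l) by
    obtain ⟨l, p1, p2, p3⟩ := H
    exact ⟨seg, l, sg1, p1, p2, p3⟩
  have hzL : ∀ i ≤ t, z i ∈ ((List.range t).flatMap (fun i => z i :: seg i) ++ [z t]) := by
    intro i hi
    rcases Nat.lt_or_ge i t with h | h
    · exact List.mem_append_left _ (List.mem_flatMap.2 ⟨i, List.mem_range.2 h, List.mem_cons_self⟩)
    · have : i = t := by omega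
      rw [this]; simp
  have hLne : ((List.range t).flatMap (fun i => z i :: seg i) ++ [z t]) ≠ [] := by simp
  generalize hL1 : ((List.range t).flatMap (fun i => z i :: seg i) ++ [z t]) = L1 at *
  generalize hlam : 1 + ∑ i ∈ Finset.range t, N i = lam at *
  clear hL1 sg1
  have hX0 : L1.toFinset.card = lam := by rw [List.toFinset_card_of_nodup sg2, sg4]
  have hlX : ∀ v, v ∉ L1.toFinset → ¬ R v v := fun v hv => hl v (fun i hi hc => hv (by rw [hc]; exact List.mem_toFinset.2 (hzL i hi)))
  obtain ⟨sv, hsv⟩ : ∃ sv : V × V → (V × V) × (V × V) → Prop, ∀ pq ω, sv pq ω ↔ (svq R pq ω ∧ Disjoint (vsq ω) L1.toFinset) :=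
    ⟨_, fun _ _ => Iff.rfl⟩
  obtain ⟨F, f1, f2, f3, f4⟩ := cover_all (Ω := (V × V) × (V × V)) (P := V × V) vsq sv M (4 * (K * T)) T
    (fun ω => by
      unfold vsq
      exact Finset.card_le_four)
    (fun ω => ⟨ω.1.1, by simp [vsq]⟩)
    (fun X hX pq => by
      have e2 : (L1.toFinset ∪ X).card ≤ lam + 4 * (K * T) := (Finset.card_union_le _ _).trans (by omega)
      have e3 := Nat.mul_le_mul_right m (Nat.add_le_add_right e2 2)
      have := svq_count R m p e0 e1 hm NE hdo hdi (L1.toFinset ∪ X)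
        (fun v hv => hlX v (fun h => hv (Finset.mem_union_left _ h))) (by
          have e4 : (lam + 4 * (K * T) + 2) * m = (4 * (K * T) + lam + 2) * m := by ring
          omega) pq
      rw [Fintype.card_prod, Fintype.card_prod, hm]
      calc m * m * (m * m) = m ^ 4 := by ring
        _ ≤ M * (e1 * e1) := hM
        _ ≤ _ := Nat.mul_le_mul_left _ (this.trans (Finset.card_le_card (by
          intro ω hω
          obtain ⟨a1, a2⟩ := (Finset.mem_filter.1 hω).2
          rw [Finset.disjoint_union_right] at a2
          exact Finset.mem_filter.2 ⟨Finset.mem_univ _, (hsv _ _).2 ⟨a1, a2.1⟩, a2.2⟩))))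
    (by rw [Fintype.card_prod, Fintype.card_prod, hm]; positivity)
    (by rw [Fintype.card_prod, hm, ← pow_two]; exact hT) ∅ K (by simp)
  have fs : ∀ ω ∈ F, Disjoint (vsq ω) L1.toFinset ∧
      (R ω.1.1 ω.1.2 ∧ R ω.2.1 ω.1.1 ∧ R ω.1.2 ω.2.2 ∧ R ω.2.1 ω.2.2) ∧
      (ω.1.1 ≠ ω.1.2 ∧ ω.2.1 ≠ ω.2.2 ∧ ω.2.1 ≠ ω.1.1 ∧ ω.2.1 ≠ ω.1.2 ∧ ω.2.2 ≠ ω.1.1 ∧ ω.2.2 ≠ ω.1.2) := by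
    intro ω hω
    obtain ⟨pq, hpq⟩ := (f2 ω hω).2
    obtain ⟨⟨g1, g2, g3⟩, h⟩ := (hsv _ _).1 hpq
    exact ⟨h, ⟨g1.2.1, g2⟩, g3⟩
  have mvs : ∀ (ω : (V × V) × (V × V)) v, v ∈ vsq ω ↔ (v = ω.1.1 ∨ v = ω.1.2 ∨ v = ω.2.1 ∨ v = ω.2.2) := by
    intro ω v; simp [vsq]
  have hvL : ∀ ω ∈ F, ∀ v ∈ vsq ω, v ∉ L1 := fun ω hω v hv hc =>
    (Finset.disjoint_left.1 (fs ω hω).1 hv) (List.mem_toFinset.2 hc)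
  have hvv : ∀ ω ∈ F, ∀ ω' ∈ F, ∀ v, v ∈ vsq ω → v ∈ vsq ω' → ω = ω' := by
    intro ω hω ω' hω' v h h'
    by_contra hc
    exact Finset.disjoint_left.1 (f3 ω hω ω' hω' hc) h h'
  have ms : ∀ ω : (V × V) × (V × V), ω.1.1 ∈ vsq ω := fun ω => by simp [vsq]
  have mt : ∀ ω : (V × V) × (V × V), ω.1.2 ∈ vsq ω := fun ω => by simp [vsq]
  have ma : ∀ ω : (V × V) × (V × V), ω.2.1 ∈ vsq ω := fun ω => by simp [vsq]
  have mb : ∀ ω : (V × V) × (V × V), ω.2.2 ∈ vsq ω := fun ω => by simp [vsq]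
  obtain ⟨E, hE⟩ : ∃ E : Finset V, E = F.biUnion (fun ω => {ω.1.1, ω.1.2}) := ⟨_, rfl⟩
  have mE : ∀ v, v ∈ E ↔ ∃ ω ∈ F, v = ω.1.1 ∨ v = ω.1.2 := by
    intro v; rw [hE]; simp
  have cE : E.card ≤ 2 * (K * T) := by
    have : E.card ≤ F.card * 2 := by
      rw [hE]; exact Finset.card_biUnion_le_card_mul _ _ _ (fun _ _ => Finset.card_le_two)
    omega
  obtain ⟨Fx, hFx⟩ : ∃ Fx : Finset V, Fx = L1.dropLast.toFinset ∪ F.biUnion (fun ω => {ω.2.1, ω.1.1, ω.1.2}) := ⟨_, rfl⟩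
  have mFx : ∀ v, v ∈ Fx ↔ (v ∈ L1.dropLast ∨ ∃ ω ∈ F, v = ω.2.1 ∨ v = ω.1.1 ∨ v = ω.1.2) := by
    intro v; rw [hFx]; simp
  have cFx : Fx.card ≤ lam + 3 * (K * T) := by
    have h1 : (F.biUnion (fun ω => ({ω.2.1, ω.1.1, ω.1.2} : Finset V))).card ≤ F.card * 3 :=
      Finset.card_biUnion_le_card_mul _ _ _ (fun _ _ => Finset.card_le_three)
    have h2 : L1.dropLast.toFinset.card ≤ L1.length := (List.toFinset_card_le _).trans (by simp)
    have := Finset.card_union_le L1.dropLast.toFinset (F.biUnion (fun ω => ({ω.2.1, ω.1.1, ω.1.2} : Finset V)))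
    rw [hFx]; omega
  have hEF : E ⊆ Fx := by
    intro v hv
    obtain ⟨ω, hω, h⟩ := (mE v).1 hv
    exact (mFx v).2 (Or.inr ⟨ω, hω, Or.inr h⟩)
  -- the initial list
  obtain ⟨rest, hrest⟩ : ∃ rest : List V, rest = (Finset.univ.filter (fun v => v ∉ L1 ∧ ∀ ω ∈ F, v ∉ vsq ω)).toList := ⟨_, rfl⟩
  have mrest : ∀ v, v ∈ rest ↔ (v ∉ L1 ∧ ∀ ω ∈ F, v ∉ vsq ω) := by
    intro v; rw [hrest]; simp
  obtain ⟨mid, hmid⟩ : ∃ mid : List V, mid = F.toList.flatMap (fun ω => [ω.2.1, ω.2.2]) := ⟨_, rfl⟩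
  have mmid : ∀ v, v ∈ mid ↔ ∃ ω ∈ F, v = ω.2.1 ∨ v = ω.2.2 := by
    intro v; rw [hmid]; simp
  have nmid : mid.Nodup := by
    rw [hmid, List.nodup_flatMap]
    constructor
    · intro ω hω
      simpa using (fs ω (Finset.mem_toList.1 hω)).2.2.2.1
    · have hnd := F.nodup_toList
      have hall : ∀ ω ∈ F.toList, ω ∈ F := fun ω h => Finset.mem_toList.1 h
      refine (List.Pairwise.imp_of_mem ?_ hnd)
      intro ω ω' hω hω' hne
      intro v hv hv'
      apply hne
      apply hvv ω (hall ω hω) ω' (hall ω' hω') v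
      · rw [mvs]; simp at hv; tauto
      · rw [mvs]; simp at hv'; tauto
  have nL0 : (L1 ++ (mid ++ rest)).Nodup := by
    rw [List.nodup_append', List.nodup_append']
    refine ⟨sg2, ⟨nmid, by rw [hrest]; exact Finset.nodup_toList _, ?_⟩, ?_⟩
    · intro v hv hv'
      obtain ⟨ω, hω, h⟩ := (mmid v).1 hv
      exact ((mrest v).1 hv').2 ω hω (by rw [mvs]; tauto)
    · intro v hv hv'
      rcases List.mem_append.1 hv' with h | h
      · obtain ⟨ω, hω, h⟩ := (mmid v).1 h
        exact hvL ω hω v (by rw [mvs]; tauto) hv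
      · exact ((mrest v).1 h).1 hv
  have mL0 : ∀ v, v ∈ (L1 ++ (mid ++ rest)) ↔ v ∉ E := by
    intro v
    rw [List.mem_append, List.mem_append, mmid, mrest, mE]
    constructor
    · rintro (h | ⟨ω, hω, h⟩ | h) ⟨ω', hω', h'⟩
      · exact hvL ω' hω' v (by rw [mvs]; tauto) h
      · have := hvv ω hω ω' hω' v (by rw [mvs]; tauto) (by rw [mvs]; tauto)
        subst this
        obtain ⟨g1, g2, g3, g4, g5, g6⟩ := (fs ω hω).2.2
        rcases h with h | h <;> rcases h' with h' | h' <;> rw [h] at h' <;> tauto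
      · exact h.2 ω' hω' (by rw [mvs]; tauto)
    · intro h
      by_contra hc
      push Not at hc
      obtain ⟨h1, h2, h3⟩ := hc
      obtain ⟨ω, hω, h4⟩ := h3 h1
      apply h
      rw [mvs] at h4
      have := h2 ω hω
      exact ⟨ω, hω, by tauto⟩
  have lL0 : ℓ ≤ (L1 ++ (mid ++ rest)).length := by
    rw [← List.toFinset_card_of_nodup nL0]
    have : (L1 ++ (mid ++ rest)).toFinset = Finset.univ \ E := by
      ext v; rw [List.mem_toFinset, mL0]; simp
    rw [this]
    have := Finset.le_card_sdiff E Finset.univ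
    rw [Finset.card_univ, hm] at this
    omega
  have hsplit : ∀ v ∈ L1.dropLast, ∃ l1 w l2, L1 = l1 ++ v :: w :: l2 := by
    intro v hv
    obtain ⟨l1, l2, h⟩ := List.append_of_mem hv
    have e := List.dropLast_append_getLast hLne
    rw [h] at e
    rcases l2 with _ | ⟨w, l2⟩
    · exact ⟨l1, L1.getLast hLne, [], e.symm.trans (by simp)⟩
    · exact ⟨l1, w, l2 ++ [L1.getLast hLne], e.symm.trans (by simp)⟩
  obtain ⟨τ0, hτ0⟩ : ∃ τ0 : Perm V, τ0 = (L1 ++ (mid ++ rest)).formPerm := ⟨_, rfl⟩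
  have t1 : ∀ l1 v w l2, L1 = l1 ++ v :: w :: l2 → τ0 v = w := by
    intro l1 v w l2 h
    have e : L1 ++ (mid ++ rest) = l1 ++ v :: w :: (l2 ++ (mid ++ rest)) := by rw [h]; simp
    rw [hτ0, e]
    rw [e] at nL0
    exact fp_consec _ _ _ _ nL0
  have t2 : ∀ ω ∈ F, τ0 ω.2.1 = ω.2.2 := by
    intro ω hω
    obtain ⟨l1, l2, h⟩ := List.append_of_mem (Finset.mem_toList.2 hω)
    have e : L1 ++ (mid ++ rest) = (L1 ++ l1.flatMap (fun ω => [ω.2.1, ω.2.2])) ++ ω.2.1 :: ω.2.2 :: (l2.flatMap (fun ω => [ω.2.1, ω.2.2]) ++ rest) := by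
      rw [hmid, h]; simp
    rw [hτ0, e]
    rw [e] at nL0
    exact fp_consec _ _ _ _ nL0
  have t3 : ∀ v ∈ E, τ0 v = v := by
    intro v hv
    rw [hτ0]
    exact List.formPerm_apply_of_notMem (fun h => (mL0 v).1 h hv)
  obtain ⟨τ, q1, q2, q3⟩ := minimize R m p e0 ℓ Fx E τ0 hm hEF (by
      intro v hv hvE
      rcases (mFx v).1 hv with h | ⟨ω, hω, h | h⟩
      · obtain ⟨l1, w, l2, h2⟩ := hsplit v h
        rw [t1 _ _ _ _ h2]
        rw [h2] at sg3
        exact (List.isChain_append_cons_cons.1 sg3).2.1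
      · rw [h, t2 ω hω]; exact (fs ω hω).2.1.2.2.2
      · exact absurd ((mE v).2 ⟨ω, hω, h⟩) hvE)
    (by
      intro v hv j h1 h2
      rw [hτ0]
      exact fp_long _ nL0 v ((mL0 v).2 hv) j h1 (by omega)) hdo hdi NE (by omega) (by
      have := Nat.mul_le_mul_right m cFx
      omega)
  obtain ⟨Rp, r1, r2, r3⟩ := reps τ Fx E ℓ hEF (by omega) q3
  have hRne : 0 < Rp.card := by
    have : 0 < L1.length := List.length_pos_of_ne_nil hLne
    obtain ⟨v, hv⟩ := List.exists_mem_of_ne_nil _ hLne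
    obtain ⟨r, hr, _⟩ := r2 v ((mL0 v).1 (List.mem_append_left _ hv))
    exact Finset.card_pos.2 ⟨r, hr⟩
  have cnE : ∀ v, (∀ i ∈ F, v ≠ i.1.1 ∧ v ≠ i.1.2) → v ∉ E := by
    intro v hv hc
    obtain ⟨ω, hω, h⟩ := (mE v).1 hc
    have := hv ω hω
    tauto
  have hmu : ∀ (ω : (V × V) × (V × V)) (c : Fin 3), (![ω.2.1, ω.1.1, ω.1.2] : Fin 3 → V) c ∈ vsq ω := by
    intro ω c
    fin_cases c
    · exact ma ω
    · exact ms ω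
    · exact mt ω
  have MI : MInv R (fun ω : (V × V) × (V × V) => (![ω.2.1, ω.1.1, ω.1.2] : Fin 3 → V)) (fun ω => ω.2.2)
      L1.dropLast.toFinset τ0 τ F Rp ∅ := by
    constructor
    · intro v _ hv
      exact q2 v (cnE v hv)
    · intro v hv
      exact q1 v ((mFx v).2 (Or.inl (List.mem_toFinset.1 hv)))
    · intro ω hω
      refine ⟨?_, ?_, ?_⟩
      · exact (q1 _ ((mFx _).2 (Or.inr ⟨ω, hω, Or.inl rfl⟩))).trans (t2 ω hω)
      · exact (q1 _ ((mFx _).2 (Or.inr ⟨ω, hω, Or.inr (Or.inl rfl)⟩))).trans (t3 _ ((mE _).2 ⟨ω, hω, Or.inl rfl⟩))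
      · exact (q1 _ ((mFx _).2 (Or.inr ⟨ω, hω, Or.inr (Or.inr rfl)⟩))).trans (t3 _ ((mE _).2 ⟨ω, hω, Or.inr rfl⟩))
    · intro v hv
      exact r2 v (cnE v hv)
    · intro ω hω ω' hω' c d h
      have e := hvv ω hω ω' hω' _ (hmu ω c) (by rw [h]; exact hmu ω' d)
      refine ⟨e, ?_⟩
      subst e
      obtain ⟨g1, g2, g3, g4, g5, g6⟩ := (fs ω hω).2.2
      fin_cases c <;> fin_cases d <;> first | rfl | (exfalso; simp at h; first | exact g1 h | exact g1 h.symm | exact g3 h | exact g3 h.symm | exact g4 h | exact g4 h.symm)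
    · intro ω hω
      obtain ⟨g1, g2, g3, g4⟩ := (fs ω hω).2.1
      exact ⟨g2, g1, g3⟩
    · intro ω hω c hc
      exact hvL ω hω _ (hmu ω c) (List.dropLast_subset _ (List.mem_toFinset.1 hc))
    · intro r hr hc
      exact r1 r hr ((mFx r).2 (Or.inl (List.mem_toFinset.1 hc)))
    · intro r hr ω hω c hc
      apply r1 r hr
      rw [mFx]
      refine Or.inr ⟨ω, hω, ?_⟩
      rw [hc]
      fin_cases c <;> simp
  obtain ⟨σ, s1, s2, s3⟩ := merge_all (Rp.card - 1) τ F Rp (by omega) MI (by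
    intro a b
    have h1 := f4 (a, b)
    have h2 : 2 * (Rp.card - 1) ≤ K := by
      have h3 : (2 * (Rp.card - 1)) * ℓ ≤ K * ℓ := by
        have : (Rp.card - 1) * ℓ ≤ Rp.card * ℓ := Nat.mul_le_mul_right _ (by omega)
        have e : (2 * (Rp.card - 1)) * ℓ = 2 * ((Rp.card - 1) * ℓ) := by ring
        rw [hm] at r3
        omega
      exact Nat.le_of_mul_le_mul_right h3 (by omega)
    refine h2.trans (h1.trans (Finset.card_le_card ?_))
    intro ω hω
    obtain ⟨a1, a2⟩ := Finset.mem_filter.1 hω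
    exact Finset.mem_filter.2 ⟨a1, ((hsv _ _).1 a2).1.1.1, ((hsv _ _).1 a2).1.1.2.2⟩)
  refine perm_list R σ s1 s3 L1 hLne sg2 ?_ (by omega)
  intro v w l1 l2 h
  rw [s2 v (List.mem_toFinset.2 (by rw [h]; simp)), t1 _ _ _ _ h]
end
end

theorem expT (M B : ℕ) (hM : 1 ≤ M) : ∃ T0 : ℕ, ∀ T, T0 ≤ T → (M - 1) ^ T * (B * T) ^ 2 < M ^ T := by
  have hMr : (0:ℝ) < M := by exact_mod_cast hM
  have hr : |((M:ℝ) - 1) / M| < 1 := by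
    rw [abs_of_nonneg (div_nonneg (by have : (1:ℝ) ≤ M := by exact_mod_cast hM
                                      linarith) hMr.le), div_lt_one hMr]; linarith
  have h1 := tendsto_pow_const_mul_const_pow_of_abs_lt_one 2 hr
  have h2 := h1.const_mul ((B:ℝ)^2)
  rw [mul_zero] at h2
  obtain ⟨T0, hT0⟩ := Filter.eventually_atTop.1 (h2.eventually (gt_mem_nhds (zero_lt_one' ℝ)))
  refine ⟨T0, fun T hT => ?_⟩
  have h3 := hT0 T hT
  have h4 : (((M - 1 : ℕ) : ℝ)) ^ T * ((B:ℝ) * T) ^ 2 < (M:ℝ) ^ T := by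
    rw [Nat.cast_sub hM, Nat.cast_one]
    have hp : (0:ℝ) < (M:ℝ)^T := by positivity
    rw [div_pow] at h3
    have : (B:ℝ)^2 * ((T:ℝ)^2 * (((M:ℝ)-1)^T / (M:ℝ)^T)) = (((M:ℝ)-1)^T * (B * T)^2) / (M:ℝ)^T := by ring
    rw [this, div_lt_one hp] at h3
    exact h3
  exact_mod_cast h4

theorem core (t : ℕ) : ∃ A0 m0 : ℕ, 0 < A0 ∧ ∀ (V : Type) [Fintype V] (R : V → V → Prop) (z : ℕ → V) (m : ℕ) (N : ℕ → ℕ),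
    DG R z t m → m0 ≤ m → (∀ i < t, 4 ≤ N i) → A0 * ∑ i ∈ Finset.range t, N i ≤ m → HamOut R z t N := by
  obtain ⟨κ, hκ⟩ : ∃ κ, κ = 4 * (t + 3) := ⟨_, rfl⟩
  obtain ⟨Q, hQ⟩ : ∃ Q, Q = 2000000 * (κ + 2) := ⟨_, rfl⟩
  obtain ⟨q, hq⟩ : ∃ q, q = Q ^ 2 := ⟨_, rfl⟩
  have hQ0 : 0 < Q := by omega
  have hq0 : 0 < q := by rw [hq]; positivity
  obtain ⟨T0, hT0⟩ := expT (64 * q ^ 2) (128000 * q ^ 2) (Nat.one_le_iff_ne_zero.2 (by positivity))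
  obtain ⟨Y, hY⟩ : ∃ Y, Y = 2 ^ (5 * κ) * (5 * κ) + 5 * κ + 4 * (t + 1) + 1 := ⟨_, rfl⟩
  obtain ⟨G, hG⟩ : ∃ G, G = 160 * q * (T0 + 1) + t + 10 := ⟨_, rfl⟩
  refine ⟨400 * q + Q, Q + Q * Y + Q ^ 2 * (6 * (t + 1) + 1) + 200 * q * G, by omega, ?_⟩
  intro V _ R z m N DG0 hm0 hN hNs
  obtain ⟨S, hS⟩ : ∃ S, S = ∑ i ∈ Finset.range t, N i := ⟨_, rfl⟩
  have b1 : Q ≤ m := by omega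
  have b2 : Q * Y ≤ m := by omega
  have b3 : Q ^ 2 * (6 * (t + 1) + 1) ≤ m := by omega
  have b4 : 200 * q * G ≤ m := by omega
  rw [← hS, Nat.add_mul] at hNs
  obtain ⟨r, hr1, hr2, hr3⟩ : ∃ r, 3 * (t + 1) ≤ r ∧ r ≤ 3 * (t + 1) + 1 ∧ (m - r) % 2 = 0 := by
    rcases Nat.mod_two_eq_zero_or_one (m - 3 * (t + 1)) with h | h
    · exact ⟨_, le_rfl, by omega, h⟩
    · exact ⟨3 * (t + 1) + 1, by omega, by omega, by omega⟩
  have hmt : 6 * (t + 1) + 1 ≤ m := le_trans (Nat.le_mul_of_pos_left _ (by positivity)) b3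
  obtain ⟨p, hp⟩ : ∃ p, m = 2 * p + r := ⟨(m - r) / 2, by omega⟩
  have hdo : ∀ v, p ≤ (Finset.univ.filter (fun u => R v u)).card := by
    intro v; have := DG0.hdo v; omega
  have hdi : ∀ v, p ≤ (Finset.univ.filter (fun u => R u v)).card := by
    intro v; have := DG0.hdi v; omega
  by_cases hE : ∃ S0 T0 : Finset V, S0.card = p ∧ T0.card = p ∧ Q ^ 2 * ∑ u ∈ S0, (T0.filter (fun v => R u v)).card ≤ m ^ 2
  · obtain ⟨S0, T0, s1, s2, s3⟩ := hE
    obtain ⟨y, hy⟩ : ∃ y, y = m / Q + 1 := ⟨_, rfl⟩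
    have y1 : m ≤ Q * y := by
      have := Nat.lt_mul_div_succ m hQ0
      rw [hy]; exact this.le
    have y2 : Q * y ≤ 2 * m := by
      have := Nat.mul_div_le m Q
      rw [hy, mul_add]; omega
    have yY : Y ≤ y := Nat.le_of_mul_le_mul_left (b2.trans y1) hQ0
    refine E_case DG0 S0 T0 p r Q y κ _ N (by omega) s1 s2 hp le_rfl ?_ s3 y1 (by omega) (by omega) hN ?_ hκ (by omega) ?_
    · exact (Nat.mul_le_mul_left _ (by omega)).trans b3
    · rw [← hS]
      refine Nat.le_of_mul_le_mul_left (show Q * S ≤ Q * y from ?_) hQ0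
      omega
    · have e : Q * y = 2 * (1000000 * (κ * y) + 2000000 * y) := by rw [hQ]; ring
      omega
  · push Not at hE
    have hcount : ∀ S T : Finset V, ((S ×ˢ T).filter (fun x => R x.1 x.2)).card = ∑ u ∈ S, (T.filter (fun v => R u v)).card := by
      intro S T
      rw [Finset.card_filter, Finset.sum_product]
      refine Finset.sum_congr rfl (fun u _ => ?_)
      rw [Finset.card_filter]
    have NE : ∀ S T : Finset V, p ≤ S.card → p ≤ T.card → m ^ 2 / q ≤ ((S ×ˢ T).filter (fun x => R x.1 x.2)).card := by
      intro S T hS hT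
      obtain ⟨S', hS', cS⟩ := Finset.exists_subset_card_eq hS
      obtain ⟨T', hT', cT⟩ := Finset.exists_subset_card_eq hT
      have h1 := hE S' T' cS cT
      rw [← hcount, ← hq] at h1
      have h2 : ((S' ×ˢ T').filter (fun x => R x.1 x.2)).card ≤ ((S ×ˢ T).filter (fun x => R x.1 x.2)).card :=
        Finset.card_le_card (Finset.filter_subset_filter _ (Finset.product_subset_product hS' hT'))
      refine le_trans ?_ h2
      exact Nat.div_le_of_le_mul h1.le
    obtain ⟨g, hg⟩ : ∃ g, g = m / (200 * q) := ⟨_, rfl⟩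
    have g1 : 200 * q * g ≤ m := by rw [hg]; exact Nat.mul_div_le _ _
    have g2 : m < 200 * q * (g + 1) := by rw [hg]; exact Nat.lt_mul_div_succ _ (by positivity)
    have gG : G ≤ g := by rw [hg]; exact (Nat.le_div_iff_mul_le (by positivity)).2 (by rw [mul_comm]; exact b4)
    have g3 : m ≤ 400 * q * g := by
      have : 200 * q * (g + 1) ≤ 400 * q * g := by
        have : 200 * q * (g + 1) ≤ 200 * q * (2 * g) := Nat.mul_le_mul_left _ (by omega)
        calc _ ≤ _ := this
          _ = _ := by ring
      omega
    have e0 : 200 * (g * m) ≤ m ^ 2 / q := by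
      rw [Nat.le_div_iff_mul_le hq0]
      calc 200 * (g * m) * q = (200 * q * g) * m := by ring
        _ ≤ m * m := Nat.mul_le_mul_right _ g1
        _ = m ^ 2 := by ring
    obtain ⟨T, hT⟩ : ∃ T, T = g / (160 * q) := ⟨_, rfl⟩
    have T1 : 160 * q * T ≤ g := by rw [hT]; exact Nat.mul_div_le _ _
    have T2 : g < 160 * q * (T + 1) := by rw [hT]; exact Nat.lt_mul_div_succ _ (by positivity)
    have TT : T0 + 1 ≤ T := by rw [hT]; exact (Nat.le_div_iff_mul_le (by positivity)).2 (by rw [mul_comm]; omega)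
    have T3 : g ≤ 320 * q * T := by
      have : 160 * q * (T + 1) ≤ 160 * q * (2 * T) := Nat.mul_le_mul_left _ (by omega)
      have e : 160 * q * (2 * T) = 320 * q * T := by ring
      omega
    have T4 : m ≤ 128000 * q ^ 2 * T := by
      calc m ≤ 400 * q * g := g3
        _ ≤ 400 * q * (320 * q * T) := Nat.mul_le_mul_left _ T3
        _ = _ := by ring
    have hSg : S ≤ g := by
      refine Nat.le_of_mul_le_mul_left (show 400 * q * S ≤ 400 * q * g from ?_) (by positivity)
      omega
    have hKT : 2 * (80 * q * T) ≤ g := by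
      have : 2 * (80 * q * T) = 160 * q * T := by ring
      omega
    have hgm : 0 < g * m := Nat.mul_pos (by omega) (by omega)
    have hmul : ∀ a b, a ≤ b * g → a * m ≤ b * (g * m) := by
      intro a b h
      calc a * m ≤ b * g * m := Nat.mul_le_mul_right _ h
        _ = _ := by ring
    have g5 : 200 * g ≤ m := le_trans (by
      calc 200 * g = 200 * 1 * g := by ring
        _ ≤ 200 * q * g := by gcongr; omega) g1
    apply NE_case R z t m p (m ^ 2 / q) (50 * (g * m)) (80 * q) T (64 * q ^ 2) (10 * g) N DG0.hm NE hdo hdi DG0.hl DG0.hzi hN (by omega)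
    · rw [← hS]
      have := hmul (S + t + 2) 2 (by omega)
      omega
    · rw [← hS]; omega
    · rw [← hS]
      have := hmul (4 * (80 * q * T) + (1 + S) + 2) 4 (by omega)
      omega
    · have h1 : m ^ 2 ≤ 8 * q * (50 * (g * m)) := by
        calc m ^ 2 = m * m := by ring
          _ ≤ 400 * q * g * m := Nat.mul_le_mul_right _ g3
          _ = _ := by ring
      calc m ^ 4 = m ^ 2 * m ^ 2 := by ring
        _ ≤ (8 * q * (50 * (g * m))) * (8 * q * (50 * (g * m))) := Nat.mul_le_mul h1 h1
        _ = _ := by ring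
    · refine lt_of_le_of_lt (Nat.mul_le_mul_left _ (Nat.pow_le_pow_left T4 2)) (hT0 T (by omega))
    · rw [← hS]
      have h1 := hmul (1 + S + 3 * (80 * q * T)) 4 (by omega)
      have h2 : 6 * (10 * g * m) = 60 * (g * m) := by ring
      omega
    · rw [← hS]; omega
    · omega
    · have : 80 * q * (10 * g) = 2 * (400 * q * g) := by ring
      omega

theorem split_flat {V : Type*} (z : ℕ → V) (s : ℕ → List V) : ∀ t i, i < t → ∃ pre post : List V,
    (List.range t).flatMap (fun i => z i :: s i) ++ [z t] = pre ++ (z i :: s i ++ [z (i+1)]) ++ post := by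
  intro t
  induction t with
  | zero => intro i hi; omega
  | succ t ih =>
    intro i hi
    rcases Nat.lt_or_ge i t with h | h
    · obtain ⟨pre, post, e⟩ := ih i h
      refine ⟨pre, post ++ s t ++ [z (t+1)], ?_⟩
      rw [List.range_succ, List.flatMap_append]
      have : List.flatMap (fun i => z i :: s i) [t] = [z t] ++ s t := by simp
      rw [this, ← List.append_assoc, e]
      simp
    · have : i = t := by omega
      subst this
      exact ⟨(List.range i).flatMap (fun i => z i :: s i), [], by rw [List.range_succ, List.flatMap_append]; simp⟩

section
variable {V : Type} [Fintype V] (A : V → V → Prop) {t : ℕ} (x y : Fin (t+1) → V) (Z : Finset V)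

/-- tail and head maps of the contracted digraph -/
def tlm : {v // v ∉ Z} ⊕ Fin (t+1) → V := Sum.elim Subtype.val x
def hdm : {v // v ∉ Z} ⊕ Fin (t+1) → V := Sum.elim Subtype.val (fun i => y (i - 1))

theorem deg_contr (P : V → Prop) (y : Fin (t+1) → V) (f : Fin (t+1) ≃ Fin (t+1)) :
    (Finset.univ.filter P).card ≤ (Finset.univ.filter (fun p : {v // v ∉ Z} ⊕ Fin (t+1) =>
      P (Sum.elim Subtype.val (fun i => y (f i)) p))).card + (Z \ Finset.univ.image y).card := by
  let S := (Finset.univ.filter (fun p : {v // v ∉ Z} ⊕ Fin (t+1) => P (Sum.elim Subtype.val (fun i => y (f i)) p)))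
  have h1 : Finset.univ.filter P ⊆ S.image (Sum.elim Subtype.val (fun i => y (f i))) ∪ (Z \ Finset.univ.image y) := by
    intro v hv
    have hv := (Finset.mem_filter.1 hv).2
    rw [Finset.mem_union]
    by_cases hz : v ∈ Z
    · by_cases hy : v ∈ Finset.univ.image y
      · obtain ⟨i, _, rfl⟩ := Finset.mem_image.1 hy
        left
        refine Finset.mem_image.2 ⟨Sum.inr (f.symm i), Finset.mem_filter.2 ⟨Finset.mem_univ _, ?_⟩, ?_⟩
        · simpa using hv
        · simp
      · right; exact Finset.mem_sdiff.2 ⟨hz, hy⟩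
    · left
      exact Finset.mem_image.2 ⟨Sum.inl ⟨v, hz⟩, Finset.mem_filter.2 ⟨Finset.mem_univ _, by simpa using hv⟩, by simp⟩
  have h2 := Finset.card_le_card h1
  have h3 := Finset.card_union_le (S.image (Sum.elim Subtype.val (fun i => y (f i)))) (Z \ Finset.univ.image y)
  have h4 := Finset.card_image_le (s := S) (f := (Sum.elim Subtype.val (fun i => y (f i))))
  exact h2.trans (h3.trans (Nat.add_le_add_right h4 _))

theorem contr_DG (hA : ∀ v, ¬ A v v) (hZ : ∀ v, v ∈ Z ↔ ∃ i, v = x i ∨ v = y i)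
    (hdo : ∀ v, Fintype.card V + 2 * (t+1) ≤ 2 * (Finset.univ.filter (fun u => A v u)).card)
    (hdi : ∀ v, Fintype.card V + 2 * (t+1) ≤ 2 * (Finset.univ.filter (fun u => A u v)).card) :
    DG (fun p q => A (tlm x Z p) (hdm y Z q)) (fun i : ℕ => (Sum.inr (Fin.ofNat (t+1) i) : {v // v ∉ Z} ⊕ Fin (t+1))) t
      (Fintype.card V - Z.card + (t+1)) := by
  have hZV : Z.card ≤ Fintype.card V := Finset.card_le_univ _
  have hxZ : ∀ i, x i ∈ Z := fun i => (hZ _).2 ⟨i, Or.inl rfl⟩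
  have hyZ : ∀ i, y i ∈ Z := fun i => (hZ _).2 ⟨i, Or.inr rfl⟩
  have o : ∀ p, (Finset.univ.filter (fun u => A (tlm x Z p) u)).card ≤
      (Finset.univ.filter (fun q => A (tlm x Z p) (hdm y Z q))).card + (Z \ Finset.univ.image y).card :=
    fun p => deg_contr Z (fun u => A (tlm x Z p) u) y (Equiv.subRight 1)
  have i : ∀ p, (Finset.univ.filter (fun u => A u (hdm y Z p))).card ≤
      (Finset.univ.filter (fun q => A (tlm x Z q) (hdm y Z p))).card + (Z \ Finset.univ.image x).card :=
    fun p => deg_contr Z (fun u => A u (hdm y Z p)) x (Equiv.refl _)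
  have h1 : (Z \ Finset.univ.image y).card + (Z \ Finset.univ.image x).card ≤ Z.card := by
    rw [← Finset.card_union_of_disjoint]
    · exact Finset.card_le_card (Finset.union_subset Finset.sdiff_subset Finset.sdiff_subset)
    · rw [Finset.disjoint_left]
      intro v hv hv'
      obtain ⟨a1, a2⟩ := Finset.mem_sdiff.1 hv
      obtain ⟨_, a3⟩ := Finset.mem_sdiff.1 hv'
      obtain ⟨i, h | h⟩ := (hZ v).1 a1
      · exact a3 (Finset.mem_image.2 ⟨i, Finset.mem_univ _, h.symm⟩)
      · exact a2 (Finset.mem_image.2 ⟨i, Finset.mem_univ _, h.symm⟩)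
  have h2 : (Z \ Finset.univ.image y).card ≤ t + 1 := by
    have : (Z \ Finset.univ.image y) ⊆ Finset.univ.image x := by
      intro v hv
      obtain ⟨a1, a2⟩ := Finset.mem_sdiff.1 hv
      obtain ⟨i, h | h⟩ := (hZ v).1 a1
      · exact Finset.mem_image.2 ⟨i, Finset.mem_univ _, h.symm⟩
      · exact absurd (Finset.mem_image.2 ⟨i, Finset.mem_univ _, h.symm⟩) a2
    exact (Finset.card_le_card this).trans (Finset.card_image_le.trans (by simp))
  have h3 : (Z \ Finset.univ.image x).card ≤ t + 1 := by
    have : (Z \ Finset.univ.image x) ⊆ Finset.univ.image y := by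
      intro v hv
      obtain ⟨a1, a2⟩ := Finset.mem_sdiff.1 hv
      obtain ⟨i, h | h⟩ := (hZ v).1 a1
      · exact absurd (Finset.mem_image.2 ⟨i, Finset.mem_univ _, h.symm⟩) a2
      · exact Finset.mem_image.2 ⟨i, Finset.mem_univ _, h.symm⟩
    exact (Finset.card_le_card this).trans (Finset.card_image_le.trans (by simp))
  constructor
  · rw [Fintype.card_sum, Fintype.card_fin, Fintype.card_subtype_compl]; simp
  · intro p q
    have := o p; have := i q; have := hdo (tlm x Z p); have := hdi (hdm y Z q)
    omega
  · intro v hv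
    rcases v with v | j
    · exact hA _
    · exfalso
      exact hv j.1 (by omega) (by simp)
  · intro a ha b hb h
    simp only [Sum.inr.injEq, Fin.ext_iff, Fin.val_ofNat] at h
    rwa [Nat.mod_eq_of_lt (by omega), Nat.mod_eq_of_lt (by omega)] at h
  · intro v; have := o v; have := hdo (tlm x Z v); omega
  · intro v; have := i v; have := hdi (hdm y Z v); omega
end

theorem chain_contr {V' V : Type*} (A : V → V → Prop) (tl hd : V' → V) (q : V') : ∀ (s : List V') (p : V'),
    (∀ c ∈ s, hd c = tl c) → (p :: s ++ [q]).IsChain (fun p q => A (tl p) (hd q)) →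
    (tl p :: s.map tl ++ [hd q]).IsChain A := by
  intro s
  induction s with
  | nil => intro p _ h; simpa using h
  | cons c s ih =>
    intro p hs h
    simp only [List.cons_append, List.isChain_cons_cons, List.map_cons] at h ⊢
    refine ⟨by rw [← hs c (by simp)]; exact h.1, ?_⟩
    exact ih c (fun d hd => hs d (List.mem_cons_of_mem _ hd)) (by simpa using h.2)

theorem list_sum_range (f : ℕ → ℕ) : ∀ n, ((List.range n).map f).sum = ∑ j ∈ Finset.range n, f j := by
  intro n
  induction n with
  | zero => simp
  | succ n ih => rw [List.range_succ, List.map_append, List.sum_append, ih, Finset.sum_range_succ]; simp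

theorem fin_aux (t i : ℕ) : Fin.ofNat (t+1) (i+1) - 1 = Fin.ofNat (t+1) i := by
  have : Fin.ofNat (t+1) (i+1) = Fin.ofNat (t+1) i + 1 := by
    ext; simp [Fin.val_add]
  rw [this, add_sub_cancel_right]

theorem reduce (t A0 m0 : ℕ)
    (hcore : ∀ (V : Type) [Fintype V] (R : V → V → Prop) (z : ℕ → V) (m : ℕ) (N : ℕ → ℕ),
      DG R z t m → m0 ≤ m → (∀ i < t, 4 ≤ N i) → A0 * ∑ i ∈ Finset.range t, N i ≤ m → HamOut R z t N)
    {V : Type} [Fintype V] (A : V → V → Prop) (x y : Fin (t+1) → V) (Z : Finset V) (N : ℕ → ℕ)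
    (hA : ∀ v, ¬ A v v) (hZ : ∀ v, v ∈ Z ↔ ∃ i, v = x i ∨ v = y i)
    (hdo : ∀ v, Fintype.card V + 2 * (t+1) ≤ 2 * (Finset.univ.filter (fun u => A v u)).card)
    (hdi : ∀ v, Fintype.card V + 2 * (t+1) ≤ 2 * (Finset.univ.filter (fun u => A u v)).card)
    (hN : ∀ i ≤ t, 4 ≤ N i) (hsum : ∑ i ∈ Finset.range (t+1), (N i - 1) + Z.card = Fintype.card V)
    (hm : m0 + Z.card ≤ Fintype.card V) (hS : A0 * ∑ i ∈ Finset.range t, N i + Z.card ≤ Fintype.card V) :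
    ∃ g, IsHamSubdivision A (fun i => (x i, y i)) (fun i : Fin (t+1) => N i) g := by
  have hZV : Z.card ≤ Fintype.card V := Finset.card_le_univ _
  have D := contr_DG A x y Z hA hZ hdo hdi
  have hxZ : ∀ i, x i ∈ Z := fun i => (hZ _).2 ⟨i, Or.inl rfl⟩
  have hyZ : ∀ i, y i ∈ Z := fun i => (hZ _).2 ⟨i, Or.inr rfl⟩
  obtain ⟨seg, l, h1, h2, h3, h4⟩ := hcore _ _ _ _ N D (by omega) (fun i hi => hN i (by omega)) (by omega)
  obtain ⟨z, hz⟩ : ∃ z : ℕ → {v // v ∉ Z} ⊕ Fin (t+1), z = fun i => Sum.inr (Fin.ofNat (t+1) i) := ⟨_, rfl⟩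
  rw [← hz] at h2 h3 h4
  obtain ⟨s, hs⟩ : ∃ s : ℕ → List ({v // v ∉ Z} ⊕ Fin (t+1)), s = fun i => if i < t then seg i else l := ⟨_, rfl⟩
  have hL : ((List.range t).flatMap (fun i => z i :: seg i) ++ [z t]) ++ l = (List.range (t+1)).flatMap (fun i => z i :: s i) := by
    rw [List.range_succ, List.flatMap_append]
    have e1 : (List.range t).flatMap (fun i => z i :: seg i) = (List.range t).flatMap (fun i => z i :: s i) := by
      apply List.flatMap_congr
      intro i hi
      rw [hs]; simp [List.mem_range.1 hi]
    rw [e1]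
    simp [hs]
  rw [hL] at h2 h3 h4
  have hlen : ∀ i ≤ t, (s i).length = N i - 1 := by
    intro i hi
    rcases Nat.lt_or_ge i t with h | h
    · rw [hs]; simp only [h, if_true]; exact h1 i h
    · have hit : i = t := by omega
      subst hit
      have c1 : ((List.range (i+1)).flatMap (fun i => z i :: s i)).length = Fintype.card V - Z.card + (i+1) := by
        rw [← List.toFinset_card_of_nodup h2, ← D.hm, ← Finset.card_univ]
        congr 1
        ext v; simp only [List.mem_toFinset, Finset.mem_univ, iff_true]; exact h3 v
      rw [List.length_flatMap] at c1
      have c2 : (List.map (fun j => (z j :: s j).length) (List.range (i+1))).sum = ∑ j ∈ Finset.range (i+1), ((s j).length + 1) := by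
        rw [list_sum_range]; rfl
      rw [c2, Finset.sum_range_succ] at c1
      rw [Finset.sum_range_succ] at hsum
      have c3 : ∑ j ∈ Finset.range i, ((s j).length + 1) = ∑ j ∈ Finset.range i, (N j - 1) + i := by
        rw [Finset.sum_add_distrib]
        congr 1
        · apply Finset.sum_congr rfl
          intro j hj
          have hj := Finset.mem_range.1 hj
          rw [hs]; simp only [hj, if_true]; exact h1 j hj
        · simp
      omega
  obtain ⟨n1, n2⟩ := List.nodup_flatMap.1 h2
  have hpw : ∀ a b, a < b → b ≤ t → List.Disjoint (z a :: s a) (z b :: s b) := by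
    intro a b hab hb
    have := List.pairwise_iff_getElem.1 n2 a b (by simp; omega) (by simp; omega) hab
    simpa using this
  have hsinl : ∀ i ≤ t, ∀ p ∈ s i, ∃ v, ∃ hv : v ∉ Z, p = Sum.inl ⟨v, hv⟩ := by
    intro i hi p hp
    rcases p with ⟨v, hv⟩ | j
    · exact ⟨v, hv, rfl⟩
    · exfalso
      have e : z j.1 = Sum.inr j := by rw [hz]; simp
      by_cases hij : i = j.1
      · have := n1 i (List.mem_range.2 (by omega))
        rw [hij, List.nodup_cons, e] at this
        rw [hij] at hp
        exact this.1 hp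
      · rcases Nat.lt_or_gt_of_ne hij with h | h
        · exact hpw i j.1 h (by omega) (List.mem_cons_of_mem _ hp) (by rw [e]; simp)
        · exact hpw j.1 i h hi (by rw [e]; simp) (List.mem_cons_of_mem _ hp)
  have hth : ∀ i ≤ t, ∀ c ∈ s i, hdm y Z c = tlm x Z c := by
    intro i hi c hc
    obtain ⟨v, hv, rfl⟩ := hsinl i hi c hc
    rfl
  have htZ : ∀ i ≤ t, ∀ v ∈ (s i).map (tlm x Z), v ∉ Z ∧ ∃ hv : v ∉ Z, Sum.inl ⟨v, hv⟩ ∈ s i := by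
    intro i hi v hv
    obtain ⟨c, hc, rfl⟩ := List.mem_map.1 hv
    obtain ⟨w, hw, rfl⟩ := hsinl i hi c hc
    exact ⟨hw, hw, hc⟩
  have hz0 : z (t+1) = z 0 := by
    rw [hz]; simp
  have hch : ∀ i ≤ t, (z i :: s i ++ [z (i+1)]).IsChain (fun p q => A (tlm x Z p) (hdm y Z q)) := by
    intro i hi
    have c : ((List.range (t+1)).flatMap (fun i => z i :: s i) ++ [z (t+1)]).IsChain (fun p q => A (tlm x Z p) (hdm y Z q)) := by
      rw [isChain_app]
      refine ⟨h4.1, by simp, ?_⟩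
      intro a ha b hb
      refine h4.2 a ha b ?_
      rw [List.range_succ_eq_map, List.flatMap_cons]
      rw [hz0] at hb
      simpa using hb
    obtain ⟨pre, post, e⟩ := split_flat z s (t+1) i (by omega)
    rw [e] at c
    exact ((isChain_app _ _ _).1 ((isChain_app _ _ _).1 c).1).2.1
  have hnd : ∀ i ≤ t, ((s i).map (tlm x Z)).Nodup := by
    intro i hi
    have := (List.nodup_flatMap.1 h2).1 i (List.mem_range.2 (by omega))
    refine List.Nodup.map_on ?_ (List.nodup_cons.1 this).2
    intro c hc d hd h
    obtain ⟨v, hv, rfl⟩ := hsinl i hi c hc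
    obtain ⟨w, hw, rfl⟩ := hsinl i hi d hd
    simpa [tlm] using h
  have hdj : ∀ i ≤ t, ∀ j ≤ t, i ≠ j → ∀ c, c ∈ s i → c ∉ s j := by
    intro i hi j hj hij c hc hc'
    rcases Nat.lt_or_gt_of_ne hij with h | h
    · exact hpw i j h hj (List.mem_cons_of_mem _ hc) (List.mem_cons_of_mem _ hc')
    · exact hpw j i h hi (List.mem_cons_of_mem _ hc') (List.mem_cons_of_mem _ hc)
  have hil : ∀ i : Fin (t+1), i.1 ≤ t := fun i => by omega
  refine ⟨fun i => x i :: (s i).map (tlm x Z) ++ [y i], ?_, ?_, ?_⟩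
  · intro i
    have hx1 : x i ∉ (s i).map (tlm x Z) := fun h => (htZ i (hil i) _ h).1 (hxZ i)
    have hy1 : y i ∉ (s i).map (tlm x Z) := fun h => (htZ i (hil i) _ h).1 (hyZ i)
    refine ⟨⟨?_, ?_, ?_, ?_, ?_⟩, ?_⟩
    · have := chain_contr A (tlm x Z) (hdm y Z) (z (i+1)) (s i) (z i) (hth i (hil i)) (hch i (hil i))
      have e1 : tlm x Z (z i) = x i := by rw [hz]; simp [tlm]
      have e2 : hdm y Z (z (i.1+1)) = y i := by
        rw [hz]
        change y (Fin.ofNat (t+1) (i.1+1) - 1) = y i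
        rw [fin_aux]; simp
      rw [e1, e2] at this
      exact this
    · simp
    · exact List.getLast?_concat
    · intro _
      rw [List.dropLast_concat]
      exact List.nodup_cons.2 ⟨hx1, hnd i (hil i)⟩
    · intro hxy
      have : x i ≠ y i := hxy
      rw [List.nodup_append']
      refine ⟨List.nodup_cons.2 ⟨hx1, hnd i (hil i)⟩, by simp, ?_⟩
      intro v hv hv'
      rw [List.mem_singleton] at hv'
      subst hv'
      rcases List.mem_cons.1 hv with h | h
      · exact this h.symm
      · exact hy1 h
    · have := hlen i (hil i)
      have := hN i (hil i)
      simp only [List.length_append, List.length_cons, List.length_map, List.length_nil]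
      omega
  · intro i j hij v hv hv'
    have e : listInterior (x i :: (s i).map (tlm x Z) ++ [y i]) = (s i).map (tlm x Z) := by
      unfold listInterior
      rw [List.cons_append, List.tail_cons, List.dropLast_concat]
    rw [e] at hv
    obtain ⟨a1, a2, a3⟩ := htZ i (hil i) v hv
    rw [List.mem_append, List.mem_cons, List.mem_singleton] at hv'
    rcases hv' with (h | h) | h
    · exact a1 (h ▸ hxZ j)
    · obtain ⟨_, _, b3⟩ := htZ j (hil j) v h
      exact hdj i (hil i) j (hil j) (fun h => hij (Fin.ext h)) _ a3 b3
    · exact a1 (h ▸ hyZ j)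
  · intro v
    by_cases hv : v ∈ Z
    · obtain ⟨i, h⟩ := (hZ v).1 hv
      refine ⟨i, ?_⟩
      rw [List.mem_append, List.mem_cons, List.mem_singleton]
      tauto
    · obtain ⟨i, hi, h⟩ := List.mem_flatMap.1 (h3 (Sum.inl ⟨v, hv⟩))
      rw [List.mem_range] at hi
      refine ⟨⟨i, hi⟩, ?_⟩
      rcases List.mem_cons.1 h with h | h
      · rw [hz] at h; simp at h
      · rw [List.mem_append, List.mem_cons]
        exact Or.inl (Or.inr (List.mem_map.2 ⟨_, h, rfl⟩))

theorem ncard_filter_eq {V : Type*} [Fintype V] (P : V → Prop) : {u | P u}.ncard = (Finset.univ.filter P).card := by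
  rw [← Set.ncard_coe_finset]; congr 1; ext; simp

theorem pos_case {W : Type} [Fintype W] (t : ℕ) (a : Fin (t+1) → W × W)
    (hδH : ∀ w : W, ∃ i, w = (a i).1 ∨ w = (a i).2) :
    ∃ (C₀ : ℕ) (α β : ℝ), 0 < α ∧ α < 1 ∧ 0 < β ∧ β < 1 ∧
      ∀ C : ℕ, C₀ ≤ C →
        ∀ (V : Type) [Fintype V] (A : V → V → Prop),
          (∀ v, ¬ A v v) →
          C * (t+1) ≤ Fintype.card V →
          (∀ v : V, (Fintype.card V : ℝ) / 2 + (t+1 : ℕ) ≤ (outDeg A v : ℝ) ∧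
                    (Fintype.card V : ℝ) / 2 + (t+1 : ℕ) ≤ (inDeg A v : ℝ)) →
          ArbHamHLinked A a α β := by
  obtain ⟨A0, m0, hA0, hcore⟩ := core t
  refine ⟨2 * m0 + 8, 1 / (2 * A0 + 2), 3 / 4, by positivity, ?_, by norm_num, by norm_num, ?_⟩
  · rw [div_lt_one (by positivity)]
    have : (0:ℝ) ≤ A0 := by positivity
    linarith
  intro C hC V _ A hA hn hdeg f hf N hN hshort hsum
  obtain ⟨n, hnn⟩ : ∃ n, n = Fintype.card V := ⟨_, rfl⟩
  have hn2 : (2 * m0 + 8) * (t + 1) ≤ n := by rw [hnn]; exact (Nat.mul_le_mul_right _ hC).trans hn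
  have hW : Fintype.card W ≤ 2 * (t + 1) := by
    have h1 : (Finset.univ : Finset W) ⊆ Finset.univ.image (fun i => (a i).1) ∪ Finset.univ.image (fun i => (a i).2) := by
      intro w _
      obtain ⟨i, h | h⟩ := hδH w
      · exact Finset.mem_union_left _ (Finset.mem_image.2 ⟨i, Finset.mem_univ _, h.symm⟩)
      · exact Finset.mem_union_right _ (Finset.mem_image.2 ⟨i, Finset.mem_univ _, h.symm⟩)
    have h2 := (Finset.card_le_card h1).trans (Finset.card_union_le _ _)
    have h3 : (Finset.univ.image (fun i => (a i).1)).card ≤ t + 1 := Finset.card_image_le.trans (by simp)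
    have h4 : (Finset.univ.image (fun i => (a i).2)).card ≤ t + 1 := Finset.card_image_le.trans (by simp)
    rw [Finset.card_univ] at h2
    omega
  have hn3 : 2 * m0 + 8 * (t + 1) ≤ n := by
    have : 2 * m0 * 1 ≤ 2 * m0 * (t + 1) := Nat.mul_le_mul_left _ (by omega)
    rw [Nat.add_mul] at hn2
    omega
  -- nat version of the short condition
  have hshort' : (2 * A0 + 2) * ∑ i, (if 4 * N i < 3 * n then N i else 0) ≤ n := by
    have e : ∀ i, (if (N i : ℝ) < 3 / 4 * Fintype.card V then (N i : ℝ) else 0) = ((if 4 * N i < 3 * n then N i else 0 : ℕ) : ℝ) := by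
      intro i
      have : (N i : ℝ) < 3 / 4 * Fintype.card V ↔ 4 * N i < 3 * n := by
        rw [← hnn]
        constructor
        · intro h
          have h' : (4 * N i : ℝ) < 3 * n := by linarith
          exact_mod_cast h'
        · intro h
          have h' : (4 * N i : ℝ) < 3 * n := by exact_mod_cast h
          linarith
      by_cases h : 4 * N i < 3 * n
      · rw [if_pos h, if_pos (this.2 h)]
      · rw [if_neg h, if_neg (fun hc => h (this.1 hc))]; simp
    rw [Finset.sum_congr rfl (fun i _ => e i), ← Nat.cast_sum, ← hnn, div_mul_eq_mul_div, one_mul,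
      le_div_iff₀ (by positivity)] at hshort
    rw [mul_comm]
    exact_mod_cast hshort
  -- a long arc
  obtain ⟨i0, hi0⟩ : ∃ i0, ¬ 4 * N i0 < 3 * n := by
    by_contra hc
    push Not at hc
    have h9 : ∑ i, (if 4 * N i < 3 * n then N i else 0) = ∑ i, N i := Finset.sum_congr rfl (fun i _ => if_pos (hc i))
    rw [h9] at hshort'
    have h1 : ∑ i, (N i - 1) ≤ ∑ i, N i := Finset.sum_le_sum (fun i _ => by omega)
    have h2 : 2 * ∑ i, N i ≤ (2 * A0 + 2) * ∑ i, N i := Nat.mul_le_mul_right _ (by omega)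
    omega
  have hone : ∀ j, j ≠ i0 → 4 * N j < 3 * n := by
    intro j hj
    by_contra hc
    have h1 : ∑ i ∈ ({i0, j} : Finset (Fin (t+1))), (N i - 1) ≤ ∑ i, (N i - 1) :=
      Finset.sum_le_sum_of_subset (Finset.subset_univ _)
    rw [Finset.sum_pair hj.symm] at h1
    omega
  obtain ⟨e, he⟩ : ∃ e : Equiv.Perm (Fin (t+1)), e (Fin.last t) = i0 := ⟨Equiv.swap (Fin.last t) i0, by simp⟩
  obtain ⟨N', hN'⟩ : ∃ N' : ℕ → ℕ, N' = fun i => N (e (Fin.ofNat (t+1) i)) := ⟨_, rfl⟩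
  have hN'f : ∀ i : Fin (t+1), N' i = N (e i) := by
    intro i; rw [hN']; simp
  have hZc : (Finset.univ.image f).card = Fintype.card W := by
    rw [Finset.card_image_of_injective _ hf, Finset.card_univ]
  have hsum1 : ∑ i ∈ Finset.range (t+1), (N' i - 1) = ∑ i, (N i - 1) := by
    rw [Finset.sum_range, ← Equiv.sum_comp e (fun i => N i - 1)]
    exact Finset.sum_congr rfl (fun i _ => by rw [hN'f])
  have hsum2 : ∑ i ∈ Finset.range t, N' i ≤ ∑ i, (if 4 * N i < 3 * n then N i else 0) := by
    rw [Finset.sum_range, ← Equiv.sum_comp e, Fin.sum_univ_castSucc]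
    refine le_trans (Finset.sum_le_sum (fun i _ => ?_)) (Nat.le_add_right _ _)
    have h1 : N' i = N (e i.castSucc) := hN'f i.castSucc
    have h2 : e i.castSucc ≠ i0 := by
      rw [← he]
      intro h
      exact absurd (e.injective h) (Fin.castSucc_lt_last i).ne
    rw [if_pos (hone _ h2), h1]
  have hd1 : ∀ v, Fintype.card V + 2 * (t+1) ≤ 2 * (Finset.univ.filter (fun u => A v u)).card := by
    intro v
    have h := (hdeg v).1
    rw [outDeg, ncard_filter_eq] at h
    have h' : ((Fintype.card V + 2 * (t+1) : ℕ) : ℝ) ≤ ((2 * (Finset.univ.filter (fun u => A v u)).card : ℕ) : ℝ) := by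
      push_cast at h ⊢; linarith
    exact_mod_cast h'
  have hd2 : ∀ v, Fintype.card V + 2 * (t+1) ≤ 2 * (Finset.univ.filter (fun u => A u v)).card := by
    intro v
    have h := (hdeg v).2
    rw [inDeg, ncard_filter_eq] at h
    have h' : ((Fintype.card V + 2 * (t+1) : ℕ) : ℝ) ≤ ((2 * (Finset.univ.filter (fun u => A u v)).card : ℕ) : ℝ) := by
      push_cast at h ⊢; linarith
    exact_mod_cast h'
  obtain ⟨g, g1, g2, g3⟩ := reduce t A0 m0 hcore A (fun i => f (a (e i)).1) (fun i => f (a (e i)).2) (Finset.univ.image f) N'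
    hA (by
      intro v
      constructor
      · intro hv
        obtain ⟨w, _, rfl⟩ := Finset.mem_image.1 hv
        obtain ⟨i, h⟩ := hδH w
        refine ⟨e.symm i, ?_⟩
        simp only [Equiv.apply_symm_apply]
        rcases h with h | h
        · left; exact congrArg f h
        · right; exact congrArg f h
      · rintro ⟨i, rfl | rfl⟩
        · exact Finset.mem_image_of_mem _ (Finset.mem_univ _)
        · exact Finset.mem_image_of_mem _ (Finset.mem_univ _)) hd1 hd2
    (by intro i hi; rw [hN']; exact hN _)
    (by rw [hsum1, hZc]; exact hsum) (by rw [hZc]; omega) (by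
      rw [hZc]
      have h1 : A0 * ∑ i ∈ Finset.range t, N' i ≤ A0 * ∑ i, (if 4 * N i < 3 * n then N i else 0) := Nat.mul_le_mul_left _ hsum2
      rw [Nat.add_mul, mul_assoc] at hshort'
      omega)
  refine ⟨fun i => g (e.symm i), ?_, ?_, ?_⟩
  · intro i
    have := g1 (e.symm i)
    simp only [hN'f, Equiv.apply_symm_apply] at this
    exact this
  · intro i j hij v hv
    exact g2 _ _ (fun h => hij (e.symm.injective h)) v hv
  · intro v
    obtain ⟨i, hi⟩ := g3 v
    exact ⟨e i, by simpa using hi⟩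

/-- **Theorem (main).** Let `H` be a digraph with `k` arcs and `δ(H) ≥ 1`.  There are a
constant `C₀` and constants `α, β ∈ (0,1)` such that for every `C ≥ C₀`, every digraph
`D` on `n ≥ C k` vertices with minimum semi-degree `δ⁰(D) ≥ n/2 + k` is arbitrary
Hamiltonian `H`-linked with parameters `α, β`. -/
theorem arbitrary_hamiltonian_H_linked
    {W : Type} [Fintype W] {k : ℕ} (a : Fin k → W × W)
    (ha : Function.Injective a)
    (hδH : ∀ w : W, ∃ i, w = (a i).1 ∨ w = (a i).2) :
    ∃ (C₀ : ℕ) (α β : ℝ), 0 < α ∧ α < 1 ∧ 0 < β ∧ β < 1 ∧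
      ∀ C : ℕ, C₀ ≤ C →
        ∀ (V : Type) [Fintype V] (A : V → V → Prop),
          (∀ v, ¬ A v v) →
          C * k ≤ Fintype.card V →
          (∀ v : V, (Fintype.card V : ℝ) / 2 + k ≤ (outDeg A v : ℝ) ∧
                    (Fintype.card V : ℝ) / 2 + k ≤ (inDeg A v : ℝ)) →
          ArbHamHLinked A a α β := by
  rcases k with _ | t
  · refine ⟨0, 1 / 2, 1 / 2, by norm_num, by norm_num, by norm_num, by norm_num, ?_⟩
    intro C _ V _ A _ _ _ f _ N _ _ hsum
    have hW : IsEmpty W := ⟨fun w => (hδH w).choose.elim0⟩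
    have hV : Fintype.card V = 0 := by
      rw [← hsum]; simp
    have hV' := Fintype.card_eq_zero_iff.1 hV
    exact ⟨fun i => i.elim0, fun i => i.elim0, fun i => i.elim0, fun v => hV'.elim v⟩
  · exact pos_case t a hδH
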